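/- For every ε > 0 there exists n₀ such that for all n ≥ n₀: if f_{n+1} is odd then (f_{n+1} : ℝ) < (3+ε)·p_n, and if f_{n+1} is even then (f_{n+1} : ℝ) < (3+ε)·p_n + p_{n+1}. -/

import Mathlib

open Filter Pointwise

/-- `nthPrime n` is the `n`-th prime number (1-indexed): `nthPrime 1 = 2`, etc. -/
noncomputable def nthPrime (n : ℕ) : ℕ := Nat.nth Nat.Prime (n - 1)

/-- `S n` is the additive submonoid of `ℕ` generated by the primes `q ≥ nthPrime n`. -/
def S (n : ℕ) : AddSubmonoid ℕ :=
  AddSubmonoid.closure {q : ℕ | q.Prime ∧ nthPrime n ≤ q}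

/-- `frob n` is the Frobenius number of `S n`: the largest natural number not in `S n`. -/
noncomputable def frob (n : ℕ) : ℕ := sSup {m : ℕ | m ∉ S n}

/-- `genus n` is the number of natural numbers not in `S n`. -/
noncomputable def genus (n : ℕ) : ℕ := {m : ℕ | m ∉ S n}.ncard

/-- `atoms n` is the minimal generating set `S n \ {0} \ ((S n \ {0}) + (S n \ {0}))`. -/
def atoms (n : ℕ) : Set ℕ :=
  ((S n : Set ℕ) \ {0}) \ (((S n : Set ℕ) \ {0}) + ((S n : Set ℕ) \ {0}))

/-- `u n` is the largest atom of `S n`. -/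
noncomputable def u (n : ℕ) : ℕ := sSup (atoms n)

/-- `e n` is the embedding dimension of `S n`: the number of atoms. -/
noncomputable def e (n : ℕ) : ℕ := (atoms n).ncard

namespace PrimeSemigroup

open Finset

/-- The additive character `x ↦ exp (2πix)`. -/
noncomputable def ex (x : ℝ) : ℂ := Complex.exp (2 * Real.pi * x * Complex.I)

/-- Distance to the nearest integer. -/
noncomputable def nd (x : ℝ) : ℝ := |x - round x|

lemma ex_add (x y : ℝ) : ex (x + y) = ex x * ex y := by
  unfold ex; rw [← Complex.exp_add]; congr 1; push_cast; ring

@[simp] lemma ex_zero : ex 0 = 1 := by simp [ex]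

lemma ex_int (n : ℤ) : ex n = 1 := by
  unfold ex
  rw [← Complex.exp_int_mul_two_pi_mul_I n]; congr 1; push_cast; ring

@[simp] lemma norm_ex (x : ℝ) : ‖ex x‖ = 1 := by
  unfold ex
  rw [show (2 * Real.pi * x * Complex.I : ℂ) = ((2 * Real.pi * x : ℝ) : ℂ) * Complex.I by
    push_cast; ring]
  exact Complex.norm_exp_ofReal_mul_I _

lemma ex_add_int (x : ℝ) (n : ℤ) : ex (x + n) = ex x := by
  rw [ex_add, ex_int, mul_one]

lemma ex_neg (x : ℝ) : ex (-x) = (starRingEnd ℂ) (ex x) := by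
  unfold ex
  rw [← Complex.exp_conj]; congr 1; simp [Complex.conj_ofNat]

lemma ex_mul_nat (x : ℝ) (n : ℕ) : ex (n * x) = ex x ^ n := by
  unfold ex; rw [← Complex.exp_nat_mul]; congr 1; push_cast; ring

lemma norm_ex_sub_one_le (x : ℝ) : ‖ex x - 1‖ ≤ 2 * Real.pi * |x| := by
  have := Real.norm_exp_I_mul_ofReal_sub_one_le (x := 2 * Real.pi * x)
  rw [show ex x = Complex.exp (Complex.I * ((2 * Real.pi * x : ℝ) : ℂ)) by
    unfold ex; congr 1; push_cast; ring]
  refine this.trans_eq ?_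
  rw [Real.norm_eq_abs, abs_mul, abs_of_pos (by positivity : (0:ℝ) < 2 * Real.pi)]

lemma norm_ex_sub_le (x y : ℝ) : ‖ex x - ex y‖ ≤ 2 * Real.pi * |x - y| := by
  have : ex x - ex y = ex y * (ex (x - y) - 1) := by
    rw [mul_sub, ← ex_add, mul_one]; congr 2; ring
  rw [this, norm_mul, norm_ex, one_mul]
  exact norm_ex_sub_one_le _

lemma nd_nonneg (x : ℝ) : 0 ≤ nd x := abs_nonneg _

lemma nd_le_half (x : ℝ) : nd x ≤ 1 / 2 := abs_sub_round x

lemma nd_le_abs_sub_int (x : ℝ) (n : ℤ) : nd x ≤ |x - n| := round_le x n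

lemma nd_neg (x : ℝ) : nd (-x) = nd x := by
  apply le_antisymm
  · have := nd_le_abs_sub_int (-x) (-round x)
    refine this.trans_eq ?_
    unfold nd; push_cast; rw [← abs_neg]; congr 1; ring
  · have := nd_le_abs_sub_int x (-round (-x))
    refine this.trans_eq ?_
    unfold nd; push_cast; rw [← abs_neg]; congr 1; ring

lemma four_nd_le (x : ℝ) : 4 * nd x ≤ ‖ex x - 1‖ := by
  set y := x - round x with hy
  have h1 : ex x = ex y := by
    rw [hy, sub_eq_add_neg]
    have := ex_add_int x (-round x)
    push_cast at this
    exact this.symm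
  have hyh : |y| ≤ 1 / 2 := abs_sub_round x
  rw [h1]
  have h2 : ‖ex y - 1‖ = ‖2 * Real.sin (2 * Real.pi * y / 2)‖ := by
    rw [← Complex.norm_exp_I_mul_ofReal_sub_one]
    congr 2
    unfold ex; congr 1; push_cast; ring
  rw [h2, norm_mul, Real.norm_eq_abs, Real.norm_eq_abs, abs_two]
  have h3 : 2 * Real.pi * y / 2 = Real.pi * y := by ring
  rw [h3]
  have h4 : 2 * |y| ≤ |Real.sin (Real.pi * y)| := by
    have := Real.mul_abs_le_abs_sin (x := Real.pi * y) (by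
      rw [abs_mul, abs_of_pos Real.pi_pos]; nlinarith [Real.pi_pos])
    rw [abs_mul, abs_of_pos Real.pi_pos] at this
    have h5 : 2 / Real.pi * (Real.pi * |y|) = 2 * |y| := by
      field_simp
    linarith
  change 4 * |y| ≤ _
  linarith

/-- Bound for a geometric sum of additive characters. -/
lemma norm_geom_le (θ : ℝ) (H : ℕ) (hθ : 0 < nd θ) :
    ‖∑ n ∈ range H, ex (n * θ)‖ ≤ 1 / (2 * nd θ) := by
  have h0 : ex θ ≠ 1 := by
    intro h
    have := four_nd_le θ
    rw [h] at this; simp at this; linarith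
  simp_rw [ex_mul_nat]
  rw [geom_sum_eq h0, norm_div]
  have h1 : ‖ex θ ^ H - 1‖ ≤ 2 := by
    refine (norm_sub_le _ _).trans ?_
    rw [norm_pow, norm_ex]; norm_num
  have h2 := four_nd_le θ
  rw [div_le_div_iff₀ (by linarith) (by linarith)]
  nlinarith

lemma norm_geom_le' (θ : ℝ) (H : ℕ) : ‖∑ n ∈ range H, ex (n * θ)‖ ≤ H := by
  refine (norm_sum_le _ _).trans ?_
  simp

/-- Geometric sums over arbitrary intervals. -/
lemma norm_geom_Ioc_le (θ : ℝ) (A B : ℕ) (hθ : 0 < nd θ) :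
    ‖∑ n ∈ Ioc A B, ex (n * θ)‖ ≤ 1 / (2 * nd θ) := by
  rcases le_or_gt B A with h | h
  · rw [Ioc_eq_empty_of_le h]; simp; exact hθ.le
  · have : ∑ n ∈ Ioc A B, ex (n * θ) = ex ((A + 1 : ℕ) * θ) * ∑ n ∈ range (B - A), ex (n * θ) := by
      rw [mul_sum]
      refine sum_bij' (fun n _ => n - (A + 1)) (fun n _ => A + 1 + n) ?_ ?_ ?_ ?_ ?_
      · intro n hn; simp only [mem_Ioc, mem_range] at *; omega
      · intro n hn; simp only [mem_Ioc, mem_range] at *; omega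
      · intro n hn; simp only [mem_Ioc] at *; omega
      · intro n hn; simp only [mem_range] at *; omega
      · intro n hn
        rw [← ex_add]; congr 1
        rw [← add_mul, ← Nat.cast_add]; congr 2
        simp only [mem_Ioc] at hn; omega
    rw [this, norm_mul, norm_ex, one_mul]
    exact norm_geom_le θ _ hθ

/-- Summation by parts, as a bound. -/
lemma norm_sum_mul_le_of_partial {f g : ℕ → ℂ} {A B : ℕ} {D : ℝ} (hAB : A < B)
    (hD : ∀ t ≤ B, ‖∑ n ∈ Ioc A t, f n‖ ≤ D) :
    ‖∑ n ∈ Ioc A B, f n * g n‖ ≤ D * (‖g B‖ + ∑ n ∈ Ioo A B, ‖g (n + 1) - g n‖) := by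
  have key : ∀ B, A < B → ∑ n ∈ Ioc A B, f n * g n = (∑ n ∈ Ioc A B, f n) * g B
      - ∑ n ∈ Ioo A B, (∑ k ∈ Ioc A n, f k) * (g (n + 1) - g n) := by
    intro B hB
    induction B, hB using Nat.le_induction with
    | base =>
      have : Ioo A A.succ = ∅ := by ext k; simp only [mem_Ioo, notMem_empty, iff_false]; omega
      rw [this]; simp
    | succ m hm ih =>
      have hm' : A < m := hm
      rw [← Finset.insert_Ioc_right_eq_Ioc_add_one hm'.le, sum_insert (by simp), ih,
        sum_insert (by simp)]
      have : Ioo A (m + 1) = insert m (Ioo A m) := by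
        ext k; simp only [mem_Ioo, mem_insert]; omega
      rw [this, sum_insert (by simp)]
      ring
  rw [key B hAB, mul_add]
  refine (norm_sub_le _ _).trans ?_
  rw [norm_mul, mul_sum]
  refine add_le_add ?_ ?_
  · exact mul_le_mul_of_nonneg_right (hD B le_rfl) (norm_nonneg _)
  · refine (norm_sum_le _ _).trans (sum_le_sum fun n hn => ?_)
    rw [norm_mul]
    exact mul_le_mul_of_nonneg_right (hD n (mem_Ioo.1 hn).2.le) (norm_nonneg _)

end PrimeSemigroup

namespace PrimeSemigroup

open MeasureTheory Topology

/-- The triangle function on `[-1, 1]`. -/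
noncomputable def tri (t : ℝ) : ℝ := max 0 (1 - |t|)

/-- The Fejér kernel, Fourier transform of the triangle function. -/
noncomputable def fejK (w : ℝ) : ℝ := if w = 0 then 1 else 2 * (1 - Real.cos w) / w ^ 2

lemma continuous_tri : Continuous tri := by unfold tri; fun_prop

lemma tri_nonneg (t : ℝ) : 0 ≤ tri t := le_max_left _ _

lemma tri_eq_zero {t : ℝ} (ht : 1 ≤ |t|) : tri t = 0 := max_eq_left (by linarith)

lemma tri_eq {t : ℝ} (ht : |t| ≤ 1) : tri t = 1 - |t| := max_eq_right (by linarith)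

lemma integrable_tri : Integrable tri := by
  apply continuous_tri.integrable_of_hasCompactSupport
  apply HasCompactSupport.intro (K := Set.Icc (-1) 1) isCompact_Icc
  intro x hx
  apply tri_eq_zero
  by_contra! h
  exact hx (Set.mem_Icc.2 ⟨by linarith [(abs_lt.1 h).1], (abs_lt.1 h).2.le⟩)

lemma fejK_nonneg (w : ℝ) : 0 ≤ fejK w := by
  unfold fejK; split_ifs
  · norm_num
  · have := Real.cos_le_one w
    positivity [sub_nonneg.2 this]

lemma fejK_le (w : ℝ) : fejK w ≤ 5 * (1 + w ^ 2)⁻¹ := by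
  unfold fejK; split_ifs with h
  · rw [h]; norm_num
  · have h1 := Real.cos_le_one w
    have h2 := Real.neg_one_le_cos w
    have h3 := Real.one_sub_sq_div_two_le_cos (x := w)
    have : 0 < w ^ 2 := by positivity
    rw [div_le_iff₀ this, mul_assoc, inv_mul_eq_div, ← mul_div_assoc, le_div_iff₀ (by positivity)]
    nlinarith

lemma measurable_fejK : Measurable fejK := by
  unfold fejK
  exact Measurable.ite (measurableSet_singleton 0) measurable_const (by fun_prop)

lemma integrable_fejK : Integrable fejK := by
  refine Integrable.mono' (integrable_inv_one_add_sq.const_mul 5)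
    measurable_fejK.aestronglyMeasurable (Eventually.of_forall fun w => ?_)
  rw [Real.norm_eq_abs, abs_of_nonneg (fejK_nonneg w)]
  exact fejK_le w

lemma integral_fejK_pos : 0 < ∫ w, fejK w := by
  rw [integral_pos_iff_support_of_nonneg fejK_nonneg integrable_fejK]
  have : Set.Ioo (0:ℝ) 1 ⊆ Function.support fejK := by
    intro w hw
    have h0 : w ≠ 0 := hw.1.ne'
    simp only [Function.mem_support, fejK, if_neg h0]
    have : Real.cos w < 1 := by
      have := Real.cos_lt_cos_of_nonneg_of_le_pi (x := 0) (y := w) le_rfl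
        (by linarith [hw.2, Real.pi_gt_three]) hw.1
      rwa [Real.cos_zero] at this
    have h2 : 0 < 1 - Real.cos w := by linarith
    positivity
  exact lt_of_lt_of_le (by simp) (measure_mono this)

lemma integral_tri_exp (w : ℝ) :
    ∫ t : ℝ, (tri t : ℂ) * Complex.exp (t * w * Complex.I) = fejK w := by
  have h1 : ∫ t : ℝ, (tri t : ℂ) * Complex.exp (t * w * Complex.I)
      = ∫ t in (-1:ℝ)..1, (tri t : ℂ) * Complex.exp (t * w * Complex.I) := by
    rw [intervalIntegral.integral_of_le (by norm_num), setIntegral_eq_integral_of_forall_compl_eq_zero]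
    intro t ht
    rw [tri_eq_zero]; · simp
    by_contra! h
    exact ht (Set.mem_Ioc.2 ⟨by linarith [(abs_lt.1 h).1], (abs_lt.1 h).2.le⟩)
  have hc : Continuous fun t : ℝ => (tri t : ℂ) * Complex.exp (t * w * Complex.I) := by
    have := continuous_tri
    fun_prop
  have h2 : ∫ t in (-1:ℝ)..1, (tri t : ℂ) * Complex.exp (t * w * Complex.I)
      = ∫ t in (0:ℝ)..1, ((2 * (1 - t) * Real.cos (t * w) : ℝ) : ℂ) := by
    rw [← intervalIntegral.integral_add_adjacent_intervals (b := 0) (hc.intervalIntegrable _ _)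
      (hc.intervalIntegrable _ _)]
    have : ∫ t in (-1:ℝ)..0, (tri t : ℂ) * Complex.exp (t * w * Complex.I)
        = ∫ t in (0:ℝ)..1, (tri (-t) : ℂ) * Complex.exp ((-t : ℝ) * w * Complex.I) := by
      rw [intervalIntegral.integral_comp_neg (f := fun t : ℝ => (tri t : ℂ) *
        Complex.exp (t * w * Complex.I))]
      simp
    rw [this, ← intervalIntegral.integral_add]
    · apply intervalIntegral.integral_congr
      intro t ht
      rw [Set.uIcc_of_le zero_le_one] at ht
      have e1 : tri t = 1 - t := by rw [tri_eq] <;> rw [abs_of_nonneg ht.1]; exact ht.2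
      have e2 : tri (-t) = 1 - t := by
        rw [tri_eq] <;> rw [abs_neg, abs_of_nonneg ht.1]; exact ht.2
      simp only [e1, e2]
      push_cast
      rw [Complex.cos]
      rw [show (-(t:ℂ) * w * Complex.I) = -(t * w) * Complex.I by ring]
      ring
    · exact (hc.comp continuous_neg).intervalIntegrable _ _
    · exact hc.intervalIntegrable _ _
  rw [h1, h2, intervalIntegral.integral_ofReal]
  congr 1
  unfold fejK
  split_ifs with hw
  · subst hw
    have : ∀ t ∈ Set.uIcc (0:ℝ) 1, HasDerivAt (fun t => 2 * t - t ^ 2)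
        (2 * (1 - t) * Real.cos (t * 0)) t := by
      intro t _
      have := ((hasDerivAt_id t).const_mul 2).sub ((hasDerivAt_id t).pow 2)
      convert! this using 1
      simp; ring
    rw [intervalIntegral.integral_eq_sub_of_hasDerivAt this]
    · norm_num
    · apply Continuous.intervalIntegrable; fun_prop
  · have : ∀ t ∈ Set.uIcc (0:ℝ) 1, HasDerivAt
        (fun t => 2 * (1 - t) * Real.sin (t * w) / w - 2 * Real.cos (t * w) / w ^ 2)
        (2 * (1 - t) * Real.cos (t * w)) t := by
      intro t _
      have a1 : HasDerivAt (fun t : ℝ => t * w) w t := by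
        simpa using (hasDerivAt_id t).mul_const w
      have a2 : HasDerivAt (fun t : ℝ => 2 * (1 - t)) (-2) t := by
        simpa using ((hasDerivAt_id t).const_sub 1).const_mul 2
      have := ((a2.mul a1.sin).div_const w).sub ((a1.cos.const_mul 2).div_const (w ^ 2))
      convert! this using 1
      field_simp
      ring
    rw [intervalIntegral.integral_eq_sub_of_hasDerivAt this]
    · simp; ring
    · apply Continuous.intervalIntegrable; fun_prop

end PrimeSemigroup

namespace PrimeSemigroup

open MeasureTheory Topology

section tauber

variable {g : ℝ → ℝ} {C : ℝ} {Φ : ℂ → ℂ}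

lemma integrable_mul_exp_of_bounded (hg : Measurable g) (hC : ∀ v, |g v| ≤ C)
    (h0 : ∀ v ≤ 0, g v = 0) {η : ℝ} (hη : 0 < η) :
    Integrable fun v => g v * Real.exp (-η * v) := by
  have h1 : IntegrableOn (fun v => g v * Real.exp (-η * v)) (Set.Ioi 0) := by
    refine Integrable.mono' ((exp_neg_integrableOn_Ioi 0 hη).const_mul C)
      (by fun_prop) (Eventually.of_forall fun v => ?_)
    rw [norm_mul, Real.norm_eq_abs, Real.norm_eq_abs, abs_of_pos (Real.exp_pos _)]
    exact mul_le_mul_of_nonneg_right (hC v) (Real.exp_pos _).le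
  rw [← integrableOn_iff_integrable_of_support_subset (s := Set.Ioi 0)]
  · exact h1
  · intro v hv
    by_contra h
    exact hv (by simp [h0 v (by simpa using h)])

lemma tri_laplace (hg : Measurable g) (hC : ∀ v, |g v| ≤ C)
    (h0 : ∀ v ≤ 0, g v = 0) {η : ℝ} (hη : 0 < η) (l u : ℝ) :
    ∫ t : ℝ, (tri t : ℂ) * Complex.exp (t * (l * u) * Complex.I) *
      (∫ v : ℝ, (g v : ℂ) * Complex.exp (-(η + l * t * Complex.I) * v))
    = ∫ v : ℝ, ((g v * Real.exp (-η * v) * fejK (l * (u - v)) : ℝ) : ℂ) := by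
  simp_rw [← integral_const_mul]
  rw [integral_integral_swap]
  · congr 1; ext v
    push_cast
    rw [← integral_tri_exp, ← integral_const_mul]
    congr 1; ext t
    have : Complex.exp (t * (l * u) * Complex.I) * Complex.exp (-(η + l * t * Complex.I) * v)
        = Complex.exp (-η * v) * Complex.exp (t * ((l * (u - v) : ℝ) : ℂ) * Complex.I) := by
      rw [← Complex.exp_add, ← Complex.exp_add]; congr 1; push_cast; ring
    calc _ = (tri t : ℂ) * g v * (Complex.exp (t * (l * u) * Complex.I) *
        Complex.exp (-(η + l * t * Complex.I) * v)) := by ring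
      _ = _ := by rw [this]; ring
  · have hi := (integrable_tri.ofReal (𝕜 := ℂ)).mul_prod
      ((integrable_mul_exp_of_bounded hg hC h0 hη).ofReal (𝕜 := ℂ))
    refine hi.mono ?_ (Eventually.of_forall ?_)
    · apply Measurable.aestronglyMeasurable
      have := continuous_tri.measurable
      fun_prop
    · rintro ⟨t, v⟩
      simp only [Function.uncurry]
      rw [norm_mul, norm_mul, norm_mul, norm_mul]
      have e1 : ‖Complex.exp (t * (l * u) * Complex.I)‖ = 1 := by
        have := Complex.norm_exp_ofReal_mul_I (t * (l * u)); push_cast at this; exact this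
      have e2 : ‖Complex.exp (-(η + l * t * Complex.I) * v)‖ = Real.exp (-η * v) := by
        rw [Complex.norm_exp]; congr 1; simp
      have e3 : ‖((g v * Real.exp (-η * v) : ℝ) : ℂ)‖ = ‖(g v : ℂ)‖ * Real.exp (-η * v) := by
        rw [Complex.ofReal_mul, norm_mul, Complex.norm_of_nonneg (Real.exp_pos _).le]
      rw [e1, e2, mul_one]
      exact le_of_eq (by rw [← e3]; rfl)

lemma fejer_identity (hg : Measurable g) (hC : ∀ v, |g v| ≤ C)
    (h0 : ∀ v ≤ 0, g v = 0) (hΦ : ContinuousOn Φ {z | 0 ≤ z.re})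
    (hL : ∀ z : ℂ, 0 < z.re → ∫ v : ℝ, (g v : ℂ) * Complex.exp (-z * v) = Φ z)
    {l : ℝ} (hl : 0 < l) (u : ℝ) :
    ∫ t : ℝ, (tri t : ℂ) * Complex.exp (t * (l * u) * Complex.I) * Φ (l * t * Complex.I)
    = ∫ v : ℝ, ((g v * fejK (l * (u - v)) : ℝ) : ℂ) := by
  have hC0 : 0 ≤ C := (abs_nonneg _).trans (hC 0)
  have hK : Integrable fun v => fejK (l * (u - v)) := by
    have h1 : Integrable fun v => fejK (l * v) := integrable_fejK.comp_mul_left' hl.ne'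
    exact h1.comp_sub_left u
  have lim1 : Tendsto (fun η : ℝ => ∫ v : ℝ,
      ((g v * Real.exp (-η * v) * fejK (l * (u - v)) : ℝ) : ℂ)) (𝓝[>] 0)
      (𝓝 (∫ v : ℝ, ((g v * fejK (l * (u - v)) : ℝ) : ℂ))) := by
    refine tendsto_integral_filter_of_dominated_convergence (fun v => C * fejK (l * (u - v)))
      ?_ ?_ (hK.const_mul C) ?_
    · refine Eventually.of_forall fun η => ?_
      apply Measurable.aestronglyMeasurable
      have := measurable_fejK
      fun_prop
    · filter_upwards [self_mem_nhdsWithin] with η hη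
      refine Eventually.of_forall fun v => ?_
      rw [Complex.norm_real, Real.norm_eq_abs, abs_mul, abs_of_nonneg (fejK_nonneg _)]
      refine mul_le_mul_of_nonneg_right ?_ (fejK_nonneg _)
      rcases le_or_gt v 0 with hv | hv
      · rw [h0 v hv]; simpa using hC0
      · rw [abs_mul, abs_of_pos (Real.exp_pos _)]
        have : Real.exp (-η * v) ≤ 1 := by
          rw [Real.exp_le_one_iff]
          have : 0 < η * v := mul_pos hη hv
          linarith
        exact (mul_le_of_le_one_right (abs_nonneg _) this).trans (hC v)
    · refine Eventually.of_forall fun v => ?_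
      have : Continuous fun η : ℝ => ((g v * Real.exp (-η * v) * fejK (l * (u - v)) : ℝ) : ℂ) := by
        fun_prop
      have := (this.tendsto 0).mono_left (nhdsWithin_le_nhds (s := Set.Ioi 0))
      simpa using this
  obtain ⟨D, hD⟩ : ∃ D, ∀ z ∈ (Set.Icc (0:ℝ) 1) ×ℂ (Set.Icc (-l) l), ‖Φ z‖ ≤ D := by
    refine IsCompact.exists_bound_of_continuousOn (isCompact_Icc.reProdIm isCompact_Icc)
      (hΦ.mono ?_)
    intro z hz
    exact hz.1.1
  have hline : ∀ η : ℝ, 0 ≤ η → Continuous fun t : ℝ => Φ (η + l * t * Complex.I) := by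
    intro η hη
    refine hΦ.comp_continuous (by fun_prop) fun t => ?_
    simpa using hη
  have lim2 : Tendsto (fun η : ℝ => ∫ t : ℝ, (tri t : ℂ) * Complex.exp (t * (l * u) * Complex.I) *
      Φ (η + l * t * Complex.I)) (𝓝[>] 0)
      (𝓝 (∫ t : ℝ, (tri t : ℂ) * Complex.exp (t * (l * u) * Complex.I) *
        Φ (l * t * Complex.I))) := by
    refine tendsto_integral_filter_of_dominated_convergence (fun t => tri t * D)
      ?_ ?_ (integrable_tri.mul_const D) ?_
    · filter_upwards [self_mem_nhdsWithin] with η hη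
      apply Continuous.aestronglyMeasurable
      have := continuous_tri
      have h2 := hline η (le_of_lt hη)
      exact Continuous.mul (by fun_prop) h2
    · filter_upwards [self_mem_nhdsWithin, nhdsWithin_le_nhds (Iic_mem_nhds one_pos)] with η hη hη1
      refine Eventually.of_forall fun t => ?_
      rw [norm_mul, norm_mul, Complex.norm_of_nonneg (tri_nonneg t)]
      have e1 : ‖Complex.exp (t * (l * u) * Complex.I)‖ = 1 := by
        have := Complex.norm_exp_ofReal_mul_I (t * (l * u)); push_cast at this; exact this
      rw [e1, mul_one]
      rcases le_or_gt 1 |t| with ht | ht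
      · rw [tri_eq_zero ht]; simp
      · refine mul_le_mul_of_nonneg_left (hD _ ?_) (tri_nonneg t)
        have h2 := abs_lt.1 ht
        refine ⟨⟨?_, ?_⟩, ?_, ?_⟩
        · simpa using le_of_lt hη
        · simpa using hη1
        · simp; nlinarith
        · simp; nlinarith
    · refine Eventually.of_forall fun t => ?_
      refine Tendsto.const_mul _ ?_
      have hc : ContinuousWithinAt Φ {z | 0 ≤ z.re} (l * t * Complex.I) := hΦ _ (by simp)
      refine hc.tendsto.comp (tendsto_nhdsWithin_iff.2 ⟨?_, ?_⟩)
      · have : Continuous fun η : ℝ => (η : ℂ) + l * t * Complex.I := by fun_prop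
        have := (this.tendsto 0).mono_left (nhdsWithin_le_nhds (s := Set.Ioi 0))
        simpa using this
      · filter_upwards [self_mem_nhdsWithin] with η hη
        simpa using le_of_lt hη
  refine tendsto_nhds_unique lim2 (lim1.congr' ?_)
  filter_upwards [self_mem_nhdsWithin] with η hη
  rw [← tri_laplace hg hC h0 hη]
  congr 1; ext t
  rw [hL]
  simpa using hη

lemma fejer_limit (hg : Measurable g) (hC : ∀ v, |g v| ≤ C)
    (h0 : ∀ v ≤ 0, g v = 0) (hΦ : ContinuousOn Φ {z | 0 ≤ z.re})
    (hL : ∀ z : ℂ, 0 < z.re → ∫ v : ℝ, (g v : ℂ) * Complex.exp (-z * v) = Φ z)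
    {l : ℝ} (hl : 0 < l) :
    Tendsto (fun u : ℝ => ∫ w, g (u - w / l) * fejK w) atTop (𝓝 0) := by
  have key : ∀ u : ℝ, ((∫ w, g (u - w / l) * fejK w : ℝ) : ℂ) =
      l * ∫ t : ℝ, (tri t : ℂ) * Complex.exp (t * (l * u) * Complex.I) *
        Φ (l * t * Complex.I) := by
    intro u
    rw [fejer_identity hg hC h0 hΦ hL hl, integral_complex_ofReal, ← Complex.ofReal_mul]
    congr 1
    have h1 : ∫ v, g v * fejK (l * (u - v)) = ∫ v, g (u - v) * fejK (l * v) := by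
      rw [← integral_sub_left_eq_self (fun v => g (u - v) * fejK (l * v)) volume u]
      simp
    have h2 := Measure.integral_comp_mul_left (fun w => g (u - w / l) * fejK w) l
    rw [h1]
    have h3 : ∀ v, l * v / l = v := fun v => by field_simp
    simp_rw [h3] at h2
    rw [h2, abs_of_pos (inv_pos.2 hl), smul_eq_mul, ← mul_assoc, mul_inv_cancel₀ hl.ne', one_mul]
  have hRL := Real.tendsto_integral_exp_smul_cocompact
    (fun t : ℝ => (tri t : ℂ) * Φ (l * t * Complex.I))
  have hto : Tendsto (fun u : ℝ => -(l * u) / (2 * Real.pi)) atTop (cocompact ℝ) := by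
    refine Tendsto.mono_right ?_ atBot_le_cocompact
    refine Tendsto.atBot_div_const (by positivity) ?_
    exact tendsto_neg_atTop_atBot.comp (tendsto_id.const_mul_atTop hl)
  have h4 := ((hRL.comp hto).const_mul (l : ℂ))
  rw [mul_zero] at h4
  have h5 : Tendsto (fun u : ℝ => ((∫ w, g (u - w / l) * fejK w : ℝ) : ℂ)) atTop (𝓝 0) := by
    refine h4.congr fun u => ?_
    rw [key]
    simp only [Function.comp]
    congr 2; ext t
    rw [Circle.smul_def, Real.fourierChar_apply, smul_eq_mul]
    have : (((2 * Real.pi * -(t * (-(l * u) / (2 * Real.pi))) : ℝ) : ℂ)) = t * (l * u) := by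
      rw [show 2 * Real.pi * -(t * (-(l * u) / (2 * Real.pi))) = t * (l * u) by
        field_simp [Real.pi_pos.ne']]
      push_cast; ring
    rw [this]; ring
  have := (Complex.continuous_re.tendsto 0).comp h5
  simpa [Function.comp_def] using this

end tauber

end PrimeSemigroup

namespace PrimeSemigroup

open MeasureTheory Topology

/-- A Tauberian theorem of Wiener–Ikehara type, in Laplace transform form. -/
theorem tendsto_of_laplace {B : ℝ → ℝ} {A C : ℝ} {Φ : ℂ → ℂ}
    (hmono : Monotone fun v => B v * Real.exp v) (hmeas : Measurable B)
    (hB0 : ∀ v, 0 ≤ B v) (hBC : ∀ v, B v ≤ C) (hneg : ∀ v ≤ 0, B v = 0) (hA : 0 ≤ A)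
    (hΦ : ContinuousOn Φ {z | 0 ≤ z.re})
    (hL : ∀ z : ℂ, 0 < z.re →
      ∫ v : ℝ, ((B v - Set.indicator (Set.Ioi 0) (fun _ => A) v : ℝ) : ℂ) * Complex.exp (-z * v)
        = Φ z) :
    Tendsto B atTop (𝓝 A) := by
  set ι : ℝ → ℝ := Set.indicator (Set.Ioi 0) (fun _ => A) with hι
  have ι0 : ∀ v, 0 ≤ ι v := fun v => Set.indicator_nonneg (fun _ _ => hA) v
  have ιA : ∀ v, ι v ≤ A := fun v => Set.indicator_le_self' (fun _ _ => hA) v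
  have ιm : Measurable ι := measurable_const.indicator measurableSet_Ioi
  have hC0 : 0 ≤ C := (hB0 0).trans (hBC 0)
  set g : ℝ → ℝ := fun v => B v - ι v with hg
  have hgm : Measurable g := hmeas.sub ιm
  have hgC : ∀ v, |g v| ≤ C + A := fun v => abs_le.2
    ⟨by simp only [hg]; linarith [hB0 v, ιA v], by simp only [hg]; linarith [hBC v, ι0 v]⟩
  have hg0 : ∀ v ≤ 0, g v = 0 := by
    intro v hv
    have : ι v = 0 := Set.indicator_of_notMem (by simpa using hv) _
    simp [hg, hneg v hv, this]
  have hlim : ∀ {l : ℝ}, 0 < l → Tendsto (fun u : ℝ => ∫ w, g (u - w / l) * fejK w) atTop (𝓝 0) :=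
    fun hl => fejer_limit hgm hgC hg0 hΦ hL hl
  set κ := ∫ w, fejK w with hκ
  have κpos : 0 < κ := integral_fejK_pos
  set κ' : ℝ → ℝ := fun W => ∫ w in Set.Icc (-W) W, fejK w with hκ'
  have hκlim : Tendsto κ' atTop (𝓝 κ) := by
    have := tendsto_setIntegral_of_monotone (μ := volume) (f := fejK)
      (s := fun W : ℝ => Set.Icc (-W) W) (fun _ => measurableSet_Icc)
      (fun a b hab => Set.Icc_subset_Icc (neg_le_neg hab) hab) integrable_fejK.integrableOn
    have hU : (⋃ W : ℝ, Set.Icc (-W) W) = Set.univ := by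
      ext x; simp only [Set.mem_iUnion, Set.mem_Icc, Set.mem_univ, iff_true]
      exact ⟨|x|, neg_abs_le x, le_abs_self x⟩
    rwa [hU, setIntegral_univ] at this
  have hexp : Tendsto (fun W : ℝ => Real.exp (-(2 / W))) atTop (𝓝 1) := by
    have h1 : Tendsto (fun W : ℝ => -(2 / W)) atTop (𝓝 0) := by
      simpa using (tendsto_const_nhds.div_atTop tendsto_id : Tendsto (fun W : ℝ => 2 / W) atTop (𝓝 0)).neg
    simpa [Function.comp_def] using (Real.continuous_exp.tendsto 0).comp h1
  have intB : ∀ (a l : ℝ) (f : ℝ → ℝ), Measurable f → (∃ D, ∀ v, |f v| ≤ D) →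
      Integrable fun w => f (a - w / l) * fejK w := by
    rintro a l f hf ⟨D, hD⟩
    refine Integrable.bdd_mul (c := D) integrable_fejK ?_ ?_
    · exact Measurable.aestronglyMeasurable (by fun_prop)
    · exact Eventually.of_forall fun w => by simpa using hD _
  have iB : ∀ a l : ℝ, Integrable fun w => B (a - w / l) * fejK w := fun a l =>
    intB a l B hmeas ⟨C, fun v => by rw [abs_of_nonneg (hB0 v)]; exact hBC v⟩
  have iι : ∀ a l : ℝ, Integrable fun w => ι (a - w / l) * fejK w := fun a l =>
    intB a l ι ιm ⟨A, fun v => by rw [abs_of_nonneg (ι0 v)]; exact ιA v⟩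
  have split : ∀ a l : ℝ, ∫ w, B (a - w / l) * fejK w =
      (∫ w, g (a - w / l) * fejK w) + ∫ w, ι (a - w / l) * fejK w := by
    intro a l
    refine Eq.trans ?_ (integral_add (intB a l g hgm ⟨_, hgC⟩) (iι a l))
    congr 1; ext w; simp only [hg]; ring
  have hcmp : ∀ {x y : ℝ}, x ≤ y → B x * Real.exp (x - y) ≤ B y := by
    intro x y hxy
    have := hmono hxy
    simp only at this
    rw [Real.exp_sub, ← mul_div_assoc, div_le_iff₀ (Real.exp_pos _)]
    exact this
  have hW0 : ∀ᶠ W : ℝ in atTop, 0 < W := eventually_gt_atTop 0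
  refine tendsto_order.2 ⟨fun a ha => ?_, fun a ha => ?_⟩
  · -- lower bound
    set η := A - a with hη
    have hηpos : 0 < η := by linarith
    have hl1 : Tendsto (fun W => Real.exp (-(2 / W)) * (A * κ' W - C * (κ - κ' W) - η * κ / 2))
        atTop (𝓝 (1 * (A * κ - C * (κ - κ) - η * κ / 2))) :=
      hexp.mul (((hκlim.const_mul A).sub ((hκlim.const_sub κ).const_mul C)).sub_const _)
    have hev := hl1.eventually_const_lt (u := a * κ) (by
      have : 0 < η * κ := mul_pos hηpos κpos
      rw [sub_self, mul_zero, sub_zero, one_mul, show a = A - η by rw [hη]; ring]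
      linarith)
    obtain ⟨W, hW, hWpos⟩ := (hev.and hW0).exists
    have hl : 0 < W ^ 2 := by positivity
    have h1 := ((hlim hl).comp (tendsto_atTop_add_const_right atTop (-(W / W ^ 2)) tendsto_id)
      ).eventually_const_lt (u := -(η * κ / 2)) (by have := mul_pos hηpos κpos; linarith)
    filter_upwards [h1, eventually_gt_atTop (2 / W)] with u hu hu2
    simp only [Function.comp, id] at hu
    have h2 : A * κ' W ≤ ∫ w, ι (u + -(W / W ^ 2) - w / W ^ 2) * fejK w := by
      rw [hκ', ← integral_const_mul]
      refine le_trans ?_ (setIntegral_le_integral (s := Set.Icc (-W) W) (iι _ _)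
        (Eventually.of_forall fun w => mul_nonneg (ι0 _) (fejK_nonneg w)))
      refine setIntegral_mono_on (integrable_fejK.integrableOn.const_mul A) (iι _ _).integrableOn
        measurableSet_Icc fun w hw => ?_
      have : ι (u + -(W / W ^ 2) - w / W ^ 2) = A := by
        refine Set.indicator_of_mem ?_ _
        have : w / W ^ 2 ≤ W / W ^ 2 := div_le_div_of_nonneg_right hw.2 hl.le
        have h3 : W / W ^ 2 = 1 / W := by field_simp
        rw [Set.mem_Ioi]
        have : 2 / W = 1 / W + 1 / W := by ring
        linarith
      rw [this]
    have h3 : ∫ w, B (u + -(W / W ^ 2) - w / W ^ 2) * fejK w ≤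
        B u * Real.exp (2 / W) * κ + C * (κ - κ' W) := by
      rw [← integral_add_compl (measurableSet_Icc (a := -W) (b := W)) (iB _ _)]
      have hc : κ - κ' W = ∫ w in (Set.Icc (-W) W)ᶜ, fejK w := by
        rw [hκ, ← integral_add_compl (measurableSet_Icc (a := -W) (b := W)) integrable_fejK]
        simp [hκ']
      refine add_le_add ?_ ?_
      · refine le_trans (b := B u * Real.exp (2 / W) * κ' W) ?_ ?_
        · rw [hκ', ← integral_const_mul]
          refine setIntegral_mono_on (iB _ _).integrableOn
            (integrable_fejK.integrableOn.const_mul _) measurableSet_Icc fun w hw => ?_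
          refine mul_le_mul_of_nonneg_right ?_ (fejK_nonneg w)
          have e1 : -(W / W ^ 2) ≤ w / W ^ 2 := by
            rw [← neg_div]; exact div_le_div_of_nonneg_right hw.1 hl.le
          have e2 : w / W ^ 2 ≤ W / W ^ 2 := div_le_div_of_nonneg_right hw.2 hl.le
          have e3 : W / W ^ 2 = 1 / W := by field_simp
          have e4 : 2 / W = 1 / W + 1 / W := by ring
          have := hcmp (x := u + -(W / W ^ 2) - w / W ^ 2) (y := u) (by linarith)
          rw [← le_div_iff₀ (Real.exp_pos _)] at this
          refine this.trans ?_
          rw [div_eq_mul_inv, ← Real.exp_neg]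
          refine mul_le_mul_of_nonneg_left (Real.exp_le_exp.2 ?_) (hB0 u)
          linarith
        · refine mul_le_mul_of_nonneg_left ?_ (mul_nonneg (hB0 u) (Real.exp_pos _).le)
          exact setIntegral_le_integral integrable_fejK
            (Eventually.of_forall fun w => fejK_nonneg w)
      · rw [hc, ← integral_const_mul]
        refine setIntegral_mono_on (iB _ _).integrableOn
          (integrable_fejK.integrableOn.const_mul _) measurableSet_Icc.compl fun w _ => ?_
        exact mul_le_mul_of_nonneg_right (hBC _) (fejK_nonneg w)
    rw [split] at h3
    have h4 : A * κ' W - C * (κ - κ' W) - η * κ / 2 < B u * Real.exp (2 / W) * κ := by linarith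
    have h5 : a * κ < B u * κ := by
      refine hW.trans ?_
      have := mul_lt_mul_of_pos_left h4 (Real.exp_pos (-(2 / W)))
      refine this.trans_eq ?_
      have e : Real.exp (-(2 / W)) * Real.exp (2 / W) = 1 := by rw [← Real.exp_add]; simp
      calc _ = B u * κ * (Real.exp (-(2 / W)) * Real.exp (2 / W)) := by ring
        _ = _ := by rw [e, mul_one]
    exact lt_of_mul_lt_mul_right h5 κpos.le
  · -- upper bound
    set η := a - A with hη
    have hηpos : 0 < η := by linarith
    have hl1 : Tendsto (fun W => a * (Real.exp (-(2 / W)) * κ' W)) atTop (𝓝 (a * (1 * κ))) :=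
      (hexp.mul hκlim).const_mul a
    have hev := hl1.eventually_const_lt (u := A * κ + η * κ / 2) (by
      have : 0 < η * κ := mul_pos hηpos κpos
      rw [one_mul, show a = A + η by rw [hη]; ring]
      linarith)
    obtain ⟨W, hW, hWpos⟩ := (hev.and hW0).exists
    have hl : 0 < W ^ 2 := by positivity
    have h1 := ((hlim hl).comp (tendsto_atTop_add_const_right atTop (W / W ^ 2) tendsto_id)
      ).eventually_lt_const (u := η * κ / 2) (by have := mul_pos hηpos κpos; linarith)
    filter_upwards [h1] with u hu
    simp only [Function.comp, id] at hu
    have h2 : ∫ w, ι (u + W / W ^ 2 - w / W ^ 2) * fejK w ≤ A * κ := by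
      rw [hκ, ← integral_const_mul]
      exact integral_mono (iι _ _) (integrable_fejK.const_mul A)
        fun w => mul_le_mul_of_nonneg_right (ιA _) (fejK_nonneg w)
    have h3 : B u * (Real.exp (-(2 / W)) * κ' W) ≤
        ∫ w, B (u + W / W ^ 2 - w / W ^ 2) * fejK w := by
      rw [← mul_assoc, hκ', ← integral_const_mul]
      refine le_trans ?_ (setIntegral_le_integral (s := Set.Icc (-W) W) (iB _ _)
        (Eventually.of_forall fun w => mul_nonneg (hB0 _) (fejK_nonneg w)))
      refine setIntegral_mono_on (integrable_fejK.integrableOn.const_mul _) (iB _ _).integrableOn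
        measurableSet_Icc fun w hw => ?_
      refine mul_le_mul_of_nonneg_right ?_ (fejK_nonneg w)
      have e1 : -(W / W ^ 2) ≤ w / W ^ 2 := by
        rw [← neg_div]; exact div_le_div_of_nonneg_right hw.1 hl.le
      have e2 : w / W ^ 2 ≤ W / W ^ 2 := div_le_div_of_nonneg_right hw.2 hl.le
      have e3 : W / W ^ 2 = 1 / W := by field_simp
      have e4 : 2 / W = 1 / W + 1 / W := by ring
      refine le_trans ?_ (hcmp (x := u) (y := u + W / W ^ 2 - w / W ^ 2) (by linarith))
      refine mul_le_mul_of_nonneg_left (Real.exp_le_exp.2 ?_) (hB0 u)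
      linarith
    rw [split] at h3
    have h4 : B u * (Real.exp (-(2 / W)) * κ' W) < a * (Real.exp (-(2 / W)) * κ' W) := by
      linarith
    refine lt_of_mul_lt_mul_right h4 (mul_nonneg (Real.exp_pos _).le ?_)
    exact setIntegral_nonneg measurableSet_Icc fun w _ => fejK_nonneg w

end PrimeSemigroup

namespace PrimeSemigroup

open MeasureTheory Topology ArithmeticFunction ArithmeticFunction.vonMangoldt

variable {q : ℕ} [NeZero q] {a : ZMod q}

lemma sum_residueClass_le (a : ZMod q) (x : ℝ) :
    ∑ n ∈ Finset.Icc 1 ⌊x⌋₊, residueClass a n ≤ Chebyshev.psi x := by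
  rw [Chebyshev.psi]
  exact Finset.sum_le_sum fun n _ => residueClass_le a n

lemma sum_residueClass_isBigO (a : ZMod q) :
    (fun n : ℕ => ∑ k ∈ Finset.Icc 1 n, residueClass a k) =O[atTop] fun n => (n : ℝ) ^ (1:ℝ) := by
  refine Asymptotics.IsBigO.of_bound (Real.log 4 + 4) (Eventually.of_forall fun n => ?_)
  have h1 := sum_residueClass_le a (n : ℝ)
  rw [Nat.floor_natCast] at h1
  rw [Real.norm_eq_abs, abs_of_nonneg (Finset.sum_nonneg fun i _ => residueClass_nonneg a i),
    Real.rpow_one, Real.norm_of_nonneg (Nat.cast_nonneg n)]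
  exact h1.trans (Chebyshev.psi_le_const_mul_self (Nat.cast_nonneg n))

lemma laplace_residueClass (z : ℂ) (hz : 0 < z.re) :
    LSeries (fun n => (residueClass a n : ℂ)) (1 + z) = (1 + z) *
      ∫ v in Set.Ioi (0:ℝ), (((∑ n ∈ Finset.Icc 1 ⌊Real.exp v⌋₊, residueClass a n) *
        Real.exp (-v) : ℝ) : ℂ) * Complex.exp (-z * v) := by
  rw [LSeries_eq_mul_integral_of_nonneg (residueClass a) (r := 1) zero_le_one (s := 1 + z)
    (by simpa using hz) (sum_residueClass_isBigO a) (residueClass_nonneg a)]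
  congr 1
  have himg : Real.exp '' Set.Ioi 0 = Set.Ioi 1 := by
    ext y; constructor
    · rintro ⟨x, hx, rfl⟩; exact Real.one_lt_exp_iff.2 hx
    · intro hy
      have : 0 < y := lt_trans one_pos hy
      exact ⟨Real.log y, Real.log_pos hy, Real.exp_log this⟩
  rw [← himg, integral_image_eq_integral_abs_deriv_smul measurableSet_Ioi
    (fun x _ => (Real.hasDerivAt_exp x).hasDerivWithinAt) Real.exp_injective.injOn]
  refine setIntegral_congr_fun measurableSet_Ioi fun v _ => ?_
  rw [abs_of_pos (Real.exp_pos v), Complex.real_smul,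
    Complex.cpow_def_of_ne_zero (by exact_mod_cast (Real.exp_pos v).ne'), ← Complex.ofReal_log
    (Real.exp_pos v).le, Real.log_exp]
  push_cast
  have : Complex.exp v * Complex.exp (v * -(1 + z + 1)) = Complex.exp (-v) * Complex.exp (-z * v) := by
    rw [← Complex.exp_add, ← Complex.exp_add]; congr 1; ring
  rw [mul_left_comm, this, mul_assoc]

lemma tendsto_sum_residueClass_div (ha : IsUnit a) :
    Tendsto (fun x : ℝ => (∑ n ∈ Finset.Icc 1 ⌊x⌋₊, residueClass a n) / x) atTop
      (𝓝 ((q.totient : ℝ)⁻¹)) := by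
  set A : ℝ := (q.totient : ℝ)⁻¹ with hA
  have hA0 : 0 ≤ A := by positivity
  set B : ℝ → ℝ := fun v => (∑ n ∈ Finset.Icc 1 ⌊Real.exp v⌋₊, residueClass a n) *
    Real.exp (-v) with hB
  have hmono0 : Monotone fun v : ℝ => ∑ n ∈ Finset.Icc 1 ⌊Real.exp v⌋₊, residueClass a n := by
    intro v w hvw
    refine Finset.sum_le_sum_of_subset_of_nonneg ?_ fun i _ _ => residueClass_nonneg a i
    exact Finset.Icc_subset_Icc le_rfl (Nat.floor_mono (Real.exp_le_exp.2 hvw))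
  have hBe : ∀ v, B v * Real.exp v = ∑ n ∈ Finset.Icc 1 ⌊Real.exp v⌋₊, residueClass a n := by
    intro v
    rw [hB]; simp only
    rw [mul_assoc, ← Real.exp_add]; simp
  have hmeas : Measurable B := hmono0.measurable.mul (by fun_prop)
  have hB0 : ∀ v, 0 ≤ B v := fun v =>
    mul_nonneg (Finset.sum_nonneg fun i _ => residueClass_nonneg a i) (Real.exp_pos _).le
  have hBC : ∀ v, B v ≤ Real.log 4 + 4 := by
    intro v
    have h1 := (sum_residueClass_le a (Real.exp v)).trans
      (Chebyshev.psi_le_const_mul_self (Real.exp_pos v).le)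
    rw [← hBe] at h1
    exact le_of_mul_le_mul_right h1 (Real.exp_pos v)
  have hneg : ∀ v ≤ 0, B v = 0 := by
    intro v hv
    have h1 := sum_residueClass_le a (Real.exp v)
    rw [Chebyshev.psi_eq_zero_of_le_one (Real.exp_le_one_iff.2 hv), ← hBe] at h1
    have := hB0 v
    have h2 := Real.exp_pos v
    nlinarith
  set Φ : ℂ → ℂ := fun z => (LFunctionResidueClassAux a (1 + z) - A) / (1 + z) with hΦd
  have hΦ : ContinuousOn Φ {z | 0 ≤ z.re} := by
    refine ContinuousOn.div (ContinuousOn.sub ?_ continuousOn_const) (by fun_prop) ?_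
    · refine (continuousOn_LFunctionResidueClassAux a).comp (by fun_prop) ?_
      intro z hz
      simpa using hz
    · intro z hz h
      have := congrArg Complex.re h
      simp at this
      have hz' : 0 ≤ z.re := hz
      linarith
  have hL : ∀ z : ℂ, 0 < z.re →
      ∫ v : ℝ, ((B v - Set.indicator (Set.Ioi 0) (fun _ => A) v : ℝ) : ℂ) * Complex.exp (-z * v)
        = Φ z := by
    intro z hz
    have hexp : IntegrableOn (fun v : ℝ => Complex.exp (-z * v)) (Set.Ioi 0) :=
      integrableOn_exp_mul_complex_Ioi (by simpa using hz) 0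
    have e0 : ∫ v : ℝ, ((B v - Set.indicator (Set.Ioi 0) (fun _ => A) v : ℝ) : ℂ) *
        Complex.exp (-z * v) = ∫ v in Set.Ioi (0:ℝ), ((B v : ℂ) * Complex.exp (-z * v) -
          A * Complex.exp (-z * v)) := by
      rw [← setIntegral_eq_integral_of_forall_compl_eq_zero (s := Set.Ioi (0:ℝ))]
      · refine setIntegral_congr_fun measurableSet_Ioi fun v hv => ?_
        rw [Set.indicator_of_mem hv]; push_cast; ring
      · intro v hv
        rw [Set.indicator_of_notMem hv, hneg v (by simpa using hv)]; simp
    rw [e0, integral_sub]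
    · rw [integral_const_mul, integral_exp_mul_complex_Ioi (by simpa using hz)]
      have h1 : LSeries (fun n => (residueClass a n : ℂ)) (1 + z) = (1 + z) *
        ∫ v in Set.Ioi (0:ℝ), (B v : ℂ) * Complex.exp (-z * v) := laplace_residueClass z hz
      set J := ∫ v in Set.Ioi (0:ℝ), (B v : ℂ) * Complex.exp (-z * v)
      have h2 := eqOn_LFunctionResidueClassAux ha (x := 1 + z) (by simpa using hz)
      have hz0 : z ≠ 0 := by rintro rfl; simp at hz
      have hz1 : 1 + z ≠ 0 := by
        intro h
        have := congrArg Complex.re h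
        simp at this; linarith
      simp only [hΦd]
      rw [h2]
      simp only
      rw [h1, hA]
      push_cast
      simp only [mul_zero, Complex.exp_zero]
      rw [add_sub_cancel_left]
      have hq0 : (q.totient : ℂ) ≠ 0 := by
        exact_mod_cast (Nat.totient_pos.2 (NeZero.pos q)).ne'
      field_simp
      ring
    · refine Integrable.bdd_mul (c := Real.log 4 + 4) hexp ?_ ?_
      · exact (Complex.measurable_ofReal.comp hmeas).aestronglyMeasurable
      · refine Eventually.of_forall fun v => ?_
        rw [Complex.norm_of_nonneg (hB0 v)]; exact hBC v
    · exact hexp.const_mul _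
  have key := tendsto_of_laplace (by simpa only [hBe] using hmono0) hmeas hB0 hBC hneg hA0 hΦ hL
  refine (key.comp Real.tendsto_log_atTop).congr' ?_
  filter_upwards [eventually_gt_atTop 0] with x hx
  simp only [Function.comp, hB]
  rw [Real.exp_log hx, Real.exp_neg, Real.exp_log hx, div_eq_mul_inv]

end PrimeSemigroup

namespace PrimeSemigroup

open Finset

/-- The prime-supported weight `log p`. -/
noncomputable def vt (n : ℕ) : ℝ := if n.Prime then Real.log n else 0

/-- The local model for the primes modulo `W`. -/
noncomputable def mdl (W n : ℕ) : ℝ := if n.Coprime W then (W : ℝ) / W.totient else 0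

lemma vt_nonneg (n : ℕ) : 0 ≤ vt n := by
  unfold vt; split_ifs
  · exact Real.log_natCast_nonneg n
  · exact le_rfl

lemma vt_le_vonMangoldt (n : ℕ) : vt n ≤ ArithmeticFunction.vonMangoldt n := by
  unfold vt; split_ifs with h
  · rw [ArithmeticFunction.vonMangoldt_apply_prime h]
  · exact ArithmeticFunction.vonMangoldt_nonneg

lemma mdl_nonneg (W n : ℕ) : 0 ≤ mdl W n := by
  unfold mdl; split_ifs
  · positivity
  · exact le_rfl

lemma sum_vonMangoldt_le (x : ℕ) :
    ∑ n ∈ Ioc 0 x, ArithmeticFunction.vonMangoldt n ≤ 6 * x := by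
  have h := Chebyshev.psi_le_const_mul_self (Nat.cast_nonneg (α := ℝ) x)
  rw [Chebyshev.psi, Nat.floor_natCast] at h
  refine h.trans (mul_le_mul_of_nonneg_right ?_ (Nat.cast_nonneg x))
  have : Real.log 4 = 2 * Real.log 2 := by
    rw [show (4:ℝ) = 2 ^ 2 by norm_num, Real.log_pow]; norm_num
  linarith [Real.log_two_lt_d9]

lemma sum_vonMangoldt_sub_vt_le {x : ℕ} (hx : 1 ≤ x) :
    ∑ n ∈ Ioc 0 x, (ArithmeticFunction.vonMangoldt n - vt n) ≤ 2 * √x * Real.log x := by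
  have h := Chebyshev.psi_sub_theta_le (x := x) (by exact_mod_cast hx)
  rw [Chebyshev.psi, Chebyshev.theta, Nat.floor_natCast, sum_filter, ← sum_sub_distrib] at h
  exact h

lemma abs_card_Ioc_modEq_sub_le {q : ℕ} (hq : 0 < q) (v A B : ℕ) (hAB : A ≤ B) :
    |(#{n ∈ Ioc A B | n ≡ v [MOD q]} : ℝ) - ((B : ℝ) - A) / q| ≤ 1 := by
  have h := Nat.Ioc_filter_modEq_card A B hq v
  have hq' : (0:ℚ) < q := by exact_mod_cast hq
  set s := ((B:ℚ) - v) / q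
  set t := ((A:ℚ) - v) / q
  have hst : t ≤ s := by
    apply div_le_div_of_nonneg_right _ hq'.le
    have : (A:ℚ) ≤ B := by exact_mod_cast hAB
    linarith
  have hd : s - t = ((B:ℚ) - A) / q := by simp only [s, t]; ring
  rw [max_eq_left (sub_nonneg.2 (Int.floor_mono hst))] at h
  have h' : ((#{n ∈ Ioc A B | n ≡ v [MOD q]} : ℕ) : ℚ) = (⌊s⌋ : ℚ) - ⌊t⌋ := by exact_mod_cast h
  have key : |((#{n ∈ Ioc A B | n ≡ v [MOD q]} : ℕ) : ℚ) - ((B:ℚ) - A) / q| ≤ 1 := by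
    rw [h', ← hd, abs_le]
    constructor <;> linarith [Int.floor_le s, Int.lt_floor_add_one s, Int.floor_le t,
      Int.lt_floor_add_one t]
  have := (Rat.cast_le (K := ℝ)).2 key
  push_cast at this
  exact this

open ArithmeticFunction.vonMangoldt in
lemma tendsto_class_sum_div {W : ℕ} (hW : 0 < W) (r : ℕ) :
    Tendsto (fun x : ℕ => (∑ n ∈ Ioc 0 x with n ≡ r [MOD W], (vt n - mdl W n)) / x) atTop
      (nhds 0) := by
  have : NeZero W := ⟨hW.ne'⟩
  by_cases hr : r.Coprime W
  · have hu : IsUnit (r : ZMod W) := (ZMod.isUnit_iff_coprime r W).2 hr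
    have h1 := (tendsto_sum_residueClass_div hu).comp (tendsto_natCast_atTop_atTop (R := ℝ))
    have h2 : Tendsto (fun x : ℕ => (∑ n ∈ Ioc 0 x with n ≡ r [MOD W],
        (ArithmeticFunction.vonMangoldt n - vt n)) / (x : ℝ)) atTop (nhds 0) := by
      have hlog : Tendsto (fun x : ℝ => 2 * (Real.log x / x ^ (1 / 2 : ℝ))) atTop (nhds (2 * 0)) :=
        ((isLittleO_log_rpow_atTop (by norm_num)).tendsto_div_nhds_zero).const_mul 2
      rw [mul_zero] at hlog
      refine squeeze_zero' ?_ ?_ (hlog.comp (tendsto_natCast_atTop_atTop (R := ℝ)))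
      · refine Eventually.of_forall fun x => div_nonneg (sum_nonneg fun n _ => ?_) (Nat.cast_nonneg x)
        linarith [vt_le_vonMangoldt n]
      · filter_upwards [eventually_ge_atTop 1] with x hx
        have hx0 : (0:ℝ) < x := by exact_mod_cast hx
        have e := sum_vonMangoldt_sub_vt_le hx
        have e' : ∑ n ∈ Ioc 0 x with n ≡ r [MOD W], (ArithmeticFunction.vonMangoldt n - vt n) ≤
            ∑ n ∈ Ioc 0 x, (ArithmeticFunction.vonMangoldt n - vt n) :=
          sum_le_sum_of_subset_of_nonneg (filter_subset _ _)
            fun n _ _ => by linarith [vt_le_vonMangoldt n]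
        simp only [Function.comp]
        rw [div_le_iff₀ hx0, ← Real.sqrt_eq_rpow]
        have hs : √(x:ℝ) * √x = x := Real.mul_self_sqrt hx0.le
        have hs0 : 0 < √(x:ℝ) := Real.sqrt_pos.2 hx0
        calc _ ≤ 2 * √(x:ℝ) * Real.log x := e'.trans e
          _ = 2 * (Real.log x / √x) * x := by
            field_simp; rw [Real.sq_sqrt hx0.le, mul_comm]
    have h3 : Tendsto (fun x : ℕ => (∑ n ∈ Ioc 0 x with n ≡ r [MOD W], mdl W n) / (x : ℝ)) atTop
        (nhds (W.totient : ℝ)⁻¹) := by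
      have hW' : (0:ℝ) < W := by exact_mod_cast hW
      have hφ : (0:ℝ) < W.totient := by exact_mod_cast Nat.totient_pos.2 hW
      have h4 : Tendsto (fun x : ℕ => (#{n ∈ Ioc 0 x | n ≡ r [MOD W]} : ℝ) / x) atTop
          (nhds (1 / W)) := by
        rw [tendsto_iff_norm_sub_tendsto_zero]
        refine squeeze_zero' (Eventually.of_forall fun _ => norm_nonneg _) ?_
          (tendsto_one_div_atTop_nhds_zero_nat (𝕜 := ℝ))
        filter_upwards [eventually_ge_atTop 1] with x hx
        have hx0 : (0:ℝ) < x := by exact_mod_cast hx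
        have := abs_card_Ioc_modEq_sub_le hW r 0 x (Nat.zero_le x)
        rw [Nat.cast_zero, sub_zero] at this
        rw [Real.norm_eq_abs, le_div_iff₀ hx0, ← abs_of_pos hx0, ← abs_mul, abs_of_pos hx0]
        refine le_trans (le_of_eq ?_) this
        congr 1; field_simp
      have h5 := h4.const_mul ((W : ℝ) / W.totient)
      have e1 : (W : ℝ) / W.totient * (1 / W) = (W.totient : ℝ)⁻¹ := by field_simp
      rw [e1] at h5
      refine h5.congr fun x => ?_
      have : ∑ n ∈ Ioc 0 x with n ≡ r [MOD W], mdl W n =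
          ∑ n ∈ Ioc 0 x with n ≡ r [MOD W], (W : ℝ) / W.totient := by
        refine sum_congr rfl fun n hn => ?_
        have hn := (mem_filter.1 hn).2
        have : n.Coprime W := by
          have := Nat.ModEq.gcd_eq hn
          rw [Nat.coprime_iff_gcd_eq_one, this]; exact hr
        rw [mdl, if_pos this]
      rw [this, sum_const, nsmul_eq_mul]; ring
    have h6 := (h1.sub h2).sub h3
    rw [sub_zero, sub_self] at h6
    refine h6.congr fun x => ?_
    simp only [Function.comp, Nat.floor_natCast]
    rw [← sub_div, ← sub_div]
    congr 1
    have : ∑ n ∈ Icc 1 x, residueClass (r : ZMod W) n =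
        ∑ n ∈ Ioc 0 x with n ≡ r [MOD W], ArithmeticFunction.vonMangoldt n := by
      rw [sum_filter]
      refine sum_congr (by ext; simp [Nat.lt_iff_add_one_le]) fun n _ => ?_
      rw [residueClass, Set.indicator_apply]
      simp only [Set.mem_ofPred_eq, ZMod.natCast_eq_natCast_iff]
    rw [this, sum_sub_distrib, sum_sub_distrib]
    ring
  · have hb : ∀ x : ℕ, |∑ n ∈ Ioc 0 x with n ≡ r [MOD W], (vt n - mdl W n)| ≤
        ∑ n ∈ Ioc 0 W, vt n := by
      intro x
      refine (abs_sum_le_sum_abs _ _).trans ?_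
      have hnc : ∀ n, n ≡ r [MOD W] → ¬ n.Coprime W := by
        intro n hn hc
        apply hr
        have := Nat.ModEq.gcd_eq hn
        rw [Nat.coprime_iff_gcd_eq_one, ← this]; exact hc
      have h1 : ∀ n ∈ (Ioc 0 x).filter (· ≡ r [MOD W]), |vt n - mdl W n| =
          if n ∈ Ioc 0 W then vt n else 0 := by
        intro n hn
        have hn' := hnc n (mem_filter.1 hn).2
        rw [mdl, if_neg hn', sub_zero, abs_of_nonneg (vt_nonneg n)]
        split_ifs with h
        · rfl
        · unfold vt
          rw [if_neg]
          intro hp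
          apply hn'
          rw [Nat.Prime.coprime_iff_not_dvd hp]
          intro hd
          exact h (mem_Ioc.2 ⟨hp.pos, Nat.le_of_dvd hW hd⟩)
      rw [sum_congr rfl h1, ← sum_filter]
      refine sum_le_sum_of_subset_of_nonneg ?_ fun n _ _ => vt_nonneg n
      intro n hn; exact (mem_filter.1 hn).2
    rw [tendsto_zero_iff_norm_tendsto_zero]
    refine squeeze_zero (fun _ => norm_nonneg _) (fun x => ?_)
      (tendsto_const_div_atTop_nhds_zero_nat (∑ n ∈ Ioc 0 W, vt n))
    rw [norm_div, Real.norm_eq_abs, Real.norm_of_nonneg (Nat.cast_nonneg x)]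
    exact div_le_div_of_nonneg_right (hb x) (Nat.cast_nonneg x)

lemma class_sum_le {W : ℕ} (hW : 0 < W) (r : ℕ) {η : ℝ} (hη : 0 < η) :
    ∃ N0 : ℕ, ∀ N ≥ N0, ∀ x ≤ N,
      |∑ n ∈ Ioc 0 x with n ≡ r [MOD W], (vt n - mdl W n)| ≤ η * N := by
  have h := tendsto_class_sum_div hW r
  rw [Metric.tendsto_atTop] at h
  obtain ⟨x0, hx0⟩ := h η hη
  set T : ℕ → ℝ := fun x => ∑ n ∈ Ioc 0 x with n ≡ r [MOD W], (vt n - mdl W n) with hT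
  obtain ⟨N0, hN0⟩ := exists_nat_ge ((∑ x ∈ range x0, |T x|) / η)
  refine ⟨N0, fun N hN x hx => ?_⟩
  change |T x| ≤ _
  have hxN : (x : ℝ) ≤ N := by exact_mod_cast hx
  rcases lt_or_ge x x0 with h1 | h1
  · have h2 : |T x| ≤ ∑ x ∈ range x0, |T x| :=
      single_le_sum (f := fun x => |T x|) (fun _ _ => abs_nonneg _) (mem_range.2 h1)
    rw [div_le_iff₀ hη] at hN0
    have : (N0 : ℝ) ≤ N := by exact_mod_cast hN
    nlinarith
  · have h2 := hx0 x h1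
    rw [Real.dist_eq, sub_zero, abs_div, Nat.abs_cast] at h2
    rcases Nat.eq_zero_or_pos x with h3 | h3
    · subst h3; simp [hT]; positivity
    · have hx0' : (0:ℝ) < x := by exact_mod_cast h3
      rw [div_lt_iff₀ hx0'] at h2
      exact h2.le.trans (mul_le_mul_of_nonneg_left hxN hη.le)

lemma ex_natCast_mul_div_modEq {W n r : ℕ} (hW : 0 < W) (c : ℤ) (h : n ≡ r [MOD W]) :
    ex (n * (c / W)) = ex (r * (c / W)) := by
  obtain ⟨k, hk⟩ := Nat.modEq_iff_dvd.1 h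
  have hW' : (W : ℝ) ≠ 0 := by exact_mod_cast hW.ne'
  have : (r : ℝ) = n + W * k := by
    have : (r : ℤ) = n + W * k := by linarith
    exact_mod_cast this
  rw [this, show ((n : ℝ) + W * k) * (c / W) = n * (c / W) + (k * c : ℤ) by
    push_cast; field_simp, ex_add_int]

lemma pnt_model {W : ℕ} (hW : 0 < W) {η : ℝ} (hη : 0 < η) :
    ∃ N0 : ℕ, ∀ N ≥ N0, ∀ x ≤ N, ∀ c : ℤ,
      ‖∑ n ∈ Ioc 0 x, ((vt n - mdl W n : ℝ) : ℂ) * ex (n * (c / W))‖ ≤ η * N := by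
  have hW' : (0:ℝ) < W := by exact_mod_cast hW
  choose N0 hN0 using fun r : ℕ => class_sum_le hW r (div_pos hη hW')
  refine ⟨(range W).sup N0, fun N hN x hx c => ?_⟩
  have h1 : ∀ n ∈ Ioc 0 x, n % W ∈ range W := fun n _ => mem_range.2 (Nat.mod_lt n hW)
  rw [← sum_fiberwise_of_maps_to h1]
  refine (norm_sum_le _ _).trans ?_
  have h2 : ∀ r ∈ range W, ‖∑ n ∈ Ioc 0 x with n % W = r,
      ((vt n - mdl W n : ℝ) : ℂ) * ex (n * (c / W))‖ ≤ η / W * N := by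
    intro r hr
    have hrW := mem_range.1 hr
    have e1 : ∀ n, n % W = r ↔ n ≡ r [MOD W] := fun n => by
      rw [Nat.ModEq, Nat.mod_eq_of_lt hrW]
    simp only [e1]
    have e2 : ∑ n ∈ Ioc 0 x with n ≡ r [MOD W], ((vt n - mdl W n : ℝ) : ℂ) * ex (n * (c / W)) =
        ((∑ n ∈ Ioc 0 x with n ≡ r [MOD W], (vt n - mdl W n) : ℝ) : ℂ) * ex (r * (c / W)) := by
      rw [Complex.ofReal_sum, sum_mul]
      refine sum_congr rfl fun n hn => ?_
      rw [ex_natCast_mul_div_modEq hW c (mem_filter.1 hn).2]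
    rw [e2, norm_mul, norm_ex, mul_one, Complex.norm_real]
    exact hN0 r N ((le_sup hr).trans hN) x hx
  refine (sum_le_sum h2).trans (le_of_eq ?_)
  rw [sum_const, card_range, nsmul_eq_mul]; field_simp

end PrimeSemigroup

namespace PrimeSemigroup

open Finset

lemma sum_inv_sq_int_le (T : Finset ℤ) (hT : ∀ k ∈ T, k ≠ 0) :
    ∑ k ∈ T, ((k : ℝ) ^ 2)⁻¹ ≤ 4 := by
  have aux : ∀ U : Finset ℕ, (∀ k ∈ U, k ≠ 0) → ∑ k ∈ U, ((k : ℝ) ^ 2)⁻¹ ≤ 2 := by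
    intro U hU
    have h1 : U ⊆ Ioo 0 (U.sup id + 1) := by
      intro k hk
      exact mem_Ioo.2 ⟨Nat.pos_of_ne_zero (hU k hk), Nat.lt_succ_of_le (le_sup (f := id) hk)⟩
    refine (sum_le_sum_of_subset_of_nonneg h1 fun _ _ _ => by positivity).trans ?_
    refine (sum_Ioo_inv_sq_le 0 _).trans ?_
    norm_num
  have half : ∀ V : Finset ℤ, (∀ k ∈ V, k ≠ 0) → Set.InjOn Int.natAbs V →
      ∑ k ∈ V, ((k : ℝ) ^ 2)⁻¹ ≤ 2 := by
    intro V hV hinj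
    have := aux (V.image Int.natAbs) (by
      intro k hk
      obtain ⟨z, hz, rfl⟩ := mem_image.1 hk
      exact Int.natAbs_ne_zero.2 (hV z hz))
    rw [sum_image hinj] at this
    refine le_trans (le_of_eq (sum_congr rfl fun k _ => ?_)) this
    have : ((k.natAbs : ℝ)) = |(k : ℝ)| := by rw [Nat.cast_natAbs]; simp
    rw [this, sq_abs]
  rw [← sum_filter_add_sum_filter_not T (fun k => 0 < k)]
  have h1 := half (T.filter fun k => 0 < k) (fun k hk => hT k (mem_filter.1 hk).1) (by
    intro a ha b hb hab
    have ha := (mem_filter.1 ha).2; have hb := (mem_filter.1 hb).2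
    omega)
  have h2 := half (T.filter fun k => ¬ 0 < k) (fun k hk => hT k (mem_filter.1 hk).1) (by
    intro a ha b hb hab
    have ha := (mem_filter.1 ha).2; have hb := (mem_filter.1 hb).2
    omega)
  linarith

lemma sum_inv_nd_sq_le {ι : Type*} (s : Finset ι) (θ : ι → ℝ) {δ : ℝ} (hδ : 0 < δ)
    (h0 : ∀ j ∈ s, δ ≤ nd (θ j)) (hs : ∀ j ∈ s, ∀ k ∈ s, j ≠ k → δ ≤ nd (θ j - θ k)) :
    ∑ j ∈ s, 1 / nd (θ j) ^ 2 ≤ 16 / δ ^ 2 := by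
  set r : ι → ℝ := fun j => θ j - round (θ j) with hr
  set κ : ι → ℤ := fun j => ⌊r j / δ⌋ with hκ
  have hnd : ∀ j, nd (θ j) = |r j| := fun j => rfl
  have hk1 : ∀ j, (κ j : ℝ) * δ ≤ r j := fun j => by
    rw [← le_div_iff₀ hδ]; exact Int.floor_le _
  have hk2 : ∀ j, r j < ((κ j : ℝ) + 1) * δ := fun j => by
    rw [← div_lt_iff₀ hδ]; exact Int.lt_floor_add_one _
  have hk0 : ∀ j ∈ s, κ j ≠ 0 := by
    intro j hj h
    have h1 := hk1 j; have h2 := hk2 j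
    rw [h] at h1 h2
    simp at h1 h2
    have := h0 j hj
    rw [hnd, abs_of_nonneg h1] at this
    linarith
  have hinj : Set.InjOn κ s := by
    intro j hj k hk hjk
    by_contra hne
    have h1 := hs j hj k hk hne
    have h2 : nd (θ j - θ k) ≤ |r j - r k| := by
      have := nd_le_abs_sub_int (θ j - θ k) (round (θ j) - round (θ k))
      refine this.trans_eq ?_
      congr 1; simp only [hr]; push_cast; ring
    have h3 : |r j - r k| < δ := by
      have := hk1 j; have := hk2 j; have := hk1 k; have := hk2 k
      rw [hjk] at *
      rw [abs_lt]; constructor <;> linarith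
    linarith
  have hbd : ∀ j ∈ s, 1 / nd (θ j) ^ 2 ≤ 4 / δ ^ 2 * ((κ j : ℝ) ^ 2)⁻¹ := by
    intro j hj
    have hkne : (κ j : ℝ) ≠ 0 := by exact_mod_cast hk0 j hj
    have hpos : 0 < nd (θ j) := hδ.trans_le (h0 j hj)
    have key : |(κ j : ℝ)| * δ ≤ 2 * nd (θ j) := by
      rcases lt_or_gt_of_ne (hk0 j hj) with h | h
      · have h' : (κ j : ℝ) ≤ -1 := by exact_mod_cast Int.le_sub_one_of_lt h
        rw [abs_of_neg (by linarith), hnd]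
        have h3 := hk2 j
        have h4 := h0 j hj
        rw [hnd] at h4
        have h5 := neg_abs_le (r j)
        nlinarith
      · have h' : (0 : ℝ) < κ j := by exact_mod_cast h
        rw [abs_of_pos h', hnd]
        have h3 := hk1 j
        have h5 := le_abs_self (r j)
        have : 0 ≤ |r j| := abs_nonneg _
        linarith
    have hsq : (κ j : ℝ) ^ 2 * δ ^ 2 ≤ 4 * nd (θ j) ^ 2 := by
      have := pow_le_pow_left₀ (by positivity) key 2
      rw [mul_pow, sq_abs] at this
      linarith
    rw [div_mul_eq_mul_div, ← div_eq_mul_inv, div_div, div_le_div_iff₀ (by positivity) (by positivity)]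
    linarith
  refine (sum_le_sum hbd).trans ?_
  rw [← mul_sum, ← sum_image (f := fun k : ℤ => ((k : ℝ) ^ 2)⁻¹) hinj]
  have := sum_inv_sq_int_le (s.image κ) (by
    intro k hk; obtain ⟨j, hj, rfl⟩ := mem_image.1 hk; exact hk0 j hj)
  calc _ ≤ 4 / δ ^ 2 * 4 := mul_le_mul_of_nonneg_left this (by positivity)
    _ = _ := by ring

/-- Dual form of the large sieve over a symmetric window. -/
lemma dual_window_le {ι : Type*} (s : Finset ι) (θ : ι → ℝ) (b : ι → ℂ) {δ : ℝ} (hδ : 0 < δ)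
    (hs : ∀ j ∈ s, ∀ k ∈ s, j ≠ k → δ ≤ nd (θ j - θ k)) (A H : ℕ) :
    ∑ u ∈ range H, ∑ v ∈ range H, ‖∑ i ∈ s, b i * ex (((A : ℝ) + u - v) * θ i)‖ ^ 2 ≤
      (H ^ 2 + 4 / δ ^ 2) * ∑ i ∈ s, ‖b i‖ ^ 2 := by
  classical
  set Dk : ℝ → ℂ := fun t => ∑ u ∈ range H, ex (u * t) with hD
  have e1 : ((∑ u ∈ range H, ∑ v ∈ range H,
      ‖∑ i ∈ s, b i * ex (((A : ℝ) + u - v) * θ i)‖ ^ 2 : ℝ) : ℂ) =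
      ∑ i ∈ s, ∑ j ∈ s, b i * (starRingEnd ℂ) (b j) * ex (A * (θ i - θ j)) *
        ((‖Dk (θ i - θ j)‖ ^ 2 : ℝ) : ℂ) := by
    push_cast
    have : ∀ u v : ℕ, ((‖∑ i ∈ s, b i * ex (((A : ℝ) + u - v) * θ i)‖ : ℂ)) ^ 2 =
        ∑ i ∈ s, ∑ j ∈ s, b i * (starRingEnd ℂ) (b j) * ex (A * (θ i - θ j)) *
          (ex (u * (θ i - θ j)) * (starRingEnd ℂ) (ex (v * (θ i - θ j)))) := by
      intro u v
      rw [← Complex.mul_conj', map_sum, sum_mul_sum]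
      refine sum_congr rfl fun i _ => sum_congr rfl fun j _ => ?_
      rw [map_mul, ← ex_neg, ← ex_neg]
      have : ex (((A : ℝ) + u - v) * θ i) * ex (-(((A : ℝ) + u - v) * θ j)) =
          ex (A * (θ i - θ j)) * (ex (u * (θ i - θ j)) * ex (-(v * (θ i - θ j)))) := by
        rw [← ex_add, ← ex_add, ← ex_add]; congr 1; ring
      calc _ = b i * (starRingEnd ℂ) (b j) * (ex (((A : ℝ) + u - v) * θ i) *
            ex (-(((A : ℝ) + u - v) * θ j))) := by ring
        _ = _ := by rw [this]; ring
    simp_rw [this]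
    have sw : ∀ F : ℕ → ℕ → ι → ι → ℂ, ∑ u ∈ range H, ∑ v ∈ range H, ∑ i ∈ s, ∑ j ∈ s, F u v i j
        = ∑ i ∈ s, ∑ j ∈ s, ∑ u ∈ range H, ∑ v ∈ range H, F u v i j := by
      intro F
      have a1 : ∀ u, ∑ v ∈ range H, ∑ i ∈ s, ∑ j ∈ s, F u v i j =
          ∑ i ∈ s, ∑ j ∈ s, ∑ v ∈ range H, F u v i j := by
        intro u; rw [sum_comm]; exact sum_congr rfl fun i _ => sum_comm
      simp_rw [a1]
      rw [sum_comm]; exact sum_congr rfl fun i _ => sum_comm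
    rw [sw]
    refine sum_congr rfl fun i _ => sum_congr rfl fun j _ => ?_
    rw [← Complex.mul_conj', hD]
    simp only
    rw [map_sum, sum_mul_sum, mul_sum]
    refine sum_congr rfl fun u _ => ?_
    rw [mul_sum]
  have hDle : ∀ i ∈ s, ∑ j ∈ s, ‖Dk (θ i - θ j)‖ ^ 2 ≤ H ^ 2 + 4 / δ ^ 2 := by
    intro i hi
    rw [← add_sum_erase _ _ hi]
    refine add_le_add ?_ ?_
    · exact pow_le_pow_left₀ (norm_nonneg _) (norm_geom_le' _ H) 2
    · have h1 := sum_inv_nd_sq_le (s.erase i) (fun j => θ i - θ j) hδ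
        (fun j hj => hs i hi j (mem_of_mem_erase hj) (ne_of_mem_erase hj).symm)
        (fun j hj k hk hjk => by
          have := hs k (mem_of_mem_erase hk) j (mem_of_mem_erase hj) hjk.symm
          rwa [sub_sub_sub_cancel_left])
      have h2 : ∀ j ∈ s.erase i, ‖Dk (θ i - θ j)‖ ^ 2 ≤ 1 / 4 * (1 / nd (θ i - θ j) ^ 2) := by
        intro j hj
        have hpos : 0 < nd (θ i - θ j) :=
          hδ.trans_le (hs i hi j (mem_of_mem_erase hj) (ne_of_mem_erase hj).symm)
        refine (pow_le_pow_left₀ (norm_nonneg _) (norm_geom_le _ H hpos) 2).trans (le_of_eq ?_)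
        field_simp; norm_num
      refine (sum_le_sum h2).trans ?_
      rw [← mul_sum]
      calc _ ≤ 1 / 4 * (16 / δ ^ 2) := mul_le_mul_of_nonneg_left h1 (by norm_num)
        _ = _ := by ring
  have e2 : ∑ u ∈ range H, ∑ v ∈ range H,
      ‖∑ i ∈ s, b i * ex (((A : ℝ) + u - v) * θ i)‖ ^ 2 ≤
      ∑ i ∈ s, ∑ j ∈ s, ‖b i‖ * ‖b j‖ * ‖Dk (θ i - θ j)‖ ^ 2 := by
    have h1 : 0 ≤ ∑ u ∈ range H, ∑ v ∈ range H,
      ‖∑ i ∈ s, b i * ex (((A : ℝ) + u - v) * θ i)‖ ^ 2 :=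
      sum_nonneg fun _ _ => sum_nonneg fun _ _ => by positivity
    rw [← Complex.norm_of_nonneg h1, e1]
    refine (norm_sum_le _ _).trans (sum_le_sum fun i _ => (norm_sum_le _ _).trans
      (sum_le_sum fun j _ => le_of_eq ?_))
    rw [norm_mul, norm_mul, norm_mul, norm_ex, mul_one, Complex.norm_of_nonneg (by positivity)]
    simp
  have hsymm : ∀ i j, ‖Dk (θ i - θ j)‖ = ‖Dk (θ j - θ i)‖ := by
    intro i j
    have : Dk (θ i - θ j) = (starRingEnd ℂ) (Dk (θ j - θ i)) := by
      simp only [hD]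
      rw [map_sum]
      refine sum_congr rfl fun u _ => ?_
      rw [← ex_neg]; congr 1; ring
    rw [this, RCLike.norm_conj]
  refine e2.trans ?_
  have e3 : ∑ i ∈ s, ∑ j ∈ s, ‖b i‖ * ‖b j‖ * ‖Dk (θ i - θ j)‖ ^ 2 ≤
      ∑ i ∈ s, ∑ j ∈ s, (1 / 2 * (‖b i‖ ^ 2 * ‖Dk (θ i - θ j)‖ ^ 2) +
        1 / 2 * (‖b j‖ ^ 2 * ‖Dk (θ j - θ i)‖ ^ 2)) := by
    refine sum_le_sum fun i _ => sum_le_sum fun j _ => ?_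
    rw [hsymm j i]
    nlinarith [sq_nonneg (‖b i‖ - ‖b j‖), sq_nonneg ‖Dk (θ i - θ j)‖,
      mul_nonneg (sq_nonneg (‖b i‖ - ‖b j‖)) (sq_nonneg ‖Dk (θ i - θ j)‖)]
  refine e3.trans ?_
  simp_rw [sum_add_distrib]
  rw [sum_comm (f := fun i j => 1 / 2 * (‖b j‖ ^ 2 * ‖Dk (θ j - θ i)‖ ^ 2)), ← sum_add_distrib,
    mul_sum]
  refine sum_le_sum fun i hi => ?_
  rw [← sum_add_distrib]
  have : ∀ j, 1 / 2 * (‖b i‖ ^ 2 * ‖Dk (θ i - θ j)‖ ^ 2) + 1 / 2 * (‖b i‖ ^ 2 *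
      ‖Dk (θ i - θ j)‖ ^ 2) = ‖b i‖ ^ 2 * ‖Dk (θ i - θ j)‖ ^ 2 := fun j => by ring
  simp_rw [this]
  rw [← mul_sum, mul_comm]
  exact mul_le_mul_of_nonneg_right (hDle i hi) (by positivity)

/-- The large sieve inequality. -/
theorem large_sieve {ι : Type*} (s : Finset ι) (θ : ι → ℝ) {δ : ℝ} (hδ : 0 < δ) (hδ1 : δ ≤ 1)
    (hs : ∀ j ∈ s, ∀ k ∈ s, j ≠ k → δ ≤ nd (θ j - θ k)) (A L : ℕ) (a : ℕ → ℂ) :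
    ∑ i ∈ s, ‖∑ n ∈ Ioc A (A + L), a n * ex (n * θ i)‖ ^ 2 ≤
      20 * (L + 1 / δ) * ∑ n ∈ Ioc A (A + L), ‖a n‖ ^ 2 := by
  set b : ι → ℂ := fun i => (starRingEnd ℂ) (∑ n ∈ Ioc A (A + L), a n * ex (n * θ i)) with hb
  set f : ℝ → ℂ := fun t => ∑ i ∈ s, b i * ex (t * θ i) with hf
  set E := ∑ i ∈ s, ‖∑ n ∈ Ioc A (A + L), a n * ex (n * θ i)‖ ^ 2 with hE
  have hE0 : 0 ≤ E := sum_nonneg fun _ _ => by positivity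
  have hbE : ∑ i ∈ s, ‖b i‖ ^ 2 = E := by
    simp only [hb, RCLike.norm_conj, hE]
  have hEf : (E : ℂ) = ∑ n ∈ Ioc A (A + L), a n * f n := by
    rw [hE]
    push_cast
    simp only [hf, mul_sum]
    rw [sum_comm]
    refine sum_congr rfl fun i _ => ?_
    rw [← Complex.conj_mul', mul_sum]
    refine sum_congr rfl fun n _ => ?_
    simp only [hb]
    ring
  have hEle : E ≤ ∑ n ∈ Ioc A (A + L), ‖a n‖ * ‖f n‖ := by
    rw [← Complex.norm_of_nonneg hE0, hEf]
    exact (norm_sum_le _ _).trans (sum_le_sum fun n _ => (norm_mul _ _).le)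
  have hcs : E ^ 2 ≤ (∑ n ∈ Ioc A (A + L), ‖a n‖ ^ 2) * ∑ n ∈ Ioc A (A + L), ‖f n‖ ^ 2 :=
    (pow_le_pow_left₀ hE0 hEle 2).trans (sum_mul_sq_le_sq_mul_sq _ _ _)
  set H : ℕ := 2 * L + ⌈1 / δ⌉₊ with hH
  have hwin : ((H : ℝ) - L) * ∑ n ∈ Ioc A (A + L), ‖f n‖ ^ 2 ≤ (H ^ 2 + 4 / δ ^ 2) * E := by
    have h1 := dual_window_le s θ b hδ hs A H
    rw [hbE] at h1
    refine le_trans ?_ h1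
    rw [sum_comm]
    have h2 : ((H : ℝ) - L) * ∑ n ∈ Ioc A (A + L), ‖f n‖ ^ 2 =
        ∑ v ∈ range (H - L), ∑ u ∈ Ioc v (v + L), ‖f ((A : ℝ) + u - v)‖ ^ 2 := by
      have : ∀ v ∈ range (H - L), ∑ u ∈ Ioc v (v + L), ‖f ((A : ℝ) + u - v)‖ ^ 2 =
          ∑ n ∈ Ioc A (A + L), ‖f n‖ ^ 2 := by
        intro v _
        refine sum_bij' (fun u _ => A + u - v) (fun n _ => n + v - A) ?_ ?_ ?_ ?_ ?_
        · intro u hu; simp only [mem_Ioc] at hu ⊢; omega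
        · intro u hu; simp only [mem_Ioc] at hu ⊢; omega
        · intro u hu; simp only [mem_Ioc] at hu ⊢; omega
        · intro u hu; simp only [mem_Ioc] at hu ⊢; omega
        · intro u hu
          simp only [mem_Ioc] at hu
          rw [Nat.cast_sub (by omega)]; push_cast; rfl
      rw [sum_congr rfl this, sum_const, card_range, nsmul_eq_mul, Nat.cast_sub (by omega)]
    rw [h2]
    refine (sum_le_sum_of_subset_of_nonneg (range_mono (Nat.sub_le _ _))
      fun _ _ _ => sum_nonneg fun _ _ => by positivity).trans' (sum_le_sum fun v hv => ?_)
    refine sum_le_sum_of_subset_of_nonneg (fun u hu => ?_) fun _ _ _ => by positivity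
    simp only [mem_Ioc, mem_range] at *
    omega
  have hc1 : 1 / δ ≤ ⌈1 / δ⌉₊ := Nat.le_ceil _
  have hc2 : (⌈1 / δ⌉₊ : ℝ) < 1 / δ + 1 := Nat.ceil_lt_add_one (by positivity)
  have hd1 : 1 ≤ 1 / δ := by rw [le_div_iff₀ hδ]; linarith
  have hHr : (H : ℝ) = 2 * L + ⌈1 / δ⌉₊ := by rw [hH]; push_cast; ring
  have hL0 : (0 : ℝ) ≤ L := Nat.cast_nonneg _
  have hbound : ∑ n ∈ Ioc A (A + L), ‖f n‖ ^ 2 ≤ 20 * (L + 1 / δ) * E := by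
    have hpos : (0 : ℝ) < H - L := by rw [hHr]; linarith
    rw [← mul_le_mul_iff_right₀ hpos]
    refine hwin.trans ?_
    rw [← mul_assoc]
    refine mul_le_mul_of_nonneg_right ?_ hE0
    have : 4 / δ ^ 2 = 4 * (1 / δ) ^ 2 := by ring
    rw [this, hHr]
    generalize (⌈1 / δ⌉₊ : ℝ) = c at *
    generalize 1 / δ = d at *
    nlinarith [mul_nonneg hL0 (by linarith : (0:ℝ) ≤ d), mul_nonneg hL0 (sub_nonneg.2 hc1)]
  have hA0 : 0 ≤ ∑ n ∈ Ioc A (A + L), ‖a n‖ ^ 2 := sum_nonneg fun _ _ => by positivity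
  rcases hE0.eq_or_lt with h | h
  · rw [← h]; positivity
  · have h3 : E * E ≤ (20 * (L + 1 / δ) * ∑ n ∈ Ioc A (A + L), ‖a n‖ ^ 2) * E := by
      calc E * E = E ^ 2 := by ring
        _ ≤ _ := hcs
        _ ≤ (∑ n ∈ Ioc A (A + L), ‖a n‖ ^ 2) * (20 * (L + 1 / δ) * E) :=
          mul_le_mul_of_nonneg_left hbound hA0
        _ = _ := by ring
    exact le_of_mul_le_mul_right h3 h

end PrimeSemigroup

namespace PrimeSemigroup
open Finset

lemma ex_eq_one_iff (x : ℝ) : ex x = 1 ↔ ∃ n : ℤ, x = n := by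
  unfold ex
  rw [Complex.exp_eq_one_iff]
  constructor
  · rintro ⟨n, hn⟩
    refine ⟨n, ?_⟩
    have h2 : (2 * Real.pi * Complex.I : ℂ) ≠ 0 := by
      simp [Real.pi_ne_zero]
    have : (x : ℂ) * (2 * Real.pi * Complex.I) = n * (2 * Real.pi * Complex.I) := by
      rw [← hn]; ring
    exact_mod_cast mul_right_cancel₀ h2 this
  · rintro ⟨n, rfl⟩
    exact ⟨n, by push_cast; ring⟩

lemma div_eq_int_iff {n : ℕ} (hn : 0 < n) (m : ℤ) :
    (∃ k : ℤ, (m : ℝ) / n = k) ↔ (n : ℤ) ∣ m := by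
  have h0 : (n : ℝ) ≠ 0 := by positivity
  constructor
  · rintro ⟨k, hk⟩
    refine ⟨k, ?_⟩
    rw [div_eq_iff h0] at hk
    rw [mul_comm]; exact_mod_cast hk
  · rintro ⟨k, rfl⟩
    exact ⟨k, by push_cast; field_simp⟩

/-- Orthogonality of additive characters modulo `n`. -/
lemma sum_range_ex_div {n : ℕ} (hn : 0 < n) (m : ℤ) :
    ∑ c ∈ range n, ex (c * ((m : ℝ) / n)) = if (n : ℤ) ∣ m then (n : ℂ) else 0 := by
  simp_rw [ex_mul_nat]
  split_ifs with h
  · rw [(ex_eq_one_iff _).2 ((div_eq_int_iff hn m).2 h)]; simp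
  · have h1 : ex ((m : ℝ) / n) ≠ 1 := fun h' => h ((div_eq_int_iff hn m).1 ((ex_eq_one_iff _).1 h'))
    rw [geom_sum_eq h1, ← ex_mul_nat, mul_div_cancel₀ _ (by positivity), ex_int, sub_self, zero_div]

/-- Ramanujan's sum. -/
noncomputable def ramanujanSum (r : ℕ) (m : ℤ) : ℂ :=
  ∑ c ∈ range r with r.Coprime c, ex (c * ((m : ℝ) / r))

lemma sum_divisors_ramanujanSum {n : ℕ} (hn : 0 < n) (m : ℤ) :
    ∑ d ∈ n.divisors, ramanujanSum d m = ∑ c ∈ range n, ex (c * ((m : ℝ) / n)) := by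
  rw [← sum_fiberwise_of_maps_to (s := range n) (t := n.divisors) (g := fun c => n / n.gcd c)
    (fun c _ => by
      rw [Nat.mem_divisors]; exact ⟨Nat.div_dvd_of_dvd (Nat.gcd_dvd_left _ _), hn.ne'⟩)]
  refine sum_congr rfl fun d hd => ?_
  obtain ⟨⟨k, rfl⟩, -⟩ := Nat.mem_divisors.1 hd
  have hd0 : 0 < d := Nat.pos_of_mul_pos_right hn
  have hk0 : 0 < k := Nat.pos_of_mul_pos_left hn
  unfold ramanujanSum
  refine sum_bij' (fun c _ => k * c) (fun c _ => c / k) ?_ ?_ ?_ ?_ ?_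
  · intro c hc
    simp only [mem_filter, mem_range] at hc ⊢
    refine ⟨by rw [mul_comm d]; exact Nat.mul_lt_mul_of_pos_left hc.1 hk0, ?_⟩
    rw [mul_comm d, Nat.gcd_mul_left, hc.2]
    simp [hk0.ne']
  · intro c hc
    simp only [mem_filter, mem_range] at hc ⊢
    have hg : (d * k).gcd c = k := by
      have h1 := Nat.div_mul_cancel (Nat.gcd_dvd_left (d * k) c)
      rw [hc.2] at h1
      exact Nat.eq_of_mul_eq_mul_left hd0 h1
    have hkc : k ∣ c := hg ▸ Nat.gcd_dvd_right _ _
    obtain ⟨t, rfl⟩ := hkc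
    rw [Nat.mul_div_cancel_left _ hk0]
    rw [mul_comm d, Nat.gcd_mul_left] at hg
    refine ⟨?_, ?_⟩
    · have := hc.1; rw [mul_comm d] at this; exact Nat.lt_of_mul_lt_mul_left this
    · exact Nat.eq_of_mul_eq_mul_left hk0 (hg.trans (mul_one k).symm)
  · intro c _; exact Nat.mul_div_cancel_left _ hk0
  · intro c hc
    simp only [mem_filter, mem_range] at hc
    have hg : (d * k).gcd c = k := by
      have h1 := Nat.div_mul_cancel (Nat.gcd_dvd_left (d * k) c)
      rw [hc.2] at h1
      exact Nat.eq_of_mul_eq_mul_left hd0 h1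
    exact Nat.mul_div_cancel' (hg ▸ Nat.gcd_dvd_right _ _)
  · intro c _
    have : (0 : ℝ) < d := by positivity
    have : (0 : ℝ) < k := by positivity
    congr 1; push_cast; field_simp

open scoped ArithmeticFunction.Moebius in
lemma ramanujanSum_of_coprime {r : ℕ} (hr : 0 < r) {m : ℤ} (h : IsCoprime (r : ℤ) m) :
    ramanujanSum r m = (μ r : ℂ) := by
  have := (ArithmeticFunction.sum_eq_iff_sum_mul_moebius_eq (f := fun d => ramanujanSum d m)
    (g := fun n => ∑ c ∈ range n, ex (c * ((m : ℝ) / n)))).1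
    (fun n hn => sum_divisors_ramanujanSum hn m) r hr
  rw [← this, sum_eq_single (r, 1)]
  · simp
  · rintro ⟨a, b⟩ hab hne
    rw [Nat.mem_divisorsAntidiagonal] at hab
    simp only at hab ⊢
    have hb0 : 0 < b := Nat.pos_of_ne_zero (by rintro rfl; simp at hab; omega)
    rw [sum_range_ex_div hb0, if_neg, mul_zero]
    intro hbm
    have hbr : (b : ℤ) ∣ r := by rw [← hab.1]; push_cast; exact dvd_mul_left _ _
    have := h.isUnit_of_dvd' hbr hbm
    have hb1 : b = 1 := by simpa using Int.isUnit_iff.1 this |>.resolve_right (by omega)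
    subst hb1
    simp at hab
    exact hne (by rw [hab.1])
  · intro h'
    exact absurd (Nat.mem_divisorsAntidiagonal.2 ⟨by simp, hr.ne'⟩) h'

lemma norm_ramanujanSum {r : ℕ} (hr : Squarefree r) {m : ℤ} (h : IsCoprime (r : ℤ) m) :
    ‖ramanujanSum r m‖ = 1 := by
  rw [ramanujanSum_of_coprime (Nat.pos_of_ne_zero hr.ne_zero) h]
  rcases ArithmeticFunction.moebius_eq_or r with h' | h' | h'
  · exact absurd h' (ArithmeticFunction.moebius_ne_zero_iff_squarefree.2 hr)
  · simp [h']
  · simp [h']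

lemma card_filter_coprime_range (r : ℕ) : #{c ∈ range r | r.Coprime c} = r.totient := by
  rw [Nat.totient_eq_card_coprime]

/-- Sums supported on values coprime to a squarefree `r` are controlled by twists modulo `r`. -/
lemma norm_sq_le_twist {r : ℕ} (hr : Squarefree r) (I : Finset ℕ) (w : ℕ → ℂ) (q : ℕ) (b : ℤ)
    (hw : ∀ n ∈ I, w n ≠ 0 → IsCoprime (r : ℤ) (q * n + b)) (α : ℝ) :
    ‖∑ n ∈ I, w n * ex (n * α)‖ ^ 2 ≤
      r.totient * ∑ c ∈ range r with r.Coprime c,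
        ‖∑ n ∈ I, w n * ex (n * (α + q * (c / r)))‖ ^ 2 := by
  have e : (∑ n ∈ I, w n * ex (n * α)) * ((ArithmeticFunction.moebius r : ℤ) : ℂ) =
      ∑ c ∈ range r with r.Coprime c, ex (b * (c / r)) *
        ∑ n ∈ I, w n * ex (n * (α + q * (c / r))) := by
    simp_rw [mul_sum]
    rw [sum_comm, sum_mul]
    refine sum_congr rfl fun n hn => ?_
    by_cases h : w n = 0
    · simp [h]
    · rw [← ramanujanSum_of_coprime (Nat.pos_of_ne_zero hr.ne_zero)
        (hw n hn h), ramanujanSum, mul_sum]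
      refine sum_congr rfl fun c _ => ?_
      rw [mul_assoc, mul_left_comm (ex _) (w n), ← ex_add, ← ex_add]
      congr 2; push_cast; ring
  have h1 : ‖((ArithmeticFunction.moebius r : ℤ) : ℂ)‖ = 1 := by
    rw [← ramanujanSum_of_coprime (m := 1) (Nat.pos_of_ne_zero hr.ne_zero) isCoprime_one_right]
    exact norm_ramanujanSum hr isCoprime_one_right
  have h2 : ‖∑ n ∈ I, w n * ex (n * α)‖ ≤
      ∑ c ∈ range r with r.Coprime c, ‖∑ n ∈ I, w n * ex (n * (α + q * (c / r)))‖ := by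
    rw [← mul_one ‖∑ n ∈ I, w n * ex (n * α)‖, ← h1, ← norm_mul, e]
    refine (norm_sum_le _ _).trans (sum_le_sum fun c _ => ?_)
    rw [norm_mul, norm_ex, one_mul]
  refine (pow_le_pow_left₀ (norm_nonneg _) h2 2).trans ?_
  refine sq_sum_le_card_mul_sum_sq.trans ?_
  rw [card_filter_coprime_range]

/-- The large sieve combined with sieving conditions modulo squarefree integers. -/
theorem sieve_energy {ι : Type*} (s : Finset ι) (α : ι → ℝ) (ℛ : Finset ℕ) (q : ℕ) (b : ℤ) (A L : ℕ)
    (hℛ : ∀ r ∈ ℛ, Squarefree r) (w : ℕ → ℂ)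
    (hw : ∀ n ∈ Ioc A (A + L), w n ≠ 0 → ∀ r ∈ ℛ, IsCoprime (r : ℤ) (q * n + b))
    {δ : ℝ} (hδ : 0 < δ) (hδ1 : δ ≤ 1)
    (hs : ∀ i ∈ s, ∀ r ∈ ℛ, ∀ c < r, r.Coprime c → ∀ j ∈ s, ∀ r' ∈ ℛ, ∀ c' < r', r'.Coprime c' →
      ¬ (i = j ∧ r = r' ∧ c = c') →
      δ ≤ nd (α i + q * ((c : ℝ) / r) - (α j + q * ((c' : ℝ) / r')))) :
    (∑ r ∈ ℛ, 1 / (r.totient : ℝ)) * ∑ i ∈ s, ‖∑ n ∈ Ioc A (A + L), w n * ex (n * α i)‖ ^ 2 ≤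
      20 * (L + 1 / δ) * ∑ n ∈ Ioc A (A + L), ‖w n‖ ^ 2 := by
  classical
  have h1 := large_sieve (s ×ˢ ℛ.sigma fun r => {c ∈ range r | r.Coprime c})
    (fun x => α x.1 + q * ((x.2.2 : ℝ) / x.2.1)) hδ hδ1 (by
      rintro ⟨i, r, c⟩ hx ⟨j, r', c'⟩ hy hne
      simp only [mem_product, mem_sigma, mem_filter, mem_range] at hx hy ⊢
      refine hs i hx.1 r hx.2.1 c hx.2.2.1 hx.2.2.2 j hy.1 r' hy.2.1 c' hy.2.2.1 hy.2.2.2 ?_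
      rintro ⟨rfl, rfl, rfl⟩
      exact hne rfl) A L w
  refine le_trans ?_ h1
  rw [sum_product, mul_sum]
  refine sum_le_sum fun i hi => ?_
  rw [sum_sigma, sum_mul]
  refine sum_le_sum fun r hr => ?_
  have hφ : (0 : ℝ) < r.totient := by
    exact_mod_cast Nat.totient_pos.2 (Nat.pos_of_ne_zero (hℛ r hr).ne_zero)
  rw [one_div, inv_mul_le_iff₀ hφ]
  exact norm_sq_le_twist (hℛ r hr) _ w q b (fun n hn h => hw n hn h r hr) (α i)

end PrimeSemigroup

namespace PrimeSemigroup
open Finset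

lemma sum_le_sum_of_inj {ι κ : Type*} {s : Finset ι} {t : Finset κ} {f : ι → ℝ} {g : κ → ℝ}
    (i : ι → κ) (hi : ∀ a ∈ s, i a ∈ t) (hinj : Set.InjOn i s) (hfg : ∀ a ∈ s, f a ≤ g (i a))
    (hg : ∀ b ∈ t, 0 ≤ g b) : ∑ a ∈ s, f a ≤ ∑ b ∈ t, g b := by
  classical
  refine (sum_le_sum hfg).trans ?_
  rw [← sum_image (f := g) hinj]
  exact sum_le_sum_of_subset_of_nonneg (image_subset_iff.2 hi) fun b hb _ => hg b hb

/-- Integers up to `R` free of prime factors in `P`. -/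
def free (P : Finset ℕ) (R : ℕ) : Finset ℕ := {n ∈ Ioc 0 R | ∀ p ∈ P, ¬ p ∣ n}

lemma sum_inv_free_ge (P : Finset ℕ) (hP : ∀ p ∈ P, p.Prime) (R : ℕ) :
    (∏ p ∈ P, (1 - 1 / (p : ℝ))) * ∑ n ∈ Ioc 0 R, 1 / (n : ℝ) ≤ ∑ n ∈ free P R, 1 / (n : ℝ) := by
  induction P using Finset.induction_on with
  | empty => simp [free]
  | insert p P hp ih =>
    have ih := ih fun q hq => hP q (mem_insert_of_mem hq)
    have hpp := hP p (mem_insert_self _ _)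
    have hp0 : (0 : ℝ) < p := by exact_mod_cast hpp.pos
    have hp1 : 1 / (p : ℝ) ≤ 1 := by
      rw [div_le_one hp0]; exact_mod_cast hpp.one_le
    rw [prod_insert hp, mul_assoc]
    have key : ∑ n ∈ free P R, 1 / (n : ℝ) ≤ ∑ n ∈ free (insert p P) R, 1 / (n : ℝ) +
        1 / p * ∑ n ∈ free P R, 1 / (n : ℝ) := by
      nth_rw 1 [← sum_filter_not_add_sum_filter (free P R) (fun n => p ∣ n)]
      refine add_le_add (le_of_eq (sum_congr ?_ fun _ _ => rfl)) ?_
      · ext n; simp only [free, mem_filter, mem_insert, forall_eq_or_imp]; tauto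
      · rw [mul_sum]
        refine sum_le_sum_of_inj (fun n => n / p) ?_ ?_ ?_ fun _ _ => by positivity
        · intro n hn
          simp only [free, mem_filter, mem_Ioc] at hn ⊢
          obtain ⟨⟨⟨h0, hR⟩, hd⟩, k, rfl⟩ := hn
          rw [Nat.mul_div_cancel_left _ hpp.pos]
          refine ⟨⟨Nat.pos_of_mul_pos_left h0, ?_⟩, fun q hq h => hd q hq (h.mul_left _)⟩
          exact (Nat.le_mul_of_pos_left k hpp.pos).trans hR
        · intro n hn m hm h
          simp only [free, coe_filter, Set.mem_ofPred_eq] at hn hm h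
          rw [← Nat.mul_div_cancel' hn.2, ← Nat.mul_div_cancel' hm.2, h]
        · intro n hn
          simp only [mem_filter] at hn
          obtain ⟨k, rfl⟩ := hn.2
          rw [Nat.mul_div_cancel_left _ hpp.pos]
          push_cast; rw [one_div_mul_one_div]
    calc _ ≤ (1 - 1 / (p : ℝ)) * ∑ n ∈ free P R, 1 / (n : ℝ) :=
          mul_le_mul_of_nonneg_left ih (by linarith)
      _ ≤ _ := by linarith

/-- Squarefree elements of `free P R`. -/
def sqfFree (P : Finset ℕ) (R : ℕ) : Finset ℕ := {n ∈ free P R | Squarefree n}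

lemma log_le_sum_inv (R : ℕ) : Real.log R ≤ ∑ n ∈ Ioc 0 R, 1 / (n : ℝ) := by
  rcases Nat.eq_zero_or_pos R with rfl | hR
  · simp
  have h := log_add_one_le_harmonic R
  rw [harmonic_eq_sum_Icc] at h
  push_cast at h
  calc Real.log R ≤ Real.log (R + 1) := Real.log_le_log (by positivity) (by linarith)
    _ ≤ _ := h
    _ = _ := by simp_rw [one_div]; rfl

lemma sum_inv_totient_ge (P : Finset ℕ) (hP : ∀ p ∈ P, p.Prime) (R : ℕ) :
    (∏ p ∈ P, (1 - 1 / (p : ℝ))) * Real.log R ≤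
      4 * ∑ r ∈ sqfFree P R, 1 / (r.totient : ℝ) := by
  have hprod : 0 ≤ ∏ p ∈ P, (1 - 1 / (p : ℝ)) := by
    refine prod_nonneg fun p hp => ?_
    have : 1 / (p : ℝ) ≤ 1 := by
      rw [div_le_one (by exact_mod_cast (hP p hp).pos)]; exact_mod_cast (hP p hp).one_le
    linarith
  have h1 := (mul_le_mul_of_nonneg_left (log_le_sum_inv R) hprod).trans (sum_inv_free_ge P hP R)
  refine h1.trans ?_
  have hsq : ∑ j ∈ Ioc 0 R, ((j : ℝ) ^ 2)⁻¹ ≤ 4 := by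
    have := sum_inv_sq_int_le ((Ioc 0 R).image fun n : ℕ => (n : ℤ)) (by
      intro k hk; obtain ⟨j, hj, rfl⟩ := mem_image.1 hk
      have := (mem_Ioc.1 hj).1
      positivity)
    rw [sum_image (fun a _ b _ h => by simpa using h)] at this
    simpa using this
  have h2 : ∑ n ∈ free P R, 1 / (n : ℝ) ≤
      ∑ x ∈ Ioc 0 R ×ˢ sqfFree P R, ((x.1 : ℝ) ^ 2)⁻¹ * (1 / (x.2 : ℝ)) := by
    choose! r j hrj using fun n : ℕ => Nat.sq_mul_squarefree n
    refine sum_le_sum_of_inj (fun n => (j n, r n)) ?_ ?_ ?_ fun _ _ => by positivity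
    · intro n hn
      simp only [mem_product, sqfFree, free, mem_filter, mem_Ioc] at hn ⊢
      obtain ⟨⟨h0, hR⟩, hd⟩ := hn
      obtain ⟨e, hsqf⟩ := hrj n
      have hr0 : 0 < r n := Nat.pos_of_ne_zero hsqf.ne_zero
      have hj0 : 0 < j n := Nat.pos_of_ne_zero (by rintro h; rw [h] at e; simp at e; omega)
      have hjn : j n ≤ n := by nlinarith
      have hrn : r n ≤ n := by nlinarith [pow_pos hj0 2]
      exact ⟨⟨hj0, hjn.trans hR⟩, ⟨⟨hr0, hrn.trans hR⟩, fun p hp h => hd p hp (by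
        rw [← e]; exact h.mul_left _)⟩, hsqf⟩
    · intro n _ m _ h
      simp only [Prod.mk.injEq] at h
      rw [← (hrj n).1, ← (hrj m).1, h.1, h.2]
    · intro n _
      simp only
      conv_lhs => rw [← (hrj n).1]
      push_cast
      rw [one_div, mul_inv, one_div]
  refine h2.trans ?_
  rw [sum_product' (f := fun a b : ℕ => ((a : ℝ) ^ 2)⁻¹ * (1 / (b : ℝ))), ← sum_mul_sum]
  refine mul_le_mul hsq (sum_le_sum fun r hr => ?_) (sum_nonneg fun _ _ => by positivity)
    (by norm_num)
  simp only [sqfFree, free, mem_filter, mem_Ioc] at hr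
  have hφ : (0 : ℝ) < r.totient := by exact_mod_cast Nat.totient_pos.2 hr.1.1.1
  exact one_div_le_one_div_of_le hφ (by exact_mod_cast Nat.totient_le r)

lemma totient_div_eq (q : ℕ) (hq : 0 < q) :
    ∏ p ∈ q.primeFactors, (1 - 1 / (p : ℝ)) = q.totient / q := by
  have := Nat.totient_eq_mul_prod_factors q
  have h2 : ((q.totient : ℚ) : ℝ) = ((q * ∏ p ∈ q.primeFactors, (1 - (p : ℚ)⁻¹) : ℚ) : ℝ) := by
    rw [this]
  push_cast at h2
  rw [h2, mul_div_cancel_left₀ _ (by positivity)]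
  simp

lemma prod_one_sub_inv_ge (P : Finset ℕ) (hP : ∀ p ∈ P, 2 ≤ p) :
    1 / ((#P : ℝ) + 1) ≤ ∏ p ∈ P, (1 - 1 / (p : ℝ)) := by
  induction P using Finset.induction_on_max with
  | empty => simp
  | insert a s hlt ih =>
    have ha : a ∉ s := fun h => lt_irrefl _ (hlt a h)
    have ih := ih fun p hp => hP p (mem_insert_of_mem hp)
    rw [prod_insert ha, card_insert_of_notMem ha]
    have hcard : #s + 2 ≤ a := by
      have : s ⊆ Ico 2 a := fun x hx => mem_Ico.2 ⟨hP x (mem_insert_of_mem hx), hlt x hx⟩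
      have h2 := card_le_card this
      have := hP a (mem_insert_self _ _)
      rw [Nat.card_Ico] at h2; omega
    have h0 : (0 : ℝ) ≤ #s := Nat.cast_nonneg _
    have h1 : (#s : ℝ) + 2 ≤ a := by exact_mod_cast hcard
    have h3 : 1 / (a : ℝ) ≤ 1 / ((#s : ℝ) + 2) := one_div_le_one_div_of_le (by positivity) h1
    have h4 : 1 - 1 / ((#s : ℝ) + 2) = (#s + 1) / (#s + 2) := by field_simp; ring
    push_cast
    calc 1 / ((#s : ℝ) + 1 + 1) = ((#s : ℝ) + 1) / (#s + 2) * (1 / (#s + 1)) := by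
          field_simp; ring
      _ ≤ (1 - 1 / (a : ℝ)) * ∏ p ∈ s, (1 - 1 / (p : ℝ)) := by
          refine mul_le_mul ?_ ih (by positivity) ?_
          · linarith
          · have : (0:ℝ) ≤ (#s + 1) / (#s + 2) := by positivity
            linarith

lemma div_totient_le (q : ℕ) (hq : 0 < q) :
    (q : ℝ) / q.totient ≤ Real.log q / Real.log 2 + 1 := by
  have h1 := prod_one_sub_inv_ge q.primeFactors fun p hp => (Nat.prime_of_mem_primeFactors hp).two_le
  rw [totient_div_eq q hq] at h1
  have hφ : (0 : ℝ) < q.totient := by exact_mod_cast Nat.totient_pos.2 hq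
  have hq' : (0 : ℝ) < q := by exact_mod_cast hq
  have h2 : (q : ℝ) / q.totient ≤ #q.primeFactors + 1 := by
    rw [div_le_div_iff₀ (by positivity) hq'] at h1
    rw [div_le_iff₀ hφ]; linarith
  refine h2.trans (add_le_add ?_ le_rfl)
  rw [le_div_iff₀ (Real.log_pos (by norm_num))]
  have h3 : 2 ^ #q.primeFactors ≤ q := by
    refine le_trans ?_ (Nat.le_of_dvd hq (Nat.prod_primeFactors_dvd q))
    exact pow_card_le_prod _ _ _ fun p hp => (Nat.prime_of_mem_primeFactors hp).two_le
  rw [← Real.log_pow]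
  exact Real.log_le_log (by positivity) (by exact_mod_cast h3)

lemma sqrt_div_totient_le (q : ℕ) (hq : 0 < q) :
    √(q : ℝ) / q.totient ≤ 10 * (q : ℝ) ^ (-(1 / 3) : ℝ) := by
  have hq' : (1 : ℝ) ≤ q := by exact_mod_cast hq
  have hq0 : (0 : ℝ) < q := by linarith
  have h1 := div_totient_le q hq
  have h2 : Real.log q ≤ (q : ℝ) ^ (1 / 6 : ℝ) / (1 / 6) :=
    Real.log_le_rpow_div hq0.le (by norm_num)
  have h3 : (1 : ℝ) ≤ (q : ℝ) ^ (1 / 6 : ℝ) := Real.one_le_rpow hq' (by norm_num)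
  have h4 : Real.log q / Real.log 2 ≤ 9 * (q : ℝ) ^ (1 / 6 : ℝ) := by
    have := Real.log_two_gt_d9
    rw [div_le_iff₀ (by linarith)]
    nlinarith
  have h5 : (q : ℝ) / q.totient ≤ 10 * (q : ℝ) ^ (1 / 6 : ℝ) := by linarith
  have h6 : √(q : ℝ) / q.totient = (q : ℝ) / q.totient * (q : ℝ) ^ (-(1 / 2) : ℝ) := by
    rw [Real.rpow_neg hq0.le, ← Real.sqrt_eq_rpow]
    have := Real.sqrt_pos.2 hq0
    have hφ : (0 : ℝ) < q.totient := by exact_mod_cast Nat.totient_pos.2 hq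
    field_simp
    exact Real.sq_sqrt hq0.le
  rw [h6]
  calc _ ≤ 10 * (q : ℝ) ^ (1 / 6 : ℝ) * (q : ℝ) ^ (-(1 / 2) : ℝ) :=
        mul_le_mul_of_nonneg_right h5 (by positivity)
    _ = _ := by rw [mul_assoc, ← Real.rpow_add hq0]; norm_num

/-- The primes up to `x`. -/
def primesLe (x : ℕ) : Finset ℕ := {p ∈ Ioc 0 x | p.Prime}

lemma card_primes_dyadic_le (k : ℕ) (hk : 0 < k) :
    (#{p ∈ Ioc (2 ^ k) (2 ^ (k + 1)) | p.Prime} : ℝ) ≤ 4 * 2 ^ k / k := by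
  have h1 := Chebyshev.theta_le_log4_mul_x (x := ((2 ^ (k + 1) : ℕ) : ℝ)) (by positivity)
  rw [Chebyshev.theta, Nat.floor_natCast] at h1
  have h2 : (#{p ∈ Ioc (2 ^ k) (2 ^ (k + 1)) | p.Prime} : ℝ) * (k * Real.log 2) ≤
      ∑ p ∈ Ioc 0 (2 ^ (k + 1)) with Nat.Prime p, Real.log (p : ℕ) := by
    rw [← nsmul_eq_mul]
    refine (card_nsmul_le_sum _ (fun p : ℕ => Real.log p) _ ?_).trans
      (sum_le_sum_of_subset_of_nonneg ?_ ?_)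
    · intro p hp
      simp only [mem_filter, mem_Ioc] at hp
      rw [← Real.log_pow]
      exact Real.log_le_log (by positivity) (by exact_mod_cast hp.1.1.le)
    · exact filter_subset_filter _ (Ioc_subset_Ioc_left (Nat.zero_le _))
    · intro p hp _
      exact Real.log_natCast_nonneg _
  have h3 : Real.log 4 = 2 * Real.log 2 := by
    rw [show (4 : ℝ) = 2 ^ 2 by norm_num, Real.log_pow]; norm_num
  have hl : 0 < Real.log 2 := Real.log_pos (by norm_num)
  have hk' : (0 : ℝ) < k := by exact_mod_cast hk
  rw [le_div_iff₀ hk']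
  rw [h3] at h1
  push_cast at h1
  have h4 := h2.trans h1
  rw [show (2 : ℝ) ^ (k + 1) = 2 * 2 ^ k by ring] at h4
  refine le_of_mul_le_mul_right ?_ hl
  linarith

lemma exp_neg_le_one_sub_inv {p : ℕ} {y : ℝ} (hy : 0 < y) (hp : y ≤ (p : ℝ) - 1) :
    Real.exp (-(1 / y)) ≤ 1 - 1 / (p : ℝ) := by
  have h1 := Real.add_one_le_exp (1 / y)
  have h3 : 1 / ((p : ℝ) - 1) ≤ 1 / y := one_div_le_one_div_of_le hy hp
  have hp1 : (0 : ℝ) < (p : ℝ) - 1 := by linarith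
  rw [Real.exp_neg, inv_le_comm₀ (Real.exp_pos _) ?_]
  · refine le_trans (le_of_eq ?_) (add_le_add_left h3 1 |>.trans h1)
    have : (p : ℝ) ≠ 0 := by linarith
    field_simp
    ring
  · have : 1 - 1 / (p : ℝ) = ((p : ℝ) - 1) / p := by
      have : (p : ℝ) ≠ 0 := by linarith
      field_simp
    rw [this]; exact div_pos hp1 (by linarith)

lemma prod_primesLe_ge_aux (i : ℕ) :
    1 / (3 * ((i : ℝ) + 1) ^ 4) ≤ ∏ p ∈ primesLe (2 ^ (i + 2)), (1 - 1 / (p : ℝ)) := by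
  induction i with
  | zero =>
    have : primesLe (2 ^ (0 + 2)) = {2, 3} := by decide
    rw [this]; norm_num
  | succ i ih =>
    have hsplit : primesLe (2 ^ (i + 1 + 2)) = primesLe (2 ^ (i + 2)) ∪
        {p ∈ Ioc (2 ^ (i + 2)) (2 ^ (i + 2 + 1)) | p.Prime} := by
      rw [primesLe, primesLe, ← filter_union, Ioc_union_Ioc_eq_Ioc (Nat.zero_le _)
        (Nat.pow_le_pow_right (by norm_num) (by omega))]
    rw [hsplit, prod_union]
    · have hb : Real.exp (-(4 / ((i + 2 : ℕ) : ℝ))) ≤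
          ∏ p ∈ Ioc (2 ^ (i + 2)) (2 ^ (i + 2 + 1)) with Nat.Prime p, (1 - 1 / ((p : ℕ) : ℝ)) := by
        calc _ ≤ Real.exp (-(1 / 2 ^ (i + 2))) ^
              #{p ∈ Ioc (2 ^ (i + 2)) (2 ^ (i + 2 + 1)) | p.Prime} := by
              rw [← Real.exp_nat_mul, Real.exp_le_exp]
              have := card_primes_dyadic_le (i + 2) (by omega)
              have h2 := mul_le_mul_of_nonneg_right this (by positivity : (0:ℝ) ≤ 1 / 2 ^ (i + 2))
              have h3 : 4 * (2 : ℝ) ^ (i + 2) / ((i + 2 : ℕ) : ℝ) * (1 / 2 ^ (i + 2)) =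
                4 / ((i + 2 : ℕ) : ℝ) := by field_simp
              linarith
          _ ≤ _ := by
              rw [← prod_const]
              refine prod_le_prod (fun _ _ => (Real.exp_pos _).le) fun p hp => ?_
              simp only [mem_filter, mem_Ioc] at hp
              refine exp_neg_le_one_sub_inv (by positivity) ?_
              have : ((2 ^ (i + 2) + 1 : ℕ) : ℝ) ≤ p := by exact_mod_cast hp.1.1
              push_cast at this; linarith
      have h1 : ((i : ℝ) + 1) / (i + 2) ≤ Real.exp (-(1 / ((i : ℝ) + 2))) := by
        have := Real.add_one_le_exp (-(1 / ((i : ℝ) + 2)))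
        refine le_trans (le_of_eq ?_) this
        field_simp; ring
      have h2 : (((i : ℝ) + 1) / (i + 2)) ^ 4 ≤ Real.exp (-(4 / ((i + 2 : ℕ) : ℝ))) := by
        refine (pow_le_pow_left₀ (by positivity) h1 4).trans (le_of_eq ?_)
        rw [← Real.exp_nat_mul]; congr 1; push_cast; ring
      calc _ = 1 / (3 * ((i : ℝ) + 1) ^ 4) * (((i : ℝ) + 1) / (i + 2)) ^ 4 := by
            push_cast; field_simp; ring
        _ ≤ _ := mul_le_mul ih (h2.trans hb) (by positivity) (le_trans (by positivity) ih)
    · rw [Finset.disjoint_left]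
      intro p hp hp'
      simp only [primesLe, mem_filter, mem_Ioc] at hp hp'
      omega

lemma prod_primesLe_ge (i : ℕ) :
    1 / (3 * ((i : ℝ) + 1) ^ 4) ≤ ∏ p ∈ primesLe (2 ^ i), (1 - 1 / (p : ℝ)) := by
  rcases i with _ | _ | i
  · have : primesLe (2 ^ 0) = ∅ := by decide
    rw [this]; norm_num
  · have : primesLe (2 ^ (0 + 1)) = {2} := by decide
    rw [this]; norm_num
  · refine le_trans ?_ (prod_primesLe_ge_aux i)
    push_cast
    gcongr
    linarith

end PrimeSemigroup

namespace PrimeSemigroup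
open Finset
open ArithmeticFunction (vonMangoldt)

lemma one_div_le_nd {n : ℕ} (hn : 0 < n) {k : ℤ} (h : ¬ (n : ℤ) ∣ k) :
    1 / (n : ℝ) ≤ nd ((k : ℝ) / n) := by
  unfold nd
  have hn' : (0 : ℝ) < n := by exact_mod_cast hn
  have e : (k : ℝ) / n - round ((k : ℝ) / n) = ((k - n * round ((k : ℝ) / n) : ℤ) : ℝ) / n := by
    push_cast; field_simp
  rw [e, abs_div, abs_of_pos hn']
  refine div_le_div_of_nonneg_right ?_ hn'.le
  rw [← Int.cast_abs]
  have : k - n * round ((k : ℝ) / n) ≠ 0 := by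
    intro h0
    exact h ⟨_, by linarith⟩
  exact_mod_cast Int.one_le_abs this

/-- Distinct reduced fractions are distinct modulo one. -/
lemma farey_eq {r r' c c' : ℕ} (hc : c < r) (hc' : c' < r') (hr : r.Coprime c)
    (hr' : r'.Coprime c') (h : ((r * r' : ℕ) : ℤ) ∣ c * r' - c' * r) : r = r' ∧ c = c' := by
  have h1 : (r : ℤ) ∣ c * r' - c' * r := (Dvd.intro _ (by push_cast; rfl)).trans h
  have h2 : (r' : ℤ) ∣ c * r' - c' * r := (Dvd.intro_left _ (by push_cast; rfl)).trans h
  have h3 : (r : ℤ) ∣ c * r' := (Int.dvd_iff_dvd_of_dvd_sub h1).2 (dvd_mul_left _ _)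
  have h4 : (r' : ℤ) ∣ c' * r := (Int.dvd_iff_dvd_of_dvd_sub h2).1 (dvd_mul_left _ _)
  have h5 : r ∣ r' := hr.dvd_of_dvd_mul_left (by exact_mod_cast h3)
  have h6 : r' ∣ r := hr'.dvd_of_dvd_mul_left (by exact_mod_cast h4)
  have e : r = r' := Nat.dvd_antisymm h5 h6
  subst e
  refine ⟨rfl, ?_⟩
  have h7 : (r : ℤ) ∣ c - c' := by
    have : (r : ℤ) * r ∣ r * (c - c') := by
      have e : (r : ℤ) * (c - c') = c * r - c' * r := by ring
      rw [e]; exact_mod_cast h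
    exact Int.dvd_of_mul_dvd_mul_left (by omega) this
  have := Int.eq_zero_of_abs_lt_dvd h7 (by rw [abs_lt]; constructor <;> omega)
  omega

/-- Sieve bound for the number of large primes in a progression in a short interval. -/
lemma card_primes_progression_le {q b : ℕ} (hq : 0 < q) (z H R : ℕ)
    (hR : 1 ≤ R) (hqH : q ≤ H) (hRH : R ^ 2 * q ≤ H) :
    (#{n ∈ Ioc z (z + H) | n ≡ b [MOD q] ∧ n.Prime ∧ R < n} : ℝ) * Real.log R ≤
      320 * (H / q.totient) := by
  classical
  set b₀ := b % q with hb₀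
  set B : ℤ := (b₀ : ℤ) - q with hB
  set A := z / q with hA
  set Lw := H / q + 2 with hLw
  set T : Finset ℕ := {m ∈ Ioc A (A + Lw) | ∃ n : ℕ, (n : ℤ) = q * m + B ∧ n.Prime ∧ R < n} with hT
  set w : ℕ → ℂ := fun m => if m ∈ T then 1 else 0 with hw
  have hcard : #{n ∈ Ioc z (z + H) | n ≡ b [MOD q] ∧ n.Prime ∧ R < n} ≤ #T := by
    refine card_le_card_of_injOn (fun n => n / q + 1) ?_ ?_
    · intro n hn
      simp only [coe_filter, mem_Ioc, Set.mem_ofPred_eq, hT] at hn ⊢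
      obtain ⟨⟨h1, h2⟩, h3, h4, h5⟩ := hn
      refine ⟨⟨Nat.lt_succ_of_le (Nat.div_le_div_right h1.le), ?_⟩, n, ?_, h4, h5⟩
      · have : n / q ≤ (z + H) / q := Nat.div_le_div_right h2
        have h6 : (z + H) / q ≤ z / q + H / q + 1 := by
          rw [Nat.div_le_iff_le_mul_add_pred hq]
          have := Nat.div_add_mod z q
          have := Nat.div_add_mod H q
          have := Nat.mod_lt z hq
          have := Nat.mod_lt H hq
          have e : q * (z / q + H / q + 1) = q * (z / q) + q * (H / q) + q := by ring
          rw [e]; omega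
        omega
      · have h7 : n % q = b₀ := h3
        have := Nat.div_add_mod n q
        rw [hB, ← h7]
        push_cast
        have h8 : (n : ℤ) = q * (n / q) + n % q := by exact_mod_cast this.symm
        linarith
    · intro n hn m hm h
      simp only [coe_filter, Set.mem_ofPred_eq] at hn hm h
      have h1 : n % q = m % q := hn.2.1.trans hm.2.1.symm
      rw [← Nat.div_add_mod n q, ← Nat.div_add_mod m q, h1, Nat.succ_injective h]
  set ℛ := sqfFree q.primeFactors R with hℛ
  have hmem : ∀ r ∈ ℛ, 0 < r ∧ r ≤ R ∧ r.Coprime q ∧ Squarefree r := by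
    intro r hr
    simp only [hℛ, sqfFree, free, mem_filter, mem_Ioc] at hr
    refine ⟨hr.1.1.1, hr.1.1.2, ?_, hr.2⟩
    refine Nat.Coprime.symm (Nat.coprime_of_dvd fun p hp h1 h2 => hr.1.2 p ?_ h2)
    exact Nat.mem_primeFactors.2 ⟨hp, h1, hq.ne'⟩
  have hR' : (1 : ℝ) ≤ R := by exact_mod_cast hR
  have hδ : (0 : ℝ) < 1 / (R : ℝ) ^ 2 := by positivity
  have key := sieve_energy ({()} : Finset Unit) (fun _ => 0) ℛ q B A Lw (fun r hr => (hmem r hr).2.2.2)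
    w (by
      intro m hm hwm r hr
      have hmT : m ∈ T := by by_contra h; exact hwm (by simp [hw, h])
      obtain ⟨-, n, hn, hp, hRn⟩ := mem_filter.1 hmT
      rw [← hn, Nat.isCoprime_iff_coprime]
      refine ((Nat.Prime.coprime_iff_not_dvd hp).2 fun hd => ?_).symm
      have := Nat.le_of_dvd (hmem r hr).1 hd
      have := (hmem r hr).2.1
      omega) hδ (by
      rw [div_le_one (by positivity)]; exact one_le_pow₀ hR') (by
      intro i _ r hr c hc hrc j _ r' hr' c' hc' hrc' hne
      obtain ⟨h0, hrR, hrq, -⟩ := hmem r hr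
      obtain ⟨h0', hrR', hrq', -⟩ := hmem r' hr'
      have e : (0 : ℝ) + q * ((c : ℝ) / r) - (0 + q * ((c' : ℝ) / r')) =
          ((q * (c * r' - c' * r) : ℤ) : ℝ) / ((r * r' : ℕ) : ℝ) := by
        have : (r : ℝ) ≠ 0 := by positivity
        have : (r' : ℝ) ≠ 0 := by positivity
        push_cast; field_simp; ring
      rw [e]
      refine le_trans ?_ (one_div_le_nd (Nat.mul_pos h0 h0') ?_)
      · refine one_div_le_one_div_of_le (by positivity) ?_
        push_cast
        rw [sq]
        gcongr
      · intro hd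
        have hcop : IsCoprime ((r * r' : ℕ) : ℤ) q :=
          Nat.isCoprime_iff_coprime.2 (Nat.Coprime.mul_left hrq hrq')
        obtain ⟨e1, e2⟩ := farey_eq hc hc' hrc hrc' (hcop.dvd_of_dvd_mul_left hd)
        exact hne ⟨rfl, e1, e2⟩)
  have hsum : ∑ n ∈ Ioc A (A + Lw), w n = #T := by
    simp only [hw]
    rw [sum_ite_mem, inter_eq_right.2 (filter_subset _ _)]; simp [hT]
  have hsum2 : ∑ n ∈ Ioc A (A + Lw), ‖w n‖ ^ 2 = #T := by
    have : ∀ n, ‖w n‖ ^ 2 = if n ∈ T then (1 : ℝ) else 0 := by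
      intro n; simp only [hw]; split_ifs <;> simp
    simp_rw [this]
    rw [sum_ite_mem, inter_eq_right.2 (filter_subset _ _)]; simp [hT]
  simp only [sum_singleton, mul_zero, ex_zero, mul_one] at key
  rw [hsum, hsum2] at key
  have hφ : (0 : ℝ) < q.totient := by exact_mod_cast Nat.totient_pos.2 hq
  have hq' : (0 : ℝ) < q := by exact_mod_cast hq
  have hL := sum_inv_totient_ge q.primeFactors (fun p hp => Nat.prime_of_mem_primeFactors hp) R
  rw [totient_div_eq q hq, ← hℛ] at hL
  set G := ∑ r ∈ ℛ, 1 / (r.totient : ℝ) with hG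
  have hlog : 0 ≤ Real.log R := Real.log_nonneg hR'
  have hGT : G * #T ≤ 80 * (H / q) := by
    have h1 : (Lw : ℝ) + 1 / (1 / (R : ℝ) ^ 2) ≤ 4 * (H / q) := by
      rw [one_div_one_div, hLw]
      have a1 : ((H / q : ℕ) : ℝ) ≤ H / q := Nat.cast_div_le
      have a2 : (R : ℝ) ^ 2 ≤ H / q := by rw [le_div_iff₀ hq']; exact_mod_cast hRH
      have a3 : (1 : ℝ) ≤ H / q := by rw [le_div_iff₀ hq', one_mul]; exact_mod_cast hqH
      push_cast
      linarith
    have hT0 : (0 : ℝ) ≤ #T := Nat.cast_nonneg _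
    rcases hT0.eq_or_lt with h | h
    · rw [← h, mul_zero]; positivity
    · rw [Complex.norm_natCast] at key
      have key2 : G * #T * #T ≤ 80 * (H / q) * #T := by
        calc G * #T * #T = G * (#T : ℝ) ^ 2 := by ring
          _ ≤ _ := key
          _ ≤ 20 * (4 * (H / q)) * #T := by gcongr
          _ = _ := by ring
      exact le_of_mul_le_mul_right key2 h
  refine (mul_le_mul_of_nonneg_right (Nat.cast_le.2 hcard) hlog).trans ?_
  have h2 : Real.log R ≤ q / q.totient * (4 * G) := by
    calc Real.log R = q / q.totient * (q.totient / q * Real.log R) := by field_simp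
      _ ≤ _ := mul_le_mul_of_nonneg_left hL (by positivity)
  calc (#T : ℝ) * Real.log R ≤ #T * (q / q.totient * (4 * G)) := by gcongr
    _ = 4 * (q / q.totient) * (G * #T) := by ring
    _ ≤ 4 * (q / q.totient) * (80 * (H / q)) := by gcongr
    _ = _ := by field_simp; ring

/-- The Brun–Titchmarsh inequality, up to a constant. -/
theorem brun_titchmarsh {q : ℕ} (hq : 0 < q) (b z H : ℕ) (hzH : z ^ 3 ≤ H ^ 4)
    (hqH : q ^ 4 ≤ H) :
    ∑ n ∈ Ioc z (z + H) with n ≡ b [MOD q], vonMangoldt n ≤ 3200 * (H / q.totient) := by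
  have hH : 1 ≤ H := le_trans (Nat.one_le_pow _ _ hq) hqH
  have hφ : (0 : ℝ) < q.totient := by exact_mod_cast Nat.totient_pos.2 hq
  have hφq : (q.totient : ℝ) ≤ q := by exact_mod_cast Nat.totient_le q
  have hqH' : q ≤ H := (Nat.le_self_pow (by norm_num) q).trans hqH
  have hq' : (0 : ℝ) < q := by exact_mod_cast hq
  have hH' : (1 : ℝ) ≤ H := by exact_mod_cast hH
  have hone : (1 : ℝ) ≤ H / q.totient := by
    rw [le_div_iff₀ hφ, one_mul]
    exact hφq.trans (by exact_mod_cast hqH')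
  have hsub : ∑ n ∈ Ioc z (z + H) with n ≡ b [MOD q], vonMangoldt n ≤
      ∑ n ∈ Ioc 0 (z + H), vonMangoldt n :=
    sum_le_sum_of_subset_of_nonneg ((filter_subset _ _).trans
      (Ioc_subset_Ioc_left (Nat.zero_le _))) fun _ _ _ => ArithmeticFunction.vonMangoldt_nonneg
  rcases Nat.lt_or_ge H 7 with h7 | h7
  · have hz : z ≤ 10 := by
      by_contra h
      have h1 : 11 ^ 3 ≤ z ^ 3 := Nat.pow_le_pow_left (by omega) 3
      have h2 : H ^ 4 ≤ 6 ^ 4 := Nat.pow_le_pow_left (by omega) 4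
      omega
    refine hsub.trans ((sum_vonMangoldt_le _).trans ?_)
    have : ((z + H : ℕ) : ℝ) ≤ 16 := by exact_mod_cast (by omega : z + H ≤ 16)
    linarith
  set R := Nat.sqrt (H / q) with hR
  have hRq : R ^ 2 * q ≤ H := by
    have := Nat.sqrt_le' (H / q)
    calc R ^ 2 * q ≤ H / q * q := Nat.mul_le_mul_right _ this
      _ ≤ H := Nat.div_mul_le_self _ _
  have hR8 : H ^ 3 < (R + 1) ^ 8 := by
    have h1 : H / q < (R + 1) ^ 2 := Nat.lt_succ_sqrt' _
    have h2 : H < q * (R + 1) ^ 2 := by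
      rw [mul_comm]; exact (Nat.div_lt_iff_lt_mul hq).1 h1
    have h3 : H ^ 4 < H * (R + 1) ^ 8 := by
      calc H ^ 4 < (q * (R + 1) ^ 2) ^ 4 := Nat.pow_lt_pow_left h2 (by norm_num)
        _ = q ^ 4 * (R + 1) ^ 8 := by ring
        _ ≤ _ := Nat.mul_le_mul_right _ hqH
    rw [show H ^ 4 = H * H ^ 3 by ring] at h3
    exact Nat.lt_of_mul_lt_mul_left h3
  have hR2 : 2 ≤ R := by
    by_contra h
    have h1 : (R + 1) ^ 8 ≤ 2 ^ 8 := Nat.pow_le_pow_left (by omega) 8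
    have h2 : 7 ^ 3 ≤ H ^ 3 := Nat.pow_le_pow_left h7 3
    omega
  have hR2' : (2 : ℝ) ≤ R := by exact_mod_cast hR2
  have hl2 : Real.log 2 ≤ Real.log R := Real.log_le_log (by norm_num) hR2'
  have hl20 : 0 < Real.log 2 := Real.log_pos (by norm_num)
  have hlogH : Real.log H ≤ 16 / 3 * Real.log R := by
    have h1 : (H : ℝ) ^ 3 ≤ ((R : ℝ) ^ 2) ^ 8 := by
      calc (H : ℝ) ^ 3 ≤ ((R : ℝ) + 1) ^ 8 := by exact_mod_cast hR8.le
        _ ≤ _ := pow_le_pow_left₀ (by positivity) (by nlinarith) 8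
    have h2 := Real.log_le_log (by positivity) h1
    rw [Real.log_pow, Real.log_pow, Real.log_pow] at h2
    push_cast at h2
    linarith
  set h : ℝ := (H : ℝ) ^ (1 / 12 : ℝ) with hh
  have hh1 : 1 ≤ h := Real.one_le_rpow hH' (by norm_num)
  have hh12 : h ^ 12 = H := by
    rw [hh, ← Real.rpow_natCast, ← Real.rpow_mul (by positivity)]; norm_num
  have hz16 : (z : ℝ) ≤ h ^ 16 := by
    have h1 : (z : ℝ) ^ 3 ≤ (h ^ 16) ^ 3 := by
      calc (z : ℝ) ^ 3 ≤ (H : ℝ) ^ 4 := by exact_mod_cast hzH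
        _ = _ := by rw [← hh12]; ring
    exact le_of_pow_le_pow_left₀ (by norm_num) (by positivity) h1
  have hqh : (q : ℝ) ≤ h ^ 3 := by
    have h1 : (q : ℝ) ^ 4 ≤ (h ^ 3) ^ 4 := by
      calc (q : ℝ) ^ 4 ≤ (H : ℝ) := by exact_mod_cast hqH
        _ = _ := by rw [← hh12]; ring
    exact le_of_pow_le_pow_left₀ (by norm_num) (by positivity) h1
  have hx16 : ((z + H : ℕ) : ℝ) ≤ 2 * h ^ 16 := by
    have : h ^ 12 ≤ h ^ 16 := pow_le_pow_right₀ hh1 (by norm_num)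
    push_cast; linarith
  have hmain : h ^ 9 ≤ H / q.totient := by
    rw [le_div_iff₀ hφ, ← hh12]
    calc h ^ 9 * q.totient ≤ h ^ 9 * h ^ 3 := by gcongr; exact hφq.trans hqh
      _ = _ := by ring
  have hzH0 : (0 : ℝ) < ((z + H : ℕ) : ℝ) := by exact_mod_cast (by omega : 0 < z + H)
  have hlogx : Real.log ((z + H : ℕ) : ℝ) ≤ Real.log 2 + 16 * Real.log h := by
    rw [← Nat.cast_ofNat (n := 16), ← Real.log_pow, ← Real.log_mul (by norm_num) (by positivity)]
    exact Real.log_le_log hzH0 hx16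
  have hlogh : Real.log H = 12 * Real.log h := by
    rw [← hh12, Real.log_pow]; norm_num
  -- split into large primes, small primes and prime powers
  have hsplit : ∀ n ∈ (Ioc z (z + H)).filter (· ≡ b [MOD q]), vonMangoldt n ≤
      (if n.Prime ∧ R < n then Real.log ((z + H : ℕ) : ℝ) else 0) + (vonMangoldt n - vt n) +
        (if n ∈ Ioc 0 R then vonMangoldt n else 0) := by
    intro n hn
    simp only [mem_filter, mem_Ioc] at hn
    have hv := ArithmeticFunction.vonMangoldt_nonneg (n := n)
    have hvt := vt_le_vonMangoldt n
    by_cases hp : n.Prime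
    · have h1 : vt n = vonMangoldt n := by
        rw [vt, if_pos hp, ArithmeticFunction.vonMangoldt_apply_prime hp]
      by_cases hRn : R < n
      · have h2 : vonMangoldt n ≤ Real.log ((z + H : ℕ) : ℝ) := by
          rw [ArithmeticFunction.vonMangoldt_apply_prime hp]
          exact Real.log_le_log (by exact_mod_cast hp.pos) (by exact_mod_cast hn.1.2)
        rw [if_pos ⟨hp, hRn⟩]
        split_ifs <;> linarith
      · rw [if_neg (fun h => hRn h.2), if_pos (mem_Ioc.2 ⟨by omega, by omega⟩)]
        linarith
    · have h1 : vt n = 0 := by rw [vt, if_neg hp]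
      rw [if_neg (fun h => hp h.1)]
      split_ifs <;> linarith
  refine (sum_le_sum hsplit).trans ?_
  rw [sum_add_distrib, sum_add_distrib]
  have p1 : ∑ n ∈ Ioc z (z + H) with n ≡ b [MOD q],
      (if n.Prime ∧ R < n then Real.log ((z + H : ℕ) : ℝ) else 0) ≤ 3000 * (H / q.totient) := by
    rw [← sum_filter, sum_const, nsmul_eq_mul, filter_filter]
    have h1 := card_primes_progression_le (b := b) hq z H R (by omega) hqH' hRq
    have h2 : Real.log ((z + H : ℕ) : ℝ) ≤ 9 * Real.log R := by linarith
    calc _ ≤ (#{n ∈ Ioc z (z + H) | n ≡ b [MOD q] ∧ n.Prime ∧ R < n} : ℝ) *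
          (9 * Real.log R) := by gcongr
      _ ≤ 9 * (320 * (H / q.totient)) := by linarith
      _ ≤ _ := by linarith
  have p2 : ∑ n ∈ Ioc z (z + H) with n ≡ b [MOD q], (vonMangoldt n - vt n) ≤
      102 * (H / q.totient) := by
    have h1 : ∑ n ∈ Ioc z (z + H) with n ≡ b [MOD q], (vonMangoldt n - vt n) ≤
        ∑ n ∈ Ioc 0 (z + H), (vonMangoldt n - vt n) :=
      sum_le_sum_of_subset_of_nonneg ((filter_subset _ _).trans
        (Ioc_subset_Ioc_left (Nat.zero_le _))) fun n _ _ => sub_nonneg.2 (vt_le_vonMangoldt n)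
    refine h1.trans ((sum_vonMangoldt_sub_vt_le (by omega)).trans ?_)
    have h2 : √((z + H : ℕ) : ℝ) ≤ 2 * h ^ 8 := by
      rw [Real.sqrt_le_left (by positivity)]
      calc _ ≤ 2 * h ^ 16 := hx16
        _ ≤ _ := by nlinarith [pow_pos (by linarith : 0 < h) 16]
    have h3 : Real.log ((z + H : ℕ) : ℝ) ≤ 17 * h := by
      have a := Real.log_le_sub_one_of_pos (by linarith : 0 < h)
      have b := Real.log_two_lt_d9
      linarith
    have h4 : 0 ≤ Real.log ((z + H : ℕ) : ℝ) := Real.log_natCast_nonneg _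
    calc _ ≤ 2 * (2 * h ^ 8) * (17 * h) := by gcongr
      _ = 68 * h ^ 9 := by ring
      _ ≤ _ := by linarith
  have p3 : ∑ n ∈ Ioc z (z + H) with n ≡ b [MOD q],
      (if n ∈ Ioc 0 R then vonMangoldt n else 0) ≤ 6 * (H / q.totient) := by
    rw [← sum_filter]
    have h1 : ∑ n ∈ ((Ioc z (z + H)).filter (fun n => n ≡ b [MOD q])).filter (· ∈ Ioc 0 R),
        vonMangoldt n ≤ ∑ n ∈ Ioc 0 R, vonMangoldt n :=
      sum_le_sum_of_subset_of_nonneg (fun n hn => (mem_filter.1 hn).2)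
        fun _ _ _ => ArithmeticFunction.vonMangoldt_nonneg
    refine h1.trans ((sum_vonMangoldt_le R).trans ?_)
    have h2 : (R : ℝ) ≤ h ^ 6 := by
      have : (R : ℝ) ^ 2 ≤ (h ^ 6) ^ 2 := by
        calc (R : ℝ) ^ 2 ≤ R ^ 2 * q := le_mul_of_one_le_right (by positivity) (by exact_mod_cast hq)
          _ ≤ H := by exact_mod_cast hRq
          _ = _ := by rw [← hh12]; ring
      exact le_of_pow_le_pow_left₀ (by norm_num) (by positivity) this
    have h3 : h ^ 6 ≤ h ^ 9 := pow_le_pow_right₀ hh1 (by norm_num)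
    linarith
  linarith

/-- Mean-square bound for prime exponential sums at frequencies close to rationals with small
denominators. -/
theorem energy_le {N M i A L : ℕ} {ρ : ℝ} (hN : 16 ≤ N) (hNM : M = 2 * N)
    (hρ : 1 / (M : ℝ) + 2 * ρ ≤ 1 / (4 ^ i * √N)) (hA : √N ≤ A) (hAL : A + L ≤ N)
    (s : Finset ℕ) (hs : ∀ k ∈ s, k < M ∧ ∃ (a : ℤ) (q : ℕ), 0 < q ∧ q ≤ 2 ^ i ∧
      |(k : ℝ) / M - a / q| ≤ ρ) :
    ∑ k ∈ s, ‖∑ n ∈ Ioc A (A + L), (vt n : ℂ) * ex (n * ((k : ℝ) / M))‖ ^ 2 ≤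
      40000 * N ^ 2 * ((i : ℝ) + 1) ^ 4 := by
  classical
  set R := Nat.sqrt (Nat.sqrt N) with hR
  have hN0 : (0 : ℝ) < N := by exact_mod_cast (by omega : 0 < N)
  have hR2N : R ^ 2 ≤ Nat.sqrt N := Nat.sqrt_le' _
  have hsN : (Nat.sqrt N : ℝ) ≤ √N := Real.nat_sqrt_le_real_sqrt
  have hR2 : 2 ≤ R := by
    rw [hR, Nat.le_sqrt', Nat.le_sqrt']; omega
  have hRr : (2 : ℝ) ≤ R := by exact_mod_cast hR2
  have hR2s : (R : ℝ) ^ 2 ≤ √N := le_trans (by exact_mod_cast hR2N) hsN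
  have hRA : R ≤ A := by
    have : (R : ℝ) ≤ A := by nlinarith
    exact_mod_cast this
  have hNR : (N : ℝ) ≤ (R : ℝ) ^ 8 := by
    have h1 : Nat.sqrt N + 1 ≤ (R + 1) ^ 2 := Nat.lt_succ_sqrt' _
    have h2 : N ≤ (Nat.sqrt N + 1) ^ 2 := (Nat.lt_succ_sqrt' _).le
    have h3 : N ≤ ((R + 1) ^ 2) ^ 2 := h2.trans (Nat.pow_le_pow_left h1 2)
    have h4 : ((R + 1) ^ 2) ^ 2 ≤ ((R ^ 2) ^ 2) ^ 2 :=
      Nat.pow_le_pow_left (Nat.pow_le_pow_left (by nlinarith) 2) 2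
    have h5 := h3.trans h4
    rw [← pow_mul, ← pow_mul] at h5
    exact_mod_cast h5
  have hlogN : Real.log N ≤ 8 * Real.log R := by
    have := Real.log_le_log hN0 hNR
    rwa [Real.log_pow] at this
  set ℛ := sqfFree (primesLe (2 ^ i)) R with hℛ
  have hmem : ∀ r ∈ ℛ, 0 < r ∧ r ≤ R ∧ Squarefree r ∧ ∀ q, 0 < q → q ≤ 2 ^ i → r.Coprime q := by
    intro r hr
    simp only [hℛ, sqfFree, free, mem_filter, mem_Ioc] at hr
    refine ⟨hr.1.1.1, hr.1.1.2, hr.2, fun q hq0 hq => ?_⟩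
    refine Nat.coprime_of_dvd fun p hp h1 h2 => hr.1.2 p ?_ h1
    simp only [primesLe, mem_filter, mem_Ioc]
    exact ⟨⟨hp.pos, (Nat.le_of_dvd hq0 h2).trans hq⟩, hp⟩
  have hM0 : (0 : ℝ) < M := by rw [hNM]; push_cast; positivity
  have hM1 : 0 < M := by omega
  choose! hkM a q hq0 hqi hkq using hs
  have key := sieve_energy s (fun k => (k : ℝ) / M) ℛ 1 0 A L (fun r hr => (hmem r hr).2.2.1)
    (fun n => (vt n : ℂ)) (by
      intro n hn hwn r hr
      have hp : n.Prime := by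
        by_contra h; exact hwn (by simp [vt, h])
      have e : (((1 : ℕ) : ℤ) * n + 0) = n := by simp
      rw [e, Nat.isCoprime_iff_coprime]
      refine ((Nat.Prime.coprime_iff_not_dvd hp).2 fun hd => ?_).symm
      have := Nat.le_of_dvd (hmem r hr).1 hd
      have := (hmem r hr).2.1
      have := (mem_Ioc.1 hn).1
      omega) (δ := 1 / M) (by positivity) (by
      rw [div_le_one hM0]; exact_mod_cast hM1) (by
      intro k hk r hr c hc hrc k' hk' r' hr' c' hc' hrc' hne
      obtain ⟨h0, hrR, -, hrq⟩ := hmem r hr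
      obtain ⟨h0', hrR', -, hrq'⟩ := hmem r' hr'
      have hq := hq0 k hk
      have hq' := hq0 k' hk'
      rw [Nat.cast_one, one_mul, one_mul]
      have r0 : (0 : ℝ) < r := by exact_mod_cast h0
      have r0' : (0 : ℝ) < r' := by exact_mod_cast h0'
      have q0 : (0 : ℝ) < q k := by exact_mod_cast hq
      have q0' : (0 : ℝ) < q k' := by exact_mod_cast hq'
      set Q := q k * q k' with hQ
      set D := r * r' with hD
      set m : ℤ := (a k * q k' - a k' * q k) * D + Q * (c * r' - c' * r) with hm
      have e : (a k : ℝ) / q k + (c : ℝ) / r - (a k' / q k' + c' / r') = (m : ℝ) / ((Q * D : ℕ)) := by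
        rw [hm, hQ, hD]; push_cast; field_simp; ring
      by_cases hd : ((Q * D : ℕ) : ℤ) ∣ m
      · have hd1 : (D : ℤ) ∣ Q * (c * r' - c' * r) := by
          have h1 : (D : ℤ) ∣ m := (Dvd.intro_left _ (by push_cast; rfl)).trans hd
          rw [hm] at h1
          exact (Int.dvd_add_right (dvd_mul_left _ _)).1 h1
        have hcop : IsCoprime (D : ℤ) Q := by
          rw [Nat.isCoprime_iff_coprime]
          refine Nat.Coprime.mul_left ?_ ?_
          · exact Nat.Coprime.mul_right (hrq _ hq (hqi k hk)) (hrq _ hq' (hqi k' hk'))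
          · exact Nat.Coprime.mul_right (hrq' _ hq (hqi k hk)) (hrq' _ hq' (hqi k' hk'))
        obtain ⟨e1, e2⟩ := farey_eq hc hc' hrc hrc' (hcop.dvd_of_dvd_mul_left hd1)
        subst e1 e2
        have e3 : (k : ℝ) / M + c / r - (k' / M + c / r) = (((k : ℤ) - k' : ℤ) : ℝ) / M := by
          push_cast; field_simp; ring
        rw [e3]
        refine one_div_le_nd hM1 fun hdd => hne ⟨?_, rfl, rfl⟩
        have := Int.eq_zero_of_abs_lt_dvd hdd (by
          have := hkM k hk; have := hkM k' hk'
          rw [abs_lt]; constructor <;> omega)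
        omega
      · have hQD : 0 < Q * D := Nat.mul_pos (Nat.mul_pos hq hq') (Nat.mul_pos h0 h0')
        have h1 := one_div_le_nd hQD hd
        rw [← e] at h1
        have h2 : 1 / (4 ^ i * √N) ≤ 1 / ((Q * D : ℕ) : ℝ) := by
          refine one_div_le_one_div_of_le (by exact_mod_cast hQD) ?_
          have a1 : (Q : ℝ) ≤ 4 ^ i := by
            have : Q ≤ 2 ^ i * 2 ^ i := Nat.mul_le_mul (hqi k hk) (hqi k' hk')
            rw [← mul_pow] at this
            exact_mod_cast this
          have a2 : (D : ℝ) ≤ √N := by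
            refine le_trans ?_ hR2s
            have : D ≤ R * R := Nat.mul_le_mul hrR hrR'
            rw [sq]; exact_mod_cast this
          push_cast
          gcongr
        have h3 : nd ((a k : ℝ) / q k + (c : ℝ) / r - (a k' / q k' + c' / r')) ≤
            nd ((k : ℝ) / M + c / r - (k' / M + c' / r')) + 2 * ρ := by
          set X := (k : ℝ) / M + c / r - (k' / M + c' / r') with hX
          refine (nd_le_abs_sub_int _ (round X)).trans ?_
          unfold nd
          have b1 := abs_le.1 (hkq k hk)
          have b2 := abs_le.1 (hkq k' hk')
          have : (a k : ℝ) / q k + (c : ℝ) / r - (a k' / q k' + c' / r') - round X =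
            (X - round X) + (-((k : ℝ) / M - a k / q k) + ((k' : ℝ) / M - a k' / q k')) := by
            rw [hX]; ring
          rw [this]
          refine (abs_add_le _ _).trans (add_le_add le_rfl ?_)
          rw [abs_le]; constructor <;> linarith
        linarith)
  have hL := sum_inv_totient_ge (primesLe (2 ^ i)) (fun p hp => (mem_filter.1 hp).2) R
  rw [← hℛ] at hL
  set G := ∑ r ∈ ℛ, 1 / (r.totient : ℝ) with hG
  set E := ∑ k ∈ s, ‖∑ n ∈ Ioc A (A + L), (vt n : ℂ) * ex (n * ((k : ℝ) / M))‖ ^ 2 with hE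
  have hE0 : 0 ≤ E := sum_nonneg fun _ _ => by positivity
  have hlogR : 0 < Real.log R := Real.log_pos (by linarith)
  have hGlow : 1 / (3 * ((i : ℝ) + 1) ^ 4) * Real.log R ≤ 4 * G :=
    (mul_le_mul_of_nonneg_right (prod_primesLe_ge i) hlogR.le).trans hL
  have hvt2 : ∑ n ∈ Ioc A (A + L), ‖(vt n : ℂ)‖ ^ 2 ≤ 8 * Real.log R * (6 * N) := by
    calc _ ≤ ∑ n ∈ Ioc A (A + L), 8 * Real.log R * vonMangoldt n := by
          refine sum_le_sum fun n hn => ?_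
          rw [Complex.norm_of_nonneg (vt_nonneg n), sq]
          refine mul_le_mul ?_ (vt_le_vonMangoldt n) (vt_nonneg n) (by positivity)
          have hn := mem_Ioc.1 hn
          refine le_trans ?_ hlogN
          unfold vt
          split_ifs
          · exact Real.log_le_log (by exact_mod_cast (by omega : 0 < n))
              (by exact_mod_cast hn.2.trans hAL)
          · exact Real.log_natCast_nonneg _
      _ ≤ _ := by
          rw [← mul_sum]
          refine mul_le_mul_of_nonneg_left ?_ (by positivity)
          refine le_trans (sum_le_sum_of_subset_of_nonneg (Ioc_subset_Ioc (Nat.zero_le _) hAL)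
            fun _ _ _ => ArithmeticFunction.vonMangoldt_nonneg) (sum_vonMangoldt_le N)
  have hLM : (L : ℝ) + 1 / (1 / M) ≤ 3 * N := by
    rw [one_div_one_div, hNM]
    have : (L : ℝ) ≤ N := by exact_mod_cast (by omega : L ≤ N)
    push_cast; linarith
  have h1 : G * E ≤ 20 * (3 * N) * (8 * Real.log R * (6 * N)) := by
    refine key.trans ?_
    gcongr
  have h2 : 1 / (3 * ((i : ℝ) + 1) ^ 4) * Real.log R * E ≤
      4 * (20 * (3 * N) * (8 * Real.log R * (6 * N))) :=
    (mul_le_mul_of_nonneg_right hGlow hE0).trans (by linarith)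
  have hi : (0 : ℝ) < 3 * ((i : ℝ) + 1) ^ 4 := by positivity
  have h3 : E * Real.log R ≤ (34560 * N ^ 2 * ((i : ℝ) + 1) ^ 4) * Real.log R := by
    rw [one_div, mul_assoc, inv_mul_le_iff₀ hi] at h2
    calc _ = Real.log R * E := mul_comm _ _
      _ ≤ _ := h2
      _ = _ := by ring
  refine (le_of_mul_le_mul_right h3 hlogR).trans ?_
  gcongr
  norm_num

lemma nd_add_ge (x y : ℝ) : nd x - |y| ≤ nd (x + y) := by
  have h := nd_le_abs_sub_int x (round (x + y))
  have h2 : |x - (round (x + y) : ℤ)| ≤ |x + y - round (x + y)| + |y| := by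
    have := abs_sub (x + y - round (x + y)) y
    refine le_trans (le_of_eq ?_) this
    congr 1; ring
  unfold nd at *
  linarith

lemma nd_eq_abs {x : ℝ} (hx : |x| ≤ 1 / 2) : nd x = |x| := by
  apply le_antisymm
  · simpa using nd_le_abs_sub_int x 0
  · unfold nd
    by_cases h : round x = 0
    · rw [h]; simp
    · have h1 : (1 : ℝ) ≤ |(round x : ℝ)| := by
        rw [← Int.cast_abs]; exact_mod_cast Int.one_le_abs h
      have := abs_sub_abs_le_abs_sub (round x : ℝ) x
      rw [abs_sub_comm] at this
      linarith

lemma nd_add_int (x : ℝ) (n : ℤ) : nd (x + n) = nd x := by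
  unfold nd; rw [round_add_intCast]; push_cast; congr 1; ring

/-- The inner sums of a bilinear form over the hyperbola `m * n ≤ x`. -/
noncomputable def fiberSum (w : ℕ → ℝ) (α : ℝ) (x m : ℕ) : ℂ :=
  ∑ n ∈ Ioc 0 (x / m), (w n : ℂ) * ex (n * (m * α))

lemma sum_norm_sq_fiberSum_le (w : ℕ → ℝ) (α : ℝ) (x M M₂ : ℕ) (hM : 0 < M) :
    ∑ m ∈ Ioc M M₂, ‖fiberSum w α x m‖ ^ 2 ≤
      ∑ n ∈ Ioc 0 (x / M), |w n| * ∑ n' ∈ Ioc 0 (x / M), |w n'| *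
        ‖∑ m ∈ Ioc M (min M₂ (min (x / n) (x / n'))), ex (m * (((n : ℤ) - n' : ℤ) * α))‖ := by
  set Y := x / M
  have h1 : ∀ m ∈ Ioc M M₂, fiberSum w α x m =
      ∑ n ∈ Ioc 0 Y, if m ≤ x / n then (w n : ℂ) * ex (n * (m * α)) else 0 := by
    intro m hm
    rw [mem_Ioc] at hm
    rw [fiberSum, ← sum_filter]
    apply sum_congr _ (fun _ _ => rfl)
    ext n
    simp only [mem_Ioc, mem_filter]
    constructor
    · rintro ⟨h0, h⟩
      refine ⟨⟨h0, h.trans (Nat.div_le_div_left hm.1.le hM)⟩, ?_⟩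
      rw [Nat.le_div_iff_mul_le h0, mul_comm, ← Nat.le_div_iff_mul_le (by omega)]
      exact h
    · rintro ⟨⟨h0, _⟩, h⟩
      refine ⟨h0, ?_⟩
      rw [Nat.le_div_iff_mul_le h0, mul_comm, ← Nat.le_div_iff_mul_le (by omega)] at h
      exact h
  have h2 : ∀ m ∈ Ioc M M₂, ((‖fiberSum w α x m‖ ^ 2 : ℝ) : ℂ) =
      ∑ n ∈ Ioc 0 Y, ∑ n' ∈ Ioc 0 Y, if m ≤ x / n ∧ m ≤ x / n' then
        (w n : ℂ) * w n' * ex (m * (((n : ℤ) - n' : ℤ) * α)) else 0 := by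
    intro m hm
    rw [Complex.ofReal_pow, ← Complex.mul_conj', h1 m hm, map_sum, sum_mul_sum]
    refine sum_congr rfl fun n _ => sum_congr rfl fun n' _ => ?_
    by_cases ha : m ≤ x / n <;> by_cases hb : m ≤ x / n' <;> simp [ha, hb]
    rw [← ex_neg, mul_mul_mul_comm, ← ex_add]
    congr 2; ring
  have h3 : ((∑ m ∈ Ioc M M₂, ‖fiberSum w α x m‖ ^ 2 : ℝ) : ℂ) =
      ∑ n ∈ Ioc 0 Y, ∑ n' ∈ Ioc 0 Y, (w n : ℂ) * w n' *
        ∑ m ∈ Ioc M (min M₂ (min (x / n) (x / n'))), ex (m * (((n : ℤ) - n' : ℤ) * α)) := by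
    rw [Complex.ofReal_sum, sum_congr rfl h2, sum_comm]
    refine sum_congr rfl fun n _ => ?_
    rw [sum_comm]
    refine sum_congr rfl fun n' _ => ?_
    rw [← sum_filter, mul_sum]
    apply sum_congr _ (fun _ _ => rfl)
    ext m
    simp only [mem_Ioc, mem_filter, le_min_iff]
    tauto
  have h4 : ∑ m ∈ Ioc M M₂, ‖fiberSum w α x m‖ ^ 2 =
      ‖((∑ m ∈ Ioc M M₂, ‖fiberSum w α x m‖ ^ 2 : ℝ) : ℂ)‖ := by
    rw [Complex.norm_real, Real.norm_of_nonneg (sum_nonneg fun _ _ => by positivity)]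
  rw [h4, h3]
  refine (norm_sum_le _ _).trans (sum_le_sum fun n _ => ?_)
  rw [mul_sum]
  refine (norm_sum_le _ _).trans (sum_le_sum fun n' _ => ?_)
  rw [norm_mul, norm_mul, Complex.norm_real, Complex.norm_real, Real.norm_eq_abs, Real.norm_eq_abs,
    mul_assoc]

lemma nd_mul_ge_of_not_dvd {q : ℕ} (hq : 0 < q) {a : ℤ} (ha : IsCoprime a (q : ℤ)) {β : ℝ} {k : ℤ}
    (hk : ¬ (q : ℤ) ∣ k) (hβ : |(k : ℝ)| * |β| ≤ 1 / (2 * q)) :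
    1 / (2 * (q : ℝ)) ≤ nd (k * (a / q + β)) := by
  have hq' : (0:ℝ) < q := by exact_mod_cast hq
  have h1 : ¬ (q : ℤ) ∣ k * a := fun h => hk (ha.symm.dvd_of_dvd_mul_right h)
  have h2 := one_div_le_nd hq h1
  have h3 := nd_add_ge (((k * a : ℤ) : ℝ) / q) (k * β)
  have h4 : (k : ℝ) * (a / q + β) = ((k * a : ℤ) : ℝ) / q + k * β := by push_cast; ring
  rw [h4]
  rw [abs_mul] at h3
  have h5 : 1 / (q : ℝ) = 1 / (2 * q) + 1 / (2 * q) := by field_simp; ring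
  linarith

lemma nd_mul_of_dvd {q : ℕ} (hq : 0 < q) (a : ℤ) {β : ℝ} {k : ℤ}
    (hk : (q : ℤ) ∣ k) (hβ : |(k : ℝ)| * |β| ≤ 1 / 2) :
    nd (k * (a / q + β)) = |(k : ℝ)| * |β| := by
  have hq' : (q : ℝ) ≠ 0 := by exact_mod_cast hq.ne'
  obtain ⟨j, rfl⟩ := hk
  have : (((q : ℤ) * j : ℤ) : ℝ) * (a / q + β) = ((q : ℤ) * j : ℤ) * β + (j * a : ℤ) := by
    push_cast; field_simp; ring
  rw [this, nd_add_int, nd_eq_abs, abs_mul]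
  rwa [abs_mul]

lemma norm_sum_Ioc_le_card (f : ℕ → ℝ) (A B : ℕ) : ‖∑ m ∈ Ioc A B, ex (f m)‖ ≤ (B - A : ℕ) := by
  refine (norm_sum_le _ _).trans ?_
  simp

lemma row_sum_le {w : ℕ → ℝ} (hw : ∀ n, 0 ≤ w n) (hwΛ : ∀ n, w n ≤ vonMangoldt n)
    {q : ℕ} (hq : 0 < q) {a : ℤ} (ha : IsCoprime a (q : ℤ)) {β K : ℝ} (hK : 0 ≤ K)
    {Y H M Lm : ℕ} (hYβ : (Y : ℝ) * |β| ≤ 1 / (2 * q)) (hYH : Y ^ 3 ≤ (2 * H + 1) ^ 4)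
    (hqH : q ^ 4 ≤ 2 * H + 1) (hqY : q ^ 4 ≤ Y) (hfar : Y ≤ H ∨ 1 ≤ 2 * K * (H * |β|))
    (n : ℕ) (hn : n ∈ Ioc 0 Y) (Bd : ℕ → ℕ) (hBd : ∀ n', Bd n' - M ≤ Lm) :
    ∑ n' ∈ Ioc 0 Y, w n' * ‖∑ m ∈ Ioc M (Bd n'), ex (m * (((n : ℤ) - n' : ℤ) * (a / q + β)))‖ ≤
      6 * q * Y + 3200 * Lm * ((2 * H + 1 : ℕ) / q.totient) + 3200 * K * (Y / q.totient) := by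
  classical
  have hq' : (0:ℝ) < q := by exact_mod_cast hq
  have hq1 : (1:ℝ) ≤ q := by exact_mod_cast hq
  rw [mem_Ioc] at hn
  have hΛ := fun n => ArithmeticFunction.vonMangoldt_nonneg (n := n)
  have hpt : ∀ n' ∈ Ioc 0 Y, w n' * ‖∑ m ∈ Ioc M (Bd n'),
      ex (m * (((n : ℤ) - n' : ℤ) * (a / q + β)))‖ ≤ q * vonMangoldt n' +
      (if n' ≡ n [MOD q] then (if n' ∈ Ioc (n - (H + 1)) (n - (H + 1) + (2 * H + 1)) then
        Lm * vonMangoldt n' else 0) else 0) +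
      (if n' ≡ n [MOD q] then K * vonMangoldt n' else 0) := by
    intro n' hn'
    rw [mem_Ioc] at hn'
    have habs : |(((n : ℤ) - n' : ℤ) : ℝ)| ≤ Y := by
      push_cast; rw [abs_le]
      have : (n : ℝ) ≤ Y := by exact_mod_cast hn.2
      have : (n' : ℝ) ≤ Y := by exact_mod_cast hn'.2
      have : (0 : ℝ) ≤ n := by positivity
      have : (0 : ℝ) ≤ n' := by positivity
      constructor <;> linarith
    have hsm : |(((n : ℤ) - n' : ℤ) : ℝ)| * |β| ≤ 1 / (2 * q) :=
      (mul_le_mul_of_nonneg_right habs (abs_nonneg β)).trans hYβ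
    have hb0 : ∀ X : ℝ, ‖∑ m ∈ Ioc M (Bd n'), ex (m * (((n : ℤ) - n' : ℤ) * (a / q + β)))‖ ≤ X →
        w n' * ‖∑ m ∈ Ioc M (Bd n'), ex (m * (((n : ℤ) - n' : ℤ) * (a / q + β)))‖ ≤
          X * vonMangoldt n' := by
      intro X hX
      calc _ ≤ w n' * X := mul_le_mul_of_nonneg_left hX (hw _)
        _ ≤ vonMangoldt n' * X := mul_le_mul_of_nonneg_right (hwΛ _) ((norm_nonneg _).trans hX)
        _ = _ := mul_comm _ _
    by_cases hc : n' ≡ n [MOD q]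
    · simp only [hc, if_true]
      have hdvd : (q : ℤ) ∣ (n : ℤ) - n' := Nat.modEq_iff_dvd.1 hc
      split_ifs with hw1
      · have := hb0 Lm ((norm_sum_Ioc_le_card _ _ _).trans (by exact_mod_cast hBd n'))
        have h1 : 0 ≤ q * vonMangoldt n' := mul_nonneg hq'.le (hΛ n')
        have h2 : 0 ≤ K * vonMangoldt n' := mul_nonneg hK (hΛ n')
        linarith
      · have hHlt : (H : ℝ) < |(((n : ℤ) - n' : ℤ) : ℝ)| := by
          rw [← Int.cast_abs]
          have : (H : ℤ) < |(n : ℤ) - n'| := by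
            rw [mem_Ioc] at hw1
            rw [lt_abs]; omega
          exact_mod_cast this
        have hfar' : 1 ≤ 2 * K * (H * |β|) := by
          rcases hfar with h | h
          · exfalso
            have : (Y : ℝ) ≤ H := by exact_mod_cast h
            linarith
          · exact h
        have hβ0 : 0 < |β| := by
          rcases (abs_nonneg β).eq_or_lt with h | h
          · rw [← h] at hfar'; simp at hfar'; linarith
          · exact h
        have hnd := nd_mul_of_dvd (β := β) hq a hdvd (hsm.trans (by
          rw [div_le_div_iff₀ (by positivity) (by positivity)]; linarith))
        have hpos : 0 < |(((n : ℤ) - n' : ℤ) : ℝ)| * |β| :=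
          mul_pos (lt_of_le_of_lt (Nat.cast_nonneg _) hHlt) hβ0
        have hg := norm_geom_Ioc_le (((n : ℤ) - n' : ℤ) * (a / q + β)) M (Bd n') (by rw [hnd]; exact hpos)
        rw [hnd] at hg
        have := hb0 K (hg.trans (by
          rw [div_le_iff₀ (by positivity)]
          refine hfar'.trans ?_
          have := mul_le_mul_of_nonneg_right hHlt.le hβ0.le
          nlinarith))
        have h1 : 0 ≤ q * vonMangoldt n' := mul_nonneg hq'.le (hΛ n')
        linarith
    · simp only [hc, if_false, add_zero]
      have hdvd : ¬ (q : ℤ) ∣ (n : ℤ) - n' := fun h => hc (Nat.modEq_iff_dvd.2 h)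
      have hnd := nd_mul_ge_of_not_dvd hq ha hdvd hsm
      have hpos : (0:ℝ) < 1 / (2 * q) := by positivity
      refine hb0 q ((norm_geom_Ioc_le _ M (Bd n') (hpos.trans_le hnd)).trans ?_)
      rw [div_le_iff₀ (by linarith)]
      have : (q : ℝ) * (2 * (1 / (2 * q))) = 1 := by field_simp
      nlinarith
  refine (sum_le_sum hpt).trans ?_
  rw [sum_add_distrib, sum_add_distrib]
  gcongr ?_ + ?_ + ?_
  · rw [← mul_sum]
    nlinarith [sum_vonMangoldt_le Y]
  · rw [← sum_filter, ← sum_filter, filter_filter, ← mul_sum]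
    have hbt := brun_titchmarsh hq n (n - (H + 1)) (2 * H + 1)
      ((Nat.pow_le_pow_left (by omega) 3).trans hYH) hqH
    calc _ ≤ (Lm : ℝ) * ∑ n' ∈ Ioc (n - (H + 1)) (n - (H + 1) + (2 * H + 1)) with n' ≡ n [MOD q],
          vonMangoldt n' := by
          refine mul_le_mul_of_nonneg_left ?_ (Nat.cast_nonneg _)
          refine sum_le_sum_of_subset_of_nonneg ?_ fun _ _ _ => hΛ _
          intro m hm
          simp only [mem_filter] at hm ⊢
          exact ⟨hm.2.2, hm.2.1⟩
      _ ≤ Lm * (3200 * ((2 * H + 1 : ℕ) / q.totient)) := by gcongr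
      _ = _ := by ring
  · rw [← sum_filter, ← mul_sum]
    have hbt := brun_titchmarsh hq n 0 Y (by simp) hqY
    rw [zero_add] at hbt
    calc _ ≤ K * (3200 * (Y / q.totient)) := by gcongr
      _ = _ := by ring

lemma sum_norm_sq_fiberSum_le' {w : ℕ → ℝ} (hw : ∀ n, 0 ≤ w n) (hwΛ : ∀ n, w n ≤ vonMangoldt n)
    {q : ℕ} (hq : 0 < q) {a : ℤ} (ha : IsCoprime a (q : ℤ)) {β K : ℝ} (hK : 0 ≤ K)
    {x H M M₂ : ℕ} (hM : 0 < M) (hYβ : ((x / M : ℕ) : ℝ) * |β| ≤ 1 / (2 * q))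
    (hYH : (x / M) ^ 3 ≤ (2 * H + 1) ^ 4)
    (hqH : q ^ 4 ≤ 2 * H + 1) (hqY : q ^ 4 ≤ x / M)
    (hfar : x / M ≤ H ∨ 1 ≤ 2 * K * (H * |β|)) :
    ∑ m ∈ Ioc M M₂, ‖fiberSum w (a / q + β) x m‖ ^ 2 ≤
      6 * (x / M : ℕ) * (6 * q * (x / M : ℕ) +
        3200 * (M₂ - M : ℕ) * ((2 * H + 1 : ℕ) / q.totient) +
        3200 * K * ((x / M : ℕ) / q.totient)) := by
  refine (sum_norm_sq_fiberSum_le w _ x M M₂ hM).trans ?_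
  simp only [abs_of_nonneg (hw _)]
  set D : ℝ := 6 * q * (x / M : ℕ) + 3200 * (M₂ - M : ℕ) * ((2 * H + 1 : ℕ) / q.totient) +
        3200 * K * ((x / M : ℕ) / q.totient)
  have hD : 0 ≤ D := by positivity
  calc _ ≤ ∑ n ∈ Ioc 0 (x / M), w n * D := by
        refine sum_le_sum fun n hn => mul_le_mul_of_nonneg_left ?_ (hw n)
        exact row_sum_le hw hwΛ hq ha hK hYβ hYH hqH hqY hfar n hn _
          fun n' => by have := min_le_left M₂ (min (x / n) (x / n')); omega
    _ ≤ ∑ n ∈ Ioc 0 (x / M), vonMangoldt n * D :=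
        sum_le_sum fun n _ => mul_le_mul_of_nonneg_right (hwΛ n) hD
    _ ≤ _ := by
        rw [← sum_mul]
        exact mul_le_mul_of_nonneg_right (sum_vonMangoldt_le _) hD

lemma vonMangoldt_le_log_of_le {n x : ℕ} (h0 : 0 < n) (h : n ≤ x) : vonMangoldt n ≤ Real.log x :=
  ArithmeticFunction.vonMangoldt_le_log.trans
    (Real.log_le_log (by exact_mod_cast h0) (by exact_mod_cast h))

lemma norm_fiberSum_sub_le {w : ℕ → ℝ} (hw : ∀ n, 0 ≤ w n) (hwΛ : ∀ n, w n ≤ vonMangoldt n)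
    {q : ℕ} (hq : 0 < q) (a : ℤ) (β : ℝ) {x M m r R : ℕ} (hM : 0 < M) (hm : M < m) (hr : r ≤ R) :
    ‖fiberSum w (a / q + β) x m - fiberSum w (a / q + β) x (m + q * r)‖ ≤
      42 * ((x / M : ℕ) : ℝ) ^ 2 * (q * R * |β|) +
        Real.log x * (x * (q * R) / (M : ℝ) ^ 2 + 1) := by
  have hq' : (q : ℝ) ≠ 0 := by exact_mod_cast hq.ne'
  have hle : x / (m + q * r) ≤ x / m := Nat.div_le_div_left (by omega) (by omega)
  have hmY : x / m ≤ x / M := Nat.div_le_div_left hm.le hM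
  have hsplit : fiberSum w (a / q + β) x m = ∑ n ∈ Ioc 0 (x / (m + q * r)),
      (w n : ℂ) * ex (n * (m * (a / q + β))) + ∑ n ∈ Ioc (x / (m + q * r)) (x / m),
      (w n : ℂ) * ex (n * (m * (a / q + β))) := by
    rw [fiberSum, ← sum_Ioc_consecutive _ (Nat.zero_le _) hle]
  rw [hsplit, fiberSum, add_sub_right_comm, ← sum_sub_distrib]
  refine (norm_add_le _ _).trans (add_le_add ?_ ?_)
  · have hterm : ∀ n ∈ Ioc 0 (x / (m + q * r)), ‖(w n : ℂ) * ex (n * (m * (a / q + β))) -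
        (w n : ℂ) * ex (n * ((m + q * r : ℕ) * (a / q + β)))‖ ≤
        vonMangoldt n * (7 * ((x / M : ℕ) : ℝ) * (q * R * |β|)) := by
      intro n hn
      rw [mem_Ioc] at hn
      have hnY : (n : ℝ) ≤ (x / M : ℕ) := by exact_mod_cast hn.2.trans (hle.trans hmY)
      rw [← mul_sub, norm_mul, Complex.norm_real, Real.norm_of_nonneg (hw n)]
      have he : ex (n * ((m + q * r : ℕ) * (a / q + β))) =
          ex (n * (m * (a / q + β)) + n * (q * r * β)) := by
        rw [← ex_add_int (n * (m * (a / q + β)) + n * (q * r * β)) (n * r * a)]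
        congr 1; push_cast; field_simp; ring
      rw [he]
      have hb := norm_ex_sub_le (n * (m * (a / q + β))) (n * (m * (a / q + β)) + n * (q * r * β))
      have h1 : |(n : ℝ) * (m * (a / q + β)) - (n * (m * (a / q + β)) + n * (q * r * β))| =
          n * (q * r * |β|) := by
        rw [show (n : ℝ) * (m * (a / q + β)) - (n * (m * (a / q + β)) + n * (q * r * β)) =
          -(n * (q * r * β)) by ring, abs_neg, abs_mul, abs_mul, abs_of_nonneg (by positivity),
          abs_of_nonneg (by positivity)]
      rw [h1] at hb
      have h2 : (n : ℝ) * (q * r * |β|) ≤ (x / M : ℕ) * (q * R * |β|) := by gcongr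
      have h3 : 2 * Real.pi ≤ 7 := by linarith [Real.pi_lt_d2]
      have h4 : 0 ≤ ((x / M : ℕ) : ℝ) * (q * R * |β|) := by positivity
      have h5 : 0 ≤ (n : ℝ) * (q * r * |β|) := by positivity
      refine mul_le_mul (hwΛ n) (hb.trans ?_) (norm_nonneg _) ArithmeticFunction.vonMangoldt_nonneg
      nlinarith [Real.pi_pos]
    refine (norm_sum_le _ _).trans ((sum_le_sum hterm).trans ?_)
    rw [← sum_mul]
    have := (sum_vonMangoldt_le (x / (m + q * r))).trans
      (mul_le_mul_of_nonneg_left (Nat.cast_le.2 (hle.trans hmY)) (by norm_num : (0:ℝ) ≤ 6))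
    calc _ ≤ 6 * ((x / M : ℕ) : ℝ) * (7 * ((x / M : ℕ) : ℝ) * (q * R * |β|)) :=
          mul_le_mul_of_nonneg_right this (by positivity)
      _ = _ := by ring
  · have hterm : ∀ n ∈ Ioc (x / (m + q * r)) (x / m),
        ‖(w n : ℂ) * ex (n * (m * (a / q + β)))‖ ≤ Real.log x := by
      intro n hn
      rw [mem_Ioc] at hn
      rw [norm_mul, norm_ex, mul_one, Complex.norm_real, Real.norm_of_nonneg (hw n)]
      exact (hwΛ n).trans (vonMangoldt_le_log_of_le (Nat.zero_lt_of_lt hn.1) (hn.2.trans (Nat.div_le_self _ _)))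
    refine (norm_sum_le _ _).trans ((sum_le_sum hterm).trans ?_)
    rw [sum_const, Nat.card_Ioc, nsmul_eq_mul, mul_comm]
    refine mul_le_mul_of_nonneg_left ?_ (Real.log_natCast_nonneg x)
    rw [Nat.cast_sub hle]
    have hm0 : (0:ℝ) < m := by exact_mod_cast (by omega : 0 < m)
    have hmM : (M : ℝ) ≤ m := by exact_mod_cast hm.le
    have hM0 : (0:ℝ) < M := by exact_mod_cast hM
    have h1 : ((x / m : ℕ) : ℝ) ≤ (x : ℝ) / m := Nat.cast_div_le
    have h2 : (x : ℝ) / (m + q * r : ℕ) < (x / (m + q * r) : ℕ) + 1 := by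
      rw [← Nat.floor_div_eq_div (K := ℝ)]
      exact Nat.lt_floor_add_one _
    have h3 : (x : ℝ) / m - x / (m + q * r : ℕ) ≤ x * (q * R) / (M : ℝ) ^ 2 := by
      have e1 : (x : ℝ) / m - x / (m + q * r : ℕ) = x * (q * r) / (m * (m + q * r)) := by
        push_cast
        field_simp
        ring
      rw [e1]
      have hrR : (r : ℝ) ≤ R := by exact_mod_cast hr
      have : (M : ℝ) ^ 2 ≤ m * (m + q * r) := by
        have : (0:ℝ) ≤ q * r := by positivity
        nlinarith
      gcongr
    linarith

lemma sum_mul_norm_sq_fiberSum_le {w : ℕ → ℝ} (hw : ∀ n, 0 ≤ w n)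
    (hwΛ : ∀ n, w n ≤ vonMangoldt n) {q : ℕ} (hq : 0 < q) (a : ℤ) (β : ℝ) {x M R : ℕ}
    (hR : 0 < R) (hRM : q * R ≤ M) (hMR : (3 * M) ^ 3 ≤ (q * R) ^ 4) (hqR : q ^ 4 ≤ q * R) {E : ℝ}
    (hE : 42 * ((x / M : ℕ) : ℝ) ^ 2 * (q * R * |β|) +
        Real.log x * (x * (q * R) / (M : ℝ) ^ 2 + 1) ≤ E) :
    ∑ m ∈ Ioc M (2 * M), w m * ‖fiberSum w (a / q + β) x m‖ ^ 2 ≤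
      6400 * (q / q.totient) * ∑ m ∈ Ioc M (3 * M), ‖fiberSum w (a / q + β) x m‖ ^ 2 +
        24 * M * E ^ 2 := by
  have hqR0 : 0 < q * R := Nat.mul_pos hq hR
  have hM : 0 < M := hqR0.trans_le hRM
  have hΛ := fun n => ArithmeticFunction.vonMangoldt_nonneg (n := n)
  set g : ℕ → ℝ := fun m => ‖fiberSum w (a / q + β) x m‖ ^ 2
  have hg : ∀ m, 0 ≤ g m := fun m => by positivity
  have hR' : (0:ℝ) < R := by exact_mod_cast hR
  have hstep : ∀ m ∈ Ioc M (2 * M), R * g m ≤ 2 * (∑ m' ∈ Ioc M (3 * M) with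
      (m' ≡ m [MOD q] ∧ m < m' ∧ m' ≤ m + q * R), g m') + 2 * R * E ^ 2 := by
    intro m hm
    rw [mem_Ioc] at hm
    have h1 : ∀ r ∈ Ioc 0 R, g m ≤ 2 * g (m + q * r) + 2 * E ^ 2 := by
      intro r hr
      rw [mem_Ioc] at hr
      have hd := (norm_fiberSum_sub_le hw hwΛ hq a β (x := x) hM hm.1 hr.2).trans hE
      have ht : ‖fiberSum w (a / q + β) x m‖ ≤ ‖fiberSum w (a / q + β) x (m + q * r)‖ + E := by
        have := norm_sub_norm_le (fiberSum w (a / q + β) x m) (fiberSum w (a / q + β) x (m + q * r))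
        linarith
      have := pow_le_pow_left₀ (norm_nonneg _) ht 2
      simp only [g]
      nlinarith [sq_nonneg (‖fiberSum w (a / q + β) x (m + q * r)‖ - E)]
    have h2 := sum_le_sum h1
    rw [sum_const, Nat.card_Ioc, sum_add_distrib, sum_const, Nat.card_Ioc, ← mul_sum] at h2
    simp only [nsmul_eq_mul, Nat.sub_zero] at h2
    have h3 : ∑ r ∈ Ioc 0 R, g (m + q * r) ≤ ∑ m' ∈ Ioc M (3 * M) with
        (m' ≡ m [MOD q] ∧ m < m' ∧ m' ≤ m + q * R), g m' := by
      refine sum_le_sum_of_inj (fun r => m + q * r) ?_ ?_ (fun _ _ => le_rfl) (fun _ _ => hg _)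
      · intro r hr
        rw [mem_Ioc] at hr
        have := Nat.mul_le_mul_left q hr.2
        have h0 := Nat.mul_pos hq hr.1
        simp only [mem_filter, mem_Ioc]
        refine ⟨by omega, ?_, by omega, by omega⟩
        exact Nat.modEq_iff_dvd.2 ⟨-r, by push_cast; ring⟩
      · intro r _ r' _ h
        have : q * r = q * r' := by simpa using h
        exact Nat.eq_of_mul_eq_mul_left hq this
    linarith
  have hsum : R * ∑ m ∈ Ioc M (2 * M), w m * g m ≤
      R * (6400 * (q / q.totient) * ∑ m ∈ Ioc M (3 * M), g m + 24 * M * E ^ 2) := by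
    have h1 : R * ∑ m ∈ Ioc M (2 * M), w m * g m ≤ ∑ m ∈ Ioc M (2 * M), vonMangoldt m *
        (2 * (∑ m' ∈ Ioc M (3 * M) with
          (m' ≡ m [MOD q] ∧ m < m' ∧ m' ≤ m + q * R), g m') + 2 * R * E ^ 2) := by
      rw [mul_sum]
      refine sum_le_sum fun m hm => ?_
      calc R * (w m * g m) = w m * (R * g m) := by ring
        _ ≤ vonMangoldt m * (R * g m) := mul_le_mul_of_nonneg_right (hwΛ m) (mul_nonneg hR'.le (hg m))
        _ ≤ _ := mul_le_mul_of_nonneg_left (hstep m hm) (hΛ m)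
    refine h1.trans ?_
    have h2 : ∑ m ∈ Ioc M (2 * M), vonMangoldt m * (2 * (∑ m' ∈ Ioc M (3 * M) with
          (m' ≡ m [MOD q] ∧ m < m' ∧ m' ≤ m + q * R), g m') + 2 * R * E ^ 2) =
        2 * ∑ m' ∈ Ioc M (3 * M), g m' * (∑ m ∈ Ioc M (2 * M) with
          (m' ≡ m [MOD q] ∧ m < m' ∧ m' ≤ m + q * R), vonMangoldt m) +
        2 * R * E ^ 2 * ∑ m ∈ Ioc M (2 * M), vonMangoldt m := by
      simp_rw [mul_add, sum_add_distrib]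
      congr 1
      · simp_rw [sum_filter, mul_sum]
        rw [sum_comm]
        refine sum_congr rfl fun m' _ => sum_congr rfl fun m _ => ?_
        split_ifs <;> ring
      · rw [mul_sum]
        refine sum_congr rfl fun m _ => by ring
    rw [h2]
    have h3 : ∀ m' ∈ Ioc M (3 * M), g m' * (∑ m ∈ Ioc M (2 * M) with
          (m' ≡ m [MOD q] ∧ m < m' ∧ m' ≤ m + q * R), vonMangoldt m) ≤
        g m' * (3200 * ((q * R : ℕ) / q.totient)) := by
      intro m' hm'
      rw [mem_Ioc] at hm'
      refine mul_le_mul_of_nonneg_left ?_ (hg _)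
      have hbt := brun_titchmarsh hq m' (m' - (q * R + 1)) (q * R)
        ((Nat.pow_le_pow_left (by omega) 3).trans hMR) hqR
      refine le_trans (sum_le_sum_of_subset_of_nonneg ?_ fun _ _ _ => hΛ _) hbt
      intro m hm
      simp only [mem_filter, mem_Ioc] at hm ⊢
      exact ⟨by omega, hm.2.1.symm⟩
    have h4 : ∑ m ∈ Ioc M (2 * M), vonMangoldt m ≤ 12 * M := by
      have h5 : ∑ m ∈ Ioc M (2 * M), vonMangoldt m ≤ ∑ m ∈ Ioc 0 (2 * M), vonMangoldt m :=
        sum_le_sum_of_subset_of_nonneg (Ioc_subset_Ioc_left (Nat.zero_le _)) fun _ _ _ => hΛ _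
      have := sum_vonMangoldt_le (2 * M)
      push_cast at this
      linarith
    have h6 := sum_le_sum h3
    rw [← sum_mul] at h6
    have h7 : 2 * R * E ^ 2 * ∑ m ∈ Ioc M (2 * M), vonMangoldt m ≤ 2 * R * E ^ 2 * (12 * M) := by
      gcongr
    push_cast at h6
    refine (add_le_add (mul_le_mul_of_nonneg_left h6 zero_le_two) h7).trans (le_of_eq ?_)
    ring
  exact le_of_mul_le_mul_left hsum hR'

lemma sum_mul_norm_fiberSum_sq_le {w : ℕ → ℝ} (hw : ∀ n, 0 ≤ w n)
    (hwΛ : ∀ n, w n ≤ vonMangoldt n) (α : ℝ) (x M : ℕ) :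
    (∑ m ∈ Ioc M (2 * M), w m * ‖fiberSum w α x m‖) ^ 2 ≤
      12 * M * ∑ m ∈ Ioc M (2 * M), w m * ‖fiberSum w α x m‖ ^ 2 := by
  have h := sum_sq_le_sum_mul_sum_of_sq_le_mul (Ioc M (2 * M)) (f := fun m => w m)
    (g := fun m => w m * ‖fiberSum w α x m‖ ^ 2) (r := fun m => w m * ‖fiberSum w α x m‖)
    (fun m _ => hw m) (fun m _ => mul_nonneg (hw m) (by positivity)) (fun m _ => le_of_eq (by ring))
  refine h.trans (mul_le_mul_of_nonneg_right ?_ (sum_nonneg fun m _ =>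
    mul_nonneg (hw m) (by positivity)))
  have h5 : ∑ m ∈ Ioc M (2 * M), w m ≤ ∑ m ∈ Ioc 0 (2 * M), vonMangoldt m :=
    (sum_le_sum fun m _ => hwΛ m).trans (sum_le_sum_of_subset_of_nonneg
      (Ioc_subset_Ioc_left (Nat.zero_le _)) fun _ _ _ => ArithmeticFunction.vonMangoldt_nonneg)
  have := sum_vonMangoldt_le (2 * M)
  push_cast at this
  linarith

lemma half_le_floor {y : ℝ} (hy : 1 ≤ y) : y / 2 ≤ ⌊y⌋₊ := by
  have h1 := Nat.lt_floor_add_one y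
  have h2 : (1 : ℝ) ≤ ⌊y⌋₊ := by exact_mod_cast Nat.floor_pos.2 hy
  linarith

set_option maxHeartbeats 1000000 in
lemma block_sum_le {w : ℕ → ℝ} (hw : ∀ n, 0 ≤ w n) (hwΛ : ∀ n, w n ≤ vonMangoldt n)
    {q : ℕ} (hq : 0 < q) {a : ℤ} (ha : IsCoprime a (q : ℤ)) {β P : ℝ} {x M : ℕ}
    (hP : 1000 ≤ P) (hL : Real.log x ≤ P) (hqP : q ≤ P) (hβ : |β| * x ≤ P) (hMP : P ^ 20 ≤ M)
    (hMx : M * P ^ 20 ≤ x) :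
    ∑ m ∈ Ioc M (2 * M), w m * ‖fiberSum w (a / q + β) x m‖ ≤
      130000 * x * (√q / q.totient / √(max 1 √(|β| * x)) + 1 / P) := by
  have hP0 : 0 < P := by linarith
  have hP1 : 1 ≤ P := by linarith
  have hpow : ∀ {i j : ℕ}, i ≤ j → P ^ i ≤ P ^ j := fun h => pow_le_pow_right₀ hP1 h
  have hM0 : (0:ℝ) < M := lt_of_lt_of_le (by positivity) hMP
  have hM0' : 0 < M := by exact_mod_cast hM0
  have hx0 : (0:ℝ) < x := lt_of_lt_of_le (by positivity) hMx
  have hq0 : (0:ℝ) < q := by exact_mod_cast hq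
  have hq1 : (1:ℝ) ≤ q := by exact_mod_cast hq
  have hφ : (1:ℝ) ≤ q.totient := by exact_mod_cast Nat.totient_pos.2 hq
  set T : ℝ := max 1 √(|β| * x) with hT
  have hT1 : 1 ≤ T := le_max_left _ _
  have hT0 : 0 < T := by linarith
  have hTP : T ≤ P := by
    refine max_le hP1 ?_
    rw [Real.sqrt_le_left hP0.le]; nlinarith
  set X : ℝ := x / M with hX
  have hX0 : 0 < X := by positivity
  have hXP : P ^ 20 ≤ X := by rw [hX, le_div_iff₀ hM0]; linarith
  have hP20 : 1 ≤ P ^ 20 := one_le_pow₀ hP1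
  set Y : ℕ := x / M with hY
  have hYfl : Y = ⌊X⌋₊ := by rw [hX, Nat.floor_div_eq_div]
  have hYX : (Y : ℝ) ≤ X := by rw [hYfl]; exact Nat.floor_le hX0.le
  have hXY : X / 2 ≤ Y := by rw [hYfl]; exact half_le_floor (hP20.trans hXP)
  have hβX : X * |β| ≤ P / M := by
    rw [hX, div_mul_eq_mul_div]; gcongr; linarith
  have hPM : P / M ≤ 1 / (2 * P) := by
    rw [div_le_div_iff₀ hM0 (by positivity)]
    calc P * (2 * P) = 2 * P ^ 2 := by ring
      _ ≤ P * P ^ 2 := by gcongr; linarith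
      _ = P ^ 3 := by ring
      _ ≤ P ^ 20 := hpow (by norm_num)
      _ ≤ _ := by linarith
  -- the near range
  set H : ℕ := ⌈Y / T⌉₊ with hH
  have hH1 : (Y : ℝ) / T ≤ H := Nat.le_ceil _
  have hYP : P ^ 19 ≤ Y := by
    have : P ^ 20 = P * P ^ 19 := by ring
    have : 1000 * P ^ 19 ≤ P * P ^ 19 := mul_le_mul_of_nonneg_right hP (by positivity)
    have : 0 < P ^ 19 := by positivity
    linarith
  have hYT1 : 1 ≤ Y / T := by
    rw [le_div_iff₀ hT0, one_mul]
    exact (hTP.trans (by simpa using hpow (show 1 ≤ 19 by norm_num))).trans hYP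
  have hH2 : (H : ℝ) ≤ 2 * (Y / T) := by
    have := Nat.ceil_lt_add_one (a := (Y:ℝ) / T) (by positivity)
    linarith
  have hYTP : P ^ 18 ≤ Y / T := by
    rw [le_div_iff₀ hT0]
    calc P ^ 18 * T ≤ P ^ 18 * P := by gcongr
      _ = P ^ 19 := by ring
      _ ≤ _ := hYP
  have c1 : (Y : ℝ) * |β| ≤ 1 / (2 * q) := by
    calc (Y : ℝ) * |β| ≤ X * |β| := by gcongr
      _ ≤ 1 / (2 * P) := hβX.trans hPM
      _ ≤ _ := by gcongr
  have c2 : Y ^ 3 ≤ (2 * H + 1) ^ 4 := by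
    have : (Y : ℝ) ^ 3 ≤ (H : ℝ) ^ 4 := by
      calc (Y : ℝ) ^ 3 ≤ (Y / T) ^ 4 := by
            rw [div_pow, le_div_iff₀ (by positivity)]
            calc (Y : ℝ) ^ 3 * T ^ 4 ≤ (Y : ℝ) ^ 3 * P ^ 4 := by gcongr
              _ ≤ (Y : ℝ) ^ 3 * Y := by gcongr; exact (hpow (by norm_num)).trans hYP
              _ = _ := by ring
        _ ≤ _ := by gcongr
    have : Y ^ 3 ≤ H ^ 4 := by exact_mod_cast this
    exact this.trans (Nat.pow_le_pow_left (by omega) 4)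
  have hq4 : (q : ℝ) ^ 4 ≤ P ^ 4 := by gcongr
  have c3 : q ^ 4 ≤ 2 * H + 1 := by
    have : (q : ℝ) ^ 4 ≤ H := hq4.trans ((hpow (by norm_num)).trans (hYTP.trans hH1))
    have : q ^ 4 ≤ H := by exact_mod_cast this
    omega
  have c4 : q ^ 4 ≤ Y := by
    have : (q : ℝ) ^ 4 ≤ Y := hq4.trans ((hpow (by norm_num)).trans hYP)
    exact_mod_cast this
  have c5 : Y ≤ H ∨ 1 ≤ 2 * (M / T) * (H * |β|) := by
    rcases le_total √(|β| * x) 1 with h | h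
    · left
      have : T = 1 := by rw [hT, max_eq_left h]
      rw [this, div_one] at hH1
      exact_mod_cast hH1
    · right
      have hTs : T = √(|β| * x) := by rw [hT, max_eq_right h]
      have hTT : T ^ 2 = |β| * x := by rw [hTs, Real.sq_sqrt (by positivity)]
      have hXM : X * M = x := by rw [hX]; field_simp
      calc (1 : ℝ) = T ^ 2 / T ^ 2 := by field_simp
        _ = 2 * (M / T) * (X / 2 / T * |β|) := by
            rw [hTT, ← hXM, mul_comm (|β|)]
            rw [show X * M * |β| / (X * M * |β|) = X * M * |β| / T ^ 2 by
              rw [hTT, ← hXM]; ring]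
            field_simp
        _ ≤ 2 * (M / T) * (Y / T * |β|) := by gcongr
        _ ≤ _ := by gcongr
  have s1 := sum_norm_sq_fiberSum_le' hw hwΛ hq ha (K := M / T) (by positivity) (M₂ := 3 * M)
    hM0' c1 c2 c3 c4 c5
  have s1' : ∑ m ∈ Ioc M (3 * M), ‖fiberSum w (a / q + β) x m‖ ^ 2 ≤
      6 * X ^ 2 * (6 * q + 35200 * (M / (q.totient * T))) := by
    refine s1.trans ?_
    have e1 : ((3 * M - M : ℕ) : ℝ) = 2 * M := by
      rw [show 3 * M - M = 2 * M by omega]; push_cast; ring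
    rw [e1]
    calc _ ≤ 6 * X * (6 * q * X + 3200 * (2 * M) * (5 * (X / T) / q.totient) +
          3200 * (M / T) * (X / q.totient)) := by
          gcongr
          push_cast
          have : (Y : ℝ) / T ≤ X / T := by gcongr
          linarith
      _ = _ := by field_simp; ring
  -- the averaging over shifts
  set R : ℕ := ⌊(M : ℝ) / (q * P ^ 3)⌋₊ with hR
  have hMq : P ^ 16 ≤ M / (q * P ^ 3) := by
    rw [le_div_iff₀ (by positivity)]
    calc P ^ 16 * (q * P ^ 3) ≤ P ^ 16 * (P * P ^ 3) := by gcongr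
      _ = P ^ 20 := by ring
      _ ≤ _ := hMP
  have hMq1 : (1:ℝ) ≤ M / (q * P ^ 3) := (one_le_pow₀ hP1).trans hMq
  have hR1 : (R : ℝ) ≤ M / (q * P ^ 3) := Nat.floor_le (by positivity)
  have hR2 : (M : ℝ) / (q * P ^ 3) / 2 ≤ R := half_le_floor hMq1
  have hqR1 : q * R ≤ M / P ^ 3 := by
    calc (q : ℝ) * R ≤ q * (M / (q * P ^ 3)) := by gcongr
      _ = _ := by field_simp
  have hqR2 : M / P ^ 3 / 2 ≤ q * R := by
    calc (M : ℝ) / P ^ 3 / 2 = q * (M / (q * P ^ 3) / 2) := by field_simp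
      _ ≤ _ := by gcongr
  have d1 : 0 < R := Nat.floor_pos.2 hMq1
  have d2 : q * R ≤ M := by
    have : (q : ℝ) * R ≤ M := hqR1.trans (div_le_self hM0.le (one_le_pow₀ hP1))
    exact_mod_cast this
  have hqR3 : P ^ 16 ≤ q * R := by
    refine le_trans ?_ hqR2
    rw [le_div_iff₀ two_pos, le_div_iff₀ (by positivity)]
    calc P ^ 16 * 2 * P ^ 3 ≤ P ^ 16 * P * P ^ 3 := by gcongr; linarith
      _ = P ^ 20 := by ring
      _ ≤ _ := hMP
  have d3 : (3 * M) ^ 3 ≤ (q * R) ^ 4 := by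
    have : (3 * M : ℝ) ^ 3 ≤ (q * R) ^ 4 := by
      calc (3 * M : ℝ) ^ 3 = (M / P ^ 3 / 2) ^ 3 * (216 * P ^ 9) := by field_simp; ring
        _ ≤ (M / P ^ 3 / 2) ^ 3 * (P * P ^ 9) := by gcongr; linarith
        _ = (M / P ^ 3 / 2) ^ 3 * P ^ 10 := by ring
        _ ≤ (q * R) ^ 3 * (q * R) := by gcongr; exact (hpow (by norm_num)).trans hqR3
        _ = _ := by ring
    exact_mod_cast this
  have d4 : q ^ 4 ≤ q * R := by
    have : (q : ℝ) ^ 4 ≤ q * R := hq4.trans ((hpow (by norm_num)).trans hqR3)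
    exact_mod_cast this
  have d5 : 42 * (Y : ℝ) ^ 2 * (q * R * |β|) + Real.log x * (x * (q * R) / (M : ℝ) ^ 2 + 1) ≤
      44 * X / P ^ 2 := by
    have e1 : 42 * (Y : ℝ) ^ 2 * (q * R * |β|) ≤ 42 * X / P ^ 2 := by
      calc 42 * (Y : ℝ) ^ 2 * (q * R * |β|) ≤ 42 * X ^ 2 * (M / P ^ 3 * |β|) := by gcongr
        _ = 42 * X * (M / P ^ 3) * (X * |β|) := by ring
        _ ≤ 42 * X * (M / P ^ 3) * (P / M) := by gcongr
        _ = _ := by field_simp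
    have e2 : Real.log x * (x * (q * R) / (M : ℝ) ^ 2 + 1) ≤ 2 * X / P ^ 2 := by
      calc _ ≤ P * (x * (M / P ^ 3) / (M : ℝ) ^ 2 + 1) := by gcongr
        _ = X / P ^ 2 + P := by rw [hX]; field_simp
        _ ≤ X / P ^ 2 + X / P ^ 2 := by
            gcongr
            rw [le_div_iff₀ (by positivity)]
            calc P * P ^ 2 = P ^ 3 := by ring
              _ ≤ P ^ 20 := hpow (by norm_num)
              _ ≤ X := hXP
        _ = _ := by ring
    calc _ ≤ _ := add_le_add e1 e2
      _ = _ := by ring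
  have s2 := sum_mul_norm_sq_fiberSum_le hw hwΛ hq a β d1 d2 d3 d4 d5
  have s3 := sum_mul_norm_fiberSum_sq_le hw hwΛ (a / q + β) x M
  have hXM : M * X = x := by rw [hX]; field_simp
  have hqM : (q : ℝ) ^ 2 / (q.totient * M) ≤ 1 / P ^ 2 := by
    rw [div_le_div_iff₀ (by positivity) (by positivity)]
    calc (q : ℝ) ^ 2 * P ^ 2 ≤ P ^ 2 * P ^ 2 := by gcongr
      _ = P ^ 4 := by ring
      _ ≤ P ^ 20 := hpow (by norm_num)
      _ ≤ 1 * (1 * M) := by linarith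
      _ ≤ _ := by gcongr
  have s4 : (∑ m ∈ Ioc M (2 * M), w m * ‖fiberSum w (a / q + β) x m‖) ^ 2 ≤
      (130000 * x) ^ 2 * (q / (q.totient ^ 2 * T) + 1 / P ^ 2) := by
    have hP24 : 1 / P ^ 4 ≤ 1 / P ^ 2 := by
      apply one_div_le_one_div_of_le (by positivity) (hpow (by norm_num))
    calc _ ≤ 12 * M * (6400 * (q / q.totient) *
          (6 * X ^ 2 * (6 * q + 35200 * (M / (q.totient * T)))) +
          24 * M * (44 * X / P ^ 2) ^ 2) := by
          refine s3.trans (mul_le_mul_of_nonneg_left (s2.trans ?_) (by positivity))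
          gcongr
      _ = (M * X) ^ 2 * (2764800 * (q ^ 2 / (q.totient * M)) +
          16220160000 * (q / (q.totient ^ 2 * T)) + 557568 * (1 / P ^ 4)) := by
          field_simp; ring
      _ ≤ (M * X) ^ 2 * (2764800 * (1 / P ^ 2) +
          16220160000 * (q / (q.totient ^ 2 * T)) + 557568 * (1 / P ^ 2)) := by
          gcongr
      _ ≤ (M * X) ^ 2 * (130000 ^ 2 * (q / (q.totient ^ 2 * T) + 1 / P ^ 2)) := by
          gcongr
          have h1 : 0 ≤ (q : ℝ) / (q.totient ^ 2 * T) := by positivity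
          have h2 : 0 ≤ 1 / P ^ 2 := by positivity
          linarith
      _ = _ := by rw [hXM]; ring
  have s5 := Real.le_sqrt_of_sq_le s4
  refine s5.trans ?_
  rw [Real.sqrt_le_left (by positivity)]
  rw [mul_pow (130000 * (x : ℝ))]
  refine mul_le_mul_of_nonneg_left ?_ (by positivity)
  have e1 : (q : ℝ) / (q.totient ^ 2 * T) = (√q / q.totient / √T) ^ 2 := by
    rw [div_pow, div_pow, Real.sq_sqrt hq0.le, Real.sq_sqrt hT0.le]; field_simp
  have e2 : 1 / P ^ 2 = (1 / P) ^ 2 := by rw [div_pow, one_pow]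
  rw [e1, e2]
  have h1 : 0 ≤ √q / q.totient / √T := by positivity
  have h2 : 0 ≤ 1 / P := by positivity
  rw [add_sq]
  linarith [mul_nonneg h1 h2]

lemma sum_divisorsAntidiagonal_eq {E : Type*} [AddCommMonoid E] (F : ℕ → ℕ → E) (x : ℕ) :
    ∑ n ∈ Ioc 0 x, ∑ p ∈ n.divisorsAntidiagonal, F p.1 p.2 =
      ∑ d ∈ Ioc 0 x, ∑ e ∈ Ioc 0 (x / d), F d e := by
  rw [sum_sigma', sum_sigma']
  refine sum_bij' (fun s _ => ⟨s.2.1, s.2.2⟩) (fun t _ => ⟨t.1 * t.2, (t.1, t.2)⟩) ?_ ?_ ?_ ?_ ?_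
  · rintro ⟨n, d, e⟩ h
    simp only [mem_sigma, mem_Ioc, Nat.mem_divisorsAntidiagonal] at h ⊢
    obtain ⟨⟨h1, h2⟩, rfl, h3⟩ := h
    have hd : 0 < d := Nat.pos_of_mul_pos_right h1
    have he : 0 < e := Nat.pos_of_mul_pos_left h1
    refine ⟨⟨hd, (Nat.le_mul_of_pos_right d he).trans h2⟩, he, ?_⟩
    rw [Nat.le_div_iff_mul_le hd, mul_comm]; exact h2
  · rintro ⟨d, e⟩ h
    simp only [mem_sigma, mem_Ioc, Nat.mem_divisorsAntidiagonal] at h ⊢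
    obtain ⟨⟨h1, h2⟩, h3, h4⟩ := h
    rw [Nat.le_div_iff_mul_le h1, mul_comm] at h4
    exact ⟨⟨Nat.mul_pos h1 h3, h4⟩, trivial, (Nat.mul_pos h1 h3).ne'⟩
  · rintro ⟨n, d, e⟩ h
    simp only [mem_sigma, mem_Ioc, Nat.mem_divisorsAntidiagonal] at h
    obtain ⟨_, rfl, _⟩ := h
    rfl
  · rintro ⟨d, e⟩ h
    rfl
  · rintro ⟨n, d, e⟩ h
    rfl

/-- Dirichlet's hyperbola method for a symmetric summand. -/
lemma norm_symm_hyperbola_le (f : ℕ → ℕ → ℂ) (hf : ∀ m n, f m n = f n m) (x z : ℕ)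
    (hz : z * z ≤ x) (hz' : x < (z + 1) * (z + 1)) :
    ‖∑ m ∈ Ioc 0 x, ∑ n ∈ Ioc 0 (x / m), f m n‖ ≤
      2 * ‖∑ m ∈ Ioc 0 z, ∑ n ∈ Ioc 0 (x / m), f m n‖ + ‖∑ m ∈ Ioc 0 z, ∑ n ∈ Ioc 0 z, f m n‖ := by
  classical
  set P := fun m n => m * n ≤ x
  have hzx : z ≤ x := (Nat.le_mul_self z).trans hz
  have e0 : ∀ k ≤ x, ∑ m ∈ Ioc 0 k, ∑ n ∈ Ioc 0 (x / m), f m n =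
      ∑ m ∈ Ioc 0 x, ∑ n ∈ Ioc 0 x, if m ≤ k ∧ m * n ≤ x then f m n else 0 := by
    intro k hk
    rw [← sum_subset (Ioc_subset_Ioc_right hk)]
    · refine sum_congr rfl fun m hm => ?_
      rw [mem_Ioc] at hm
      rw [← sum_filter]
      apply sum_congr _ fun _ _ => rfl
      ext n
      simp only [mem_Ioc, mem_filter, Nat.le_div_iff_mul_le hm.1, hm.2, true_and]
      constructor
      · rintro ⟨h1, h2⟩
        exact ⟨⟨h1, (Nat.le_mul_of_pos_right n hm.1).trans h2⟩, by linarith⟩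
      · rintro ⟨⟨h1, _⟩, h2⟩
        exact ⟨h1, by linarith⟩
    · intro m _ hm
      rw [mem_Ioc] at hm
      refine sum_eq_zero fun n hn => if_neg ?_
      rintro ⟨h, _⟩
      simp_all
  have e1 : ∑ m ∈ Ioc 0 z, ∑ n ∈ Ioc 0 z, f m n =
      ∑ m ∈ Ioc 0 x, ∑ n ∈ Ioc 0 x, if m ≤ z ∧ n ≤ z then f m n else 0 := by
    have : ∀ m, (∑ n ∈ Ioc 0 x, if m ≤ z ∧ n ≤ z then f m n else 0) =
        if m ≤ z then ∑ n ∈ Ioc 0 z, f m n else 0 := by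
      intro m
      by_cases h : m ≤ z
      · simp only [h, true_and, if_true]
        rw [← sum_filter]
        apply sum_congr _ fun _ _ => rfl
        ext n; simp only [mem_filter, mem_Ioc]; omega
      · simp [h]
    simp_rw [this]
    rw [← sum_filter]
    apply sum_congr _ fun _ _ => rfl
    ext n; simp only [mem_filter, mem_Ioc]; omega
  have e2 : ∑ m ∈ Ioc 0 z, ∑ n ∈ Ioc 0 (x / m), f m n =
      ∑ m ∈ Ioc 0 x, ∑ n ∈ Ioc 0 x, if n ≤ z ∧ m * n ≤ x then f m n else 0 := by
    rw [e0 z hzx, sum_comm]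
    refine sum_congr rfl fun m _ => sum_congr rfl fun n _ => ?_
    rw [hf, mul_comm]
  have key : ∑ m ∈ Ioc 0 x, ∑ n ∈ Ioc 0 (x / m), f m n =
      ∑ m ∈ Ioc 0 z, ∑ n ∈ Ioc 0 (x / m), f m n + ∑ m ∈ Ioc 0 z, ∑ n ∈ Ioc 0 (x / m), f m n -
      ∑ m ∈ Ioc 0 z, ∑ n ∈ Ioc 0 z, f m n := by
    nth_rewrite 2 [e2]
    rw [e0 x le_rfl, e0 z hzx, e1, ← sum_add_distrib, ← sum_sub_distrib]
    refine sum_congr rfl fun m hm => ?_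
    rw [← sum_add_distrib, ← sum_sub_distrib]
    refine sum_congr rfl fun n hn => ?_
    rw [mem_Ioc] at hm hn
    by_cases h : m * n ≤ x
    · have : m ≤ z ∨ n ≤ z := by
        by_contra! hc
        have := Nat.mul_le_mul (Nat.succ_le_of_lt hc.1) (Nat.succ_le_of_lt hc.2)
        simp only [Nat.succ_eq_add_one] at this
        omega
      by_cases h1 : m ≤ z <;> by_cases h2 : n ≤ z <;> simp_all
    · have : ¬ (m ≤ z ∧ n ≤ z) := fun hc => h ((Nat.mul_le_mul hc.1 hc.2).trans hz)
      simp [h, this]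
  rw [key]
  refine (norm_sub_le _ _).trans ?_
  gcongr
  refine (norm_add_le _ _).trans (by linarith)

lemma norm_fiberSum_le {w : ℕ → ℝ} (hw : ∀ n, 0 ≤ w n) (hwΛ : ∀ n, w n ≤ vonMangoldt n)
    (α : ℝ) (x m : ℕ) : ‖fiberSum w α x m‖ ≤ 6 * (x / m : ℕ) := by
  refine (norm_sum_le _ _).trans (le_trans (sum_le_sum fun n _ => ?_) (sum_vonMangoldt_le _))
  rw [norm_mul, norm_ex, mul_one, Complex.norm_real, Real.norm_of_nonneg (hw n)]
  exact hwΛ n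

lemma block_sum_le_trivial {w : ℕ → ℝ} (hw : ∀ n, 0 ≤ w n) (hwΛ : ∀ n, w n ≤ vonMangoldt n)
    (α : ℝ) (x : ℕ) {M : ℕ} (hM : 0 < M) :
    ∑ m ∈ Ioc M (2 * M), w m * ‖fiberSum w α x m‖ ≤ 72 * x := by
  have hM0 : (0:ℝ) < M := by exact_mod_cast hM
  have h1 : ∀ m ∈ Ioc M (2 * M), w m * ‖fiberSum w α x m‖ ≤ vonMangoldt m * (6 * (x / M)) := by
    intro m hm
    rw [mem_Ioc] at hm
    refine mul_le_mul (hwΛ m) ((norm_fiberSum_le hw hwΛ α x m).trans ?_) (norm_nonneg _)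
      ArithmeticFunction.vonMangoldt_nonneg
    refine mul_le_mul_of_nonneg_left (Nat.cast_div_le.trans ?_) (by norm_num)
    have : (M : ℝ) ≤ m := by exact_mod_cast hm.1.le
    gcongr
  refine (sum_le_sum h1).trans ?_
  rw [← sum_mul]
  have h5 : ∑ m ∈ Ioc M (2 * M), vonMangoldt m ≤ ∑ m ∈ Ioc 0 (2 * M), vonMangoldt m :=
    sum_le_sum_of_subset_of_nonneg (Ioc_subset_Ioc_left (Nat.zero_le _))
      fun _ _ _ => ArithmeticFunction.vonMangoldt_nonneg
  have h6 := h5.trans (sum_vonMangoldt_le (2 * M))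
  push_cast at h6
  calc _ ≤ 6 * (2 * (M : ℝ)) * (6 * (x / M)) := by gcongr
    _ = _ := by field_simp; ring

lemma sum_Ioc_le_sum_dyadic {f : ℕ → ℝ} (hf1 : f 1 = 0) (J : ℕ) :
    ∑ m ∈ Ioc 0 (2 ^ J), f m ≤ ∑ j ∈ range J, ∑ m ∈ Ioc (2 ^ j) (2 * 2 ^ j), f m := by
  induction J with
  | zero => rw [pow_zero, show Ioc 0 1 = {1} from rfl, sum_singleton, hf1]; simp
  | succ J ih =>
    rw [sum_range_succ, ← sum_Ioc_consecutive f (Nat.zero_le (2 ^ J))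
      (Nat.pow_le_pow_right two_pos (Nat.le_succ J)), ← pow_succ']
    linarith

/-- The bilinear sum over prime powers near a rational with small denominator. -/
lemma bilinear_sum_le {w : ℕ → ℝ} (hw : ∀ n, 0 ≤ w n) (hwΛ : ∀ n, w n ≤ vonMangoldt n)
    {q : ℕ} (hq : 0 < q) {a : ℤ} (ha : IsCoprime a (q : ℤ)) {β P : ℝ} {x : ℕ}
    (hP : 1000 ≤ P) (hL : Real.log x ≤ P) (hqP : q ≤ P) (hβ : |β| * x ≤ P) (hx : P ^ 40 ≤ x) :
    ‖∑ m ∈ Ioc 0 x, ∑ n ∈ Ioc 0 (x / m), (w m : ℂ) * w n * ex ((m * n : ℕ) * (a / q + β))‖ ≤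
      260000 * x * Real.log x * (√q / q.totient / √(max 1 √(|β| * x))) +
        50000 * x * Real.log P := by
  have hP0 : 0 < P := by linarith
  have hP1 : 1 ≤ P := by linarith
  have hx1 : (1:ℝ) ≤ x := (one_le_pow₀ hP1).trans hx
  set α := (a / q + β : ℝ)
  set g : ℝ := √q / q.totient / √(max 1 √(|β| * x)) with hg
  have hg0 : 0 ≤ g := by positivity
  set z := Nat.sqrt x with hz
  have hzz : z * z ≤ x := Nat.sqrt_le x
  have hlogx : 40 * Real.log P ≤ Real.log x := by
    have := Real.log_le_log (by positivity) hx
    rwa [Real.log_pow] at this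
  have hlogP : 6 ≤ Real.log P := by
    have h1 : Real.log (2 ^ 9) ≤ Real.log P :=
      Real.log_le_log (by norm_num) (by norm_num; linarith)
    rw [Real.log_pow] at h1
    have := Real.log_two_gt_d9
    push_cast at h1
    linarith
  have hin : ∀ m, ∑ n ∈ Ioc 0 (x / m), (w m : ℂ) * w n * ex ((m * n : ℕ) * α) =
      w m * fiberSum w α x m := by
    intro m
    rw [fiberSum, mul_sum]
    refine sum_congr rfl fun n _ => ?_
    rw [mul_assoc]; congr 3; push_cast; ring
  refine (norm_symm_hyperbola_le (fun m n => (w m : ℂ) * w n * ex ((m * n : ℕ) * α)) ?_ x z hzz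
    (Nat.lt_succ_sqrt x)).trans ?_
  · intro m n
    simp only [mul_comm m n, mul_comm (w m : ℂ)]
  have h2 : ‖∑ m ∈ Ioc 0 z, ∑ n ∈ Ioc 0 z, (w m : ℂ) * w n * ex ((m * n : ℕ) * α)‖ ≤ 36 * x := by
    calc _ ≤ ∑ m ∈ Ioc 0 z, ∑ n ∈ Ioc 0 z, vonMangoldt m * vonMangoldt n := by
          refine (norm_sum_le _ _).trans (sum_le_sum fun m _ => (norm_sum_le _ _).trans
            (sum_le_sum fun n _ => ?_))
          rw [norm_mul, norm_mul, norm_ex, mul_one, Complex.norm_real, Complex.norm_real,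
            Real.norm_of_nonneg (hw _), Real.norm_of_nonneg (hw _)]
          exact mul_le_mul (hwΛ m) (hwΛ n) (hw n) ArithmeticFunction.vonMangoldt_nonneg
      _ = (∑ m ∈ Ioc 0 z, vonMangoldt m) * ∑ n ∈ Ioc 0 z, vonMangoldt n := by rw [sum_mul_sum]
      _ ≤ (6 * z) * (6 * z) := by
          gcongr
          · exact sum_vonMangoldt_le z
          · exact sum_vonMangoldt_le z
      _ = 36 * (z * z : ℕ) := by push_cast; ring
      _ ≤ _ := by gcongr
  set f : ℕ → ℝ := fun m => w m * ‖fiberSum w α x m‖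
  have hf : ∀ m, 0 ≤ f m := fun m => mul_nonneg (hw m) (norm_nonneg _)
  have hf1 : f 1 = 0 := by
    have : w 1 = 0 := le_antisymm ((hwΛ 1).trans (by simp)) (hw 1)
    simp [f, this]
  set J := Nat.clog 2 z
  have h3 : ‖∑ m ∈ Ioc 0 z, ∑ n ∈ Ioc 0 (x / m), (w m : ℂ) * w n * ex ((m * n : ℕ) * α)‖ ≤
      ∑ j ∈ range J, ∑ m ∈ Ioc (2 ^ j) (2 * 2 ^ j), f m := by
    refine le_trans ?_ (sum_Ioc_le_sum_dyadic hf1 J)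
    refine le_trans ?_ (sum_le_sum_of_subset_of_nonneg
      (Ioc_subset_Ioc_right (Nat.le_pow_clog (by norm_num) z)) fun _ _ _ => hf _)
    simp_rw [hin]
    refine (norm_sum_le _ _).trans (sum_le_sum fun m _ => ?_)
    rw [norm_mul, Complex.norm_real, Real.norm_of_nonneg (hw m)]
  have hblock : ∀ j ∈ range J, ∑ m ∈ Ioc (2 ^ j) (2 * 2 ^ j), f m ≤
      130000 * x * (g + 1 / P) + if (j : ℝ) < 30 * Real.log P then 72 * (x : ℝ) else 0 := by
    intro j hj
    have hjz : 2 ^ j < z := by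
      rw [mem_range] at hj
      by_contra! hc
      exact absurd (Nat.clog_le_of_le_pow hc) (by omega)
    by_cases hc : (j : ℝ) < 30 * Real.log P
    · rw [if_pos hc]
      have := block_sum_le_trivial hw hwΛ α x (M := 2 ^ j) (by positivity)
      have : 0 ≤ 130000 * x * (g + 1 / P) := by positivity
      linarith
    · rw [if_neg hc, add_zero]
      refine block_sum_le hw hwΛ hq ha hP hL hqP hβ ?_ ?_
      · rw [← Real.log_le_log_iff (by positivity) (by positivity)]
        push_cast
        rw [Real.log_pow, Real.log_pow]
        have := Real.log_two_gt_d9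
        push_cast
        nlinarith
      · have h1 : ((2 ^ j : ℕ) : ℝ) ≤ √x := by
          apply Real.le_sqrt_of_sq_le
          have : 2 ^ j * 2 ^ j ≤ x := (Nat.mul_le_mul hjz.le hjz.le).trans hzz
          rw [sq]; exact_mod_cast this
        have h4 : P ^ 20 ≤ √x := by
          apply Real.le_sqrt_of_sq_le
          rw [← pow_mul]; exact hx
        calc _ ≤ √x * √x := by gcongr
          _ = x := Real.mul_self_sqrt (by positivity)
  have hJ : (J : ℝ) ≤ Real.log x := by
    rcases Nat.eq_zero_or_pos J with h0 | h0
    · rw [h0]; simp only [Nat.cast_zero]; linarith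
    · have : 2 ^ (J - 1) < z := by
        by_contra! hc
        exact absurd (Nat.clog_le_of_le_pow hc) (by omega)
      have h1 : 2 ^ (J - 1) * 2 ^ (J - 1) ≤ x := (Nat.mul_le_mul this.le this.le).trans hzz
      have h4 : (2:ℝ) ^ (2 * (J - 1)) ≤ x := by
        rw [two_mul, pow_add]; exact_mod_cast h1
      have h5 := Real.log_le_log (by positivity) h4
      rw [Real.log_pow] at h5
      push_cast [Nat.cast_sub h0] at h5
      have := Real.log_two_gt_d9
      have h6 : (1:ℝ) ≤ J := by exact_mod_cast h0
      nlinarith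
  have hcount : ∑ j ∈ range J, (if (j : ℝ) < 30 * Real.log P then 72 * (x : ℝ) else 0) ≤
      (30 * Real.log P + 1) * (72 * x) := by
    rw [← sum_filter, sum_const, nsmul_eq_mul]
    refine mul_le_mul_of_nonneg_right ?_ (by positivity)
    have : #{j ∈ range J | ((j : ℕ) : ℝ) < 30 * Real.log P} ≤ #(range ⌈30 * Real.log P⌉₊) := by
      apply card_le_card
      intro j hj
      rw [mem_filter] at hj
      rw [mem_range]
      exact Nat.lt_ceil.2 hj.2
    rw [card_range] at this
    have h1 := Nat.ceil_lt_add_one (a := 30 * Real.log P) (by positivity)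
    have h4 : (#{j ∈ range J | ((j : ℕ) : ℝ) < 30 * Real.log P} : ℝ) ≤ ⌈30 * Real.log P⌉₊ := by
      exact_mod_cast this
    linarith
  have h4 : ∑ j ∈ range J, ∑ m ∈ Ioc (2 ^ j) (2 * 2 ^ j), f m ≤
      Real.log x * (130000 * x * (g + 1 / P)) + (30 * Real.log P + 1) * (72 * x) := by
    refine (sum_le_sum hblock).trans ?_
    rw [sum_add_distrib, sum_const, card_range, nsmul_eq_mul]
    gcongr
  have h5 : Real.log x * (1 / P) ≤ 1 := by
    rw [mul_one_div, div_le_one hP0]; exact hL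
  have h6 : x * 6 ≤ x * Real.log P := by gcongr
  have h7 : (x : ℝ) * (Real.log x * (1 / P)) ≤ x * 1 := by gcongr
  linarith

lemma sum_one_div_Ioc_le_log {D x : ℕ} (hD : 1 ≤ D) (hx : D ≤ x) :
    ∑ d ∈ Ioc D x, 1 / (d : ℝ) ≤ Real.log x - Real.log D := by
  induction x, hx using Nat.le_induction with
  | base => simp
  | succ n hn ih =>
    have hn0 : (0 : ℝ) < n := by exact_mod_cast (by omega : 0 < n)
    rw [← insert_Ioc_right_eq_Ioc_add_one hn, sum_insert (by simp)]
    have h := Real.one_sub_inv_le_log_of_pos (x := ((n + 1 : ℕ) : ℝ) / n) (by positivity)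
    rw [Real.log_div (by positivity) hn0.ne'] at h
    have h2 : 1 - (((n + 1 : ℕ) : ℝ) / n)⁻¹ = 1 / ((n + 1 : ℕ) : ℝ) := by
      push_cast; field_simp; ring
    linarith

/-- Summation by parts with monotone weights. -/
lemma norm_sum_mul_le_of_monotoneOn {A B : ℕ} {f : ℕ → ℂ} {g : ℕ → ℝ} {D G : ℝ}
    (hf : ∀ t ≤ B, ‖∑ n ∈ Ioc A t, f n‖ ≤ D) (hg : MonotoneOn g (Set.Ioc A B))
    (hG0 : 0 ≤ G) (hG : ∀ n ∈ Set.Ioc A B, |g n| ≤ G) :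
    ‖∑ n ∈ Ioc A B, f n * g n‖ ≤ 3 * D * G := by
  have hD : 0 ≤ D := (norm_nonneg _).trans (hf 0 (Nat.zero_le _))
  rcases le_or_gt B A with h | h
  · simp only [Ioc_eq_empty_of_le h, sum_empty, norm_zero]; positivity
  refine (norm_sum_mul_le_of_partial h hf).trans ?_
  have h1 : ∑ n ∈ Ioo A B, ‖((g (n + 1) : ℝ) : ℂ) - (g n : ℝ)‖ = g B - g (A + 1) := by
    rw [sum_congr rfl (g := fun n => g (n + 1) - g n)]
    · have : Ioo A B = Ico (A + 1) B := by ext; simp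
      rw [this, sum_Ico_sub _ (by omega)]
    · intro n hn
      rw [mem_Ioo] at hn
      rw [← Complex.ofReal_sub, Complex.norm_real, Real.norm_eq_abs, abs_of_nonneg]
      exact sub_nonneg.2 (hg ⟨hn.1, by omega⟩ ⟨by omega, by omega⟩ (by omega))
  have hB := abs_le.1 (hG B ⟨h, le_rfl⟩)
  have hA := abs_le.1 (hG (A + 1) ⟨by omega, by omega⟩)
  rw [h1, Complex.norm_real, Real.norm_eq_abs]
  have := hG B ⟨h, le_rfl⟩
  nlinarith

lemma norm_sum_mul_le_of_antitoneOn {A B : ℕ} {f : ℕ → ℂ} {g : ℕ → ℝ} {D G : ℝ}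
    (hf : ∀ t ≤ B, ‖∑ n ∈ Ioc A t, f n‖ ≤ D) (hg : AntitoneOn g (Set.Ioc A B))
    (hG0 : 0 ≤ G) (hG : ∀ n ∈ Set.Ioc A B, |g n| ≤ G) :
    ‖∑ n ∈ Ioc A B, f n * g n‖ ≤ 3 * D * G := by
  have := norm_sum_mul_le_of_monotoneOn hf hg.neg hG0 (by simpa using hG)
  simpa using this

lemma norm_sum_mul_ex_le {A B : ℕ} {f : ℕ → ℂ} {D : ℝ} (hf : ∀ t ≤ B, ‖∑ n ∈ Ioc A t, f n‖ ≤ D)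
    (β : ℝ) : ‖∑ n ∈ Ioc A B, f n * ex (n * β)‖ ≤ D * (1 + 7 * (B * |β|)) := by
  have hD : 0 ≤ D := (norm_nonneg _).trans (hf 0 (Nat.zero_le _))
  rcases le_or_gt B A with h | h
  · simp only [Ioc_eq_empty_of_le h, sum_empty, norm_zero]; positivity
  refine (norm_sum_mul_le_of_partial h hf).trans ?_
  gcongr
  · rw [norm_ex]
  · calc ∑ n ∈ Ioo A B, ‖ex (((n + 1 : ℕ) : ℝ) * β) - ex (n * β)‖
        ≤ ∑ n ∈ Ioo A B, 7 * |β| := by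
          refine sum_le_sum fun n _ => (norm_ex_sub_le _ _).trans ?_
          have : (((n + 1 : ℕ) : ℝ) * β) - n * β = β := by push_cast; ring
          rw [this]
          have := Real.pi_lt_d2
          have := abs_nonneg β
          nlinarith
      _ ≤ _ := by
          rw [sum_const, nsmul_eq_mul]
          have : ((#(Ioo A B) : ℕ) : ℝ) ≤ B := by
            rw [Nat.card_Ioo]; exact_mod_cast (by omega)
          have h0 := abs_nonneg β
          nlinarith

/-- The generalised von Mangoldt function `μ * log ^ k`. -/
noncomputable def lam (k n : ℕ) : ℝ :=
  ∑ p ∈ n.divisorsAntidiagonal, (ArithmeticFunction.moebius p.1 : ℝ) * Real.log p.2 ^ k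

lemma lam_eq_sum {x n : ℕ} (hn : 0 < n) (hx : n ≤ x) (k : ℕ) :
    lam k n = ∑ d ∈ Ioc 0 x, if d ∣ n then
      (ArithmeticFunction.moebius d : ℝ) * Real.log ((n : ℝ) / d) ^ k else 0 := by
  rw [lam, ← sum_filter, Nat.sum_divisorsAntidiagonal
    (fun a b => (ArithmeticFunction.moebius a : ℝ) * Real.log b ^ k)]
  refine sum_congr ?_ ?_
  · ext d
    simp only [Nat.mem_divisors, mem_filter, mem_Ioc]
    exact ⟨fun h => ⟨⟨Nat.pos_of_dvd_of_pos h.1 hn, (Nat.le_of_dvd hn h.1).trans hx⟩, h.1⟩,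
      fun h => ⟨h.2, hn.ne'⟩⟩
  · intro d hd
    have h := (mem_filter.1 hd)
    rw [Nat.cast_div h.2 (by have := (mem_Ioc.1 h.1).1; positivity)]

lemma lam_zero {n : ℕ} (hn : 1 < n) : lam 0 n = 0 := by
  have h := congrArg (fun f => f n) (ArithmeticFunction.coe_moebius_mul_coe_zeta (R := ℝ))
  simp only [ArithmeticFunction.mul_apply, ArithmeticFunction.one_apply_ne hn.ne'] at h
  rw [← h, lam]
  refine sum_congr rfl fun p hp => ?_
  have : p.2 ≠ 0 := fun h0 => by
    have := Nat.mem_divisorsAntidiagonal.1 hp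
    rw [h0, mul_zero] at this; omega
  simp [this]

lemma lam_one (n : ℕ) : lam 1 n = vonMangoldt n := by
  rw [← ArithmeticFunction.moebius_mul_log_eq_vonMangoldt, ArithmeticFunction.mul_apply]
  simp [lam]

lemma lam_two (n : ℕ) : lam 2 n = vonMangoldt n * Real.log n +
    ∑ p ∈ n.divisorsAntidiagonal, vonMangoldt p.1 * vonMangoldt p.2 := by
  let sq : ArithmeticFunction ℝ := ArithmeticFunction.log.pmul ArithmeticFunction.log
  let dl : ArithmeticFunction ℝ := vonMangoldt.pmul ArithmeticFunction.log
  have h : sq = (dl + vonMangoldt * vonMangoldt) * ArithmeticFunction.zeta := by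
    rw [add_mul, mul_assoc, ArithmeticFunction.vonMangoldt_mul_zeta]
    ext m
    rw [ArithmeticFunction.add_apply, ArithmeticFunction.mul_apply, ArithmeticFunction.mul_apply,
      ← sum_add_distrib]
    have hm : sq m = (vonMangoldt * ArithmeticFunction.zeta : ArithmeticFunction ℝ) m *
        Real.log m := by
      rw [ArithmeticFunction.vonMangoldt_mul_zeta]; simp [sq]
    rw [hm, ArithmeticFunction.mul_apply, sum_mul]
    refine sum_congr rfl fun p hp => ?_
    obtain ⟨h1, h2⟩ := Nat.mem_divisorsAntidiagonal.1 hp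
    have hp1 : p.1 ≠ 0 := fun h => h2 (by rw [← h1, h, zero_mul])
    have hp2 : p.2 ≠ 0 := fun h => h2 (by rw [← h1, h, mul_zero])
    have : Real.log m = Real.log p.1 + Real.log p.2 := by
      rw [← Real.log_mul (by exact_mod_cast hp1) (by exact_mod_cast hp2), ← h1]; push_cast; rfl
    simp [this, dl, hp2]; ring
  have h2 : lam 2 n = ((ArithmeticFunction.moebius : ArithmeticFunction ℝ) * sq) n := by
    simp [lam, sq, ArithmeticFunction.mul_apply, pow_two]
  rw [h2, h, mul_comm, mul_assoc, mul_comm (ArithmeticFunction.zeta : ArithmeticFunction ℝ),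
    ArithmeticFunction.coe_moebius_mul_coe_zeta, mul_one, ArithmeticFunction.add_apply,
    ArithmeticFunction.mul_apply]
  simp [dl]

lemma lam_two_nonneg (n : ℕ) : 0 ≤ lam 2 n := by
  rw [lam_two]
  exact add_nonneg (mul_nonneg ArithmeticFunction.vonMangoldt_nonneg (Real.log_natCast_nonneg n))
    (sum_nonneg fun p _ => mul_nonneg ArithmeticFunction.vonMangoldt_nonneg
      ArithmeticFunction.vonMangoldt_nonneg)

lemma sum_vonMangoldt_mul_div_le (x : ℕ) :
    ∑ m ∈ Ioc 0 x, vonMangoldt m * ((x / m : ℕ) : ℝ) ≤ x * Real.log x := by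
  have h := sum_divisorsAntidiagonal_eq (fun d _ => (vonMangoldt d : ℝ)) x
  simp only [sum_const, Nat.card_Ioc, Nat.sub_zero, nsmul_eq_mul] at h
  rw [sum_congr rfl (fun m _ => mul_comm (vonMangoldt m) _), ← h]
  calc _ ≤ ∑ n ∈ Ioc 0 x, Real.log x := by
        refine sum_le_sum fun n hn => ?_
        rw [mem_Ioc] at hn
        rw [Nat.sum_divisorsAntidiagonal (fun a _ => (vonMangoldt a : ℝ)),
          ArithmeticFunction.vonMangoldt_sum]
        exact Real.log_le_log (by exact_mod_cast hn.1) (by exact_mod_cast hn.2)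
    _ = _ := by simp

lemma sum_lam_two_le (x : ℕ) : ∑ n ∈ Ioc 0 x, lam 2 n ≤ 12 * (x * Real.log x) := by
  simp only [lam_two]
  rw [sum_add_distrib, sum_divisorsAntidiagonal_eq (fun a b => vonMangoldt a * vonMangoldt b)]
  have h1 : ∑ n ∈ Ioc 0 x, vonMangoldt n * Real.log n ≤ 6 * (x * Real.log x) := by
    calc _ ≤ ∑ n ∈ Ioc 0 x, vonMangoldt n * Real.log x := by
          refine sum_le_sum fun n hn => ?_
          rw [mem_Ioc] at hn
          exact mul_le_mul_of_nonneg_left (Real.log_le_log (by exact_mod_cast hn.1)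
            (by exact_mod_cast hn.2)) ArithmeticFunction.vonMangoldt_nonneg
      _ ≤ _ := by
          rw [← sum_mul]
          have := mul_le_mul_of_nonneg_right (sum_vonMangoldt_le x) (Real.log_natCast_nonneg x)
          linarith
  have h2 : ∑ d ∈ Ioc 0 x, ∑ e ∈ Ioc 0 (x / d), vonMangoldt d * vonMangoldt e ≤
      6 * (x * Real.log x) := by
    calc _ ≤ ∑ d ∈ Ioc 0 x, 6 * (vonMangoldt d * ((x / d : ℕ) : ℝ)) := by
          refine sum_le_sum fun d _ => ?_
          rw [← mul_sum]
          have := mul_le_mul_of_nonneg_left (sum_vonMangoldt_le (x / d))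
            (ArithmeticFunction.vonMangoldt_nonneg (n := d))
          linarith
      _ ≤ _ := by
          rw [← mul_sum]
          linarith [sum_vonMangoldt_mul_div_le x]
  linarith

lemma sum_vonMangoldt_mul_log_div_le (x : ℕ) :
    ∑ n ∈ Ioc 0 x, vonMangoldt n * (Real.log x - Real.log n) ≤ 6 * x := by
  induction x with
  | zero => simp
  | succ x ih =>
    rw [← insert_Ioc_right_eq_Ioc_add_one (Nat.zero_le x), sum_insert (by simp), sub_self,
      mul_zero, zero_add]
    rcases Nat.eq_zero_or_pos x with rfl | hx
    · simp
    have hx0 : (0 : ℝ) < x := by exact_mod_cast hx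
    have h1 : Real.log ((x + 1 : ℕ) : ℝ) - Real.log x ≤ 1 / x := by
      rw [← Real.log_div (by positivity) hx0.ne']
      refine (Real.log_le_sub_one_of_pos (by positivity)).trans (le_of_eq ?_)
      push_cast; field_simp; ring
    have h2 : ∑ n ∈ Ioc 0 x, vonMangoldt n * (Real.log ((x + 1 : ℕ) : ℝ) - Real.log n) =
        ∑ n ∈ Ioc 0 x, vonMangoldt n * (Real.log x - Real.log n) +
          (∑ n ∈ Ioc 0 x, vonMangoldt n) * (Real.log ((x + 1 : ℕ) : ℝ) - Real.log x) := by
      rw [sum_mul, ← sum_add_distrib]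
      exact sum_congr rfl fun n _ => by ring
    have h3 : (∑ n ∈ Ioc 0 x, vonMangoldt n) * (Real.log ((x + 1 : ℕ) : ℝ) - Real.log x) ≤
        6 * x * (1 / x) := by
      refine mul_le_mul (sum_vonMangoldt_le x) h1 (sub_nonneg.2 ?_) (by positivity)
      exact Real.log_le_log hx0 (by push_cast; linarith)
    rw [mul_one_div, mul_div_assoc, div_self hx0.ne', mul_one] at h3
    push_cast at *
    linarith
lemma sum_Ioc_eq_sum_range {E : Type*} [AddCommMonoid E] (G : ℕ → E) (a k : ℕ) :
    ∑ n ∈ Ioc a (a + k), G n = ∑ n ∈ range k, G (a + 1 + n) := by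
  rw [sum_bij' (fun n _ => n - (a + 1)) (fun n _ => a + 1 + n)]
  · intro n hn; rw [mem_Ioc] at hn; rw [mem_range]; omega
  · intro n hn; rw [mem_range] at hn; rw [mem_Ioc]; omega
  · intro n hn; rw [mem_Ioc] at hn; omega
  · intro n hn; omega
  · intro n hn; rw [mem_Ioc] at hn; congr 1; omega

lemma sum_range_periodic {E : Type*} [AddCommGroup E] {G : ℕ → E} {q : ℕ}
    (hG : ∀ n, G (n + q) = G n) (a : ℕ) :
    ∑ n ∈ range q, G (a + n) = ∑ n ∈ range q, G n := by
  induction a with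
  | zero => simp
  | succ a ih =>
    rw [← ih]
    have h1 := sum_range_succ (fun n => G (a + n)) q
    have h2 := sum_range_succ' (fun n => G (a + n)) q
    rw [h1] at h2
    simp only [add_zero, hG] at h2
    have h3 := add_right_cancel h2
    rw [h3]
    exact sum_congr rfl fun n _ => by congr 1; ring

lemma norm_sum_periodic_sub_le {G : ℕ → ℂ} {q : ℕ} (hq : 0 < q) (hG : ∀ n, G (n + q) = G n)
    (hG1 : ∀ n, ‖G n‖ ≤ 1) {κ : ℂ} (hκ : ∑ n ∈ range q, G n = κ * q) (a k : ℕ) :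
    ‖∑ n ∈ Ioc a (a + k), G n - κ * k‖ ≤ 2 * q := by
  have hκ1 : ‖κ‖ ≤ 1 := by
    have : ‖κ * q‖ ≤ q := by
      rw [← hκ]
      exact (norm_sum_le_of_le _ fun n _ => hG1 n).trans (by simp)
    rw [norm_mul, Complex.norm_natCast] at this
    have hq0 : (0 : ℝ) < q := by exact_mod_cast hq
    nlinarith
  rw [sum_Ioc_eq_sum_range]
  induction k using Nat.strong_induction_on generalizing a with
  | _ k ih =>
    rcases lt_or_ge k q with h | h
    · have h0 : (k : ℝ) ≤ q := by exact_mod_cast h.le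
      calc _ ≤ ‖∑ n ∈ range k, G (a + 1 + n)‖ + ‖κ * k‖ := norm_sub_le _ _
        _ ≤ k + 1 * k := by
          gcongr
          · exact (norm_sum_le_of_le _ fun n _ => hG1 _).trans (by simp)
          · rw [norm_mul, Complex.norm_natCast]; gcongr
        _ ≤ _ := by linarith
    · obtain ⟨j, rfl⟩ := Nat.exists_eq_add_of_le h
      have := ih j (by omega) (a + q)
      rw [sum_range_add, sum_range_periodic hG, hκ]
      convert this using 2
      push_cast
      have : ∑ x ∈ range j, G (a + 1 + (q + x)) = ∑ x ∈ range j, G (a + q + 1 + x) :=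
        sum_congr rfl fun n _ => by congr 1; ring
      rw [this]; ring

lemma sum_Ioc_filter_dvd {E : Type*} [AddCommMonoid E] (G : ℕ → E) {d : ℕ} (hd : 0 < d) (A t : ℕ) :
    ∑ n ∈ Ioc A t, (if d ∣ n then G n else 0) = ∑ m ∈ Ioc (A / d) (t / d), G (d * m) := by
  rw [← sum_filter]
  symm
  refine sum_bij' (fun m _ => d * m) (fun n _ => n / d) ?_ ?_ ?_ ?_ ?_
  · intro m hm
    rw [mem_Ioc] at hm
    rw [mem_filter, mem_Ioc]
    exact ⟨⟨(Nat.div_lt_iff_lt_mul hd).1 hm.1 |>.trans_eq (mul_comm _ _),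
      (mul_comm d m).trans_le ((Nat.le_div_iff_mul_le hd).1 hm.2)⟩, dvd_mul_right _ _⟩
  · intro n hn
    rw [mem_filter, mem_Ioc] at hn
    obtain ⟨⟨h1, h2⟩, m, rfl⟩ := hn
    rw [Nat.mul_div_cancel_left _ hd, mem_Ioc]
    exact ⟨(Nat.div_lt_iff_lt_mul hd).2 (by linarith [mul_comm d m]),
      (Nat.le_div_iff_mul_le hd).2 (by linarith [mul_comm d m])⟩
  · intro m _; exact Nat.mul_div_cancel_left _ hd
  · intro n hn
    exact Nat.mul_div_cancel' (mem_filter.1 hn).2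
  · intro m _; rfl

/-- A `q`-periodic function supported on the units modulo `q`, whose average over the multiples
of any `d` prime to `q` is `κ / d`. -/
structure UnitPeriodic (q : ℕ) (g : ℕ → ℂ) (κ : ℂ) : Prop where
  periodic : ∀ n, g (n + q) = g n
  norm_le : ∀ n, ‖g n‖ ≤ 1
  eq_zero : ∀ n, ¬ n.Coprime q → g n = 0
  mean : ∀ d : ℕ, d.Coprime q → ∑ r ∈ range q, g (d * r) = κ * q

lemma UnitPeriodic.norm_sum_sub_le {q : ℕ} {g : ℕ → ℂ} {κ : ℂ} (h : UnitPeriodic q g κ)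
    (hq : 0 < q) {d : ℕ} (hd : 0 < d) (A t : ℕ) :
    ‖∑ n ∈ Ioc A t, ((if d ∣ n then g n else 0) - if d.Coprime q then κ / d else 0)‖ ≤ 4 * q := by
  have hq1 : (1 : ℝ) ≤ q := by exact_mod_cast hq
  rcases le_or_gt t A with htA | htA
  · simp only [Ioc_eq_empty_of_le htA, sum_empty, norm_zero]; positivity
  rw [sum_sub_distrib, sum_Ioc_filter_dvd _ hd]
  by_cases hdq : d.Coprime q
  · have hp : ∀ n, g (d * (n + q)) = g (d * n) := by
      intro n
      rw [mul_add]
      have : ∀ j, g (d * n + j * q) = g (d * n) := by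
        intro j
        induction j with
        | zero => simp
        | succ j ih => rw [add_mul, one_mul, ← add_assoc, h.periodic, ih]
      exact this d
    obtain ⟨j, hj⟩ := Nat.exists_eq_add_of_le (Nat.div_le_div_right (c := d) htA.le)
    have h1 := norm_sum_periodic_sub_le hq hp (fun n => h.norm_le _) (h.mean d hdq) (A / d) j
    have hκ1 : ‖κ‖ ≤ 1 := by
      have : ‖κ * q‖ ≤ q := by
        rw [← h.mean 1 (Nat.coprime_one_left q)]
        exact (norm_sum_le_of_le _ fun n _ => h.norm_le _).trans (by simp)
      rw [norm_mul, Complex.norm_natCast] at this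
      nlinarith
    rw [if_pos hdq, hj, sum_const, Nat.card_Ioc, nsmul_eq_mul]
    have hd0 : (0 : ℝ) < d := by exact_mod_cast hd
    have hdc : (d : ℂ) ≠ 0 := by exact_mod_cast hd.ne'
    have h2 : ‖κ * j - ((t - A : ℕ) : ℂ) * (κ / d)‖ ≤ 2 := by
      have : κ * j - ((t - A : ℕ) : ℂ) * (κ / d) = κ * (((j : ℝ) - (t - A : ℝ) / d : ℝ) : ℂ) := by
        rw [Nat.cast_sub htA.le]; push_cast; field_simp
      rw [this, norm_mul, Complex.norm_real, Real.norm_eq_abs]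
      have e1 : (d : ℝ) * (A / d : ℕ) + (A % d : ℕ) = A := by exact_mod_cast Nat.div_add_mod A d
      have e2 : (d : ℝ) * (t / d : ℕ) + (t % d : ℕ) = t := by exact_mod_cast Nat.div_add_mod t d
      have f1 : ((A % d : ℕ) : ℝ) ≤ d := by exact_mod_cast (Nat.mod_lt A hd).le
      have f2 : ((t % d : ℕ) : ℝ) ≤ d := by exact_mod_cast (Nat.mod_lt t hd).le
      have hj' : ((t / d : ℕ) : ℝ) = (A / d : ℕ) + j := by exact_mod_cast hj
      have e3 : (t - A : ℝ) / d = j + ((t % d : ℕ) - (A % d : ℕ) : ℝ) / d := by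
        field_simp
        nlinarith
      have e4 : |(j : ℝ) - (t - A : ℝ) / d| ≤ 1 := by
        rw [e3, sub_add_cancel_left, abs_neg, abs_div, abs_of_pos hd0, div_le_one hd0, abs_le]
        have g1 : (0 : ℝ) ≤ (A % d : ℕ) := Nat.cast_nonneg _
        have g2 : (0 : ℝ) ≤ (t % d : ℕ) := Nat.cast_nonneg _
        constructor <;> linarith
      nlinarith [abs_nonneg ((j : ℝ) - (t - A : ℝ) / d), norm_nonneg κ]
    have := norm_add_le (∑ m ∈ Ioc (A / d) (A / d + j), g (d * m) - κ * j)
      (κ * j - ((t - A : ℕ) : ℂ) * (κ / d))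
    rw [sub_add_sub_cancel] at this
    linarith
  · rw [sum_eq_zero, if_neg hdq]
    · simp
    · intro m _
      exact h.eq_zero _ fun hc => hdq (Nat.Coprime.coprime_mul_right hc)

/-- Truncation of the average of `lam k` along integers prime to `q`. -/
noncomputable def lamMean (q D k n : ℕ) : ℝ :=
  ∑ d ∈ Ioc 0 D with d.Coprime q,
    (ArithmeticFunction.moebius d : ℝ) / d * Real.log ((n : ℝ) / d) ^ k

lemma abs_moebius_le_one (d : ℕ) : |(ArithmeticFunction.moebius d : ℝ)| ≤ 1 := by
  exact_mod_cast ArithmeticFunction.abs_moebius_le_one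

lemma sum_big_divisors_le {g : ℕ → ℂ} (hg : ∀ n, ‖g n‖ ≤ 1) {D x : ℕ} (hD : 1 ≤ D) (hx : D ≤ x)
    (k : ℕ) : ‖∑ n ∈ Ioc D x, ∑ d ∈ Ioc D x, (if d ∣ n then g n else 0) *
      ((ArithmeticFunction.moebius d : ℝ) * Real.log ((n : ℝ) / d) ^ k : ℝ)‖ ≤
      x * (Real.log x - Real.log D) ^ (k + 1) := by
  have hD0 : (0 : ℝ) < D := by exact_mod_cast hD
  have hxD : (D : ℝ) ≤ x := by exact_mod_cast hx
  set l := Real.log x - Real.log D with hl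
  have hl0 : 0 ≤ l := sub_nonneg.2 (Real.log_le_log hD0 hxD)
  rw [sum_comm]
  calc _ ≤ ∑ d ∈ Ioc D x, (x : ℝ) * l ^ k * (1 / d) := by
        refine norm_sum_le_of_le _ fun d hd => ?_
        rw [mem_Ioc] at hd
        have hd0 : 0 < d := by omega
        have hdr : (0 : ℝ) < d := by exact_mod_cast hd0
        calc _ ≤ ∑ n ∈ Ioc D x, (if d ∣ n then l ^ k else 0) := by
              refine norm_sum_le_of_le _ fun n hn => ?_
              rw [mem_Ioc] at hn
              split_ifs with hdn
              · rw [norm_mul, Complex.norm_real, Real.norm_eq_abs, abs_mul, abs_pow]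
                have h1 : |Real.log ((n : ℝ) / d)| ≤ l := by
                  have hn0 : 0 < n := by omega
                  have hnd : (d : ℝ) ≤ n := by exact_mod_cast Nat.le_of_dvd hn0 hdn
                  have hnr : (0 : ℝ) < n := by exact_mod_cast hn0
                  rw [abs_of_nonneg (Real.log_nonneg ((one_le_div hdr).2 hnd)),
                    Real.log_div hnr.ne' hdr.ne']
                  exact sub_le_sub (Real.log_le_log hnr (by exact_mod_cast hn.2))
                    (Real.log_le_log hD0 (by exact_mod_cast hd.1.le))
                calc _ ≤ 1 * (1 * l ^ k) := by
                      gcongr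
                      · exact hg n
                      · exact abs_moebius_le_one d
                  _ = _ := by ring
              · simp
          _ ≤ _ := by
              rw [sum_Ioc_filter_dvd (fun _ => l ^ k) hd0, sum_const, Nat.card_Ioc, nsmul_eq_mul]
              have : (((x / d - D / d : ℕ) : ℕ) : ℝ) ≤ x / d :=
                (Nat.cast_le.2 (Nat.sub_le _ _)).trans Nat.cast_div_le
              calc _ ≤ (x : ℝ) / d * l ^ k := by gcongr
                _ = _ := by ring
    _ ≤ _ := by
        rw [← mul_sum, pow_succ, ← mul_assoc]
        gcongr
        exact sum_one_div_Ioc_le_log hD hx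

lemma UnitPeriodic.norm_sum_lam_sub_le {q : ℕ} {g : ℕ → ℂ} {κ : ℂ} (h : UnitPeriodic q g κ)
    (hq : 0 < q) {D x : ℕ} (hD : 1 ≤ D) (hx : D ≤ x) (k : ℕ) (β : ℝ) :
    ‖∑ n ∈ Ioc D x, g n * lam k n * ex (n * β) -
      κ * ∑ n ∈ Ioc D x, (lamMean q D k n : ℂ) * ex (n * β)‖ ≤
      D * (12 * q * (1 + 7 * (x * |β|)) * Real.log x ^ k) +
        x * (Real.log x - Real.log D) ^ (k + 1) := by
  have key : ∑ n ∈ Ioc D x, g n * lam k n * ex (n * β) -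
      κ * ∑ n ∈ Ioc D x, (lamMean q D k n : ℂ) * ex (n * β) =
      ∑ d ∈ Ioc 0 D, (ArithmeticFunction.moebius d : ℂ) * ∑ n ∈ Ioc D x,
        (((if d ∣ n then g n else 0) - if d.Coprime q then κ / d else 0) * ex (n * β)) *
          ((Real.log ((n : ℝ) / d) ^ k : ℝ) : ℂ) +
      ∑ n ∈ Ioc D x, ∑ d ∈ Ioc D x, (if d ∣ n then g n * ex (n * β) else 0) *
      ((ArithmeticFunction.moebius d : ℝ) * Real.log ((n : ℝ) / d) ^ k : ℝ) := by
    simp only [mul_sum]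
    rw [sum_comm (s := Ioc 0 D), ← sum_add_distrib, ← sum_sub_distrib]
    refine sum_congr rfl fun n hn => ?_
    rw [mem_Ioc] at hn
    rw [lam_eq_sum (by omega) hn.2 k, ← Ioc_union_Ioc_eq_Ioc (Nat.zero_le D) hx,
      sum_union (Ioc_disjoint_Ioc_of_le le_rfl), lamMean, sum_filter]
    push_cast
    rw [mul_add, add_mul, add_sub_right_comm]
    congr 1
    · simp only [mul_sum, sum_mul]
      rw [← sum_sub_distrib]
      refine sum_congr rfl fun d _ => ?_
      split_ifs <;> push_cast <;> ring
    · simp only [mul_sum, sum_mul]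
      refine sum_congr rfl fun d _ => ?_
      split_ifs <;> push_cast <;> ring
  rw [key]
  refine (norm_add_le _ _).trans (add_le_add ?_ ?_)
  · calc _ ≤ ∑ d ∈ Ioc 0 D, (12 * q * (1 + 7 * (x * |β|)) * Real.log x ^ k) := by
          refine norm_sum_le_of_le _ fun d hd => ?_
          rw [mem_Ioc] at hd
          have hdr : (0 : ℝ) < d := by exact_mod_cast hd.1
          rw [norm_mul]
          have h1 : ‖(ArithmeticFunction.moebius d : ℂ)‖ ≤ 1 := by
            have := abs_moebius_le_one d
            rwa [← Real.norm_eq_abs, ← Complex.norm_real, Complex.ofReal_intCast] at this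
          have hpos : ∀ n ∈ Set.Ioc D x, 0 ≤ Real.log ((n : ℝ) / d) := fun n hn =>
            Real.log_nonneg ((one_le_div hdr).2 (by exact_mod_cast hd.2.trans hn.1.le))
          have h2 := norm_sum_mul_le_of_monotoneOn (A := D) (B := x)
            (f := fun n => ((if d ∣ n then g n else 0) - if d.Coprime q then κ / d else 0) *
              ex (n * β)) (g := fun n => Real.log ((n : ℝ) / d) ^ k)
            (D := 4 * q * (1 + 7 * (x * |β|))) (G := Real.log x ^ k) ?_ ?_ ?_ ?_
          · calc _ ≤ 1 * (3 * (4 * q * (1 + 7 * (x * |β|))) * Real.log x ^ k) := by gcongr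
              _ = _ := by ring
          · intro t ht
            refine (norm_sum_mul_ex_le (fun t' _ => h.norm_sum_sub_le hq hd.1 D t') β).trans ?_
            gcongr
          · intro n hn m hm hnm
            have hn0 : 0 < n := by have := hn.1; omega
            have := hpos n hn
            dsimp only
            gcongr
          · exact pow_nonneg (Real.log_natCast_nonneg x) k
          · intro n hn
            have := hpos n hn
            rw [abs_of_nonneg (by positivity)]
            gcongr
            · have hn0 : 0 < n := by have := hn.1; omega
              have : (0 : ℝ) < n := by exact_mod_cast hn0
              positivity
            · calc (n : ℝ) / d ≤ n := div_le_self (by positivity) (by exact_mod_cast hd.1)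
                _ ≤ x := by exact_mod_cast hn.2
      _ = _ := by simp
  · exact sum_big_divisors_le (g := fun n => g n * ex (n * β))
      (fun n => by rw [norm_mul, norm_ex, mul_one]; exact h.norm_le n) hD hx k
lemma unitPeriodic_one {q : ℕ} (hq : 0 < q) :
    UnitPeriodic q (fun n => if n.Coprime q then 1 else 0) (q.totient / q : ℝ) where
  periodic n := by simp [Nat.coprime_add_self_left]
  norm_le n := by split_ifs <;> simp
  eq_zero n h := if_neg h
  mean d hd := by
    have hqc : (q : ℂ) ≠ 0 := by exact_mod_cast hq.ne'
    simp only [Nat.coprime_mul_iff_left]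
    rw [← sum_filter, sum_const, nsmul_eq_mul, mul_one, Nat.totient_eq_card_coprime]
    push_cast
    rw [div_mul_cancel₀ _ hqc]
    congr 2
    exact filter_congr fun n _ => ⟨fun h => h.2.symm, fun h => ⟨hd, h.symm⟩⟩

lemma unitPeriodic_ex {q : ℕ} (hq : 0 < q) {a : ℤ} (ha : IsCoprime a (q : ℤ)) :
    UnitPeriodic q (fun n => if n.Coprime q then ex (n * (a / q)) else 0)
      ((ArithmeticFunction.moebius q : ℝ) / q : ℝ) where
  periodic n := by
    have hqr : (q : ℝ) ≠ 0 := by exact_mod_cast hq.ne'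
    have : ((n + q : ℕ) : ℝ) * (a / q) = n * (a / q) + (a : ℤ) := by push_cast; field_simp
    simp only [Nat.coprime_add_self_left, this, ex_add_int]
  norm_le n := by split_ifs <;> simp [norm_ex]
  eq_zero n h := if_neg h
  mean d hd := by
    have hqc : (q : ℂ) ≠ 0 := by exact_mod_cast hq.ne'
    have h := ramanujanSum_of_coprime hq (m := d * a)
      (IsCoprime.mul_left (Nat.isCoprime_iff_coprime.2 hd) ha).symm
    simp only [Nat.coprime_mul_iff_left]
    push_cast
    rw [div_mul_cancel₀ _ hqc, ← sum_filter]
    have h2 : ramanujanSum q (d * a) = ((ArithmeticFunction.moebius q : ℤ) : ℂ) := by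
      simpa using h
    rw [← h2, ramanujanSum]
    refine sum_congr (filter_congr fun n _ => ⟨fun h => h.2.symm, fun h => ⟨hd, h.symm⟩⟩) fun n _ => ?_
    congr 1
    push_cast; ring

lemma lamMean_one_eq {q D x n : ℕ} (hx : 0 < x) (hn : 0 < n) :
    lamMean q D 1 n = lamMean q D 1 x + lamMean q D 0 x * (Real.log n - Real.log x) := by
  have hx0 : (x : ℝ) ≠ 0 := by exact_mod_cast hx.ne'
  have hn0 : (n : ℝ) ≠ 0 := by exact_mod_cast hn.ne'
  simp only [lamMean, sum_mul]
  rw [← sum_add_distrib]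
  refine sum_congr rfl fun d hd => ?_
  have hd0 : (d : ℝ) ≠ 0 := by exact_mod_cast (mem_Ioc.1 (mem_filter.1 hd).1).1.ne'
  rw [Real.log_div hn0 hd0, Real.log_div hx0 hd0]; ring

lemma lamMean_two_eq {q D x n : ℕ} (hx : 0 < x) (hn : 0 < n) :
    lamMean q D 2 n = lamMean q D 2 x + 2 * lamMean q D 1 x * (Real.log n - Real.log x) +
      lamMean q D 0 x * (Real.log n - Real.log x) ^ 2 := by
  have hx0 : (x : ℝ) ≠ 0 := by exact_mod_cast hx.ne'
  have hn0 : (n : ℝ) ≠ 0 := by exact_mod_cast hn.ne'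
  simp only [lamMean, sum_mul, mul_sum]
  rw [← sum_add_distrib, ← sum_add_distrib]
  refine sum_congr rfl fun d hd => ?_
  have hd0 : (d : ℝ) ≠ 0 := by exact_mod_cast (mem_Ioc.1 (mem_filter.1 hd).1).1.ne'
  rw [Real.log_div hn0 hd0, Real.log_div hx0 hd0]; ring

lemma lamMean_zero_eq (q D x n : ℕ) : lamMean q D 0 n = lamMean q D 0 x := by
  simp [lamMean]

section
variable {q D x : ℕ} {lo : ℝ}

/-- Comparison at frequency zero. -/
lemma totient_mul_abs_sum_lamMean_le (hq : 0 < q) (hD : 1 ≤ D) (hx : D ≤ x) {k : ℕ} (hk : k ≤ 2)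
    (hL : 1 ≤ Real.log x) (hs : (D : ℝ) * (12 * q * Real.log x ^ 2) ≤ x)
    (hlo : Real.log x - Real.log D = lo) (hlo1 : 1 ≤ lo) (hpos : ∀ n, 1 < n → 0 ≤ lam k n) :
    (q.totient / q : ℝ) * |∑ n ∈ Ioc D x, lamMean q D k n| ≤
      ∑ n ∈ Ioc D x, lam k n + 2 * (x * lo ^ (k + 1)) := by
  have h := (unitPeriodic_one hq).norm_sum_lam_sub_le hq hD hx k 0
  simp only [mul_zero, ex_zero, mul_one, abs_zero, add_zero] at h
  rw [hlo] at h
  have h1 : ‖∑ n ∈ Ioc D x, (if n.Coprime q then (1 : ℂ) else 0) * (lam k n : ℂ)‖ ≤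
      ∑ n ∈ Ioc D x, lam k n := by
    refine norm_sum_le_of_le _ fun n hn => ?_
    rw [mem_Ioc] at hn
    have := hpos n (by omega)
    split_ifs
    · rw [one_mul, Complex.norm_real, Real.norm_eq_abs, abs_of_nonneg this]
    · simpa using this
  have h2 : ‖((q.totient / q : ℝ) : ℂ) * ∑ n ∈ Ioc D x, (lamMean q D k n : ℂ)‖ =
      (q.totient / q : ℝ) * |∑ n ∈ Ioc D x, lamMean q D k n| := by
    rw [norm_mul, ← Complex.ofReal_sum, Complex.norm_real, Complex.norm_real, Real.norm_eq_abs,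
      Real.norm_eq_abs, abs_of_nonneg (by positivity)]
  rw [← h2]
  have h3 := norm_sub_norm_le (((q.totient / q : ℝ) : ℂ) * ∑ n ∈ Ioc D x, (lamMean q D k n : ℂ))
    (∑ n ∈ Ioc D x, (if n.Coprime q then (1 : ℂ) else 0) * (lam k n : ℂ))
  rw [norm_sub_rev] at h3
  have h4 : (D : ℝ) * (12 * q * Real.log x ^ k) ≤ x := by
    refine le_trans ?_ hs
    gcongr
  have h5 : (x : ℝ) * 1 ≤ x * lo ^ (k + 1) := by gcongr; exact one_le_pow₀ hlo1
  linarith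

/-- Bounds for the truncated averages `∑ μ(d) / d * log (x / d) ^ k`. -/
lemma lamMean_bounds (hq : 0 < q) (hD : 1 ≤ D) (hx : 2 * D ≤ x)
    (hL : 1 ≤ Real.log x) (hs : (D : ℝ) * (12 * q * Real.log x ^ 2) ≤ x)
    (hlo : Real.log x - Real.log D = lo) (hlo1 : 1 ≤ lo) :
    (q.totient / q : ℝ) * |lamMean q D 0 x| ≤ 4 * lo ∧
    (q.totient / q : ℝ) * |lamMean q D 1 x| ≤ 24 * lo ^ 2 ∧
    (q.totient / q : ℝ) * |lamMean q D 2 x| ≤ 24 * Real.log x + 108 * lo ^ 3 := by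
  have hx0 : (0 : ℝ) < x := by exact_mod_cast (by omega : 0 < x)
  have hDx : (D : ℝ) ≤ x / 2 := by
    rw [le_div_iff₀ two_pos, mul_comm]; exact_mod_cast hx
  have hD0 : (0 : ℝ) < D := by exact_mod_cast hD
  have hDx' : D ≤ x := by omega
  set κ := (q.totient / q : ℝ) with hκ
  have hκ0 : 0 ≤ κ := by positivity
  have hcard : ∑ _n ∈ Ioc D x, (1 : ℝ) = x - D := by
    rw [sum_const, Nat.card_Ioc, nsmul_eq_mul, mul_one, Nat.cast_sub hDx']
  have hcancel : ∀ F C : ℝ, 0 ≤ F → F * (x - D) ≤ x * C → F ≤ 2 * C := by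
    intro F C hF h
    have : F * (x / 2) ≤ x * C := le_trans (by gcongr; linarith) h
    have h2 : x * (F / 2) ≤ x * C := by linarith
    have := le_of_mul_le_mul_left h2 hx0
    linarith
  have hy : ∀ n ∈ Ioc D x, |Real.log n - Real.log x| ≤ lo := by
    intro n hn
    rw [mem_Ioc] at hn
    have hn0 : (0 : ℝ) < n := by exact_mod_cast (by omega : 0 < n)
    rw [abs_sub_comm, abs_of_nonneg (sub_nonneg.2 (Real.log_le_log hn0 (by exact_mod_cast hn.2))),
      ← hlo]
    have := Real.log_le_log hD0 (by exact_mod_cast hn.1.le : (D : ℝ) ≤ n)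
    linarith
  set F0 := lamMean q D 0 x
  set F1 := lamMean q D 1 x
  set F2 := lamMean q D 2 x
  have hsub : Ioc D x ⊆ Ioc 0 x := Ioc_subset_Ioc_left (Nat.zero_le _)
  have b0 : κ * |F0| ≤ 4 * lo := by
    have h := totient_mul_abs_sum_lamMean_le hq hD hDx' (k := 0) (by norm_num) hL hs hlo hlo1
      (fun n hn => (lam_zero hn).ge)
    rw [sum_congr rfl (fun n _ => lamMean_zero_eq q D x n), sum_const, Nat.card_Ioc, nsmul_eq_mul,
      Nat.cast_sub hDx', abs_mul, abs_of_nonneg (by linarith : (0 : ℝ) ≤ x - D),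
      sum_eq_zero (fun n hn => lam_zero (by have := (mem_Ioc.1 hn).1; omega))] at h
    have := hcancel (κ * |F0|) (2 * lo) (by positivity) (by linarith)
    linarith
  have hS0 : ∀ j : ℕ, |∑ n ∈ Ioc D x, (Real.log n - Real.log x) ^ j| ≤ x * lo ^ j := by
    intro j
    calc _ ≤ ∑ n ∈ Ioc D x, lo ^ j := by
          refine abs_sum_le_sum_abs _ _ |>.trans (sum_le_sum fun n hn => ?_)
          rw [abs_pow]
          exact pow_le_pow_left₀ (abs_nonneg _) (hy n hn) j
      _ ≤ _ := by
          rw [sum_const, Nat.card_Ioc, nsmul_eq_mul, Nat.cast_sub hDx']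
          gcongr; linarith
  have b1 : κ * |F1| ≤ 24 * lo ^ 2 := by
    have h := totient_mul_abs_sum_lamMean_le hq hD hDx' (k := 1) (by norm_num) hL hs hlo hlo1
      (fun n _ => (lam_one n).symm ▸ ArithmeticFunction.vonMangoldt_nonneg)
    have hsum : ∑ n ∈ Ioc D x, lamMean q D 1 n = F1 * (x - D) +
        F0 * ∑ n ∈ Ioc D x, (Real.log n - Real.log x) ^ 1 := by
      rw [← hcard, mul_sum, mul_sum, ← sum_add_distrib]
      refine sum_congr rfl fun n hn => ?_
      have := (mem_Ioc.1 hn)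
      rw [lamMean_one_eq (by omega : 0 < x) (by omega)]; ring
    have hl : ∑ n ∈ Ioc D x, lam 1 n ≤ 6 * x := by
      simp only [lam_one]
      exact (sum_le_sum_of_subset_of_nonneg hsub fun _ _ _ =>
        ArithmeticFunction.vonMangoldt_nonneg).trans (sum_vonMangoldt_le x)
    have hF : |F1| * (x - D) ≤ |∑ n ∈ Ioc D x, lamMean q D 1 n| + |F0| * (x * lo) := by
      have e : F1 * (x - D) = ∑ n ∈ Ioc D x, lamMean q D 1 n -
        F0 * ∑ n ∈ Ioc D x, (Real.log n - Real.log x) ^ 1 := by rw [hsum]; ring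
      calc |F1| * (x - D) = |F1 * (x - D)| := by
            rw [abs_mul, abs_of_nonneg (by linarith : (0 : ℝ) ≤ x - D)]
        _ ≤ _ := by
            rw [e]
            refine (abs_sub _ _).trans ?_
            rw [abs_mul]
            have := hS0 1
            rw [pow_one] at this
            gcongr
    have h2 := mul_le_mul_of_nonneg_left hF hκ0
    have h3 : κ * |F0| * (x * lo) ≤ 4 * lo * (x * lo) := by gcongr
    have h4 : (x : ℝ) * 1 ≤ x * lo ^ 2 := by gcongr; exact one_le_pow₀ hlo1
    have := hcancel (κ * |F1|) (12 * lo ^ 2) (by positivity) (by nlinarith)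
    linarith
  refine ⟨b0, b1, ?_⟩
  have h := totient_mul_abs_sum_lamMean_le hq hD hDx' (k := 2) le_rfl hL hs hlo hlo1
    (fun n _ => lam_two_nonneg n)
  have hsum : ∑ n ∈ Ioc D x, lamMean q D 2 n = F2 * (x - D) +
      (2 * F1 * ∑ n ∈ Ioc D x, (Real.log n - Real.log x) ^ 1 +
      F0 * ∑ n ∈ Ioc D x, (Real.log n - Real.log x) ^ 2) := by
    rw [← hcard, mul_sum, mul_sum, mul_sum, ← sum_add_distrib, ← sum_add_distrib]
    refine sum_congr rfl fun n hn => ?_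
    have := (mem_Ioc.1 hn)
    rw [lamMean_two_eq (by omega : 0 < x) (by omega)]; ring
  have hl : ∑ n ∈ Ioc D x, lam 2 n ≤ 12 * (x * Real.log x) :=
    (sum_le_sum_of_subset_of_nonneg hsub fun _ _ _ => lam_two_nonneg _).trans (sum_lam_two_le x)
  have hF : |F2| * (x - D) ≤ |∑ n ∈ Ioc D x, lamMean q D 2 n| +
      (2 * |F1| * (x * lo) + |F0| * (x * lo ^ 2)) := by
    have e : F2 * (x - D) = ∑ n ∈ Ioc D x, lamMean q D 2 n -
      (2 * F1 * ∑ n ∈ Ioc D x, (Real.log n - Real.log x) ^ 1 +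
      F0 * ∑ n ∈ Ioc D x, (Real.log n - Real.log x) ^ 2) := by rw [hsum]; ring
    calc |F2| * (x - D) = |F2 * (x - D)| := by
          rw [abs_mul, abs_of_nonneg (by linarith : (0 : ℝ) ≤ x - D)]
      _ ≤ _ := by
          rw [e]
          refine (abs_sub _ _).trans (add_le_add le_rfl ((abs_add_le _ _).trans ?_))
          rw [abs_mul, abs_mul, abs_mul, abs_two]
          have := hS0 1
          rw [pow_one lo] at this
          have := hS0 2
          gcongr
  have h2 := mul_le_mul_of_nonneg_left hF hκ0
  have h3 : κ * |F0| * (x * lo ^ 2) ≤ 4 * lo * (x * lo ^ 2) := by gcongr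
  have h4 : κ * |F1| * (x * lo) ≤ 24 * lo ^ 2 * (x * lo) := by gcongr
  have := hcancel (κ * |F2|) (12 * Real.log x + 54 * lo ^ 3) (by positivity) (by nlinarith)
  linarith

/-- Exponential sums of the truncated average. -/
lemma norm_sum_lamMean_ex_le (hq : 0 < q) (hD : 1 ≤ D) (hx : 2 * D ≤ x)
    (hL : 1 ≤ Real.log x) (hs : (D : ℝ) * (12 * q * Real.log x ^ 2) ≤ x)
    (hlo : Real.log x - Real.log D = lo) (hlo1 : 1 ≤ lo) {β Y : ℝ}
    (hY : ∀ t ≤ x, ‖∑ n ∈ Ioc D t, ex (n * β)‖ ≤ Y) :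
    (q.totient / q : ℝ) * ‖∑ n ∈ Ioc D x, (lamMean q D 2 n : ℂ) * ex (n * β)‖ ≤
      Y * (72 * Real.log x + 480 * lo ^ 3) := by
  obtain ⟨b0, b1, b2⟩ := lamMean_bounds hq hD hx hL hs hlo hlo1
  have hD0 : (0 : ℝ) < D := by exact_mod_cast hD
  have hY0 : 0 ≤ Y := (norm_nonneg _).trans (hY 0 (Nat.zero_le _))
  have hlo0 : 0 ≤ lo := by linarith
  set κ := (q.totient / q : ℝ) with hκ
  have hκ0 : 0 ≤ κ := by positivity
  set F0 := lamMean q D 0 x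
  set F1 := lamMean q D 1 x
  set F2 := lamMean q D 2 x
  have hy : ∀ n ∈ Set.Ioc D x, Real.log n - Real.log x ≤ 0 ∧ -lo ≤ Real.log n - Real.log x := by
    intro n hn
    have hn0 : (0 : ℝ) < n := by exact_mod_cast (by have := hn.1; omega : 0 < n)
    refine ⟨sub_nonpos.2 (Real.log_le_log hn0 (by exact_mod_cast hn.2)), ?_⟩
    have := Real.log_le_log hD0 (by exact_mod_cast hn.1.le : (D : ℝ) ≤ n)
    linarith
  have hmono : MonotoneOn (fun n : ℕ => Real.log n - Real.log x) (Set.Ioc D x) := by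
    intro n hn m hm hnm
    have hn0 : (0 : ℝ) < n := by exact_mod_cast (by have := hn.1; omega : 0 < n)
    exact sub_le_sub_right (Real.log_le_log hn0 (by exact_mod_cast hnm)) _
  have s1 := norm_sum_mul_le_of_monotoneOn hY hmono (G := lo) hlo0
    (fun n hn => abs_le.2 ⟨(hy n hn).2, (hy n hn).1.trans hlo0⟩)
  have s2 := norm_sum_mul_le_of_antitoneOn hY
    (g := fun n : ℕ => (Real.log n - Real.log x) ^ 2) (G := lo ^ 2)
    (by
      intro n hn m hm hnm
      have h1 := hmono hn hm hnm
      have h2 := hy m hm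
      have h3 := hy n hn
      dsimp only at h1 ⊢
      nlinarith) (by positivity)
    (fun n hn => by
      have := hy n hn
      rw [abs_of_nonneg (by positivity)]
      nlinarith)
  have e : ∑ n ∈ Ioc D x, (lamMean q D 2 n : ℂ) * ex (n * β) =
      F2 * ∑ n ∈ Ioc D x, ex (n * β) +
      (2 * F1 * ∑ n ∈ Ioc D x, ex (n * β) * ((Real.log n - Real.log x : ℝ) : ℂ) +
      F0 * ∑ n ∈ Ioc D x, ex (n * β) * (((Real.log n - Real.log x) ^ 2 : ℝ) : ℂ)) := by
    rw [mul_sum, mul_sum, mul_sum, ← sum_add_distrib, ← sum_add_distrib]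
    refine sum_congr rfl fun n hn => ?_
    have := (mem_Ioc.1 hn)
    rw [lamMean_two_eq (by omega : 0 < x) (by omega : 0 < n)]; push_cast; ring
  have hb : ‖∑ n ∈ Ioc D x, (lamMean q D 2 n : ℂ) * ex (n * β)‖ ≤
      |F2| * Y + (2 * |F1| * (3 * Y * lo) + |F0| * (3 * Y * lo ^ 2)) := by
    rw [e]
    refine (norm_add_le _ _).trans (add_le_add ?_ ((norm_add_le _ _).trans (add_le_add ?_ ?_)))
    · rw [norm_mul, Complex.norm_real, Real.norm_eq_abs]
      gcongr; exact hY x le_rfl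
    · rw [norm_mul, norm_mul, Complex.norm_real, Real.norm_eq_abs, Complex.norm_ofNat]
      gcongr
    · rw [norm_mul, Complex.norm_real, Real.norm_eq_abs]
      gcongr
  have h1 := mul_le_mul_of_nonneg_left hb hκ0
  have t2 : κ * |F2| * Y ≤ (24 * Real.log x + 108 * lo ^ 3) * Y := by gcongr
  have t1 : κ * |F1| * (6 * Y * lo) ≤ 24 * lo ^ 2 * (6 * Y * lo) := by gcongr
  have t0 : κ * |F0| * (3 * Y * lo ^ 2) ≤ 4 * lo * (3 * Y * lo ^ 2) := by gcongr
  have p1 : 0 ≤ Y * lo ^ 3 := by positivity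
  have p2 : 0 ≤ Y * Real.log x := by positivity
  nlinarith
end
lemma norm_sum_ex_le {D t x : ℕ} (ht : t ≤ x) (hx : 0 < x) {β : ℝ} (hβ : |β| ≤ 1 / 2) :
    ‖∑ n ∈ Ioc D t, ex (n * β)‖ ≤ x / max 1 (|β| * x) := by
  have hx0 : (0 : ℝ) < x := by exact_mod_cast hx
  rcases le_total (|β| * x) 1 with h | h
  · rw [max_eq_left h, div_one]
    refine (norm_sum_Ioc_le_card _ _ _).trans ?_
    exact_mod_cast (Nat.sub_le t D).trans ht
  · rw [max_eq_right h]
    have hb : 0 < |β| := by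
      by_contra hb
      have : |β| = 0 := le_antisymm (not_lt.1 hb) (abs_nonneg _)
      rw [this, zero_mul] at h
      linarith
    have hnd : nd β = |β| := nd_eq_abs hβ
    refine (norm_geom_Ioc_le β D t (by rwa [hnd])).trans ?_
    rw [hnd, div_le_div_iff₀ (by positivity) (by positivity)]
    nlinarith [mul_pos hb hx0]

lemma sum_vonMangoldt_not_coprime_le {q : ℕ} (hq : 0 < q) (x : ℕ) :
    ∑ n ∈ Ioc 0 x with ¬ n.Coprime q, vonMangoldt n ≤
      (q + 1) * (2 * Real.log x + 1) * Real.log x := by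
  set T := (Ioc 0 x).filter (fun n => ¬ n.Coprime q ∧ IsPrimePow n) with hT
  have hcard : #T ≤ (q + 1) * (Nat.log 2 x + 1) := by
    have : T ⊆ ((range (q + 1)) ×ˢ (range (Nat.log 2 x + 1))).image (fun p => p.1 ^ p.2) := by
      intro n hn
      obtain ⟨hn1, hn2, hn3⟩ := mem_filter.1 hn
      rw [mem_Ioc] at hn1
      obtain ⟨p, k, hp, hk, rfl⟩ := (isPrimePow_nat_iff _).1 hn3
      refine mem_image.2 ⟨(p, k), mem_product.2 ⟨mem_range.2 ?_, mem_range.2 ?_⟩, rfl⟩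
      · have : ¬ p.Coprime q := fun h => hn2 (Nat.Coprime.pow_left k h)
        have hpq : p ∣ q := by
          by_contra h
          exact this ((Nat.Prime.coprime_iff_not_dvd hp).2 h)
        exact Nat.lt_succ_of_le (Nat.le_of_dvd hq hpq)
      · refine Nat.lt_succ_of_le (Nat.le_log_of_pow_le (by norm_num) ?_)
        exact (Nat.pow_le_pow_left hp.two_le k).trans hn1.2
    refine (card_le_card this).trans (card_image_le.trans ?_)
    simp
  rcases Nat.eq_zero_or_pos x with rfl | hx
  · simp
  have hlog : ((Nat.log 2 x : ℕ) : ℝ) ≤ 2 * Real.log x := by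
    have h1 : (2 : ℝ) ^ (Nat.log 2 x) ≤ x := by exact_mod_cast Nat.pow_log_le_self 2 hx.ne'
    have h2 := Real.log_le_log (by positivity) h1
    rw [Real.log_pow] at h2
    have := Real.log_two_gt_d9
    have h3 : (0 : ℝ) ≤ (Nat.log 2 x : ℕ) := Nat.cast_nonneg _
    nlinarith
  have hL := Real.log_natCast_nonneg x
  calc _ = ∑ n ∈ T, vonMangoldt n := by
        rw [hT, ← filter_filter]
        refine (sum_filter_of_ne fun n _ h => ?_).symm
        rwa [ArithmeticFunction.vonMangoldt_ne_zero_iff] at h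
    _ ≤ ∑ n ∈ T, Real.log x := by
        refine sum_le_sum fun n hn => ArithmeticFunction.vonMangoldt_le_log.trans ?_
        have := mem_Ioc.1 (mem_filter.1 hn).1
        exact Real.log_le_log (by exact_mod_cast this.1) (by exact_mod_cast this.2)
    _ = #T * Real.log x := by simp
    _ ≤ _ := by
        gcongr
        calc (#T : ℝ) ≤ (q + 1) * ((Nat.log 2 x : ℕ) + 1) := by exact_mod_cast hcard
          _ ≤ _ := by gcongr

lemma poly_bound_one {P : ℝ} (hP : 1000 ≤ P) : 12 * P * (1 + 7 * P) * P ^ 2 ≤ P ^ 5 := by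
  have h : 12 * (1 + 7 * P) ≤ P ^ 2 := by nlinarith
  calc 12 * P * (1 + 7 * P) * P ^ 2 = 12 * (1 + 7 * P) * P ^ 3 := by ring
    _ ≤ P ^ 2 * P ^ 3 := by gcongr
    _ = P ^ 5 := by ring

lemma poly_bound_two {P : ℝ} (hP : 1000 ≤ P) : (P + 1) * (2 * P + 1) * P * P ≤ P ^ 5 := by
  have h : (P + 1) * (2 * P + 1) ≤ P ^ 3 := by
    calc (P + 1) * (2 * P + 1) ≤ (2 * P) * (3 * P) := by gcongr <;> linarith
      _ = 6 * P ^ 2 := by ring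
      _ ≤ P * P ^ 2 := by gcongr; linarith
      _ = P ^ 3 := by ring
  calc (P + 1) * (2 * P + 1) * P * P = (P + 1) * (2 * P + 1) * P ^ 2 := by ring
    _ ≤ P ^ 3 * P ^ 2 := by gcongr
    _ = P ^ 5 := by ring

set_option maxHeartbeats 1000000 in
/-- Exponential sums over primes near a rational with small denominator. -/
theorem major_sum_le {q : ℕ} (hq : 0 < q) {a : ℤ} (ha : IsCoprime a (q : ℤ)) {β P : ℝ} {x : ℕ}
    (hP : 1000 ≤ P) (hL : Real.log x ≤ P) (hqP : q ≤ P) (hβ : |β| * x ≤ P) (hx : P ^ 40 ≤ x) :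
    ‖∑ n ∈ Ioc 0 x, (vonMangoldt n : ℂ) * ex (n * (a / q + β))‖ * Real.log x ≤
      270000 * (x * Real.log x * (√q / q.totient / √(max 1 √(|β| * x)))) +
        170000 * (x * Real.log P ^ 3) := by
  have hP0 : 0 < P := by linarith
  have hP1 : 1 ≤ P := by linarith
  have hPx : P ≤ x := (le_self_pow₀ hP1 (by norm_num)).trans hx
  have hx0 : (0 : ℝ) < x := by linarith
  have hxn : 0 < x := by exact_mod_cast hx0
  have hq1 : (1 : ℝ) ≤ q := by exact_mod_cast hq
  have hlogP : 6 ≤ Real.log P := by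
    have h1 : Real.log 512 ≤ Real.log P := Real.log_le_log (by norm_num) (by linarith)
    have h2 : Real.log 512 = 9 * Real.log 2 := by
      rw [show (512 : ℝ) = 2 ^ 9 by norm_num, Real.log_pow]; norm_num
    have := Real.log_two_gt_d9
    linarith
  have hlogx : 40 * Real.log P ≤ Real.log x := by
    have := Real.log_le_log (by positivity) hx
    rwa [Real.log_pow] at this
  have hL1 : 1 ≤ Real.log x := by linarith
  set L := Real.log x with hLdef
  set α := (a / q + β : ℝ) with hα
  set gam : ℝ := √q / q.totient / √(max 1 √(|β| * x)) with hgam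
  set w : ℕ → ℝ := fun n => if n.Coprime q then vonMangoldt n else 0 with hw
  set D := ⌊(x : ℝ) / P ^ 5⌋₊ with hD
  have hxP : P ^ 35 ≤ x / P ^ 5 := by
    rw [le_div_iff₀ (by positivity), ← pow_add]; exact hx
  have hbig : (1 : ℝ) ≤ x / P ^ 5 := (one_le_pow₀ hP1).trans hxP
  have hD1 : 1 ≤ D := Nat.one_le_floor_iff _ |>.2 hbig
  have hDr : (1 : ℝ) ≤ D := by exact_mod_cast hD1
  have hDle : (D : ℝ) ≤ x / P ^ 5 := Nat.floor_le (by positivity)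
  have hDge : x / P ^ 5 ≤ 2 * D := by
    have := Nat.lt_floor_add_one ((x : ℝ) / P ^ 5)
    linarith
  have hD5 : D * P ^ 5 ≤ x := (le_div_iff₀ (by positivity)).1 hDle
  have h2D : 2 * D ≤ x := by
    have h2 : (2 : ℝ) ≤ P ^ 5 := (by linarith : (2 : ℝ) ≤ P).trans (le_self_pow₀ hP1 (by norm_num))
    have : (2 : ℝ) * D ≤ x := by
      refine le_trans ?_ hD5
      rw [mul_comm]
      gcongr
    exact_mod_cast this
  have hDx : D ≤ x := by omega
  set lo := L - Real.log D with hlo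
  have hlo1 : 1 ≤ lo := by
    have := Real.log_le_log (by positivity) hD5
    rw [Real.log_mul (by positivity) (by positivity), Real.log_pow] at this
    push_cast at this
    linarith
  have hlo2 : lo ≤ 6 * Real.log P := by
    have h1 : (x : ℝ) ≤ 2 * D * P ^ 5 := (div_le_iff₀ (by positivity)).1 hDge
    have := Real.log_le_log (by positivity) h1
    rw [Real.log_mul (by positivity) (by positivity), Real.log_pow,
      Real.log_mul (by positivity) (by positivity)] at this
    push_cast at this
    have := Real.log_two_lt_d9
    linarith
  have hLP : L ≤ P := hL
  have hL0 : 0 ≤ L := by linarith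
  have hs2 : (D : ℝ) * (12 * q * (1 + 7 * (x * |β|)) * L ^ 2) ≤ x := by
    have : x * |β| ≤ P := by linarith [mul_comm (x : ℝ) |β|]
    calc (D : ℝ) * (12 * q * (1 + 7 * (x * |β|)) * L ^ 2)
        ≤ D * (12 * P * (1 + 7 * P) * P ^ 2) := by gcongr
      _ ≤ D * P ^ 5 := by
        gcongr
        exact poly_bound_one hP
      _ ≤ x := hD5
  have hs : (D : ℝ) * (12 * q * L ^ 2) ≤ x := by
    refine le_trans ?_ hs2
    have : 12 * (q : ℝ) ≤ 12 * q * (1 + 7 * (x * |β|)) := by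
      refine le_mul_of_one_le_right (by positivity) ?_
      linarith [show 0 ≤ 7 * (x * |β|) by positivity]
    gcongr
  -- The twisted Selberg sum over integers prime to `q`.
  have hβ2 : |β| ≤ 1 / 2 := by
    have : |β| * P ^ 40 ≤ P := le_trans (by gcongr) hβ
    have h1 : 1000 * P ≤ P ^ 40 := by
      calc 1000 * P ≤ P * P := by gcongr
        _ = P ^ 2 := by ring
        _ ≤ P ^ 40 := pow_le_pow_right₀ hP1 (by norm_num)
    have h2 : |β| * (1000 * P) ≤ 1 / 2 * (1000 * P) :=
      (le_trans (by gcongr) this).trans (by linarith)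
    exact le_of_mul_le_mul_right h2 (by positivity)
  set Y := (x : ℝ) / max 1 (|β| * x) with hYdef
  have hYx : Y ≤ x := div_le_self hx0.le (le_max_left _ _)
  have hY0 : 0 ≤ Y := by positivity
  have hphi : (1 : ℝ) ≤ q.totient := by exact_mod_cast Nat.totient_pos.2 hq
  have hYg : Y / q.totient ≤ x * gam := by
    rw [hYdef, hgam, div_div, div_div, mul_div_assoc', mul_comm (max 1 (|β| * x))]
    have hsq : 1 ≤ √(q : ℝ) := Real.one_le_sqrt.2 hq1
    have hm1 : (1 : ℝ) ≤ max 1 (|β| * x) := le_max_left _ _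
    have hmm : √(max 1 √(|β| * x)) ≤ max 1 (|β| * x) := by
      have h1 : √(|β| * x) ≤ max 1 (|β| * x) := by
        rw [Real.sqrt_le_left (by positivity)]
        exact (le_max_right 1 _).trans (le_self_pow₀ hm1 two_ne_zero)
      rw [Real.sqrt_le_left (by positivity)]
      exact max_le (one_le_pow₀ hm1) (h1.trans (le_self_pow₀ hm1 two_ne_zero))
    gcongr
    · exact le_mul_of_one_le_right hx0.le hsq
  have hsel : ‖∑ n ∈ Ioc D x, (if n.Coprime q then ex (n * (a / q)) else 0) * lam 2 n *
      ex (n * β)‖ ≤ 72 * (x * L * gam) + 482 * (x * lo ^ 3) := by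
    have h1 := (unitPeriodic_ex hq ha).norm_sum_lam_sub_le hq hD1 hDx 2 β
    have h2 := norm_sum_lamMean_ex_le hq hD1 h2D hL1 hs rfl hlo1
      (fun t ht => norm_sum_ex_le (D := D) ht hxn hβ2)
    set B := ∑ n ∈ Ioc D x, (lamMean q D 2 n : ℂ) * ex (n * β)
    have h3 : ‖(((ArithmeticFunction.moebius q : ℝ) / q : ℝ) : ℂ) * B‖ ≤
        1 / q.totient * (q.totient / q * ‖B‖) := by
      rw [norm_mul, Complex.norm_real, Real.norm_eq_abs, abs_div, Nat.abs_cast]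
      have : 1 / (q.totient : ℝ) * (q.totient / q * ‖B‖) = 1 / q * ‖B‖ := by
        field_simp
      rw [this]
      gcongr
      exact abs_moebius_le_one q
    have h4 : 1 / (q.totient : ℝ) * (q.totient / q * ‖B‖) ≤
        1 / q.totient * (Y * (72 * L + 480 * lo ^ 3)) := by gcongr
    have h5 : 1 / (q.totient : ℝ) * (Y * (72 * L + 480 * lo ^ 3)) =
      72 * L * (Y / q.totient) + 480 * lo ^ 3 * (Y / q.totient) := by ring
    have h6 : 72 * L * (Y / q.totient) ≤ 72 * L * (x * gam) := by gcongr
    have h7 : 480 * lo ^ 3 * (Y / q.totient) ≤ 480 * lo ^ 3 * x := by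
      have : Y / q.totient ≤ x := (div_le_self hY0 hphi).trans hYx
      gcongr
    have h8 : (x : ℝ) * 1 ≤ x * lo ^ 3 := by gcongr; exact one_le_pow₀ hlo1
    have h9 := norm_le_norm_add_norm_sub' (∑ n ∈ Ioc D x,
      (if n.Coprime q then ex (n * (a / q)) else 0) * lam 2 n * ex (n * β))
      ((((ArithmeticFunction.moebius q : ℝ) / q : ℝ) : ℂ) * B)
    linarith
  have hselD : ‖∑ n ∈ Ioc 0 D, (if n.Coprime q then ex (n * (a / q)) else 0) * lam 2 n *
      ex (n * β)‖ ≤ x := by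
    calc _ ≤ ∑ n ∈ Ioc 0 D, lam 2 n := by
          refine norm_sum_le_of_le _ fun n _ => ?_
          rw [norm_mul, norm_mul, norm_ex, mul_one, Complex.norm_real, Real.norm_eq_abs,
            abs_of_nonneg (lam_two_nonneg n)]
          refine mul_le_of_le_one_left (lam_two_nonneg n) ?_
          split_ifs <;> simp [norm_ex]
      _ ≤ 12 * (D * Real.log D) := sum_lam_two_le D
      _ ≤ D * (12 * 1 * L ^ 2) := by
          have : Real.log D ≤ L := by linarith
          have h2 : L ≤ L ^ 2 := by nlinarith
          have h3 : (D : ℝ) * Real.log D ≤ D * L ^ 2 := by gcongr; linarith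
          linarith
      _ ≤ D * (12 * q * L ^ 2) := by gcongr
      _ ≤ x := hs
  have hbil : ‖∑ m ∈ Ioc 0 x, ∑ n ∈ Ioc 0 (x / m), (w m : ℂ) * w n * ex ((m * n : ℕ) * α)‖ ≤
      260000 * x * L * gam + 50000 * x * Real.log P := bilinear_sum_le (w := w)
    (fun n => by rw [hw]; dsimp only; split_ifs <;> simp [ArithmeticFunction.vonMangoldt_nonneg])
    (fun n => by rw [hw]; dsimp only; split_ifs <;> simp [ArithmeticFunction.vonMangoldt_nonneg])
    hq ha hP hL hqP hβ hx
  have hid : ∑ n ∈ Ioc 0 x, ((w n * Real.log n : ℝ) : ℂ) * ex (n * α) =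
      ∑ n ∈ Ioc 0 D, (if n.Coprime q then ex (n * (a / q)) else 0) * lam 2 n * ex (n * β) +
      ∑ n ∈ Ioc D x, (if n.Coprime q then ex (n * (a / q)) else 0) * lam 2 n * ex (n * β) -
      ∑ m ∈ Ioc 0 x, ∑ n ∈ Ioc 0 (x / m), (w m : ℂ) * w n * ex ((m * n : ℕ) * α) := by
    rw [← sum_union (Ioc_disjoint_Ioc_of_le le_rfl), Ioc_union_Ioc_eq_Ioc (Nat.zero_le D) hDx,
      ← sum_divisorsAntidiagonal_eq (fun m n => (w m : ℂ) * w n * ex ((m * n : ℕ) * α)),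
      ← sum_sub_distrib]
    refine sum_congr rfl fun n _ => ?_
    have h1 : ∑ p ∈ n.divisorsAntidiagonal, (w p.1 : ℂ) * w p.2 * ex ((p.1 * p.2 : ℕ) * α) =
        (if n.Coprime q then ((∑ p ∈ n.divisorsAntidiagonal,
          vonMangoldt p.1 * vonMangoldt p.2 : ℝ) : ℂ) else 0) * ex (n * α) := by
      split_ifs with hc
      · rw [Complex.ofReal_sum, sum_mul]
        refine sum_congr rfl fun p hp => ?_
        obtain ⟨h1, -⟩ := Nat.mem_divisorsAntidiagonal.1 hp
        rw [← h1, Nat.coprime_mul_iff_left] at hc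
        simp only [hw, if_pos hc.1, if_pos hc.2, h1]
        push_cast; ring
      · rw [zero_mul]
        refine sum_eq_zero fun p hp => ?_
        obtain ⟨h1, -⟩ := Nat.mem_divisorsAntidiagonal.1 hp
        rw [← h1, Nat.coprime_mul_iff_left, not_and_or] at hc
        rcases hc with hc | hc <;> simp [hw, if_neg hc]
    have h2 : ex (n * α) = ex (n * (a / q)) * ex (n * β) := by
      rw [hα, mul_add, ex_add]
    rw [h1, lam_two, h2, hw]
    dsimp only
    split_ifs
    · push_cast; ring
    · push_cast; ring
  have hlogsum : ‖∑ n ∈ Ioc 0 x, ((w n * (L - Real.log n) : ℝ) : ℂ) * ex (n * α)‖ ≤ 6 * x := by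
    refine (norm_sum_le_of_le _ fun n hn => ?_).trans (sum_vonMangoldt_mul_log_div_le x)
    rw [mem_Ioc] at hn
    have : Real.log n ≤ L :=
      Real.log_le_log (by exact_mod_cast hn.1) (by exact_mod_cast hn.2)
    have h0 := ArithmeticFunction.vonMangoldt_nonneg (n := n)
    rw [norm_mul, norm_ex, mul_one, Complex.norm_real, Real.norm_eq_abs, abs_mul,
      abs_of_nonneg (sub_nonneg.2 this)]
    refine mul_le_mul_of_nonneg_right ?_ (sub_nonneg.2 this)
    rw [hw]
    dsimp only
    split_ifs
    · rw [abs_of_nonneg h0]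
    · simp [h0]
  have hnc : ‖∑ n ∈ Ioc 0 x, ((vonMangoldt n - w n : ℝ) : ℂ) * ex (n * α)‖ ≤
      (q + 1) * (2 * L + 1) * L := by
    refine le_trans ?_ (sum_vonMangoldt_not_coprime_le hq x)
    rw [sum_filter]
    refine norm_sum_le_of_le _ fun n hn => ?_
    rw [norm_mul, norm_ex, mul_one, Complex.norm_real, Real.norm_eq_abs, hw]
    dsimp only
    split_ifs
    · simp
    · rw [sub_zero, abs_of_nonneg ArithmeticFunction.vonMangoldt_nonneg]
  have hnc2 : (q + 1) * (2 * L + 1) * L * L ≤ x := by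
    calc (q + 1) * (2 * L + 1) * L * L ≤ (P + 1) * (2 * P + 1) * P * P := by gcongr
      _ ≤ P ^ 5 := poly_bound_two hP
      _ ≤ P ^ 40 := pow_le_pow_right₀ hP1 (by norm_num)
      _ ≤ x := hx
  have hfin : (∑ n ∈ Ioc 0 x, (vonMangoldt n : ℂ) * ex (n * α)) * (L : ℂ) =
      ∑ n ∈ Ioc 0 x, ((w n * Real.log n : ℝ) : ℂ) * ex (n * α) +
      ∑ n ∈ Ioc 0 x, ((w n * (L - Real.log n) : ℝ) : ℂ) * ex (n * α) +
      (∑ n ∈ Ioc 0 x, ((vonMangoldt n - w n : ℝ) : ℂ) * ex (n * α)) * (L : ℂ) := by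
    rw [sum_mul, sum_mul, ← sum_add_distrib, ← sum_add_distrib]
    refine sum_congr rfl fun n _ => ?_
    push_cast; ring
  have e1 : ‖∑ n ∈ Ioc 0 x, (vonMangoldt n : ℂ) * ex (n * α)‖ * L =
      ‖(∑ n ∈ Ioc 0 x, (vonMangoldt n : ℂ) * ex (n * α)) * (L : ℂ)‖ := by
    rw [norm_mul, Complex.norm_real, Real.norm_eq_abs, abs_of_nonneg hL0]
  have e2 : ‖(∑ n ∈ Ioc 0 x, ((vonMangoldt n - w n : ℝ) : ℂ) * ex (n * α)) * (L : ℂ)‖ ≤ x := by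
    rw [norm_mul, Complex.norm_real, Real.norm_eq_abs, abs_of_nonneg hL0]
    exact (mul_le_mul_of_nonneg_right hnc hL0).trans hnc2
  have e3 : (x : ℝ) * lo ^ 3 ≤ x * (6 * Real.log P) ^ 3 := by gcongr
  have e4 : (x : ℝ) * Real.log P ≤ x * Real.log P ^ 3 := by
    gcongr
    exact le_self_pow₀ (by linarith) (by norm_num)
  have e5 : (x : ℝ) * 1 ≤ x * Real.log P ^ 3 := by
    gcongr
    exact one_le_pow₀ (by linarith)
  have e6 : x * (6 * Real.log P) ^ 3 = 216 * (x * Real.log P ^ 3) := by ring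
  rw [e1, hfin]
  refine (norm_add₃_le).trans ?_
  rw [hid]
  have e7 := norm_sub_le (∑ n ∈ Ioc 0 D, (if n.Coprime q then ex (n * (a / q)) else 0) *
      lam 2 n * ex (n * β) +
      ∑ n ∈ Ioc D x, (if n.Coprime q then ex (n * (a / q)) else 0) * lam 2 n * ex (n * β))
      (∑ m ∈ Ioc 0 x, ∑ n ∈ Ioc 0 (x / m), (w m : ℂ) * w n * ex ((m * n : ℕ) * α))
  have e8 := norm_add_le (∑ n ∈ Ioc 0 D, (if n.Coprime q then ex (n * (a / q)) else 0) *
      lam 2 n * ex (n * β))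
      (∑ n ∈ Ioc D x, (if n.Coprime q then ex (n * (a / q)) else 0) * lam 2 n * ex (n * β))
  have e9 : 0 ≤ x * L * gam := by positivity
  linarith
lemma sum_one_div_le (y : ℕ) : ∑ n ∈ Ioc 0 y, 1 / (n : ℝ) ≤ 1 + Real.log y := by
  have h := harmonic_le_one_add_log y
  rw [harmonic_eq_sum_Icc] at h
  push_cast at h
  simpa [one_div, ← Finset.Icc_add_one_left_eq_Ioc] using h

lemma card_divisors_mul_le (m n : ℕ) :
    (m * n).divisors.card ≤ m.divisors.card * n.divisors.card := by
  rw [Nat.divisors_mul]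
  exact Finset.card_mul_le

lemma sum_card_divisors_le (y : ℕ) :
    ∑ n ∈ Ioc 0 y, (n.divisors.card : ℝ) ≤ y * (1 + Real.log y) := by
  have h := sum_divisorsAntidiagonal_eq (fun _ _ => (1 : ℝ)) y
  simp only [sum_const, nsmul_eq_mul, mul_one, Nat.card_Ioc, Nat.sub_zero,
    ← Nat.map_div_right_divisors, card_map] at h
  rw [h]
  calc _ ≤ ∑ d ∈ Ioc 0 y, (y : ℝ) * (1 / d) := by
        refine sum_le_sum fun d _ => ?_
        rw [mul_one_div]; exact Nat.cast_div_le
    _ ≤ _ := by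
        rw [← mul_sum]
        exact mul_le_mul_of_nonneg_left (sum_one_div_le y) (Nat.cast_nonneg _)

lemma sum_card_divisors_div_le (y : ℕ) :
    ∑ n ∈ Ioc 0 y, (n.divisors.card : ℝ) / n ≤ (1 + Real.log y) ^ 2 := by
  have h := sum_divisorsAntidiagonal_eq (fun a b => (1 : ℝ) / (a * b)) y
  have h1 : ∀ n ∈ Ioc 0 y, ∑ p ∈ n.divisorsAntidiagonal, (1 : ℝ) / (p.1 * p.2) =
      (n.divisors.card : ℝ) / n := by
    intro n _
    rw [sum_congr rfl (g := fun _ => 1 / (n : ℝ))]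
    · rw [sum_const, ← Nat.map_div_right_divisors, card_map, nsmul_eq_mul, mul_one_div]
    · intro p hp
      rw [Nat.mem_divisorsAntidiagonal] at hp
      rw [← hp.1]; push_cast; rfl
  rw [← sum_congr rfl h1, h, sq]
  calc _ ≤ ∑ d ∈ Ioc 0 y, ∑ e ∈ Ioc 0 y, (1 / (d : ℝ)) * (1 / e) := by
        refine sum_le_sum fun d _ => ?_
        calc _ ≤ ∑ e ∈ Ioc 0 y, 1 / ((d : ℝ) * e) :=
              sum_le_sum_of_subset_of_nonneg (Ioc_subset_Ioc_right (Nat.div_le_self _ _))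
                fun _ _ _ => by positivity
          _ = _ := sum_congr rfl fun e _ => by rw [one_div_mul_one_div]
    _ = (∑ d ∈ Ioc 0 y, 1 / (d : ℝ)) * ∑ d ∈ Ioc 0 y, 1 / (d : ℝ) := by rw [sum_mul_sum]
    _ ≤ _ := by
        have h2 := sum_one_div_le y
        have h3 : 0 ≤ ∑ d ∈ Ioc 0 y, 1 / (d : ℝ) := sum_nonneg fun _ _ => by positivity
        exact mul_le_mul h2 h2 h3 (h3.trans h2)

lemma sum_card_divisors_sq_le (y : ℕ) :
    ∑ n ∈ Ioc 0 y, (n.divisors.card : ℝ) ^ 2 ≤ y * (1 + Real.log y) ^ 3 := by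
  have h := sum_divisorsAntidiagonal_eq (fun a b => ((a * b).divisors.card : ℝ)) y
  have h1 : ∀ n ∈ Ioc 0 y, ∑ p ∈ n.divisorsAntidiagonal, ((p.1 * p.2).divisors.card : ℝ) =
      (n.divisors.card : ℝ) ^ 2 := by
    intro n _
    rw [sum_congr rfl (g := fun _ => (n.divisors.card : ℝ))]
    · rw [sum_const, ← Nat.map_div_right_divisors, card_map, nsmul_eq_mul, sq]
    · intro p hp
      rw [Nat.mem_divisorsAntidiagonal] at hp
      rw [hp.1]
  have hlog : 0 ≤ 1 + Real.log y := by
    have := Real.log_natCast_nonneg y; linarith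
  rw [← sum_congr rfl h1, h]
  calc _ ≤ ∑ d ∈ Ioc 0 y, (d.divisors.card : ℝ) * ((y / d : ℝ) * (1 + Real.log y)) := by
        refine sum_le_sum fun d hd => ?_
        calc _ ≤ ∑ e ∈ Ioc 0 (y / d), (d.divisors.card : ℝ) * e.divisors.card :=
              sum_le_sum fun e _ => by exact_mod_cast card_divisors_mul_le d e
          _ ≤ _ := by
              rw [← mul_sum]
              refine mul_le_mul_of_nonneg_left ?_ (Nat.cast_nonneg _)
              refine (sum_card_divisors_le _).trans ?_
              rcases Nat.eq_zero_or_pos (y / d) with h0 | h0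
              · rw [h0]; simp; positivity
              · have hl : Real.log (y / d : ℕ) ≤ Real.log y :=
                  Real.log_le_log (by exact_mod_cast h0) (by exact_mod_cast Nat.div_le_self _ _)
                have := Real.log_natCast_nonneg (y / d)
                exact mul_le_mul Nat.cast_div_le (by linarith) (by linarith) (by positivity)
    _ = (∑ d ∈ Ioc 0 y, (d.divisors.card : ℝ) / d) * (y * (1 + Real.log y)) := by
        rw [sum_mul]; exact sum_congr rfl fun d _ => by ring
    _ ≤ (1 + Real.log y) ^ 2 * (y * (1 + Real.log y)) :=
        mul_le_mul_of_nonneg_right (sum_card_divisors_div_le y) (by positivity)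
    _ = _ := by ring

/-- A geometric sum of length `M` has size about `M / max 1 (2 * M * nd y)`. -/
lemma norm_geom_le_div_max (y : ℝ) {A B M : ℕ} (hM : B - A ≤ M) :
    ‖∑ m ∈ Ioc A B, ex (m * y)‖ ≤ M / max 1 (2 * M * nd y) := by
  have hc : ‖∑ m ∈ Ioc A B, ex (m * y)‖ ≤ M :=
    (norm_sum_Ioc_le_card _ _ _).trans (by exact_mod_cast hM)
  rcases le_total (2 * M * nd y) 1 with h | h
  · rw [max_eq_left h, div_one]; exact hc
  · rw [max_eq_right h]
    have hpos : 0 < 2 * M * nd y := by linarith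
    have hM0 : (0:ℝ) < M := by
      rcases (Nat.cast_nonneg (α := ℝ) M).eq_or_lt with h0 | h0
      · rw [← h0] at hpos; simp at hpos
      · exact h0
    have hnd : 0 < nd y := by
      by_contra hneg
      have : nd y = 0 := le_antisymm (not_lt.1 hneg) (nd_nonneg y)
      rw [this] at hpos; simp at hpos
    refine (norm_geom_Ioc_le y A B hnd).trans (le_of_eq ?_)
    field_simp

/-- Well-spaced points: the sum of `M / max 1 (2 * M * nd (h * α + γ))` over a short block. -/
lemma sum_div_max_nd_block_le {α : ℝ} {q T M : ℕ} (hq : 0 < q)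
    (hsp : ∀ k : ℤ, k ≠ 0 → |k| ≤ T → 1 / (2 * (q : ℝ)) ≤ nd (k * α)) (f : ℕ → ℤ) (A : ℕ)
    (hf : ∀ h h', f h - f h' = (h' : ℤ) - h) :
    ∑ h ∈ Ioc A (A + T), (M : ℝ) / max 1 (2 * M * nd (f h * α)) ≤
      2 * (M + q * (1 + Real.log q)) := by
  classical
  have hq' : (0:ℝ) < q := by exact_mod_cast hq
  set y : ℕ → ℝ := fun h => f h * α - round (f h * α) with hy
  have hynd : ∀ h, |y h| = nd (f h * α) := fun h => rfl
  set G : ℕ → ℝ := fun i => (M : ℝ) / max 1 (M * (i : ℝ) / q) with hG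
  have hGs : ∑ i ∈ range (q + 1), G i ≤ M + q * (1 + Real.log q) := by
    rw [sum_range_succ', add_comm]
    refine add_le_add (by simp [hG]) ?_
    calc ∑ k ∈ range q, G (k + 1) ≤ ∑ k ∈ range q, (q : ℝ) * (1 / (k + 1 : ℕ)) := by
          refine sum_le_sum fun k _ => ?_
          simp only [hG]
          rw [div_le_iff₀ (by positivity)]
          calc (M : ℝ) = q * (1 / (k + 1 : ℕ)) * (M * (k + 1 : ℕ) / q) := by
                have : ((k + 1 : ℕ) : ℝ) ≠ 0 := by positivity
                field_simp
            _ ≤ _ := mul_le_mul_of_nonneg_left (le_max_right 1 _) (by positivity)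
      _ = q * ∑ k ∈ Ioc 0 q, 1 / (k : ℝ) := by
          have := sum_Ioc_eq_sum_range (fun k : ℕ => 1 / (k : ℝ)) 0 q
          simp only [zero_add] at this
          rw [← mul_sum, this]
          exact congrArg _ (sum_congr rfl fun k _ => by rw [add_comm])
      _ ≤ _ := mul_le_mul_of_nonneg_left (sum_one_div_le q) hq'.le
  have key : ∀ s : Finset ℕ, s ⊆ Ioc A (A + T) → (∀ h ∈ s, ∀ h' ∈ s, |y h - y h'| = abs (|y h| - |y h'|)) →
      ∑ h ∈ s, (M : ℝ) / max 1 (2 * M * nd (f h * α)) ≤ M + q * (1 + Real.log q) := by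
    intro s hs hsgn
    refine le_trans (sum_le_sum_of_inj (t := range (q + 1)) (g := G)
      (fun h => ⌊|y h| * (2 * q)⌋₊) ?_ ?_ ?_ ?_) hGs
    · intro h _
      rw [mem_range, Nat.lt_succ_iff]
      apply Nat.floor_le_of_le
      have := nd_le_half (f h * α)
      rw [hynd]; nlinarith
    · intro h hh h' hh' heq
      by_contra hne
      have h1 := mem_Ioc.1 (hs hh)
      have h2 := mem_Ioc.1 (hs hh')
      have h3 := hsp (f h - f h') (by rw [hf]; omega) (by rw [hf, abs_le]; omega)
      have h4 : nd (((f h - f h' : ℤ) : ℝ) * α) ≤ |y h - y h'| := by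
        refine (nd_le_abs_sub_int _ (round (f h * α) - round (f h' * α))).trans (le_of_eq ?_)
        simp only [hy]; push_cast; congr 1; ring
      rw [hsgn h hh h' hh'] at h4
      have h5 : |(|y h| * (2 * q)) - (|y h'| * (2 * q))| < 1 := by
        have heq' : ⌊|y h| * (2 * q)⌋₊ = ⌊|y h'| * (2 * q)⌋₊ := heq
        have a1 := Nat.floor_le (a := |y h| * (2 * q)) (by positivity)
        have a2 := Nat.lt_floor_add_one (|y h| * (2 * q))
        have a3 := Nat.floor_le (a := |y h'| * (2 * q)) (by positivity)
        have a4 := Nat.lt_floor_add_one (|y h'| * (2 * q))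
        rw [heq'] at a1 a2
        rw [abs_lt]; constructor <;> linarith
      rw [← sub_mul, abs_mul, abs_of_pos (by positivity : (0:ℝ) < 2 * q)] at h5
      have h6 := h3.trans h4
      rw [div_le_iff₀ (by positivity)] at h6
      linarith
    · intro h _
      simp only [hG]
      refine div_le_div_of_nonneg_left (Nat.cast_nonneg _) (by positivity)
        (max_le_max le_rfl ?_)
      have := Nat.floor_le (a := |y h| * (2 * q)) (by positivity)
      rw [hynd] at this
      rw [div_le_iff₀ hq', hynd]
      have hM : (0:ℝ) ≤ M := Nat.cast_nonneg _
      nlinarith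
    · intro i _; positivity
  rw [← sum_filter_add_sum_filter_not (Ioc A (A + T)) (fun h => 0 ≤ y h),
    two_mul ((M : ℝ) + _)]
  apply add_le_add <;> refine key _ (filter_subset _ _) ?_
  · intro h hh h' hh'
    rw [abs_of_nonneg (mem_filter.1 hh).2, abs_of_nonneg (mem_filter.1 hh').2]
  · intro h hh h' hh'
    rw [abs_of_neg (not_le.1 (mem_filter.1 hh).2), abs_of_neg (not_le.1 (mem_filter.1 hh').2),
      abs_sub_comm]
    congr 1; ring

lemma sum_Ioc_mul_eq_sum_blocks (g : ℕ → ℝ) (T k : ℕ) :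
    ∑ n ∈ Ioc 0 (k * T), g n = ∑ b ∈ range k, ∑ n ∈ Ioc (b * T) (b * T + T), g n := by
  induction k with
  | zero => simp
  | succ k ih =>
    rw [sum_range_succ, ← ih, Nat.succ_mul,
      ← Finset.sum_Ioc_consecutive g (Nat.zero_le (k * T)) (Nat.le_add_right _ _)]

lemma sum_div_max_nd_le {α : ℝ} {q T M : ℕ} (hq : 0 < q) (hT : 0 < T)
    (hsp : ∀ k : ℤ, k ≠ 0 → |k| ≤ T → 1 / (2 * (q : ℝ)) ≤ nd (k * α)) (n Y : ℕ) :
    ∑ n' ∈ Ioc 0 Y, (M : ℝ) / max 1 (2 * M * nd (((n : ℤ) - n' : ℤ) * α)) ≤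
      (Y / T + 1) * (2 * (M + q * (1 + Real.log q))) := by
  calc _ ≤ ∑ n' ∈ Ioc 0 ((Y / T + 1) * T), (M : ℝ) / max 1 (2 * M * nd (((n : ℤ) - n' : ℤ) * α)) := by
        refine sum_le_sum_of_subset_of_nonneg (Ioc_subset_Ioc_right ?_) fun _ _ _ => by positivity
        have := Nat.lt_mul_div_succ Y hT
        rw [mul_comm]; exact this.le
    _ = ∑ b ∈ range (Y / T + 1), ∑ n' ∈ Ioc (b * T) (b * T + T),
          (M : ℝ) / max 1 (2 * M * nd (((n : ℤ) - n' : ℤ) * α)) := sum_Ioc_mul_eq_sum_blocks _ _ _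
    _ ≤ ∑ b ∈ range (Y / T + 1), 2 * (M + q * (1 + Real.log q)) :=
        sum_le_sum fun b _ => sum_div_max_nd_block_le hq hsp (fun n' => (n : ℤ) - n') _
          fun h h' => by ring
    _ = ((Y / T : ℕ) + 1) * (2 * (M + q * (1 + Real.log q))) := by
        rw [sum_const, card_range, nsmul_eq_mul]; push_cast; ring
    _ ≤ _ := by
        have := Real.log_natCast_nonneg q
        have : ((Y / T : ℕ) : ℝ) ≤ (Y : ℝ) / T := Nat.cast_div_le
        gcongr

lemma sum_norm_sq_fiberSum_le_of_spaced (w : ℕ → ℝ) {α : ℝ} {q T x M : ℕ} (hq : 0 < q) (hT : 0 < T)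
    (hM : 0 < M)
    (hsp : ∀ k : ℤ, k ≠ 0 → |k| ≤ T → 1 / (2 * (q : ℝ)) ≤ nd (k * α)) :
    ∑ m ∈ Ioc M (2 * M), ‖fiberSum w α x m‖ ^ 2 ≤
      (∑ n ∈ Ioc 0 (x / M), w n ^ 2) *
        (((x / M : ℕ) / T + 1) * (2 * (M + q * (1 + Real.log q)))) := by
  refine (sum_norm_sq_fiberSum_le w α x M (2 * M) hM).trans ?_
  set Y := x / M
  set g : ℕ → ℕ → ℝ := fun n n' => (M : ℝ) / max 1 (2 * M * nd (((n : ℤ) - n' : ℤ) * α)) with hg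
  have hg0 : ∀ n n', 0 ≤ g n n' := fun n n' => by simp only [hg]; positivity
  have hsymm : ∀ n n', g n n' = g n' n := by
    intro n n'
    simp only [hg]
    rw [← nd_neg]
    congr 4; push_cast; ring
  calc _ ≤ ∑ n ∈ Ioc 0 Y, ∑ n' ∈ Ioc 0 Y, (w n ^ 2 / 2 * g n n' + w n' ^ 2 / 2 * g n' n) := by
        refine sum_le_sum fun n _ => ?_
        rw [mul_sum]
        refine sum_le_sum fun n' _ => ?_
        rw [← hsymm n n', ← add_mul, ← mul_assoc]
        refine mul_le_mul ?_ ?_ (norm_nonneg _) (by positivity)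
        · nlinarith [sq_nonneg (|w n| - |w n'|), sq_abs (w n), sq_abs (w n')]
        · exact norm_geom_le_div_max _ (by have := min_le_left (2 * M) (min (x / n) (x / n')); omega)
    _ = ∑ n ∈ Ioc 0 Y, w n ^ 2 * ∑ n' ∈ Ioc 0 Y, g n n' := by
        simp only [sum_add_distrib]
        rw [sum_comm (f := fun n n' => w n' ^ 2 / 2 * g n' n), ← sum_add_distrib]
        refine sum_congr rfl fun n _ => ?_
        rw [← mul_sum]; ring
    _ ≤ _ := by
        rw [sum_mul]
        exact sum_le_sum fun n _ => mul_le_mul_of_nonneg_left (sum_div_max_nd_le hq hT hsp n Y)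
          (sq_nonneg _)

/-- The bilinear form over one dyadic block. -/
lemma sum_vonMangoldt_mul_norm_fiberSum_le (w : ℕ → ℝ) {α : ℝ} {q T x M : ℕ} (hq : 0 < q)
    (hT : 0 < T) (hM : 0 < M)
    (hsp : ∀ k : ℤ, k ≠ 0 → |k| ≤ T → 1 / (2 * (q : ℝ)) ≤ nd (k * α)) :
    (∑ m ∈ Ioc M (2 * M), vonMangoldt m * ‖fiberSum w α x m‖) ^ 2 ≤
      12 * M * Real.log (2 * M) * ((∑ n ∈ Ioc 0 (x / M), w n ^ 2) *
        (((x / M : ℕ) / T + 1) * (2 * (M + q * (1 + Real.log q))))) := by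
  have h1 := sum_norm_sq_fiberSum_le_of_spaced w (x := x) hq hT hM hsp
  refine (sum_mul_sq_le_sq_mul_sq _ _ _).trans ?_
  have h2 : ∑ m ∈ Ioc M (2 * M), vonMangoldt m ^ 2 ≤ 12 * M * Real.log (2 * M) := by
    have hlog : 0 ≤ Real.log (2 * M) := by
      apply Real.log_nonneg
      have : (1:ℝ) ≤ M := by exact_mod_cast hM
      linarith
    calc _ ≤ ∑ m ∈ Ioc M (2 * M), vonMangoldt m * Real.log (2 * M) := by
          refine sum_le_sum fun m hm => ?_
          rw [mem_Ioc] at hm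
          rw [sq]
          refine mul_le_mul_of_nonneg_left (ArithmeticFunction.vonMangoldt_le_log.trans ?_)
            ArithmeticFunction.vonMangoldt_nonneg
          exact Real.log_le_log (by exact_mod_cast hM.trans hm.1) (by exact_mod_cast hm.2)
      _ ≤ _ := by
          rw [← sum_mul]
          refine mul_le_mul_of_nonneg_right ?_ hlog
          have h3 := sum_vonMangoldt_le (2 * M)
          have h4 : ∑ m ∈ Ioc M (2 * M), vonMangoldt m ≤ ∑ m ∈ Ioc 0 (2 * M), vonMangoldt m :=
            sum_le_sum_of_subset_of_nonneg (Ioc_subset_Ioc_left (Nat.zero_le _))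
              fun _ _ _ => ArithmeticFunction.vonMangoldt_nonneg
          push_cast at h3
          linarith
  have h5 : 0 ≤ ∑ m ∈ Ioc M (2 * M), vonMangoldt m ^ 2 := sum_nonneg fun _ _ => sq_nonneg _
  exact mul_le_mul h2 h1 (sum_nonneg fun _ _ => sq_nonneg _) (h5.trans h2)

lemma sum_mul_apply_mul_ex (f g : ArithmeticFunction ℝ) (α : ℝ) (x : ℕ) :
    ∑ n ∈ Ioc 0 x, (((f * g) n : ℝ) : ℂ) * ex (n * α) =
      ∑ d ∈ Ioc 0 x, (f d : ℂ) * fiberSum g α x d := by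
  have h := sum_divisorsAntidiagonal_eq (fun d e => ((f d : ℂ) * ((g e : ℂ) * ex (e * (d * α))))) x
  rw [sum_congr rfl (fun n _ => ?_), h]
  · simp only [fiberSum, mul_sum]
  · rw [ArithmeticFunction.mul_apply, Complex.ofReal_sum, sum_mul]
    refine sum_congr rfl fun p hp => ?_
    rw [Nat.mem_divisorsAntidiagonal] at hp
    rw [← hp.1]; push_cast
    rw [mul_assoc, mul_comm (p.1 : ℝ) (p.2 : ℝ), mul_assoc (p.2 : ℝ)]

/-- The restriction of an arithmetic function to the integers up to `U`. -/
noncomputable def trunc (U : ℕ) (f : ArithmeticFunction ℝ) : ArithmeticFunction ℝ :=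
  ⟨fun n => if n ≤ U then f n else 0, by simp⟩

lemma trunc_apply (U : ℕ) (f : ArithmeticFunction ℝ) (n : ℕ) :
    trunc U f n = if n ≤ U then f n else 0 := rfl

/-- Vaughan's identity. -/
lemma vaughan_identity (U : ℕ) :
    vonMangoldt = trunc U vonMangoldt +
      trunc U (ArithmeticFunction.moebius : ArithmeticFunction ℝ) * ArithmeticFunction.log -
      trunc U vonMangoldt * trunc U (ArithmeticFunction.moebius : ArithmeticFunction ℝ) *
        (ArithmeticFunction.zeta : ArithmeticFunction ℝ) +
      (vonMangoldt - trunc U vonMangoldt) * ((ArithmeticFunction.zeta : ArithmeticFunction ℝ) *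
        ((ArithmeticFunction.moebius : ArithmeticFunction ℝ) -
          trunc U (ArithmeticFunction.moebius : ArithmeticFunction ℝ))) := by
  have h1 : (ArithmeticFunction.zeta : ArithmeticFunction ℝ) *
      (ArithmeticFunction.moebius : ArithmeticFunction ℝ) = 1 :=
    ArithmeticFunction.coe_zeta_mul_coe_moebius
  have h2 := ArithmeticFunction.vonMangoldt_mul_zeta
  generalize (ArithmeticFunction.zeta : ArithmeticFunction ℝ) = z at *
  generalize (ArithmeticFunction.moebius : ArithmeticFunction ℝ) = m at *
  linear_combination (-(vonMangoldt - trunc U vonMangoldt)) * h1 + trunc U m * h2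

lemma norm_fiberSum_zeta_le {α : ℝ} {q d : ℕ} (x : ℕ) (hq : 0 < q)
    (hd : 1 / (2 * (q : ℝ)) ≤ nd (d * α)) :
    ‖fiberSum (ArithmeticFunction.zeta : ArithmeticFunction ℝ) α x d‖ ≤ q := by
  have hq' : (0:ℝ) < q := by exact_mod_cast hq
  have hpos : 0 < nd (d * α) := lt_of_lt_of_le (by positivity) hd
  have h1 : fiberSum (ArithmeticFunction.zeta : ArithmeticFunction ℝ) α x d =
      ∑ n ∈ Ioc 0 (x / d), ex (n * (d * α)) := by
    refine sum_congr rfl fun n hn => ?_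
    rw [mem_Ioc] at hn
    rw [ArithmeticFunction.natCoe_apply, ArithmeticFunction.zeta_apply, if_neg (by omega)]
    simp
  rw [h1]
  refine (norm_geom_Ioc_le _ _ _ hpos).trans ?_
  rw [div_le_iff₀ (by positivity)] at hd ⊢
  linarith

lemma norm_fiberSum_log_le {α : ℝ} {q d x : ℕ} (hq : 0 < q)
    (hd : 1 / (2 * (q : ℝ)) ≤ nd (d * α)) :
    ‖fiberSum (ArithmeticFunction.log) α x d‖ ≤ 3 * q * Real.log x := by
  have hq' : (0:ℝ) < q := by exact_mod_cast hq
  have hpos : 0 < nd (d * α) := lt_of_lt_of_le (by positivity) hd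
  have h1 : fiberSum (ArithmeticFunction.log) α x d =
      ∑ n ∈ Ioc 0 (x / d), ex (n * (d * α)) * (Real.log n : ℝ) :=
    sum_congr rfl fun n _ => by rw [ArithmeticFunction.log_apply, mul_comm]
  rw [h1]
  refine norm_sum_mul_le_of_monotoneOn (fun t _ => ?_) ?_ (Real.log_natCast_nonneg x) ?_
  · refine (norm_geom_Ioc_le _ _ _ hpos).trans ?_
    rw [div_le_iff₀ (by positivity)] at hd ⊢
    linarith
  · intro a ha b _ hab
    exact Real.log_le_log (by exact_mod_cast ha.1) (by exact_mod_cast hab)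
  · intro n hn
    rw [abs_of_nonneg (Real.log_natCast_nonneg n)]
    exact Real.log_le_log (by exact_mod_cast hn.1)
      (by exact_mod_cast hn.2.trans (Nat.div_le_self _ _))

lemma abs_moebius_real_le_one (n : ℕ) :
    |(ArithmeticFunction.moebius : ArithmeticFunction ℝ) n| ≤ 1 := by
  rw [ArithmeticFunction.intCoe_apply, ← Int.cast_abs]
  exact_mod_cast ArithmeticFunction.abs_moebius_le_one

lemma abs_trunc_mul_trunc_le (U n : ℕ) :
    |(trunc U vonMangoldt * trunc U (ArithmeticFunction.moebius : ArithmeticFunction ℝ)) n| ≤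
      Real.log n := by
  rw [ArithmeticFunction.mul_apply, ← ArithmeticFunction.vonMangoldt_sum,
    ← Nat.map_div_right_divisors, sum_map]
  refine (abs_sum_le_sum_abs _ _).trans (sum_le_sum fun d _ => ?_)
  change |(if d ≤ U then vonMangoldt d else 0) *
    (if n / d ≤ U then (ArithmeticFunction.moebius : ArithmeticFunction ℝ) (n / d) else 0)| ≤
      vonMangoldt d
  rw [abs_mul]
  have h0 := ArithmeticFunction.vonMangoldt_nonneg (n := d)
  have h1 := abs_moebius_real_le_one (n / d)
  split_ifs <;> simp only [abs_zero, mul_zero, zero_mul, h0, abs_of_nonneg]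
  exact mul_le_of_le_one_right h0 h1

lemma trunc_mul_trunc_eq_zero {U n : ℕ} (hn : U * U < n) (f g : ArithmeticFunction ℝ) :
    (trunc U f * trunc U g) n = 0 := by
  rw [ArithmeticFunction.mul_apply]
  refine sum_eq_zero fun p hp => ?_
  rw [Nat.mem_divisorsAntidiagonal] at hp
  simp only [trunc_apply]
  split_ifs with h1 h2
  · have := Nat.mul_le_mul h1 h2
    omega
  all_goals simp

lemma zeta_mul_moebius_tail (U n : ℕ) :
    |((ArithmeticFunction.zeta : ArithmeticFunction ℝ) *
      ((ArithmeticFunction.moebius : ArithmeticFunction ℝ) -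
        trunc U (ArithmeticFunction.moebius : ArithmeticFunction ℝ))) n| ≤ n.divisors.card ∧
    (n ≤ U → ((ArithmeticFunction.zeta : ArithmeticFunction ℝ) *
      ((ArithmeticFunction.moebius : ArithmeticFunction ℝ) -
        trunc U (ArithmeticFunction.moebius : ArithmeticFunction ℝ))) n = 0) := by
  rw [ArithmeticFunction.coe_zeta_mul_apply]
  have h : ∀ d, ((ArithmeticFunction.moebius : ArithmeticFunction ℝ) -
      trunc U (ArithmeticFunction.moebius : ArithmeticFunction ℝ)) d =
      if d ≤ U then 0 else (ArithmeticFunction.moebius : ArithmeticFunction ℝ) d := by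
    intro d
    rw [sub_eq_add_neg, ArithmeticFunction.add_apply]
    have : (-(trunc U (ArithmeticFunction.moebius : ArithmeticFunction ℝ))) d =
      -(trunc U (ArithmeticFunction.moebius : ArithmeticFunction ℝ) d) := rfl
    rw [this, trunc_apply]
    split_ifs <;> simp
  constructor
  · refine (abs_sum_le_sum_abs _ _).trans ?_
    calc _ ≤ ∑ d ∈ n.divisors, (1 : ℝ) := by
          refine sum_le_sum fun d _ => ?_
          rw [h]
          split_ifs
          · simp
          · exact abs_moebius_real_le_one d
      _ = _ := by simp
  · intro hn
    refine sum_eq_zero fun d hd => ?_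
    rw [h, if_pos ((Nat.divisor_le hd).trans hn)]

lemma dyadic_block_arith {x M U q L : ℝ} (hM : 0 < M) (hU : 0 < U) (hq : 0 < q) (hL : 1 ≤ L)
    (hUM : U ≤ 2 * M) (hMx : M * U ≤ x) (hUq : U ≤ q) (hqx : q * U ≤ x) :
    12 * M * L * (x / M * L ^ 3 * ((4 * (x / M) / q + 1) * (2 * (L * (M + q))))) ≤
      (19 * L ^ 3 * x) ^ 2 / U := by
  have hx : 0 < x := lt_of_lt_of_le (by positivity) hMx
  have h1 : 4 * x / q + 4 * x / M + M + q ≤ 14 * x / U := by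
    have a1 : 4 * x / q ≤ 4 * x / U := by gcongr
    have a2 : 4 * x / M ≤ 8 * x / U := by
      rw [div_le_div_iff₀ hM hU]; nlinarith
    have a3 : M ≤ x / U := by rwa [le_div_iff₀ hU]
    have a4 : q ≤ x / U := by rwa [le_div_iff₀ hU]
    have a5 : 14 * x / U = 4 * x / U + 8 * x / U + x / U + x / U := by ring
    linarith
  have h2 : 12 * M * L * (x / M * L ^ 3 * ((4 * (x / M) / q + 1) * (2 * (L * (M + q))))) =
      24 * L ^ 5 * x * (4 * x / q + 4 * x / M + M + q) := by
    field_simp; ring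
  rw [h2]
  calc _ ≤ 24 * L ^ 5 * x * (14 * x / U) := by gcongr
    _ ≤ 24 * L ^ 6 * x * (14 * x / U) := by gcongr; norm_num
    _ = 336 * (L ^ 6 * x ^ 2 / U) := by ring
    _ ≤ 361 * (L ^ 6 * x ^ 2 / U) := by gcongr; norm_num
    _ = _ := by ring

lemma type_two_block_le {α : ℝ} {q x U M : ℕ} (hU : 1 ≤ U) (hUq : 2 * U ^ 2 ≤ q)
    (hqx : q * U ^ 3 ≤ x) (hM : 0 < M) (hUM : U < 2 * M) (hMx : U < x / M)
    (hsp : ∀ k : ℤ, k ≠ 0 → |k| ≤ (q / 2 : ℕ) → 1 / (2 * (q : ℝ)) ≤ nd (k * α)) {w : ℕ → ℝ}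
    (hw : ∀ n, |w n| ≤ n.divisors.card) :
    ∑ m ∈ Ioc M (2 * M), vonMangoldt m * ‖fiberSum w α x m‖ ≤
      19 * (1 + Real.log x) ^ 3 * x / √U := by
  have hq2 : 2 ≤ q := by nlinarith
  have hT : 0 < q / 2 := by omega
  have hx : 0 < x := by
    rcases Nat.eq_zero_or_pos x with h | h
    · subst h; simp at hMx
    · exact h
  have hlog : 0 ≤ Real.log x := Real.log_natCast_nonneg x
  set L := 1 + Real.log x with hL
  have hL1 : 1 ≤ L := by linarith
  have hMr : (0:ℝ) < M := by exact_mod_cast hM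
  have hUr : (0:ℝ) < U := by exact_mod_cast hU
  have hqr : (0:ℝ) < q := by exact_mod_cast (by omega : 0 < q)
  have hxr : (0:ℝ) < x := by exact_mod_cast hx
  have hMU : M * U ≤ x := by
    have := (Nat.le_div_iff_mul_le hM).1 hMx.le
    rwa [mul_comm] at this
  have hMlex : M ≤ x := le_trans (Nat.le_mul_of_pos_right M hU) hMU
  have hUq' : U ≤ q := by nlinarith
  have hqU : q * U ≤ x := le_trans (Nat.mul_le_mul_left q (Nat.le_self_pow (by norm_num) U)) hqx
  have hqlex : q ≤ x := le_trans (Nat.le_mul_of_pos_right q hU) hqU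
  have hmain := sum_vonMangoldt_mul_norm_fiberSum_le w (x := x) (by omega : 0 < q) hT hM hsp
  have hlogM : Real.log (2 * M) ≤ L := by
    rw [Real.log_mul (by norm_num) hMr.ne']
    have h1 := Real.log_le_log hMr (by exact_mod_cast hMlex : (M:ℝ) ≤ x)
    have h2 := Real.log_two_lt_d9
    linarith
  have hlogq : 1 + Real.log q ≤ L := by
    have h1 := Real.log_le_log hqr (by exact_mod_cast hqlex : (q:ℝ) ≤ x)
    linarith
  have hw2 : ∑ n ∈ Ioc 0 (x / M), w n ^ 2 ≤ x / M * L ^ 3 := by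
    calc _ ≤ ∑ n ∈ Ioc 0 (x / M), (n.divisors.card : ℝ) ^ 2 := by
          refine sum_le_sum fun n _ => ?_
          rw [← sq_abs]
          exact pow_le_pow_left₀ (abs_nonneg _) (hw n) 2
      _ ≤ (x / M : ℕ) * (1 + Real.log (x / M : ℕ)) ^ 3 := sum_card_divisors_sq_le _
      _ ≤ _ := by
          have h0 : 0 < x / M := by omega
          have h1 : Real.log (x / M : ℕ) ≤ Real.log x :=
            Real.log_le_log (by exact_mod_cast h0) (by exact_mod_cast Nat.div_le_self _ _)
          have h2 := Real.log_natCast_nonneg (x / M)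
          have h3 : ((x / M : ℕ) : ℝ) ≤ x / M := Nat.cast_div_le
          have h4 : 1 + Real.log (x / M : ℕ) ≤ L := by linarith
          gcongr
  have hT4 : (((x / M : ℕ) : ℝ) / (q / 2 : ℕ) + 1) ≤ 4 * (x / M) / q + 1 := by
    have h3 : ((x / M : ℕ) : ℝ) ≤ x / M := Nat.cast_div_le
    have h4 : (q : ℝ) ≤ 4 * (q / 2 : ℕ) := by exact_mod_cast (by omega : q ≤ 4 * (q / 2))
    have h5 : (0:ℝ) < (q / 2 : ℕ) := by exact_mod_cast hT
    rw [add_le_add_iff_right, div_le_div_iff₀ h5 hqr]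
    calc _ ≤ ((x:ℝ) / M) * (4 * (q / 2 : ℕ)) := by gcongr
      _ = _ := by ring
  have hMq : 2 * ((M : ℝ) + q * (1 + Real.log q)) ≤ 2 * (L * (M + q)) := by nlinarith
  have hlog2M : 0 ≤ Real.log (2 * M) := by
    apply Real.log_nonneg
    have : (1:ℝ) ≤ M := by exact_mod_cast hM
    linarith
  have hlogq0 := Real.log_natCast_nonneg q
  have harith := dyadic_block_arith (x := x) (M := M) (U := U) (q := q) hMr hUr hqr hL1
    (by exact_mod_cast hUM.le) (by exact_mod_cast hMU) (by exact_mod_cast hUq')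
    (by exact_mod_cast hqU)
  have hfin : (∑ m ∈ Ioc M (2 * M), vonMangoldt m * ‖fiberSum w α x m‖) ^ 2 ≤
      (19 * L ^ 3 * x / √U) ^ 2 := by
    rw [div_pow, Real.sq_sqrt hUr.le]
    refine hmain.trans (le_trans ?_ harith)
    have hs : 0 ≤ ∑ n ∈ Ioc 0 (x / M), w n ^ 2 := sum_nonneg fun _ _ => sq_nonneg _
    gcongr
  exact le_of_sq_le_sq hfin (by positivity)

lemma type_two_sum_le {α : ℝ} {q x U : ℕ} (hU : 1 ≤ U) (hUq : 2 * U ^ 2 ≤ q)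
    (hqx : q * U ^ 3 ≤ x)
    (hsp : ∀ k : ℤ, k ≠ 0 → |k| ≤ (q / 2 : ℕ) → 1 / (2 * (q : ℝ)) ≤ nd (k * α)) {w : ℕ → ℝ}
    (hw : ∀ n, |w n| ≤ n.divisors.card) (hw0 : ∀ n ≤ U, w n = 0) :
    ∑ m ∈ Ioc 0 x with U < m, vonMangoldt m * ‖fiberSum w α x m‖ ≤
      38 * ((1 + Real.log x) ^ 4 * x / √U) := by
  have hx : 0 < x := by
    have : 0 < q * U ^ 3 := Nat.mul_pos (by nlinarith) (by positivity)
    omega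
  have hlog : 0 ≤ Real.log x := Real.log_natCast_nonneg x
  set J := Nat.log 2 x + 1 with hJ
  have hxJ : x ≤ 2 ^ J := (Nat.lt_pow_succ_log_self one_lt_two x).le
  have hJL : (J : ℝ) ≤ 2 * (1 + Real.log x) := by
    have h1 : Real.log ((2:ℝ) ^ (Nat.log 2 x)) ≤ Real.log x :=
      Real.log_le_log (by positivity) (by exact_mod_cast Nat.pow_log_le_self 2 hx.ne')
    rw [Real.log_pow] at h1
    have h2 := Real.log_two_gt_d9
    have h3 : (0:ℝ) ≤ Nat.log 2 x := Nat.cast_nonneg _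
    rw [hJ]; push_cast
    nlinarith
  set f : ℕ → ℝ := fun m => if U < m then vonMangoldt m * ‖fiberSum w α x m‖ else 0 with hf
  have hf0 : ∀ m, 0 ≤ f m := by
    intro m
    simp only [hf]
    split_ifs
    · exact mul_nonneg ArithmeticFunction.vonMangoldt_nonneg (norm_nonneg _)
    · exact le_rfl
  have hB : (0:ℝ) ≤ 19 * (1 + Real.log x) ^ 3 * x / √U := by positivity
  rw [sum_filter]
  calc _ ≤ ∑ m ∈ Ioc 0 (2 ^ J), f m :=
        sum_le_sum_of_subset_of_nonneg (Ioc_subset_Ioc_right hxJ) fun m _ _ => hf0 m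
    _ ≤ ∑ j ∈ range J, ∑ m ∈ Ioc (2 ^ j) (2 * 2 ^ j), f m := by
        refine sum_Ioc_le_sum_dyadic ?_ J
        simp [hf]
    _ ≤ ∑ j ∈ range J, 19 * (1 + Real.log x) ^ 3 * x / √U := by
        refine sum_le_sum fun j _ => ?_
        have hM : 0 < 2 ^ j := by positivity
        by_cases h1 : U < 2 * 2 ^ j
        · by_cases h2 : U < x / 2 ^ j
          · refine le_trans (sum_le_sum fun m _ => ?_)
              (type_two_block_le hU hUq hqx hM h1 h2 hsp hw)
            simp only [hf]
            split_ifs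
            · exact le_rfl
            · exact mul_nonneg ArithmeticFunction.vonMangoldt_nonneg (norm_nonneg _)
          · refine le_trans (le_of_eq (sum_eq_zero fun m hm => ?_)) hB
            rw [mem_Ioc] at hm
            have h3 : fiberSum w α x m = 0 := by
              refine sum_eq_zero fun n hn => ?_
              rw [mem_Ioc] at hn
              have := Nat.div_le_div_left (a := x) hm.1.le hM
              rw [hw0 n (by omega)]; simp
            simp [hf, h3]
        · refine le_trans (le_of_eq (sum_eq_zero fun m hm => ?_)) hB
          rw [mem_Ioc] at hm
          simp only [hf]
          rw [if_neg (by omega)]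
    _ = J * (19 * (1 + Real.log x) ^ 3 * x / √U) := by rw [sum_const, card_range, nsmul_eq_mul]
    _ ≤ (2 * (1 + Real.log x)) * (19 * (1 + Real.log x) ^ 3 * x / √U) := by gcongr
    _ = _ := by ring

/-- Exponential sums over prime powers at points well approximated by a fraction with neither
small nor large denominator. -/
theorem minor_sum_le {q x U : ℕ} {a : ℤ} {β : ℝ} (hU : 1 ≤ U) (hUq : 2 * U ^ 2 ≤ q)
    (hqx : q * U ^ 3 ≤ x) (ha : IsCoprime a (q : ℤ)) (hβ : |β| ≤ 1 / (q : ℝ) ^ 2) :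
    ‖∑ n ∈ Ioc 0 x, (vonMangoldt n : ℂ) * ex (n * (a / q + β))‖ ≤
      50 * ((1 + Real.log x) ^ 4 * x / √U) := by
  have hq : 0 < q := by nlinarith
  have hqr : (0:ℝ) < q := by exact_mod_cast hq
  have hUr : (1:ℝ) ≤ U := by exact_mod_cast hU
  set α : ℝ := a / q + β with hα
  have hsp : ∀ k : ℤ, k ≠ 0 → |k| ≤ (q / 2 : ℕ) → 1 / (2 * (q : ℝ)) ≤ nd (k * α) := by
    intro k hk0 hk
    refine nd_mul_ge_of_not_dvd hq ha (fun h => ?_) ?_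
    · have := Int.le_of_dvd (abs_pos.2 hk0) ((dvd_abs _ _).2 h)
      omega
    · have h1 : |(k : ℝ)| ≤ q / 2 := by
        rw [← Int.cast_abs]
        have h2 : ((|k| : ℤ) : ℝ) ≤ ((q / 2 : ℕ) : ℤ) := by exact_mod_cast hk
        refine h2.trans ?_
        have := @Nat.cast_div_le ℝ _ _ _ q 2
        exact_mod_cast this
      calc _ ≤ (q / 2 : ℝ) * (1 / (q : ℝ) ^ 2) := by gcongr
        _ = _ := by field_simp
  have hspn : ∀ d ∈ Ioc 0 (U * U), 1 / (2 * (q : ℝ)) ≤ nd (d * α) := by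
    intro d hd
    rw [mem_Ioc] at hd
    have := hsp d (by omega) (by rw [abs_of_nonneg (by omega)]; norm_cast; rw [Nat.le_div_iff_mul_le two_pos]; nlinarith)
    exact_mod_cast this
  have hUUx : U * U ≤ x := by 
    calc U * U ≤ 2 * U ^ 2 * 1 := by nlinarith
      _ ≤ q * U ^ 3 := Nat.mul_le_mul hUq (Nat.one_le_pow _ _ hU)
      _ ≤ x := hqx
  have hUx : U ≤ x := le_trans (Nat.le_mul_of_pos_right U hU) hUUx
  have hlog : 0 ≤ Real.log x := Real.log_natCast_nonneg x
  set L := 1 + Real.log x with hL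
  have hL1 : 1 ≤ L := by linarith
  have hxr : (0:ℝ) < x := by exact_mod_cast hU.trans hUx
  set E : ℝ := L ^ 4 * x / √U with hE
  have hsqrtU : 1 ≤ √(U:ℝ) := Real.one_le_sqrt.2 hUr
  have hqx' : (q:ℝ) * U ^ 3 ≤ x := by exact_mod_cast hqx
  have hUq' : 2 * (U:ℝ) ^ 2 ≤ q := by exact_mod_cast hUq
  have hsU : √(U:ℝ) ≤ U := by
    have := Real.sq_sqrt (by linarith : (0:ℝ) ≤ U)
    nlinarith
  have hbase : ∀ y : ℝ, y * U ≤ L ^ 4 * x → y ≤ E := by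
    intro y hy
    rw [hE, le_div_iff₀ (by linarith)]
    rcases le_total y 0 with h | h
    · have : 0 ≤ L ^ 4 * x := by positivity
      nlinarith
    · nlinarith
  have hL4 : L ≤ L ^ 4 := by
    calc L = L ^ 1 := by ring
      _ ≤ L ^ 4 := pow_le_pow_right₀ hL1 (by norm_num)
  have e1 : (U:ℝ) ≤ E := by
    apply hbase
    have : (U:ℝ) * U ≤ x := by exact_mod_cast hUUx
    nlinarith
  have e2 : (U:ℝ) * (q * L) ≤ E := by
    apply hbase
    have h1 : (q:ℝ) * U ^ 2 ≤ q * U ^ 3 := by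
      gcongr
      norm_num
    calc (U:ℝ) * (q * L) * U = q * U ^ 2 * L := by ring
      _ ≤ x * L := by gcongr; linarith
      _ ≤ _ := by nlinarith
  have e3 : (U:ℝ) * U * (L * q) ≤ E := by
    apply hbase
    calc (U:ℝ) * U * (L * q) * U = q * U ^ 3 * L := by ring
      _ ≤ x * L := by gcongr
      _ ≤ _ := by nlinarith
  set z : ArithmeticFunction ℝ := (ArithmeticFunction.zeta : ArithmeticFunction ℝ) with hz
  set m : ArithmeticFunction ℝ := (ArithmeticFunction.moebius : ArithmeticFunction ℝ) with hm
  have hpt : ∀ n ∈ Ioc 0 x, (vonMangoldt n : ℂ) * ex (n * α) =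
      (trunc U vonMangoldt n : ℂ) * ex (n * α) +
      ((trunc U m * ArithmeticFunction.log) n : ℂ) * ex (n * α) -
      ((trunc U vonMangoldt * trunc U m * z) n : ℂ) * ex (n * α) +
      (((vonMangoldt - trunc U vonMangoldt) * (z * (m - trunc U m))) n : ℂ) * ex (n * α) := by
    intro n _
    have h := congrArg (fun f : ArithmeticFunction ℝ => f n) (vaughan_identity U)
    have hsub : ∀ f g : ArithmeticFunction ℝ, (f - g) n = f n - g n := fun f g => by
      rw [sub_eq_add_neg, ArithmeticFunction.add_apply, sub_eq_add_neg]; rfl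
    simp only [ArithmeticFunction.add_apply, hsub] at h
    rw [h]; push_cast; ring
  rw [sum_congr rfl hpt, sum_add_distrib, sum_sub_distrib, sum_add_distrib,
    sum_mul_apply_mul_ex, sum_mul_apply_mul_ex, sum_mul_apply_mul_ex]
  have b1 : ‖∑ n ∈ Ioc 0 x, (trunc U vonMangoldt n : ℂ) * ex (n * α)‖ ≤ 6 * U := by
    refine (norm_sum_le _ _).trans (le_trans (le_of_eq ?_) (sum_vonMangoldt_le U))
    rw [← sum_subset (Ioc_subset_Ioc_right hUx)]
    · refine sum_congr rfl fun n hn => ?_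
      rw [norm_mul, norm_ex, mul_one, Complex.norm_real, trunc_apply, if_pos (mem_Ioc.1 hn).2,
        Real.norm_of_nonneg ArithmeticFunction.vonMangoldt_nonneg]
    · intro n hn hn'
      rw [mem_Ioc] at hn hn'
      rw [trunc_apply, if_neg (by omega)]; simp
  have b2 : ‖∑ d ∈ Ioc 0 x, (trunc U m d : ℂ) * fiberSum ArithmeticFunction.log α x d‖ ≤
      U * (3 * q * Real.log x) := by
    rw [← sum_subset (Ioc_subset_Ioc_right hUx)]
    · refine (norm_sum_le _ _).trans ?_
      calc _ ≤ ∑ d ∈ Ioc 0 U, 1 * (3 * q * Real.log x) := by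
            refine sum_le_sum fun d hd => ?_
            rw [norm_mul, Complex.norm_real, trunc_apply, if_pos (mem_Ioc.1 hd).2]
            refine mul_le_mul (abs_moebius_real_le_one d) (norm_fiberSum_log_le hq (hspn d ?_))
              (norm_nonneg _) zero_le_one
            rw [mem_Ioc] at hd ⊢
            exact ⟨hd.1, hd.2.trans (Nat.le_mul_of_pos_right U hU)⟩
        _ = _ := by simp
    · intro n hn hn'
      rw [mem_Ioc] at hn hn'
      rw [trunc_apply, if_neg (by omega)]; simp
  have b3 : ‖∑ d ∈ Ioc 0 x, ((trunc U vonMangoldt * trunc U m) d : ℂ) * fiberSum z α x d‖ ≤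
      U * U * (Real.log x * q) := by
    rw [← sum_subset (Ioc_subset_Ioc_right hUUx)]
    · refine (norm_sum_le _ _).trans ?_
      calc _ ≤ ∑ d ∈ Ioc 0 (U * U), Real.log x * q := by
            refine sum_le_sum fun d hd => ?_
            rw [norm_mul, Complex.norm_real]
            refine mul_le_mul ((abs_trunc_mul_trunc_le U d).trans ?_)
              (norm_fiberSum_zeta_le x hq (hspn d hd)) (norm_nonneg _) hlog
            rw [mem_Ioc] at hd
            exact Real.log_le_log (by exact_mod_cast hd.1) (by exact_mod_cast hd.2.trans hUUx)
        _ = _ := by simp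
    · intro n hn hn'
      rw [mem_Ioc] at hn hn'
      rw [trunc_mul_trunc_eq_zero (by omega)]; simp
  have b4 : ‖∑ d ∈ Ioc 0 x, ((vonMangoldt - trunc U vonMangoldt) d : ℂ) *
      fiberSum (z * (m - trunc U m) : ArithmeticFunction ℝ) α x d‖ ≤ 38 * E := by
    refine le_trans ?_ (type_two_sum_le hU hUq hqx hsp (w := fun n => (z * (m - trunc U m)) n)
      (fun n => (zeta_mul_moebius_tail U n).1) (fun n => (zeta_mul_moebius_tail U n).2))
    rw [sum_filter]
    refine (norm_sum_le _ _).trans (sum_le_sum fun d _ => ?_)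
    rw [norm_mul, Complex.norm_real, sub_eq_add_neg, ArithmeticFunction.add_apply]
    change ‖vonMangoldt d + -(if d ≤ U then vonMangoldt d else 0)‖ * _ ≤ _
    split_ifs with h1 h2 h2
    · omega
    · simp
    · rw [neg_zero, add_zero, Real.norm_of_nonneg ArithmeticFunction.vonMangoldt_nonneg]
    · omega
  have hlogL : Real.log x ≤ L := by linarith
  have b2' : (U:ℝ) * (3 * q * Real.log x) ≤ 3 * (U * (q * L)) := by
    have : (U:ℝ) * q * Real.log x ≤ U * q * L := by gcongr
    linarith
  have b3' : (U:ℝ) * U * (Real.log x * q) ≤ U * U * (L * q) := by gcongr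
  refine (norm_add_le _ _).trans ?_
  have n1 := norm_sub_le (∑ n ∈ Ioc 0 x, (trunc U vonMangoldt n : ℂ) * ex (n * α) +
    ∑ d ∈ Ioc 0 x, (trunc U m d : ℂ) * fiberSum ArithmeticFunction.log α x d)
    (∑ d ∈ Ioc 0 x, ((trunc U vonMangoldt * trunc U m) d : ℂ) * fiberSum z α x d)
  have n2 := norm_add_le (∑ n ∈ Ioc 0 x, (trunc U vonMangoldt n : ℂ) * ex (n * α))
    (∑ d ∈ Ioc 0 x, (trunc U m d : ℂ) * fiberSum ArithmeticFunction.log α x d)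
  linarith

/-- The exponential sum of `f` over the interval `(A, B]`. -/
noncomputable def expSum (f : ℕ → ℝ) (A B : ℕ) (α : ℝ) : ℂ :=
  ∑ n ∈ Ioc A B, (f n : ℂ) * ex (n * α)

lemma sum_range_norm_sq_expSum (f : ℕ → ℝ) {A B M : ℕ} (hM : 0 < M) (hB : B < M) :
    ∑ k ∈ range M, ‖expSum f A B ((k : ℝ) / M)‖ ^ 2 = M * ∑ n ∈ Ioc A B, f n ^ 2 := by
  have h : ((∑ k ∈ range M, ‖expSum f A B ((k : ℝ) / M)‖ ^ 2 : ℝ) : ℂ) =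
      ((M * ∑ n ∈ Ioc A B, f n ^ 2 : ℝ) : ℂ) := by
    push_cast
    calc _ = ∑ k ∈ range M, ∑ n ∈ Ioc A B, ∑ n' ∈ Ioc A B,
          (f n : ℂ) * f n' * ex (k * ((((n : ℤ) - n' : ℤ) : ℝ) / M)) := by
          refine sum_congr rfl fun k _ => ?_
          rw [← Complex.mul_conj', expSum, map_sum, sum_mul_sum]
          refine sum_congr rfl fun n _ => sum_congr rfl fun n' _ => ?_
          rw [map_mul, Complex.conj_ofReal, ← ex_neg, mul_mul_mul_comm, ← ex_add]
          congr 2; push_cast; ring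
      _ = ∑ n ∈ Ioc A B, ∑ n' ∈ Ioc A B, (f n : ℂ) * f n' * (if n = n' then (M : ℂ) else 0) := by
          rw [sum_comm]
          refine sum_congr rfl fun n hn => ?_
          rw [sum_comm]
          refine sum_congr rfl fun n' hn' => ?_
          rw [← mul_sum, sum_range_ex_div hM]
          congr 1
          rw [mem_Ioc] at hn hn'
          refine if_congr ⟨fun h => ?_, fun h => by simp [h]⟩ rfl rfl
          have := Int.eq_zero_of_abs_lt_dvd h (by rw [abs_lt]; omega)
          omega
      _ = _ := by
          rw [mul_sum]
          refine sum_congr rfl fun n hn => ?_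
          simp only [mul_ite, mul_zero]
          rw [sum_ite_eq, if_pos hn]
          ring
  exact_mod_cast h

/-- The circle method: cubes of exponential sums count ternary representations. -/
lemma sum_range_expSum_cube (f : ℕ → ℝ) {A B N : ℕ} (hN : 0 < N) (hB : 2 * B ≤ N) :
    ∑ k ∈ range (2 * N), expSum f A B ((k : ℝ) / (2 * N : ℕ)) ^ 3 * ex (-(k * (N / (2 * N : ℕ)))) =
      ((2 * N : ℕ) * ∑ n₁ ∈ Ioc A B, ∑ n₂ ∈ Ioc A B, ∑ n₃ ∈ Ioc A B,
        (if n₁ + n₂ + n₃ = N then f n₁ * f n₂ * f n₃ else 0) : ℝ) := by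
  have hM : 0 < 2 * N := by omega
  calc _ = ∑ k ∈ range (2 * N), ∑ n₁ ∈ Ioc A B, ∑ n₂ ∈ Ioc A B, ∑ n₃ ∈ Ioc A B,
        (f n₁ : ℂ) * f n₂ * f n₃ *
          ex (k * ((((n₁ : ℤ) + n₂ + n₃ - N : ℤ) : ℝ) / (2 * N : ℕ))) := by
        refine sum_congr rfl fun k _ => ?_
        rw [pow_succ, sq, expSum, sum_mul_sum, sum_mul, sum_mul]
        refine sum_congr rfl fun n₁ _ => ?_
        rw [sum_mul, sum_mul]
        refine sum_congr rfl fun n₂ _ => ?_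
        rw [mul_sum, sum_mul]
        refine sum_congr rfl fun n₃ _ => ?_
        have e : (k : ℝ) * ((((n₁ : ℤ) + n₂ + n₃ - N : ℤ) : ℝ) / (2 * N : ℕ)) =
          n₁ * ((k : ℝ) / (2 * N : ℕ)) + n₂ * ((k : ℝ) / (2 * N : ℕ)) + n₃ * ((k : ℝ) / (2 * N : ℕ))
            + -(k * (N / (2 * N : ℕ))) := by push_cast; ring
        rw [e, ex_add, ex_add, ex_add]; ring
    _ = ∑ n₁ ∈ Ioc A B, ∑ n₂ ∈ Ioc A B, ∑ n₃ ∈ Ioc A B, (f n₁ : ℂ) * f n₂ * f n₃ *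
          (if n₁ + n₂ + n₃ = N then ((2 * N : ℕ) : ℂ) else 0) := by
        rw [sum_comm]
        refine sum_congr rfl fun n₁ h₁ => ?_
        rw [sum_comm]
        refine sum_congr rfl fun n₂ h₂ => ?_
        rw [sum_comm]
        refine sum_congr rfl fun n₃ h₃ => ?_
        rw [← mul_sum, sum_range_ex_div hM]
        congr 1
        rw [mem_Ioc] at h₁ h₂ h₃
        refine if_congr ⟨fun h => ?_, fun h => ?_⟩ rfl rfl
        · have := Int.eq_zero_of_abs_lt_dvd h (by rw [abs_lt]; omega)
          omega
        · have : (n₁ : ℤ) + n₂ + n₃ - N = 0 := by omega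
          rw [this]; simp
    _ = _ := by
        push_cast
        rw [mul_sum]
        refine sum_congr rfl fun n₁ _ => ?_
        rw [mul_sum]
        refine sum_congr rfl fun n₂ _ => ?_
        rw [mul_sum]
        refine sum_congr rfl fun n₃ _ => ?_
        split_ifs <;> push_cast <;> ring

lemma norm_cube_sub_cube_le (z w : ℂ) :
    ‖z ^ 3 - w ^ 3‖ ≤ 3 / 2 * ‖z - w‖ * (‖z‖ ^ 2 + ‖w‖ ^ 2) := by
  have h : z ^ 3 - w ^ 3 = (z - w) * (z ^ 2 + z * w + w ^ 2) := by ring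
  rw [h, norm_mul, mul_comm (3 / 2 : ℝ), mul_assoc]
  refine mul_le_mul_of_nonneg_left ?_ (norm_nonneg _)
  have h1 : ‖z ^ 2 + z * w + w ^ 2‖ ≤ ‖z‖ ^ 2 + ‖z‖ * ‖w‖ + ‖w‖ ^ 2 := by
    refine (norm_add₃_le).trans (le_of_eq ?_)
    rw [norm_pow, norm_mul, norm_pow]
  nlinarith [sq_nonneg (‖z‖ - ‖w‖)]

lemma norm_cube_sub_cube_le' (z w : ℂ) : ‖z ^ 3 - w ^ 3‖ ≤ ‖z‖ ^ 3 + ‖w‖ ^ 3 := by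
  refine (norm_sub_le _ _).trans (le_of_eq ?_)
  rw [norm_pow, norm_pow]

lemma sum_norm_cube_le {ι : Type*} (s : Finset ι) (f : ι → ℂ) {D E : ℝ} (hD : ∀ k ∈ s, ‖f k‖ ≤ D)
    (hE : ∑ k ∈ s, ‖f k‖ ^ 2 ≤ E) (hD0 : 0 ≤ D) : ∑ k ∈ s, ‖f k‖ ^ 3 ≤ D * E := by
  calc _ ≤ ∑ k ∈ s, D * ‖f k‖ ^ 2 := by
        refine sum_le_sum fun k hk => ?_
        rw [pow_succ, mul_comm]
        exact mul_le_mul_of_nonneg_right (hD k hk) (sq_nonneg _)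
    _ ≤ _ := by rw [← mul_sum]; exact mul_le_mul_of_nonneg_left hE hD0

/-! ### The local model -/

lemma mdl_eq_sum {W : ℕ} (hW : 0 < W) (n : ℕ) :
    mdl W n = (W : ℝ) / W.totient *
      ∑ d ∈ W.divisors, (ArithmeticFunction.moebius d : ℝ) * (if d ∣ n then 1 else 0) := by
  have h : ∑ d ∈ W.divisors, (ArithmeticFunction.moebius d : ℝ) * (if d ∣ n then 1 else 0) =
      if n.Coprime W then 1 else 0 := by
    have h1 : ∑ d ∈ W.divisors, (ArithmeticFunction.moebius d : ℝ) * (if d ∣ n then (1 : ℝ) else 0) =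
        ((∑ d ∈ (n.gcd W).divisors, ArithmeticFunction.moebius d : ℤ) : ℝ) := by
      push_cast
      simp only [mul_ite, mul_one, mul_zero]
      rw [← sum_filter]
      apply sum_congr _ (fun _ _ => rfl)
      ext d
      simp only [mem_filter, Nat.mem_divisors, Nat.dvd_gcd_iff]
      have : n.gcd W ≠ 0 := Nat.gcd_ne_zero_right hW.ne'
      have hW0 : W ≠ 0 := hW.ne'
      tauto
    rw [h1, ← ArithmeticFunction.coe_mul_zeta_apply, ArithmeticFunction.moebius_mul_coe_zeta,
      ArithmeticFunction.one_apply]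
    simp [Nat.Coprime]
  rw [h, mdl]; split_ifs <;> simp

lemma mdl_le (W n : ℕ) : mdl W n ≤ W := by
  unfold mdl
  split_ifs
  · rcases Nat.eq_zero_or_pos W with h | h
    · simp [h]
    · refine div_le_self (Nat.cast_nonneg _) ?_
      exact_mod_cast Nat.totient_pos.2 h
  · exact Nat.cast_nonneg _

/-- The model has small exponential sums away from fractions whose denominator divides `W`. -/
lemma norm_expSum_mdl_le {W q A B : ℕ} {a : ℤ} {β D : ℝ} (hW : 0 < W) (hq : 0 < q)
    (ha : IsCoprime a (q : ℤ)) (hβ : W * |β| ≤ 1 / (2 * q)) (hqD : q ≤ D) (hD : 0 < D)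
    (h : q ∣ W → 1 ≤ 2 * D * |β|) :
    ‖expSum (mdl W) A B (a / q + β)‖ ≤ W ^ 2 * D := by
  have hq' : (0:ℝ) < q := by exact_mod_cast hq
  have hq1 : (1:ℝ) ≤ q := by exact_mod_cast hq
  set α := (a : ℝ) / q + β with hα
  have h1 : expSum (mdl W) A B α = ((W : ℝ) / W.totient : ℝ) * ∑ d ∈ W.divisors,
      ((ArithmeticFunction.moebius d : ℝ) : ℂ) * ∑ m ∈ Ioc (A / d) (B / d), ex (m * (d * α)) := by
    have h2 : ∀ d ∈ W.divisors, ∑ m ∈ Ioc (A / d) (B / d), ex (m * (d * α)) =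
        ∑ n ∈ Ioc A B, (if d ∣ n then ex (n * α) else 0) := fun d hd => by
      rw [sum_Ioc_filter_dvd (fun n => ex (n * α)) (Nat.pos_of_mem_divisors hd) A B]
      refine sum_congr rfl fun m _ => ?_
      push_cast; congr 1; ring
    calc expSum (mdl W) A B α = ∑ n ∈ Ioc A B, ∑ d ∈ W.divisors, ((W : ℝ) / W.totient : ℝ) *
          (((ArithmeticFunction.moebius d : ℝ) : ℂ) * (if d ∣ n then ex (n * α) else 0)) := by
          rw [expSum]
          refine sum_congr rfl fun n _ => ?_
          rw [mdl_eq_sum hW n, Complex.ofReal_mul, Complex.ofReal_sum, mul_assoc, sum_mul, mul_sum]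
          refine sum_congr rfl fun d _ => ?_
          split_ifs <;> simp
      _ = _ := by
          rw [sum_comm, mul_sum]
          refine sum_congr rfl fun d hd => ?_
          rw [h2 d hd, mul_sum, mul_sum]
  rw [h1, norm_mul, Complex.norm_real]
  have hφ : ‖(W : ℝ) / W.totient‖ ≤ W := by
    rw [Real.norm_of_nonneg (by positivity)]
    refine div_le_self (Nat.cast_nonneg _) ?_
    exact_mod_cast Nat.totient_pos.2 hW
  have hsum : ‖∑ d ∈ W.divisors, ((ArithmeticFunction.moebius d : ℝ) : ℂ) *
      ∑ m ∈ Ioc (A / d) (B / d), ex (m * (d * α))‖ ≤ W * D := by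
    refine (norm_sum_le _ _).trans ?_
    calc _ ≤ ∑ d ∈ W.divisors, 1 * D := by
          refine sum_le_sum fun d hd => ?_
          rw [norm_mul, Complex.norm_real]
          have hd0 := Nat.pos_of_mem_divisors hd
          have hdW : d ≤ W := Nat.divisor_le hd
          have hdr : (1:ℝ) ≤ d := by exact_mod_cast hd0
          have hdβ : |((d : ℤ) : ℝ)| * |β| ≤ 1 / (2 * q) := by
            refine le_trans ?_ hβ
            rw [Int.cast_natCast, Nat.abs_cast]
            have : (d : ℝ) ≤ W := by exact_mod_cast hdW
            gcongr
          have hnd : 1 / (2 * D) ≤ nd (d * α) := by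
            by_cases hqd : (q : ℤ) ∣ (d : ℤ)
            · have h2 := nd_mul_of_dvd (β := β) hq a hqd (hdβ.trans (by
                rw [div_le_div_iff₀ (by positivity) (by positivity)]; linarith))
              rw [Int.cast_natCast, Nat.abs_cast] at h2
              rw [h2, div_le_iff₀ (by positivity)]
              have h3 := h ((Int.natCast_dvd_natCast.1 hqd).trans (Nat.dvd_of_mem_divisors hd))
              nlinarith [abs_nonneg β]
            · have h2 := nd_mul_ge_of_not_dvd (β := β) hq ha hqd hdβ
              rw [Int.cast_natCast] at h2
              exact (one_div_le_one_div_of_le (by positivity) (by linarith)).trans h2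
          have hnd0 : 0 < nd (d * α) := lt_of_lt_of_le (by positivity) hnd
          refine mul_le_mul ?_ ((norm_geom_Ioc_le _ _ _ hnd0).trans ?_) (norm_nonneg _) zero_le_one
          · rw [Real.norm_eq_abs, ← Int.cast_abs]
            exact_mod_cast ArithmeticFunction.abs_moebius_le_one
          · rw [div_le_iff₀ (by positivity)] at hnd ⊢
            linarith
      _ ≤ _ := by
          rw [sum_const, nsmul_eq_mul, one_mul]
          have : (W.divisors.card : ℝ) ≤ W := by exact_mod_cast Nat.card_divisors_le_self W
          gcongr
  calc _ ≤ (W : ℝ) * (W * D) := mul_le_mul hφ hsum (norm_nonneg _) (Nat.cast_nonneg _)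
    _ = _ := by ring

/-- The model approximates the primes near fractions with denominator dividing `W`. -/
lemma norm_expSum_sub_le {W A B N : ℕ} {η β : ℝ} {c : ℤ} (hAB : A ≤ B) (hBN : B ≤ N)
    (h : ∀ x ≤ N, ‖∑ n ∈ Ioc 0 x, ((vt n - mdl W n : ℝ) : ℂ) * ex (n * (c / W))‖ ≤ η * N) :
    ‖expSum vt A B (c / W + β) - expSum (mdl W) A B (c / W + β)‖ ≤
      2 * η * N * (1 + 7 * (N * |β|)) := by
  have e : expSum vt A B (c / W + β) - expSum (mdl W) A B (c / W + β) =
      ∑ n ∈ Ioc A B, (((vt n - mdl W n : ℝ) : ℂ) * ex (n * (c / W))) * ex (n * β) := by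
    rw [expSum, expSum, ← sum_sub_distrib]
    refine sum_congr rfl fun n _ => ?_
    rw [mul_add, ex_add]; push_cast; ring
  have hη : 0 ≤ η * N := (norm_nonneg _).trans (h 0 (Nat.zero_le _))
  rw [e]
  refine (norm_sum_mul_ex_le (D := 2 * η * N) (fun t ht => ?_) β).trans ?_
  · rcases le_total t A with htA | htA
    · rw [Ioc_eq_empty_of_le htA]; simp; linarith
    · have h1 := sum_Ioc_consecutive (fun n => ((vt n - mdl W n : ℝ) : ℂ) * ex (n * (c / W)))
        (Nat.zero_le A) htA
      have h2 := eq_sub_of_add_eq' h1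
      rw [h2]
      refine (norm_sub_le _ _).trans ?_
      have := h A (hAB.trans hBN)
      have := h t (ht.trans hBN)
      linarith
  · have : (B : ℝ) ≤ N := by exact_mod_cast hBN
    have : 0 ≤ 2 * η * N := by linarith
    gcongr

/-! ### The main term -/

/-- The number of ways to write `c` as a sum of three units of `R`. -/
noncomputable def unitReps (R : Type*) [CommRing R] (c : R) : ℕ :=
  Nat.card {z : R × R // IsUnit z.1 ∧ IsUnit z.2 ∧ IsUnit (c - z.1 - z.2)}

lemma unitReps_ringEquiv {R T : Type*} [CommRing R] [CommRing T] (f : R ≃+* T) (c : R) :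
    unitReps R c = unitReps T (f c) := by
  refine Nat.card_congr (Equiv.subtypeEquiv (f.toEquiv.prodCongr f.toEquiv) fun z => ?_)
  simp [← map_sub, MulEquiv.isUnit_map]

lemma unitReps_prod {R T : Type*} [CommRing R] [CommRing T] (c : R × T) :
    unitReps (R × T) c = unitReps R c.1 * unitReps T c.2 := by
  rw [unitReps, unitReps, unitReps, ← Nat.card_prod]
  refine Nat.card_congr ((Equiv.subtypeEquiv (Equiv.prodProdProdComm R T R T)
    (q := fun z => (IsUnit z.1.1 ∧ IsUnit z.1.2 ∧ IsUnit (c.1 - z.1.1 - z.1.2)) ∧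
      (IsUnit z.2.1 ∧ IsUnit z.2.2 ∧ IsUnit (c.2 - z.2.1 - z.2.2))) fun z => ?_).trans
    (Equiv.subtypeProdEquivProd
      (p := fun z : R × R => IsUnit z.1 ∧ IsUnit z.2 ∧ IsUnit (c.1 - z.1 - z.2))
      (q := fun z : T × T => IsUnit z.1 ∧ IsUnit z.2 ∧ IsUnit (c.2 - z.1 - z.2))))
  simp only [Prod.isUnit_iff, Equiv.prodProdProdComm_apply, Prod.fst_sub, Prod.snd_sub]
  tauto

lemma unitReps_mul {m n : ℕ} (h : m.Coprime n) (N : ℕ) :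
    unitReps (ZMod (m * n)) N = unitReps (ZMod m) N * unitReps (ZMod n) N := by
  rw [unitReps_ringEquiv (ZMod.chineseRemainder h), unitReps_prod]
  simp

lemma unitReps_prime_ge {p : ℕ} (hp : p.Prime) (c : ZMod p) :
    (p - 1) * (p - 2) ≤ unitReps (ZMod p) c := by
  have : Fact p.Prime := ⟨hp⟩
  have h : unitReps (ZMod p) c = ((univ.erase (0 : ZMod p)).sigma
      fun x => (univ.erase (0 : ZMod p)).erase (c - x)).card := by
    rw [unitReps, Nat.card_eq_fintype_card, Fintype.card_subtype]
    refine card_bij (fun z _ => ⟨z.1, z.2⟩) ?_ ?_ ?_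
    · rintro ⟨x, y⟩ h
      simp only [mem_filter, isUnit_iff_ne_zero, mem_univ, true_and] at h
      simp only [mem_sigma, mem_erase, mem_univ, and_true]
      exact ⟨h.1, fun h' => h.2.2 (by rw [h', sub_self]), h.2.1⟩
    · rintro ⟨x, y⟩ _ ⟨x', y'⟩ _ h
      simpa using h
    · rintro ⟨x, y⟩ h
      simp only [mem_sigma, mem_erase, mem_univ, and_true] at h
      refine ⟨(x, y), ?_, rfl⟩
      simp only [mem_filter, isUnit_iff_ne_zero, mem_univ, true_and]
      exact ⟨h.1, h.2.2, fun h' => h.2.1 (sub_eq_zero.1 h').symm⟩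
  have hc : (univ.erase (0 : ZMod p)).card = p - 1 := by
    rw [card_erase_of_mem (mem_univ _), card_univ, ZMod.card]
  rw [h, card_sigma]
  calc (p - 1) * (p - 2) = ∑ x ∈ univ.erase (0 : ZMod p), (p - 2) := by
        rw [sum_const, hc, smul_eq_mul]
    _ ≤ _ := by
        refine sum_le_sum fun x _ => ?_
        have := pred_card_le_card_erase (s := univ.erase (0 : ZMod p)) (a := c - x)
        omega

lemma unitReps_two_pos {N : ℕ} (hN : Odd N) : 0 < unitReps (ZMod 2) N := by
  have : (N : ZMod 2) = 1 := by
    rw [← Nat.cast_one, ZMod.natCast_eq_natCast_iff]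
    exact Nat.odd_iff.1 hN
  rw [this, unitReps, Nat.card_pos_iff]
  exact ⟨⟨⟨(1, 1), by decide⟩⟩, inferInstance⟩

lemma unitReps_primorial_ge {N : ℕ} (hN : Odd N) {K : ℕ} (hK : 2 ≤ K) :
    ((primorial K).totient : ℝ) ^ 3 * (K / (K - 1)) ≤
      unitReps (ZMod (primorial K)) N * primorial K := by
  induction K, hK using Nat.le_induction with
  | base =>
    have h2 : primorial 2 = 2 := by decide
    have := unitReps_two_pos hN
    have : (1:ℝ) ≤ unitReps (ZMod 2) N := by exact_mod_cast this
    rw [h2, Nat.totient_two]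
    norm_num
    linarith
  | succ K hK ih =>
    have hK' : (2:ℝ) ≤ K := by exact_mod_cast hK
    by_cases hp : (K + 1).Prime
    · have e : primorial (K + 1) = (K + 1) * primorial K := by
        rw [primorial, primorial, range_add_one, filter_insert, if_pos hp, prod_insert]
        simp
      have hco : (K + 1).Coprime (primorial K) := by
        rw [Nat.Prime.coprime_iff_not_dvd hp, primorial]
        intro h
        obtain ⟨q, hq, hpq⟩ := (Nat.Prime.prime hp).exists_mem_finset_dvd h
        rw [mem_filter, mem_range] at hq
        have := Nat.le_of_dvd hq.2.pos hpq
        omega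
      have h1 := unitReps_prime_ge hp (N : ZMod (K + 1))
      rw [e, unitReps_mul hco, Nat.totient_mul hco, Nat.totient_prime hp]
      have h2 : (K : ℝ) * (K - 1) ≤ unitReps (ZMod (K + 1)) N := by
        have : ((K * (K - 1) : ℕ) : ℝ) ≤ unitReps (ZMod (K + 1)) N := by exact_mod_cast h1
        rwa [Nat.cast_mul, Nat.cast_sub (by omega), Nat.cast_one] at this
      push_cast
      have h3 : (0:ℝ) ≤ unitReps (ZMod (primorial K)) N * primorial K := by positivity
      calc ((K : ℝ) * (primorial K).totient) ^ 3 * (((K : ℝ) + 1) / (K + 1 - 1))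
          = (((primorial K).totient : ℝ) ^ 3 * (K / (K - 1))) * (K * (K - 1)) * (K + 1) := by
            have : (K : ℝ) - 1 ≠ 0 := by linarith
            have : (K : ℝ) ≠ 0 := by linarith
            rw [add_sub_cancel_right]
            field_simp
        _ ≤ (unitReps (ZMod (primorial K)) N * primorial K : ℝ) * unitReps (ZMod (K + 1)) N * (K + 1) := by
            have : (0:ℝ) ≤ K - 1 := by linarith
            gcongr
        _ = _ := by ring
    · have e : primorial (K + 1) = primorial K := by
        rw [primorial, primorial, range_add_one, filter_insert, if_neg hp]
      rw [e]
      refine le_trans ?_ ih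
      gcongr _ * ?_
      push_cast
      rw [div_le_div_iff₀ (by linarith) (by linarith)]
      nlinarith

lemma sum_Ioc_zmod {W : ℕ} (hW : 0 < W) (F : ZMod W → ℝ) (A t : ℕ) :
    ∑ n ∈ Ioc A (A + t * W), F n = t * ∑' x, F x := by
  have : NeZero W := ⟨hW.ne'⟩
  rw [tsum_fintype]
  induction t with
  | zero => simp
  | succ t ih =>
    rw [← sum_Ioc_consecutive _ (Nat.le_add_right A (t * W)) (by gcongr; omega), ih]
    push_cast
    rw [add_mul (t : ℝ), one_mul, add_right_inj]
    have hinj : Set.InjOn (fun n : ℕ => (n : ZMod W))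
        (Ioc (A + t * W) (A + (t + 1) * W) : Finset ℕ) := by
      intro m hm n hn h
      simp only [coe_Ioc, Set.mem_Ioc] at hm hn
      simp only [ZMod.natCast_eq_natCast_iff] at h
      have h' := (Nat.modEq_iff_dvd.1 h)
      have h4 : (t + 1) * W = t * W + W := by ring
      have := Int.eq_zero_of_abs_lt_dvd h' (by rw [abs_lt]; omega)
      omega
    rw [← sum_image (f := F) hinj]
    refine sum_congr ?_ fun _ _ => rfl
    rw [← card_eq_iff_eq_univ, card_image_of_injOn hinj, Nat.card_Ioc, ZMod.card]
    have h4 : (t + 1) * W = t * W + W := by ring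
    omega

/-- The number of ternary representations in the model. -/
lemma sum_mdl_primorial_ge {K N A B t : ℕ} (hK : 2 ≤ K) (hN : Odd N)
    (hB : A + t * primorial K ≤ B) (hA : 3 * A + 2 * (t * primorial K) < N)
    (hN' : N ≤ 2 * A + B) :
    ((t * primorial K : ℕ) : ℝ) ^ 2 ≤ ∑ n₁ ∈ Ioc A B, ∑ n₂ ∈ Ioc A B, ∑ n₃ ∈ Ioc A B,
      (if n₁ + n₂ + n₃ = N then
        mdl (primorial K) n₁ * mdl (primorial K) n₂ * mdl (primorial K) n₃ else 0) := by
  set W := primorial K with hWdef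
  have hW : 0 < W := primorial_pos K
  have : NeZero W := ⟨hW.ne'⟩
  set κ : ℝ := (W : ℝ) / W.totient with hκ
  have hκ0 : 0 ≤ κ := by positivity
  classical
  set G : ZMod W → ZMod W → ℝ := fun x y =>
    if IsUnit x ∧ IsUnit y ∧ IsUnit ((N : ZMod W) - x - y) then κ ^ 3 else 0 with hG
  have hnn : ∀ n₁ n₂ n₃ : ℕ,
      0 ≤ (if n₁ + n₂ + n₃ = N then mdl W n₁ * mdl W n₂ * mdl W n₃ else 0) := fun n₁ n₂ n₃ => by
    split_ifs
    · exact mul_nonneg (mul_nonneg (mdl_nonneg _ _) (mdl_nonneg _ _)) (mdl_nonneg _ _)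
    · exact le_rfl
  have hsub : Ioc A (A + t * W) ⊆ Ioc A B := Ioc_subset_Ioc le_rfl hB
  calc ((t * W : ℕ) : ℝ) ^ 2 ≤ t * (t * (unitReps (ZMod W) N * κ ^ 3)) := by
        have h1 := unitReps_primorial_ge hN hK
        rw [← hWdef] at h1
        have hφ : (0:ℝ) < W.totient := by exact_mod_cast Nat.totient_pos.2 hW
        have hWr : (0:ℝ) < W := by exact_mod_cast hW
        have hKr : (2:ℝ) ≤ K := by exact_mod_cast hK
        have h2 : (1:ℝ) ≤ K / (K - 1) := by
          rw [le_div_iff₀ (by linarith)]; linarith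
        have h3 : (W.totient : ℝ) ^ 3 ≤ unitReps (ZMod W) N * W :=
          le_trans (le_mul_of_one_le_right (by positivity) h2) h1
        have h4 : (W : ℝ) ^ 2 ≤ unitReps (ZMod W) N * κ ^ 3 := by
          rw [hκ, div_pow, mul_div_assoc', le_div_iff₀ (by positivity)]
          calc (W : ℝ) ^ 2 * W.totient ^ 3 ≤ W ^ 2 * (unitReps (ZMod W) N * W) := by gcongr
            _ = _ := by ring
        calc ((t * W : ℕ) : ℝ) ^ 2 = t * (t * (W : ℝ) ^ 2) := by push_cast; ring
          _ ≤ _ := by gcongr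
    _ = ∑ n₁ ∈ Ioc A (A + t * W), ∑ n₂ ∈ Ioc A (A + t * W), G n₁ n₂ := by
        have h1 : ∀ n₁ : ℕ, ∑ n₂ ∈ Ioc A (A + t * W), G n₁ n₂ = t * ∑' y, G n₁ y := fun n₁ =>
          sum_Ioc_zmod hW (G n₁) A t
        rw [sum_congr rfl fun n₁ _ => h1 n₁, ← mul_sum, sum_Ioc_zmod hW (fun x => ∑' y, G x y) A t]
        simp only [tsum_fintype]
        congr 2
        rw [← Fintype.sum_prod_type', hG, ← sum_filter, sum_const, nsmul_eq_mul, unitReps,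
          Nat.card_eq_fintype_card, Fintype.card_subtype]
    _ ≤ ∑ n₁ ∈ Ioc A (A + t * W), ∑ n₂ ∈ Ioc A (A + t * W), ∑ n₃ ∈ Ioc A B,
          (if n₁ + n₂ + n₃ = N then mdl W n₁ * mdl W n₂ * mdl W n₃ else 0) := by
        refine sum_le_sum fun n₁ h₁ => sum_le_sum fun n₂ h₂ => ?_
        rw [mem_Ioc] at h₁ h₂
        have hle : n₁ + n₂ ≤ N := by omega
        refine le_trans ?_ (single_le_sum (f := fun n₃ => if n₁ + n₂ + n₃ = N then
          mdl W n₁ * mdl W n₂ * mdl W n₃ else 0) (fun n₃ _ => hnn n₁ n₂ n₃)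
          (a := N - n₁ - n₂) (by rw [mem_Ioc]; omega))
        rw [if_pos (by omega)]
        have hc : ((N - n₁ - n₂ : ℕ) : ZMod W) = N - n₁ - n₂ := by
          rw [Nat.cast_sub (by omega), Nat.cast_sub (by omega)]
        simp only [hG, ← hc, ZMod.isUnit_iff_coprime]
        split_ifs with h
        · rw [mdl, mdl, mdl, if_pos h.1, if_pos h.2.1, if_pos h.2.2, ← hκ]
          exact le_of_eq (by ring)
        · exact mul_nonneg (mul_nonneg (mdl_nonneg _ _) (mdl_nonneg _ _)) (mdl_nonneg _ _)
    _ ≤ ∑ n₁ ∈ Ioc A (A + t * W), ∑ n₂ ∈ Ioc A B, ∑ n₃ ∈ Ioc A B,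
          (if n₁ + n₂ + n₃ = N then mdl W n₁ * mdl W n₂ * mdl W n₃ else 0) :=
        sum_le_sum fun n₁ _ => sum_le_sum_of_subset_of_nonneg hsub
          fun n₂ _ _ => sum_nonneg fun n₃ _ => hnn n₁ n₂ n₃
    _ ≤ _ := sum_le_sum_of_subset_of_nonneg hsub
          fun n₁ _ _ => sum_nonneg fun n₂ _ => sum_nonneg fun n₃ _ => hnn n₁ n₂ n₃

lemma mdl_factorial (K n : ℕ) : mdl K.factorial n = mdl (primorial K) n := by
  have hp : (primorial K).primeFactors = K.factorial.primeFactors := by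
    ext p
    rw [Nat.mem_primeFactors_of_ne_zero (primorial_pos K).ne',
      Nat.mem_primeFactors_of_ne_zero K.factorial_ne_zero]
    refine and_congr_right fun hp => ?_
    rw [hp.dvd_factorial, primorial]
    refine ⟨fun h => ?_, fun h => dvd_prod_of_mem _ ?_⟩
    · obtain ⟨q, hq, hpq⟩ := (Nat.Prime.prime hp).exists_mem_finset_dvd h
      rw [mem_filter, mem_range] at hq
      have := Nat.le_of_dvd hq.2.pos hpq
      omega
    · rw [mem_filter, mem_range]; exact ⟨by omega, hp⟩
  have hc : ∀ m : ℕ, m ≠ 0 → (n.Coprime m ↔ ∀ p ∈ m.primeFactors, ¬ p ∣ n) := fun m hm => by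
    rw [Nat.coprime_comm]
    constructor
    · intro h p hp hpn
      exact Nat.not_coprime_of_dvd_of_dvd (Nat.prime_of_mem_primeFactors hp).one_lt
        (Nat.dvd_of_mem_primeFactors hp) hpn h
    · intro h
      refine Nat.coprime_of_dvd fun p hp hpm hpn => h p ?_ hpn
      exact (Nat.mem_primeFactors_of_ne_zero hm).2 ⟨hp, hpm⟩
  have hr : ∀ m : ℕ, m ≠ 0 → (m : ℝ) / m.totient = (∏ p ∈ m.primeFactors, (1 - (p : ℝ)⁻¹))⁻¹ :=
    fun m hm => by
      have h := congrArg (fun x : ℚ => (x : ℝ)) (Nat.totient_eq_mul_prod_factors m)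
      push_cast at h
      have : (m : ℝ) ≠ 0 := by exact_mod_cast hm
      rw [h, div_mul_eq_div_div, div_self this, one_div]
  simp only [mdl, hr _ K.factorial_ne_zero, hr _ (primorial_pos K).ne', hp,
    hc _ K.factorial_ne_zero, hc _ (primorial_pos K).ne']

/-! ### Pointwise bounds for the exponential sum over primes -/

lemma eventually_le_log (C : ℝ) : ∀ᶠ N : ℕ in atTop, C ≤ Real.log N :=
  (Real.tendsto_log_atTop.comp tendsto_natCast_atTop_atTop).eventually_ge_atTop C

lemma eventually_log_pow_le_sqrt (C : ℝ) (m : ℕ) :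
    ∀ᶠ N : ℕ in atTop, C * Real.log N ^ m ≤ √(N : ℝ) := by
  have h := (isLittleO_log_rpow_rpow_atTop (m : ℝ) (s := 1 / 2) (by norm_num)).comp_tendsto
    (tendsto_natCast_atTop_atTop (R := ℝ))
  have h1 := h.bound (c := (|C| + 1)⁻¹) (by positivity)
  filter_upwards [h1, eventually_le_log 0] with N hN hl
  simp only [Function.comp_apply, Real.rpow_natCast, ← Real.sqrt_eq_rpow] at hN
  rw [Real.norm_of_nonneg (by positivity), Real.norm_of_nonneg (by positivity),
    inv_mul_eq_div, le_div_iff₀ (by positivity)] at hN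
  have h2 : (0:ℝ) ≤ Real.log N ^ m := by positivity
  nlinarith [le_abs_self C]

lemma eventually_loglog_pow_div_log_le (m : ℕ) {c : ℝ} (hc : 0 < c) :
    ∀ᶠ N : ℕ in atTop, Real.log (Real.log N) ^ m / Real.log N ≤ c := by
  have h := (Real.isLittleO_pow_log_id_atTop (n := m)).comp_tendsto
    (Real.tendsto_log_atTop.comp (tendsto_natCast_atTop_atTop (R := ℝ)))
  filter_upwards [h.bound hc, eventually_le_log 1] with N hN hl
  simp only [Function.comp_apply, id] at hN
  rw [div_le_iff₀ (by linarith)]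
  rw [Real.norm_of_nonneg (r := Real.log N) (by linarith)] at hN
  exact (le_abs_self _).trans hN

lemma norm_expSum_vt_le {A B : ℕ} (hA : 1 ≤ A) (hAB : A ≤ B) {α DA DB : ℝ}
    (hDA : ‖∑ n ∈ Ioc 0 A, (vonMangoldt n : ℂ) * ex (n * α)‖ ≤ DA)
    (hDB : ‖∑ n ∈ Ioc 0 B, (vonMangoldt n : ℂ) * ex (n * α)‖ ≤ DB) :
    ‖expSum vt A B α‖ ≤ DA + DB + 4 * √B * Real.log B := by
  have key : ∀ x : ℕ, 1 ≤ x → ‖(∑ n ∈ Ioc 0 x, (vt n : ℂ) * ex (n * α)) -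
      ∑ n ∈ Ioc 0 x, (vonMangoldt n : ℂ) * ex (n * α)‖ ≤ 2 * √x * Real.log x := fun x hx => by
    rw [← sum_sub_distrib]
    refine (norm_sum_le _ _).trans ((sum_le_sum fun n _ => ?_).trans (sum_vonMangoldt_sub_vt_le hx))
    rw [← sub_mul, norm_mul, norm_ex, mul_one, ← Complex.ofReal_sub, Complex.norm_real,
      Real.norm_eq_abs, abs_sub_comm]
    exact (abs_of_nonneg (by linarith [vt_le_vonMangoldt n])).le
  have h1 := sum_Ioc_consecutive (fun n => (vt n : ℂ) * ex (n * α)) (Nat.zero_le A) hAB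
  have e : expSum vt A B α = ((∑ n ∈ Ioc 0 B, (vt n : ℂ) * ex (n * α)) -
      ∑ n ∈ Ioc 0 B, (vonMangoldt n : ℂ) * ex (n * α)) -
      ((∑ n ∈ Ioc 0 A, (vt n : ℂ) * ex (n * α)) -
      ∑ n ∈ Ioc 0 A, (vonMangoldt n : ℂ) * ex (n * α)) +
      (∑ n ∈ Ioc 0 B, (vonMangoldt n : ℂ) * ex (n * α)) -
      ∑ n ∈ Ioc 0 A, (vonMangoldt n : ℂ) * ex (n * α) := by
    rw [expSum, ← h1]; ring
  have hA' := key A hA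
  have hB' := key B (hA.trans hAB)
  have hmono : 2 * √A * Real.log A ≤ 2 * √B * Real.log B := by
    have hA1 : (1:ℝ) ≤ A := by exact_mod_cast hA
    have hABr : (A:ℝ) ≤ B := by exact_mod_cast hAB
    have := Real.log_nonneg hA1
    gcongr
  rw [e]
  refine (norm_sub_le _ _).trans ?_
  have h2 := norm_add_le ((∑ n ∈ Ioc 0 B, (vt n : ℂ) * ex (n * α)) -
      ∑ n ∈ Ioc 0 B, (vonMangoldt n : ℂ) * ex (n * α) -
      ((∑ n ∈ Ioc 0 A, (vt n : ℂ) * ex (n * α)) -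
      ∑ n ∈ Ioc 0 A, (vonMangoldt n : ℂ) * ex (n * α)))
      (∑ n ∈ Ioc 0 B, (vonMangoldt n : ℂ) * ex (n * α))
  have h3 := norm_sub_le ((∑ n ∈ Ioc 0 B, (vt n : ℂ) * ex (n * α)) -
      ∑ n ∈ Ioc 0 B, (vonMangoldt n : ℂ) * ex (n * α))
      ((∑ n ∈ Ioc 0 A, (vt n : ℂ) * ex (n * α)) -
      ∑ n ∈ Ioc 0 A, (vonMangoldt n : ℂ) * ex (n * α))
  linarith

lemma eventually_norm_expSum_minor_le : ∀ᶠ N : ℕ in atTop, ∀ A B : ℕ, N ≤ 4 * A → A ≤ B →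
    2 * B ≤ N → ∀ (q : ℕ) (a : ℤ) (β : ℝ), IsCoprime a (q : ℤ) → 2 * Real.log N ^ 24 ≤ q →
    q * Real.log N ^ 40 ≤ N → |β| ≤ 1 / (q : ℝ) ^ 2 →
    ‖expSum vt A B (a / q + β)‖ ≤ 2000 * (N / Real.log N ^ 2) := by
  filter_upwards [eventually_le_log 4, eventually_log_pow_le_sqrt 1 3, eventually_ge_atTop 4] with
    N hl hs hN4 A B hA hAB hB q a β ha hq1 hq2 hβ
  set l := Real.log N with hldef
  have hN0 : (0:ℝ) < N := by exact_mod_cast (by omega : 0 < N)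
  have hl0 : 0 < l := by linarith
  have hl12 : (4:ℝ) ≤ l ^ 12 := hl.trans (le_self_pow₀ (by linarith) (by norm_num))
  set U := ⌊l ^ 12⌋₊ with hU
  have hU1 : 1 ≤ U := by
    rw [hU, Nat.one_le_floor_iff]; linarith
  have hUle : (U : ℝ) ≤ l ^ 12 := Nat.floor_le (by positivity)
  have hUge : l ^ 12 / 4 ≤ U := by
    have := Nat.sub_one_lt_floor (l ^ 12)
    rw [← hU] at this
    linarith
  have hsU : l ^ 6 / 2 ≤ √U := by
    apply Real.le_sqrt_of_sq_le
    refine le_trans (le_of_eq (by ring)) hUge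
  have hUq : 2 * U ^ 2 ≤ q := by
    have : (2 * (U:ℝ) ^ 2) ≤ q := by
      calc (2 * (U:ℝ) ^ 2) ≤ 2 * (l ^ 12) ^ 2 := by gcongr
        _ = 2 * l ^ 24 := by ring
        _ ≤ q := hq1
    exact_mod_cast this
  have key : ∀ x : ℕ, N ≤ 4 * x → 2 * x ≤ N →
      ‖∑ n ∈ Ioc 0 x, (vonMangoldt n : ℂ) * ex (n * (a / q + β))‖ ≤ 800 * (N / l ^ 2) := by
    intro x hx hxN
    have hxN' : 2 * (x:ℝ) ≤ N := by exact_mod_cast hxN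
    have hx' : (N:ℝ) ≤ 4 * x := by exact_mod_cast hx
    have hx0 : (0:ℝ) < x := by linarith
    have hqx : q * U ^ 3 ≤ x := by
      have : (q : ℝ) * U ^ 3 ≤ x := by
        have h1 : (q : ℝ) * U ^ 3 ≤ q * l ^ 36 := by
          calc (q : ℝ) * U ^ 3 ≤ q * (l ^ 12) ^ 3 := by gcongr
            _ = _ := by ring
        have h2 : (q : ℝ) * l ^ 40 = q * l ^ 36 * l ^ 4 := by ring
        have h3 : 4 ≤ l ^ 4 := hl.trans (le_self_pow₀ (by linarith) (by norm_num))
        have h4 : (0:ℝ) ≤ q * l ^ 36 := by positivity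
        nlinarith
      exact_mod_cast this
    have h := minor_sum_le hU1 hUq hqx ha hβ
    refine h.trans ?_
    have hlog : 1 + Real.log x ≤ 2 * l := by
      have := Real.log_le_log hx0 (by linarith : (x:ℝ) ≤ N)
      linarith
    have hlog0 : 0 ≤ 1 + Real.log x := by
      have : 0 ≤ Real.log (x:ℝ) := Real.log_natCast_nonneg x
      linarith
    calc 50 * ((1 + Real.log x) ^ 4 * x / √U)
        ≤ 50 * ((2 * l) ^ 4 * (N / 2) / (l ^ 6 / 2)) := by
          gcongr
          linarith
      _ = 800 * (N / l ^ 2) := by field_simp; ring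
  have hA1 : 1 ≤ A := by omega
  refine (norm_expSum_vt_le hA1 hAB (key A hA (by omega)) (key B (by omega) hB)).trans ?_
  have hBN : (B : ℝ) ≤ N := by exact_mod_cast (by omega : B ≤ N)
  have hB0 : (0:ℝ) < B := by exact_mod_cast (by omega : 0 < B)
  have h1 : 4 * √B * Real.log B ≤ 4 * √N * l := by
    have : 0 ≤ Real.log (B:ℝ) := Real.log_natCast_nonneg B
    have : Real.log B ≤ l := Real.log_le_log hB0 hBN
    gcongr
  have h2 : √N * l ≤ N / l ^ 2 := by
    rw [le_div_iff₀ (by positivity)]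
    calc √N * l * l ^ 2 = √N * (1 * l ^ 3) := by ring
      _ ≤ √N * √N := by gcongr
      _ = N := Real.mul_self_sqrt hN0.le
  have h3 : 0 ≤ N / l ^ 2 := by positivity
  linarith

lemma eventually_norm_expSum_major_le : ∀ᶠ N : ℕ in atTop, ∀ A B : ℕ, N ≤ 4 * A → A ≤ B →
    2 * B ≤ N → ∀ (q : ℕ) (a : ℤ) (β : ℝ), 0 < q → IsCoprime a (q : ℤ) →
    q ≤ 2 * Real.log N ^ 24 → |β| * N ≤ Real.log N ^ 40 →
    ‖expSum vt A B (a / q + β)‖ ≤ 10 ^ 12 * (N * ((q : ℝ) ^ (-(1 / 3) : ℝ) / √(max 1 √(|β| * N)) +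
      Real.log (Real.log N) ^ 3 / Real.log N)) := by
  filter_upwards [eventually_le_log 1000, eventually_log_pow_le_sqrt 4 1600] with
    N hl hs A B hA hAB hB q a β hq0 ha hq hβ
  set l := Real.log N with hldef
  have hN0 : (0:ℝ) < N := by
    rcases Nat.eq_zero_or_pos N with h | h
    · rw [hldef, h] at hl; norm_num at hl
    · exact_mod_cast h
  have hl0 : 0 < l := by linarith
  have hl1 : 1 ≤ l := by linarith
  have hN1 : 1 ≤ √(N:ℝ) := by
    have : (1:ℝ) ≤ l ^ 1600 := one_le_pow₀ hl1
    linarith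
  have hNs : √(N:ℝ) * √N = N := Real.mul_self_sqrt hN0.le
  have hs4 : 4 * √(N:ℝ) ≤ N := by
    have : (1:ℝ) ≤ l ^ 1600 := one_le_pow₀ hl1
    nlinarith
  have hll : 1 ≤ Real.log l := by
    rw [Real.le_log_iff_exp_le hl0]
    linarith [Real.exp_one_lt_d9]
  set P := l ^ 40 with hP
  have hlP : l ≤ P := le_self_pow₀ hl1 (by norm_num)
  have hlogP : Real.log P = 40 * Real.log l := by
    rw [hP, Real.log_pow]; norm_num
  set Z := (q : ℝ) ^ (-(1 / 3) : ℝ) / √(max 1 √(|β| * N)) with hZ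
  have hZ0 : 0 ≤ Z := by positivity
  have key : ∀ x : ℕ, N ≤ 4 * x → 2 * x ≤ N →
      ‖∑ n ∈ Ioc 0 x, (vonMangoldt n : ℂ) * ex (n * (a / q + β))‖ ≤
        4 * 10 ^ 11 * (N * (Z + Real.log l ^ 3 / l)) := by
    intro x hx hxN
    have hxN' : 2 * (x:ℝ) ≤ N := by exact_mod_cast hxN
    have hx' : (N:ℝ) ≤ 4 * x := by exact_mod_cast hx
    have hx0 : (0:ℝ) < x := by linarith
    have hxl : Real.log x ≤ l := Real.log_le_log hx0 (by linarith)
    have hxl' : l / 2 ≤ Real.log x := by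
      have : Real.log (√N) ≤ Real.log x := Real.log_le_log (by linarith) (by linarith)
      rwa [Real.log_sqrt hN0.le] at this
    have hqP : (q:ℝ) ≤ P := by
      refine hq.trans ?_
      have e : P = l ^ 16 * l ^ 24 := by rw [hP]; ring
      rw [e]
      have : (2:ℝ) ≤ l ^ 16 := (by linarith : (2:ℝ) ≤ l).trans (le_self_pow₀ hl1 (by norm_num))
      gcongr
    have hPx : P ^ 40 ≤ x := by
      have : P ^ 40 = l ^ 1600 := by rw [hP, ← pow_mul]
      rw [this]; linarith
    have hβx : |β| * x ≤ P := le_trans (by gcongr; linarith) hβ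
    have h := major_sum_le hq0 ha (hl.trans hlP) (hxl.trans hlP) hqP hβx hPx
    have hZ' : √q / q.totient / √(max 1 √(|β| * x)) ≤ 20 * Z := by
      have h1 : √(|β| * N) ≤ 2 * √(|β| * x) := by
        rw [show (2:ℝ) = √4 by rw [show (4:ℝ) = 2 ^ 2 by norm_num, Real.sqrt_sq (by norm_num)],
          ← Real.sqrt_mul (by norm_num)]
        apply Real.sqrt_le_sqrt
        nlinarith [abs_nonneg β]
      have h2 : max 1 √(|β| * N) ≤ 4 * max 1 √(|β| * x) := by
        refine max_le ?_ ?_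
        · linarith [le_max_left 1 √(|β| * x)]
        · linarith [le_max_right 1 √(|β| * x), Real.sqrt_nonneg (|β| * x)]
      have h3 : √(max 1 √(|β| * N)) ≤ 2 * √(max 1 √(|β| * x)) := by
        rw [show (2:ℝ) = √4 by rw [show (4:ℝ) = 2 ^ 2 by norm_num, Real.sqrt_sq (by norm_num)],
          ← Real.sqrt_mul (by norm_num)]
        exact Real.sqrt_le_sqrt h2
      have h4 : 0 < √(max 1 √(|β| * N)) := Real.sqrt_pos.2 (by positivity)
      have h5 : 0 < √(max 1 √(|β| * x)) := Real.sqrt_pos.2 (by positivity)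
      have h6 := sqrt_div_totient_le q hq0
      rw [hZ, div_le_iff₀ h5]
      calc √q / q.totient ≤ 10 * (q : ℝ) ^ (-(1 / 3) : ℝ) := h6
        _ = 20 * ((q : ℝ) ^ (-(1 / 3) : ℝ) / √(max 1 √(|β| * N))) * (√(max 1 √(|β| * N)) / 2) := by
            field_simp; norm_num
        _ ≤ _ := by gcongr; linarith
    have hlx : 0 < Real.log x := by linarith
    refine le_of_mul_le_mul_right (h.trans ?_) hlx
    rw [hlogP]
    have e1 : (x:ℝ) * (40 * Real.log l) ^ 3 ≤ 64000 * N * (Real.log l ^ 3 / l) * Real.log x := by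
      have h1 : (x:ℝ) ≤ N / 2 := by linarith
      calc (x:ℝ) * (40 * Real.log l) ^ 3 ≤ N / 2 * (40 * Real.log l) ^ 3 := by gcongr
        _ = 64000 * N * (Real.log l ^ 3 / l) * (l / 2) := by field_simp; ring
        _ ≤ _ := by gcongr
    have e2 : (x:ℝ) * Real.log x * (√q / q.totient / √(max 1 √(|β| * x))) ≤
        20 * (N * Z) * Real.log x := by
      calc _ ≤ (N:ℝ) * Real.log x * (20 * Z) := by
            gcongr; linarith
        _ = _ := by ring
    have e3 : 0 ≤ N * Z * Real.log x := by positivity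
    have e4 : 0 ≤ N * (Real.log l ^ 3 / l) * Real.log x := by positivity
    nlinarith
  have hA1 : 1 ≤ A := by
    have : (1:ℝ) ≤ N := by linarith
    have : 1 ≤ N := by exact_mod_cast this
    omega
  refine (norm_expSum_vt_le hA1 hAB (key A hA (by omega)) (key B (by omega) hB)).trans ?_
  have hBN : (B : ℝ) ≤ N := by exact_mod_cast (by omega : B ≤ N)
  have hB0 : (0:ℝ) < B := by exact_mod_cast (by omega : 0 < B)
  have h1 : 4 * √B * Real.log B ≤ 4 * √N * l := by
    have : 0 ≤ Real.log (B:ℝ) := Real.log_natCast_nonneg B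
    have : Real.log B ≤ l := Real.log_le_log hB0 hBN
    gcongr
  have h2 : √N * l ≤ N * (Real.log l ^ 3 / l) := by
    have h3 : l ^ 2 ≤ √N := by
      have : l ^ 2 ≤ l ^ 1600 := pow_le_pow_right₀ hl1 (by norm_num)
      linarith [pow_nonneg hl0.le 1600]
    have h4 : 1 ≤ Real.log l ^ 3 := one_le_pow₀ hll
    calc √N * l = √N * l ^ 2 * (1 / l) := by field_simp
      _ ≤ √N * √N * (Real.log l ^ 3 / l) := by gcongr
      _ = _ := by rw [hNs]
  have e3 : 0 ≤ N * Z := by positivity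
  have e4 : 0 ≤ N * (Real.log l ^ 3 / l) := by positivity
  nlinarith

/-! ### Third moments over the arcs -/

lemma energy_expSum_le {N A B i : ℕ} {r : ℝ} (hN : 16 ≤ N) (hr : 1 ≤ r)
    (h : 3 * r * 4 ^ i ≤ √(N : ℝ)) (hA : N ≤ 4 * A) (hAB : A ≤ B) (hB : B ≤ N) (s : Finset ℕ)
    (hs : ∀ k ∈ s, k < 2 * N ∧ ∃ (q : ℕ) (a : ℤ), 0 < q ∧ q ≤ 2 ^ i ∧
      |(k : ℝ) / (2 * N : ℕ) - a / q| * N ≤ r) :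
    ∑ k ∈ s, ‖expSum vt A B ((k : ℝ) / (2 * N : ℕ))‖ ^ 2 ≤ 40000 * N ^ 2 * ((i : ℝ) + 1) ^ 4 := by
  have hNr : (16:ℝ) ≤ N := by exact_mod_cast hN
  have hN0 : (0:ℝ) < N := by linarith
  have hNs : √(N:ℝ) * √N = N := Real.mul_self_sqrt hN0.le
  have hs0 : 0 < √(N:ℝ) := Real.sqrt_pos.2 hN0
  obtain ⟨L, rfl⟩ := Nat.exists_eq_add_of_le hAB
  refine energy_le (ρ := r / N) hN rfl ?_ ?_ hB s fun k hk => ?_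
  · have h4 : (0:ℝ) < 4 ^ i := by positivity
    push_cast
    have e : 1 / (2 * (N:ℝ)) + 2 * (r / N) ≤ 3 * r / N := by
      have : 1 / (2 * (N:ℝ)) = (1 / 2) / N := by rw [div_div]
      rw [this, mul_div_assoc', ← add_div]
      gcongr
      linarith
    refine e.trans ?_
    rw [div_le_div_iff₀ hN0 (by positivity)]
    calc 3 * r * (4 ^ i * √N) = 3 * r * 4 ^ i * √N := by ring
      _ ≤ √N * √N := by gcongr
      _ = 1 * N := by rw [hNs, one_mul]
  · have hA' : (N:ℝ) ≤ 4 * A := by exact_mod_cast hA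
    have : 4 ≤ √(N:ℝ) := Real.le_sqrt_of_sq_le (by linarith)
    nlinarith
  · obtain ⟨hk1, q, a, hq, hqi, h1⟩ := hs k hk
    refine ⟨hk1, a, q, hq, hqi, ?_⟩
    rwa [le_div_iff₀ hN0]

lemma rpow_neg_third_le_two_mul {q : ℕ} (hq : 0 < q) :
    (q : ℝ) ^ (-(1 / 3) : ℝ) ≤ 2 * ((2 : ℝ) ^ (-(1 / 3) : ℝ)) ^ (Nat.clog 2 q + 1) := by
  have h1 : (2:ℝ) ^ (Nat.clog 2 q + 1) / 4 ≤ q := by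
    have : 2 ^ (Nat.clog 2 q) ≤ 2 * q := by
      rcases Nat.lt_or_ge 1 q with h | h
      · have := Nat.pow_pred_clog_lt_self (b := 2) (by norm_num) h
        have h2 : 0 < Nat.clog 2 q := Nat.clog_pos (by norm_num) h
        obtain ⟨m, hm⟩ : ∃ m, Nat.clog 2 q = m + 1 := ⟨Nat.clog 2 q - 1, by omega⟩
        rw [hm] at this ⊢
        simp only [Nat.pred_succ] at this
        rw [pow_succ]; omega
      · have : q = 1 := by omega
        rw [this]; simp
    have : (2:ℝ) ^ (Nat.clog 2 q) ≤ 2 * q := by exact_mod_cast this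
    rw [pow_succ]; linarith
  calc (q : ℝ) ^ (-(1 / 3) : ℝ) ≤ ((2:ℝ) ^ (Nat.clog 2 q + 1) / 4) ^ (-(1 / 3) : ℝ) :=
        Real.rpow_le_rpow_of_nonpos (by positivity) h1 (by norm_num)
    _ = (4:ℝ) ^ (1 / 3 : ℝ) * ((2 : ℝ) ^ (-(1 / 3) : ℝ)) ^ (Nat.clog 2 q + 1) := by
        rw [Real.div_rpow (by positivity) (by norm_num), Real.rpow_neg (x := 4) (by norm_num),
          div_inv_eq_mul, mul_comm, ← Real.rpow_natCast, ← Real.rpow_natCast,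
          ← Real.rpow_mul (by norm_num), ← Real.rpow_mul (by norm_num), mul_comm (-(1 / 3) : ℝ)]
    _ ≤ _ := by
        gcongr
        calc (4:ℝ) ^ (1 / 3 : ℝ) ≤ 4 ^ (1 / 2 : ℝ) :=
              Real.rpow_le_rpow_of_exponent_le (by norm_num) (by norm_num)
          _ = 2 := by
              rw [← Real.sqrt_eq_rpow, show (4:ℝ) = 2 ^ 2 by norm_num, Real.sqrt_sq (by norm_num)]

lemma exists_tail_le {c : ℝ} (hc : 0 < c) : ∃ i₀ : ℕ, ∀ n : ℕ,
    ∑ i ∈ Ico i₀ n, ((2 : ℝ) ^ (-(1 / 3) : ℝ)) ^ (i + 1) * ((i : ℝ) + 1) ^ 4 ≤ c := by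
  set r : ℝ := (2 : ℝ) ^ (-(1 / 3) : ℝ) with hr
  have hr0 : 0 < r := by positivity
  have hr1 : r < 1 := Real.rpow_lt_one_of_one_lt_of_neg (by norm_num) (by norm_num)
  set f : ℕ → ℝ := fun i => r ^ (i + 1) * ((i : ℝ) + 1) ^ 4 with hf
  have hsum : Summable f := by
    have h := summable_pow_mul_geometric_of_norm_lt_one 4
      (by rwa [Real.norm_of_nonneg hr0.le] : ‖r‖ < 1)
    have h2 := (summable_nat_add_iff 1).2 h
    refine h2.congr fun i => ?_
    rw [hf]; push_cast; ring
  have h := (tendsto_sum_nat_add f).eventually (eventually_le_nhds hc)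
  obtain ⟨i₀, hi₀⟩ := h.exists
  refine ⟨i₀, fun n => ?_⟩
  change ∑ i ∈ Ico i₀ n, f i ≤ c
  rw [sum_Ico_eq_sum_range]
  refine le_trans ?_ hi₀
  have hs' : Summable fun k => f (k + i₀) := (summable_nat_add_iff i₀).2 hsum
  refine le_trans (le_of_eq (sum_congr rfl fun k _ => by rw [add_comm])) (hs'.sum_le_tsum _ ?_)
  intro k _
  positivity

/-- Fractions with a large denominator contribute little to the third moment. -/
lemma exists_sum_cube_large_denominator_le {c : ℝ} (hc : 0 < c) : ∃ i₀ : ℕ, ∀ᶠ N : ℕ in atTop,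
    ∀ A B : ℕ, N ≤ 4 * A → A ≤ B → 2 * B ≤ N → ∀ s : Finset ℕ,
    (∀ k ∈ s, k < 2 * N ∧ ∃ (q : ℕ) (a : ℤ), 0 < q ∧ IsCoprime a (q : ℤ) ∧ 2 ^ i₀ ≤ q ∧
      q ≤ 2 * Real.log N ^ 24 ∧ |(k : ℝ) / (2 * N : ℕ) - a / q| * N ≤ Real.log N ^ 40) →
    ∑ k ∈ s, ‖expSum vt A B ((k : ℝ) / (2 * N : ℕ))‖ ^ 3 ≤ c * N ^ 3 := by
  set C : ℝ := 10 ^ 12 * 40000 with hC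
  have hC0 : 0 < C := by positivity
  obtain ⟨i₀, hi₀⟩ := exists_tail_le (c := c / (4 * C)) (by positivity)
  refine ⟨i₀, ?_⟩
  filter_upwards [eventually_norm_expSum_major_le, eventually_le_log 1000,
    eventually_log_pow_le_sqrt 48 88, eventually_ge_atTop 16,
    eventually_loglog_pow_div_log_le 8 (c := c / (2 * C * 41 ^ 5)) (by positivity)] with
    N hmaj hl hs88 hN16 hll8 A B hA hAB hB s hs
  set l := Real.log N with hldef
  set r : ℝ := (2 : ℝ) ^ (-(1 / 3) : ℝ) with hr
  have hl0 : 0 < l := by linarith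
  have hl1 : 1 ≤ l := by linarith
  have hll : 1 ≤ Real.log l := by
    rw [Real.le_log_iff_exp_le hl0]
    linarith [Real.exp_one_lt_d9]
  set y := Real.log l with hy
  set n₁ := ⌊40 * y⌋₊ + 1 with hn₁
  have hn₁le : (n₁ : ℝ) ≤ 41 * y := by
    have := Nat.floor_le (a := 40 * y) (by linarith)
    rw [hn₁]; push_cast; linarith
  have hs' : ∀ k, ∃ (q : ℕ) (a : ℤ), k ∈ s → k < 2 * N ∧ (0 < q ∧ IsCoprime a (q : ℤ) ∧ 2 ^ i₀ ≤ q ∧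
      (q : ℝ) ≤ 2 * l ^ 24 ∧ |(k : ℝ) / (2 * N : ℕ) - a / q| * N ≤ l ^ 40) := fun k => by
    by_cases hk : k ∈ s
    · obtain ⟨h1, q, a, h2⟩ := hs k hk
      exact ⟨q, a, fun _ => ⟨h1, h2⟩⟩
    · exact ⟨0, 0, fun h => absurd h hk⟩
  choose q a hqa using hs'
  have hlev : ∀ k ∈ s, Nat.clog 2 (q k) ∈ Ico i₀ n₁ ∧ (4:ℝ) ^ Nat.clog 2 (q k) ≤ 16 * l ^ 48 := by
    intro k hk
    obtain ⟨-, hq0, -, hq1, hq2, -⟩ := hqa k hk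
    have h1 : (2:ℝ) ^ Nat.clog 2 (q k) ≤ 2 * q k := by
      rcases Nat.lt_or_ge 1 (q k) with h | h
      · have := Nat.pow_pred_clog_lt_self (b := 2) (by norm_num) h
        have h2 : 0 < Nat.clog 2 (q k) := Nat.clog_pos (by norm_num) h
        obtain ⟨m, hm⟩ : ∃ m, Nat.clog 2 (q k) = m + 1 := ⟨Nat.clog 2 (q k) - 1, by omega⟩
        rw [hm] at this ⊢
        simp only [Nat.pred_succ] at this
        have : (2:ℝ) ^ m ≤ q k := by exact_mod_cast this.le
        rw [pow_succ]; linarith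
      · have : q k = 1 := by omega
        rw [this]; simp
    have h2 : (2:ℝ) ^ Nat.clog 2 (q k) ≤ 4 * l ^ 24 := by linarith
    refine ⟨mem_Ico.2 ⟨?_, ?_⟩, ?_⟩
    · have := Nat.clog_mono_right 2 hq1
      rwa [Nat.clog_pow _ _ (by norm_num)] at this
    · have h3 := Real.log_le_log (by positivity) h2
      rw [Real.log_pow, Real.log_mul (by norm_num) (by positivity), Real.log_pow] at h3
      have h4 : Real.log 4 = 2 * Real.log 2 := by
        rw [show (4:ℝ) = 2 ^ 2 by norm_num, Real.log_pow]; norm_num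
      rw [h4] at h3
      have h5 := Real.log_two_gt_d9
      have h6 := Real.log_two_lt_d9
      push_cast at h3
      rw [hn₁, Nat.lt_succ_iff]
      apply Nat.le_floor
      by_contra hcon
      push Not at hcon
      have h7 : 40 * y * 0.69 ≤ (Nat.clog 2 (q k) : ℝ) * Real.log 2 := by
        have : 0 ≤ y := by linarith
        nlinarith
      linarith
    · calc (4:ℝ) ^ Nat.clog 2 (q k) = (2 ^ Nat.clog 2 (q k)) ^ 2 := by
            rw [← pow_mul, mul_comm, pow_mul]; norm_num
        _ ≤ (4 * l ^ 24) ^ 2 := by gcongr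
        _ = _ := by ring
  have hlevel : ∀ i ∈ Ico i₀ n₁, ∑ k ∈ s with Nat.clog 2 (q k) = i,
      ‖expSum vt A B ((k : ℝ) / (2 * N : ℕ))‖ ^ 3 ≤
      C * N ^ 3 * (2 * (r ^ (i + 1) * ((i : ℝ) + 1) ^ 4)) + C * N ^ 3 * (41 ^ 4 * (y ^ 7 / l)) := by
    intro i hi
    rcases (s.filter fun k => Nat.clog 2 (q k) = i).eq_empty_or_nonempty with h | ⟨k₀, hk₀⟩
    · rw [h, sum_empty]; positivity
    rw [mem_filter] at hk₀
    have h4i : (4:ℝ) ^ i ≤ 16 * l ^ 48 := hk₀.2 ▸ (hlev k₀ hk₀.1).2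
    have henergy := energy_expSum_le (N := N) (i := i) (r := l ^ 40) hN16 (one_le_pow₀ hl1)
      (by
        calc 3 * l ^ 40 * 4 ^ i ≤ 3 * l ^ 40 * (16 * l ^ 48) := by gcongr
          _ = 48 * l ^ 88 := by ring
          _ ≤ _ := hs88) hA hAB (by omega) (s.filter fun k => Nat.clog 2 (q k) = i) (by
        intro k hk
        rw [mem_filter] at hk
        obtain ⟨h1, hq0, -, -, -, h2⟩ := hqa k hk.1
        exact ⟨h1, q k, a k, hq0, hk.2 ▸ Nat.le_pow_clog (by norm_num) _, h2⟩)
    have hD : ∀ k ∈ s.filter fun k => Nat.clog 2 (q k) = i,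
        ‖expSum vt A B ((k : ℝ) / (2 * N : ℕ))‖ ≤
          10 ^ 12 * (N * (2 * r ^ (i + 1) + y ^ 3 / l)) := by
      intro k hk
      rw [mem_filter] at hk
      obtain ⟨-, hq0, hco, -, hq2, hβ⟩ := hqa k hk.1
      have h := hmaj A B hA hAB hB (q k) (a k) ((k : ℝ) / (2 * N : ℕ) - a k / q k) hq0 hco hq2 hβ
      rw [add_sub_cancel] at h
      refine h.trans ?_
      gcongr
      refine (div_le_self (by positivity) ?_).trans (hk.2 ▸ rpow_neg_third_le_two_mul hq0)
      rw [Real.one_le_sqrt]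
      exact le_max_left _ _
    refine (sum_norm_cube_le _ _ hD henergy (by positivity)).trans ?_
    have hi' : (i : ℝ) + 1 ≤ 41 * y := by
      have : i + 1 ≤ n₁ := (mem_Ico.1 hi).2
      have : (i : ℝ) + 1 ≤ n₁ := by exact_mod_cast this
      linarith
    have e1 : y ^ 3 / l * ((i : ℝ) + 1) ^ 4 ≤ 41 ^ 4 * (y ^ 7 / l) := by
      calc y ^ 3 / l * ((i : ℝ) + 1) ^ 4 ≤ y ^ 3 / l * (41 * y) ^ 4 := by gcongr
        _ = _ := by ring
    calc 10 ^ 12 * (N * (2 * r ^ (i + 1) + y ^ 3 / l)) * (40000 * N ^ 2 * ((i : ℝ) + 1) ^ 4)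
        = C * N ^ 3 * (2 * (r ^ (i + 1) * ((i : ℝ) + 1) ^ 4)) +
          C * N ^ 3 * (y ^ 3 / l * ((i : ℝ) + 1) ^ 4) := by rw [hC]; ring
      _ ≤ _ := by gcongr
  rw [← sum_fiberwise_of_maps_to (fun k hk => (hlev k hk).1)]
  refine (sum_le_sum hlevel).trans ?_
  rw [sum_add_distrib, ← mul_sum, ← mul_sum, sum_const, nsmul_eq_mul, Nat.card_Ico]
  have h1 := hi₀ n₁
  have h2 : ((n₁ - i₀ : ℕ) : ℝ) ≤ 41 * y := le_trans (by exact_mod_cast Nat.sub_le _ _) hn₁le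
  calc _ ≤ C * N ^ 3 * (2 * (c / (4 * C))) + 41 * y * (C * N ^ 3 * (41 ^ 4 * (y ^ 7 / l))) := by
        gcongr
    _ = c / 2 * N ^ 3 + C * N ^ 3 * 41 ^ 5 * (y ^ 8 / l) := by
        field_simp; ring
    _ ≤ c / 2 * N ^ 3 + C * N ^ 3 * 41 ^ 5 * (c / (2 * C * 41 ^ 5)) := by gcongr
    _ = c * N ^ 3 := by field_simp; ring

/-- Points far from a fraction with bounded denominator contribute little to the third moment. -/
lemma exists_sum_cube_far_le {c : ℝ} (hc : 0 < c) (W : ℕ) : ∃ K₀ : ℝ, ∀ᶠ N : ℕ in atTop,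
    ∀ A B : ℕ, N ≤ 4 * A → A ≤ B → 2 * B ≤ N → ∀ s : Finset ℕ,
    (∀ k ∈ s, k < 2 * N ∧ ∃ (q : ℕ) (a : ℤ), 0 < q ∧ IsCoprime a (q : ℤ) ∧ q ≤ W ∧
      K₀ ≤ |(k : ℝ) / (2 * N : ℕ) - a / q| * N ∧
      |(k : ℝ) / (2 * N : ℕ) - a / q| * N ≤ Real.log N ^ 40) →
    ∑ k ∈ s, ‖expSum vt A B ((k : ℝ) / (2 * N : ℕ))‖ ^ 3 ≤ c * N ^ 3 := by
  set C : ℝ := 10 ^ 12 * (40000 * (W + 1) ^ 4) with hC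
  have hC0 : 0 < C := by positivity
  set c' := c / (2 * C) with hc'
  have hc'0 : 0 < c' := by positivity
  refine ⟨(1 / c') ^ 4, ?_⟩
  filter_upwards [eventually_norm_expSum_major_le, eventually_le_log (W + 1),
    eventually_log_pow_le_sqrt (3 * 4 ^ W) 40, eventually_ge_atTop 16,
    eventually_loglog_pow_div_log_le 3 hc'0] with
    N hmaj hl hs40 hN16 hll3 A B hA hAB hB s hs
  set l := Real.log N with hldef
  have hW0 : (0:ℝ) ≤ W := Nat.cast_nonneg W
  have hl1 : 1 ≤ l := by linarith
  have henergy := energy_expSum_le (N := N) (i := W) (r := l ^ 40) hN16 (one_le_pow₀ hl1)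
      (le_trans (le_of_eq (by ring)) hs40) hA hAB (by omega) s (fun k hk => by
        obtain ⟨h1, q, a, hq0, -, hqW, -, h2⟩ := hs k hk
        exact ⟨h1, q, a, hq0, hqW.trans Nat.lt_two_pow_self.le, h2⟩)
  have hD : ∀ k ∈ s, ‖expSum vt A B ((k : ℝ) / (2 * N : ℕ))‖ ≤ 10 ^ 12 * (N * (c' + c')) := by
    intro k hk
    obtain ⟨-, q, a, hq0, hco, hqW, hK, hβ⟩ := hs k hk
    have hqW' : (q:ℝ) ≤ W := by exact_mod_cast hqW
    have hq2 : (q:ℝ) ≤ 2 * l ^ 24 := by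
      have : l ≤ l ^ 24 := le_self_pow₀ hl1 (by norm_num)
      linarith
    have h := hmaj A B hA hAB hB q a ((k : ℝ) / (2 * N : ℕ) - a / q) hq0 hco hq2 hβ
    rw [add_sub_cancel] at h
    refine h.trans ?_
    have h1 : (q : ℝ) ^ (-(1 / 3) : ℝ) ≤ 1 :=
      Real.rpow_le_one_of_one_le_of_nonpos (by exact_mod_cast hq0) (by norm_num)
    have h2 : 1 / c' ≤ √(max 1 √(|(k : ℝ) / (2 * N : ℕ) - a / q| * N)) := by
      apply Real.le_sqrt_of_sq_le
      refine le_trans ?_ (le_max_right _ _)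
      apply Real.le_sqrt_of_sq_le
      rwa [← pow_mul]
    gcongr
    calc _ ≤ 1 / (1 / c') := by gcongr
      _ = c' := one_div_one_div c'
  refine (sum_norm_cube_le _ _ hD henergy (by positivity)).trans (le_of_eq ?_)
  rw [hc', hC]
  field_simp; ring

lemma sum_norm_sq_expSum_mdl_le {W N A B : ℕ} (hN : 0 < N) (hB : 2 * B ≤ N) {s : Finset ℕ}
    (hs : ∀ k ∈ s, k < 2 * N) :
    ∑ k ∈ s, ‖expSum (mdl W) A B ((k : ℝ) / (2 * N : ℕ))‖ ^ 2 ≤ 2 * W ^ 2 * N ^ 2 := by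
  have hsub : s ⊆ range (2 * N) := fun k hk => mem_range.2 (hs k hk)
  refine (sum_le_sum_of_subset_of_nonneg hsub fun _ _ _ => by positivity).trans ?_
  rw [sum_range_norm_sq_expSum _ (by omega) (by omega)]
  have h : ∑ n ∈ Ioc A B, mdl W n ^ 2 ≤ N * (W : ℝ) ^ 2 := by
    calc _ ≤ ∑ n ∈ Ioc A B, (W : ℝ) ^ 2 :=
          sum_le_sum fun n _ => pow_le_pow_left₀ (mdl_nonneg _ _) (mdl_le _ _) 2
      _ = ((B - A : ℕ) : ℝ) * (W : ℝ) ^ 2 := by rw [sum_const, Nat.card_Ioc, nsmul_eq_mul]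
      _ ≤ _ := by
          gcongr
          omega
  push_cast
  calc 2 * (N : ℝ) * ∑ n ∈ Ioc A B, mdl W n ^ 2 ≤ 2 * N * (N * (W : ℝ) ^ 2) := by gcongr
    _ = _ := by ring

lemma sum_norm_sq_expSum_vt_le {N A B : ℕ} (hN : 0 < N) (hB : 2 * B ≤ N) {s : Finset ℕ}
    (hs : ∀ k ∈ s, k < 2 * N) :
    ∑ k ∈ s, ‖expSum vt A B ((k : ℝ) / (2 * N : ℕ))‖ ^ 2 ≤ 12 * N ^ 2 * Real.log N := by
  have hsub : s ⊆ range (2 * N) := fun k hk => mem_range.2 (hs k hk)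
  refine (sum_le_sum_of_subset_of_nonneg hsub fun _ _ _ => by positivity).trans ?_
  rw [sum_range_norm_sq_expSum _ (by omega) (by omega)]
  have hl : 0 ≤ Real.log (N:ℝ) := Real.log_natCast_nonneg N
  have h : ∑ n ∈ Ioc A B, vt n ^ 2 ≤ Real.log N * (6 * N) := by
    calc _ ≤ ∑ n ∈ Ioc A B, Real.log N * vonMangoldt n := by
          refine sum_le_sum fun n hn => ?_
          rw [mem_Ioc] at hn
          have hnN : vt n ≤ Real.log N := by
            refine (vt_le_vonMangoldt n).trans (ArithmeticFunction.vonMangoldt_le_log.trans ?_)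
            exact Real.log_le_log (by exact_mod_cast (by omega : 0 < n))
              (by exact_mod_cast (by omega : n ≤ N))
          rw [sq]
          exact mul_le_mul hnN (vt_le_vonMangoldt n) (vt_nonneg n) hl
      _ ≤ ∑ n ∈ Ioc 0 N, Real.log N * vonMangoldt n := by
          refine sum_le_sum_of_subset_of_nonneg (Ioc_subset_Ioc (Nat.zero_le _) (by omega)) ?_
          exact fun n _ _ => mul_nonneg hl ArithmeticFunction.vonMangoldt_nonneg
      _ ≤ _ := by
          rw [← mul_sum]
          exact mul_le_mul_of_nonneg_left (sum_vonMangoldt_le N) hl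
  push_cast
  calc 2 * (N : ℝ) * ∑ n ∈ Ioc A B, vt n ^ 2 ≤ 2 * N * (Real.log N * (6 * N)) := by gcongr
    _ = _ := by ring

/-- The minor arcs contribute little to the third moment. -/
lemma eventually_sum_cube_minor_le {c : ℝ} (hc : 0 < c) : ∀ᶠ N : ℕ in atTop,
    ∀ A B : ℕ, N ≤ 4 * A → A ≤ B → 2 * B ≤ N → ∀ s : Finset ℕ,
    (∀ k ∈ s, k < 2 * N ∧ ∃ (q : ℕ) (a : ℤ), IsCoprime a (q : ℤ) ∧ 2 * Real.log N ^ 24 ≤ q ∧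
      q * Real.log N ^ 40 ≤ N ∧ |(k : ℝ) / (2 * N : ℕ) - a / q| ≤ 1 / (q : ℝ) ^ 2) →
    ∑ k ∈ s, ‖expSum vt A B ((k : ℝ) / (2 * N : ℕ))‖ ^ 3 ≤ c * N ^ 3 := by
  filter_upwards [eventually_norm_expSum_minor_le, eventually_le_log 1,
    eventually_le_log (24000 / c), eventually_gt_atTop 0] with N hmin hl1 hlc hN A B hA hAB hB s hs
  have hD : ∀ k ∈ s, ‖expSum vt A B ((k : ℝ) / (2 * N : ℕ))‖ ≤ 2000 * (N / Real.log N ^ 2) := by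
    intro k hk
    obtain ⟨-, q, a, hco, h1, h2, h3⟩ := hs k hk
    have h := hmin A B hA hAB hB q a _ hco h1 h2 h3
    rwa [add_sub_cancel] at h
  refine (sum_norm_cube_le _ _ hD (sum_norm_sq_expSum_vt_le hN hB fun k hk => (hs k hk).1)
    (by positivity)).trans ?_
  set l := Real.log N
  have hl0 : 0 < l := by linarith
  rw [div_le_iff₀ hc] at hlc
  calc 2000 * (N / l ^ 2) * (12 * N ^ 2 * l) = 24000 / l * N ^ 3 := by field_simp; norm_num
    _ ≤ c * N ^ 3 := by
        gcongr
        rw [div_le_iff₀ hl0]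
        linarith

/-- The model has a small third moment away from fractions with denominator dividing `W`. -/
lemma exists_sum_cube_mdl_le {c : ℝ} (hc : 0 < c) {W : ℕ} (hW : 0 < W) : ∃ K₀ : ℝ,
    ∀ᶠ N : ℕ in atTop, ∀ A B : ℕ, 2 * B ≤ N → ∀ s : Finset ℕ,
    (∀ k ∈ s, k < 2 * N ∧ ∃ (q : ℕ) (a : ℤ), 0 < q ∧ IsCoprime a (q : ℤ) ∧
      q * Real.log N ^ 40 ≤ N ∧
      |(k : ℝ) / (2 * N : ℕ) - a / q| * (q * N) ≤ Real.log N ^ 40 ∧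
      (q ∣ W → K₀ ≤ |(k : ℝ) / (2 * N : ℕ) - a / q| * N)) →
    ∑ k ∈ s, ‖expSum (mdl W) A B ((k : ℝ) / (2 * N : ℕ))‖ ^ 3 ≤ c * N ^ 3 := by
  set K₀ : ℝ := max 1 (2 * W ^ 4 / c) with hK₀
  have hK1 : 1 ≤ K₀ := le_max_left _ _
  have hKc : 2 * W ^ 4 / c ≤ K₀ := le_max_right _ _
  refine ⟨K₀, ?_⟩
  filter_upwards [eventually_le_log K₀, eventually_log_pow_le_sqrt (2 * W) 40,
    eventually_gt_atTop 0] with N hl hs40 hN A B hB s hs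
  set l := Real.log N with hldef
  have hN0 : (0:ℝ) < N := by exact_mod_cast hN
  have hN1 : (1:ℝ) ≤ N := by exact_mod_cast hN
  have hlK : K₀ ≤ l ^ 40 := hl.trans (le_self_pow₀ (hK1.trans hl) (by norm_num))
  have hsN : √(N:ℝ) ≤ N := by
    rw [Real.sqrt_le_left (by positivity)]
    nlinarith
  have hD : ∀ k ∈ s, ‖expSum (mdl W) A B ((k : ℝ) / (2 * N : ℕ))‖ ≤ W ^ 2 * (N / K₀) := by
    intro k hk
    obtain ⟨-, q, a, hq, hco, h1, h2, h3⟩ := hs k hk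
    have hqr : (0:ℝ) < q := by exact_mod_cast hq
    have h := norm_expSum_mdl_le (A := A) (B := B) (β := (k : ℝ) / (2 * N : ℕ) - a / q)
      (D := N / K₀) hW hq hco ?_ ?_ (by positivity) ?_
    · rwa [add_sub_cancel] at h
    · rw [le_div_iff₀ (by positivity)]
      set b := |(k : ℝ) / (2 * N : ℕ) - a / q|
      have h4 : (W:ℝ) * b * (2 * q) * N ≤ 1 * N := by
        calc (W:ℝ) * b * (2 * q) * N = 2 * W * (b * (q * N)) := by ring
          _ ≤ 2 * W * l ^ 40 := by gcongr
          _ ≤ 1 * N := by linarith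
      exact le_of_mul_le_mul_right h4 hN0
    · rw [le_div_iff₀ (by positivity)]
      exact le_trans (by gcongr) h1
    · intro hqW
      have := h3 hqW
      rw [mul_div_assoc', div_mul_eq_mul_div, le_div_iff₀ (by positivity)]
      linarith
  refine (sum_norm_cube_le _ _ hD (sum_norm_sq_expSum_mdl_le hN hB fun k hk => (hs k hk).1)
    (by positivity)).trans ?_
  calc (W:ℝ) ^ 2 * (N / K₀) * (2 * W ^ 2 * N ^ 2) = (2 * W ^ 4) / K₀ * N ^ 3 := by ring
    _ ≤ c * N ^ 3 := by
        gcongr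
        rw [div_le_iff₀ hc] at hKc
        rw [div_le_iff₀ (by linarith)]
        linarith

/-- Near fractions with denominator dividing `W` the primes are well approximated by the model. -/
lemma eventually_sum_cube_sub_le {c : ℝ} (hc : 0 < c) {W : ℕ} (hW : 0 < W) {K : ℝ} (hK : 1 ≤ K) :
    ∀ᶠ N : ℕ in atTop, ∀ A B : ℕ, N ≤ 4 * A → A ≤ B → 2 * B ≤ N → ∀ s : Finset ℕ,
    (∀ k ∈ s, k < 2 * N ∧ ∃ (q : ℕ) (a : ℤ), 0 < q ∧ q ∣ W ∧
      |(k : ℝ) / (2 * N : ℕ) - a / q| * N ≤ K) →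
    ∑ k ∈ s, ‖expSum vt A B ((k : ℝ) / (2 * N : ℕ)) ^ 3 -
      expSum (mdl W) A B ((k : ℝ) / (2 * N : ℕ)) ^ 3‖ ≤ c * N ^ 3 := by
  set E : ℝ := 40000 * (W + 1) ^ 4 + 2 * W ^ 2 with hE
  have hE0 : 0 < E := by positivity
  set η : ℝ := c / (3 * (1 + 7 * K) * E) with hη
  obtain ⟨N₀, hN₀⟩ := pnt_model hW (η := η) (by positivity)
  filter_upwards [eventually_ge_atTop N₀, eventually_log_pow_le_sqrt (3 * K * 4 ^ W) 0,
    eventually_ge_atTop 16] with N hNN hs0 hN16 A B hA hAB hB s hs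
  have hvt := energy_expSum_le (N := N) (i := W) (r := K) hN16 hK
      (le_trans (le_of_eq (by ring)) hs0) hA hAB (by omega) s (fun k hk => by
        obtain ⟨h1, q, a, hq0, hqW, h2⟩ := hs k hk
        exact ⟨h1, q, a, hq0, (Nat.le_of_dvd hW hqW).trans Nat.lt_two_pow_self.le, h2⟩)
  have hmdl := sum_norm_sq_expSum_mdl_le (W := W) (A := A) (B := B) (by omega : 0 < N) hB
    fun k hk => (hs k hk).1
  have hη0 : 0 < η := by positivity
  calc _ ≤ ∑ k ∈ s, 3 * η * N * (1 + 7 * K) * (‖expSum vt A B ((k : ℝ) / (2 * N : ℕ))‖ ^ 2 +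
        ‖expSum (mdl W) A B ((k : ℝ) / (2 * N : ℕ))‖ ^ 2) := by
        refine sum_le_sum fun k hk => (norm_cube_sub_cube_le _ _).trans ?_
        obtain ⟨-, q, a, hq0, ⟨d, hd⟩, hβ⟩ := hs k hk
        have h := norm_expSum_sub_le (W := W) (β := (k : ℝ) / (2 * N : ℕ) - a / q) (c := a * d)
          hAB (by omega) (fun x hx => hN₀ N hNN x hx _)
        have e : ((a * d : ℤ) : ℝ) / W + ((k : ℝ) / (2 * N : ℕ) - a / q) =
            (k : ℝ) / (2 * N : ℕ) := by
          have hqr : (q:ℝ) ≠ 0 := by exact_mod_cast hq0.ne'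
          have hdr : (d:ℝ) ≠ 0 := by
            have : d ≠ 0 := by rintro rfl; omega
            exact_mod_cast this
          rw [hd]; push_cast
          rw [mul_div_mul_right _ _ hdr]; ring
        rw [e] at h
        have h' : 3 / 2 * ‖expSum vt A B ((k : ℝ) / (2 * N : ℕ)) -
            expSum (mdl W) A B ((k : ℝ) / (2 * N : ℕ))‖ ≤ 3 * η * N * (1 + 7 * K) := by
          calc _ ≤ 3 / 2 * (2 * η * N * (1 + 7 * K)) := by
                refine mul_le_mul_of_nonneg_left (h.trans ?_) (by norm_num)
                rw [mul_comm (N:ℝ) |_|]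
                gcongr
            _ = _ := by ring
        gcongr
    _ ≤ 3 * η * N * (1 + 7 * K) * (40000 * N ^ 2 * ((W : ℝ) + 1) ^ 4 + 2 * W ^ 2 * N ^ 2) := by
        rw [← mul_sum, sum_add_distrib]
        gcongr
    _ = c * N ^ 3 := by
        have : 3 * η * N * (1 + 7 * K) * (40000 * N ^ 2 * ((W : ℝ) + 1) ^ 4 + 2 * W ^ 2 * N ^ 2) =
          (η * (3 * (1 + 7 * K) * E)) * N ^ 3 := by rw [hE]; ring
        rw [this, hη, div_mul_cancel₀ _ (by positivity)]

lemma exists_dirichlet {N : ℕ} {L : ℝ} (hL : 1 ≤ L) (hLN : L ≤ N) (α : ℝ) :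
    ∃ (q : ℕ) (a : ℤ), 0 < q ∧ IsCoprime a (q : ℤ) ∧ q * L ≤ N ∧
      |α - a / q| * (q * N) ≤ L ∧ |α - a / q| ≤ 1 / (q : ℝ) ^ 2 := by
  have hn : 0 < ⌊N / L⌋₊ := by
    rw [Nat.floor_pos, le_div_iff₀ (by linarith)]; linarith
  obtain ⟨r, hr, hden⟩ := Real.exists_rat_abs_sub_le_and_den_le α hn
  have hq : (0:ℝ) < r.den := by exact_mod_cast r.den_pos
  have hqn : (r.den : ℝ) ≤ ⌊N / L⌋₊ := by exact_mod_cast hden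
  have hnL : (⌊N / L⌋₊ : ℝ) ≤ N / L := Nat.floor_le (by positivity)
  have hnL' := Nat.lt_floor_add_one (N / L)
  have e : (r : ℝ) = (r.num : ℝ) / r.den := by rw [Rat.cast_def]
  rw [e] at hr
  refine ⟨r.den, r.num, r.den_pos, ?_, ?_, ?_, ?_⟩
  · rw [Int.isCoprime_iff_gcd_eq_one]
    exact r.reduced
  · rw [← le_div_iff₀ (by linarith)]; linarith
  · have hN : (0:ℝ) < N := by linarith
    calc _ ≤ 1 / ((⌊N / L⌋₊ + 1) * (r.den : ℝ)) * (r.den * N) := by gcongr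
      _ = N / (⌊N / L⌋₊ + 1) := by field_simp
      _ ≤ N / (N / L) := by gcongr
      _ = L := by field_simp
  · refine hr.trans ?_
    rw [sq]
    gcongr
    linarith

/-- Third moments of the primes and of the model nearly agree. -/
theorem exists_sum_cube_sub_le {c : ℝ} (hc : 0 < c) : ∃ K : ℕ, 2 ≤ K ∧ ∀ᶠ N : ℕ in atTop,
    ∀ A B : ℕ, N ≤ 4 * A → A ≤ B → 2 * B ≤ N →
    ∑ k ∈ range (2 * N), ‖expSum vt A B ((k : ℝ) / (2 * N : ℕ)) ^ 3 -
      expSum (mdl K.factorial) A B ((k : ℝ) / (2 * N : ℕ)) ^ 3‖ ≤ c * N ^ 3 := by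
  have hc5 : 0 < c / 5 := by positivity
  obtain ⟨i₀, hlarge⟩ := exists_sum_cube_large_denominator_le hc5
  set K := max 2 (2 ^ i₀) with hK
  have hW : 0 < K.factorial := K.factorial_pos
  set W := K.factorial with hWdef
  obtain ⟨K₁, hfar⟩ := exists_sum_cube_far_le hc5 W
  obtain ⟨K₂, hmdl⟩ := exists_sum_cube_mdl_le hc5 hW
  set K₃ := max 1 (max K₁ K₂) with hK₃
  have h1 : 1 ≤ K₃ := le_max_left _ _
  have h2 : K₁ ≤ K₃ := (le_max_left _ _).trans (le_max_right _ _)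
  have h3 : K₂ ≤ K₃ := (le_max_right _ _).trans (le_max_right _ _)
  refine ⟨K, le_max_left _ _, ?_⟩
  filter_upwards [hlarge, hfar, hmdl, eventually_sum_cube_sub_le hc5 hW h1,
    eventually_sum_cube_minor_le hc5, eventually_le_log 1, eventually_log_pow_le_sqrt 1 40,
    eventually_gt_atTop 0] with N hlarge hfar hmdl hnear hminor hl hs40 hN A B hA hAB hB
  have hN1 : (1:ℝ) ≤ N := by exact_mod_cast hN
  have hsN : √(N:ℝ) ≤ N := by
    rw [Real.sqrt_le_left (by positivity)]
    nlinarith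
  choose q a hq hco hqN hβq hβ2 using fun k : ℕ =>
    exists_dirichlet (N := N) (one_le_pow₀ hl : 1 ≤ Real.log N ^ 40) (by linarith)
      ((k : ℝ) / (2 * N : ℕ))
  set l := Real.log N with hldef
  set α : ℕ → ℝ := fun k => (k : ℝ) / (2 * N : ℕ) with hα
  have hβ : ∀ k, |α k - a k / q k| * N ≤ l ^ 40 := fun k => by
    refine le_trans ?_ (hβq k)
    have : (1:ℝ) ≤ q k := by exact_mod_cast hq k
    gcongr
    nlinarith
  classical
  have hpt : ∀ k ∈ range (2 * N), ‖expSum vt A B (α k) ^ 3 - expSum (mdl W) A B (α k) ^ 3‖ ≤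
      (if q k ∣ W ∧ |α k - a k / q k| * N ≤ K₃ then
        ‖expSum vt A B (α k) ^ 3 - expSum (mdl W) A B (α k) ^ 3‖ else 0) +
      (if ¬ (q k ∣ W ∧ |α k - a k / q k| * N ≤ K₃) then ‖expSum (mdl W) A B (α k)‖ ^ 3 else 0) +
      (if 2 * l ^ 24 ≤ q k then ‖expSum vt A B (α k)‖ ^ 3 else 0) +
      (if q k ∣ W ∧ K₃ ≤ |α k - a k / q k| * N then ‖expSum vt A B (α k)‖ ^ 3 else 0) +
      (if ¬ q k ∣ W ∧ q k ≤ 2 * l ^ 24 then ‖expSum vt A B (α k)‖ ^ 3 else 0) := by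
    intro k _
    have hS : 0 ≤ ‖expSum vt A B (α k)‖ ^ 3 := by positivity
    have hM : 0 ≤ ‖expSum (mdl W) A B (α k)‖ ^ 3 := by positivity
    have hle := norm_cube_sub_cube_le' (expSum vt A B (α k)) (expSum (mdl W) A B (α k))
    by_cases hqW : q k ∣ W <;> rcases le_total (|α k - a k / q k| * N) K₃ with hβ3 | hβ3 <;>
      rcases le_total (q k : ℝ) (2 * l ^ 24) with hq24 | hq24 <;> simp only [hqW, hβ3, hq24] <;>
      simp <;> (repeat' split_ifs) <;> linarith
  refine (sum_le_sum hpt).trans ?_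
  simp only [sum_add_distrib, ← sum_filter]
  have b1 := hnear A B hA hAB hB ((range (2 * N)).filter
    fun k => q k ∣ W ∧ |α k - a k / q k| * N ≤ K₃) fun k hk => by
      rw [mem_filter, mem_range] at hk
      exact ⟨hk.1, q k, a k, hq k, hk.2.1, hk.2.2⟩
  have b2 := hmdl A B hB ((range (2 * N)).filter
    fun k => ¬ (q k ∣ W ∧ |α k - a k / q k| * N ≤ K₃)) fun k hk => by
      rw [mem_filter, mem_range] at hk
      refine ⟨hk.1, q k, a k, hq k, hco k, hqN k, hβq k, fun h => ?_⟩
      by_contra hcon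
      exact hk.2 ⟨h, by linarith⟩
  have b3 := hminor A B hA hAB hB ((range (2 * N)).filter
    fun k => 2 * l ^ 24 ≤ q k) fun k hk => by
      rw [mem_filter, mem_range] at hk
      exact ⟨hk.1, q k, a k, hco k, hk.2, hqN k, hβ2 k⟩
  have b4 := hfar A B hA hAB hB ((range (2 * N)).filter
    fun k => q k ∣ W ∧ K₃ ≤ |α k - a k / q k| * N) fun k hk => by
      rw [mem_filter, mem_range] at hk
      exact ⟨hk.1, q k, a k, hq k, hco k, Nat.le_of_dvd hW hk.2.1, h2.trans hk.2.2, hβ k⟩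
  have b5 := hlarge A B hA hAB hB ((range (2 * N)).filter
    fun k => ¬ q k ∣ W ∧ q k ≤ 2 * l ^ 24) fun k hk => by
      rw [mem_filter, mem_range] at hk
      refine ⟨hk.1, q k, a k, hq k, hco k, ?_, hk.2.2, hβ k⟩
      by_contra hcon
      refine hk.2.1 (Nat.dvd_factorial (hq k) ?_)
      exact (not_le.1 hcon).le.trans (le_max_right _ _)
  linarith

/-- Vinogradov's theorem with almost equal lower bounds for the three primes. -/
theorem eventually_exists_three_primes {δ : ℝ} (hδ : 0 < δ) (hδ' : δ ≤ 1 / 12) :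
    ∀ᶠ N : ℕ in atTop, Odd N → ∃ q₁ q₂ q₃ : ℕ, q₁.Prime ∧ q₂.Prime ∧ q₃.Prime ∧
      q₁ + q₂ + q₃ = N ∧ (1 / 3 - δ) * N < q₁ ∧ (1 / 3 - δ) * N < q₂ ∧ (1 / 3 - δ) * N < q₃ := by
  obtain ⟨K, hK, hcube⟩ := exists_sum_cube_sub_le (c := δ ^ 2 / 4) (by positivity)
  have hP : 0 < primorial K := primorial_pos K
  set P := primorial K with hPdef
  have hPr : (0:ℝ) < P := by exact_mod_cast hP
  filter_upwards [hcube, eventually_ge_atTop 9,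
    (tendsto_natCast_atTop_atTop (R := ℝ)).eventually_gt_atTop ((2 * P + 3) / δ)] with
    N hN hN9 hNδ hodd
  rw [div_lt_iff₀ hδ] at hNδ
  have hN9r : (9:ℝ) ≤ N := by exact_mod_cast hN9
  set A := ⌈(1 / 3 - δ) * N⌉₊ with hA
  set t := ⌊δ * N / P⌋₊ with ht
  have hA1 : (1 / 3 - δ) * N ≤ A := Nat.le_ceil _
  have hA2 : (A:ℝ) < (1 / 3 - δ) * N + 1 := Nat.ceil_lt_add_one (by
    have : (0:ℝ) ≤ 1 / 3 - δ := by linarith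
    positivity)
  have ht1 : (t:ℝ) * P ≤ δ * N := by
    rw [← le_div_iff₀ hPr]
    exact Nat.floor_le (by positivity)
  have ht2 : δ * N < (t + 1) * P := by
    rw [← div_lt_iff₀ hPr]
    exact Nat.lt_floor_add_one _
  have hB1 : N / 2 * 2 ≤ N := Nat.div_mul_le_self N 2
  have hB2 : N ≤ 2 * (N / 2) + 1 := by omega
  have hB2r : (N:ℝ) ≤ 2 * (N / 2 : ℕ) + 1 := by exact_mod_cast hB2
  have hδN : δ * N ≤ 1 / 12 * N := by gcongr
  have hAt : A + t * P ≤ N / 2 := by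
    have : ((A + t * P : ℕ) : ℝ) < (N / 2 : ℕ) + 1 := by
      push_cast; linarith
    have : A + t * P < N / 2 + 1 := by exact_mod_cast this
    omega
  have h3A : 3 * A + 2 * (t * P) < N := by
    have : ((3 * A + 2 * (t * P) : ℕ) : ℝ) < N := by
      push_cast; linarith
    exact_mod_cast this
  have h2A : N ≤ 2 * A + N / 2 := by
    have : (N : ℝ) < ((2 * A + N / 2 : ℕ) : ℝ) + 1 := by
      push_cast; linarith
    have : N < 2 * A + N / 2 + 1 := by exact_mod_cast this
    omega
  have h4A : N ≤ 4 * A := by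
    have : (N : ℝ) ≤ ((4 * A : ℕ) : ℝ) := by
      push_cast; linarith
    exact_mod_cast this
  have hdiff := hN A (N / 2) h4A (by omega) (by omega)
  have hvt := sum_range_expSum_cube vt (A := A) (B := N / 2) (N := N) (by omega) (by omega)
  have hmdl := sum_range_expSum_cube (mdl K.factorial) (A := A) (B := N / 2) (N := N)
    (by omega) (by omega)
  have hmain := sum_mdl_primorial_ge hK hodd hAt h3A h2A
  rw [← hPdef] at hmain
  simp only [mdl_factorial, ← hPdef] at hmdl hdiff
  set Rv := ∑ n₁ ∈ Ioc A (N / 2), ∑ n₂ ∈ Ioc A (N / 2), ∑ n₃ ∈ Ioc A (N / 2),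
        (if n₁ + n₂ + n₃ = N then vt n₁ * vt n₂ * vt n₃ else 0) with hRv
  set Rm := ∑ n₁ ∈ Ioc A (N / 2), ∑ n₂ ∈ Ioc A (N / 2), ∑ n₃ ∈ Ioc A (N / 2),
        (if n₁ + n₂ + n₃ = N then mdl P n₁ * mdl P n₂ * mdl P n₃ else 0) with hRm
  have hR : |(2 * N : ℕ) * Rv - (2 * N : ℕ) * Rm| ≤ δ ^ 2 / 4 * N ^ 3 := by
    rw [← Real.norm_eq_abs, ← Complex.norm_real, Complex.ofReal_sub, ← hvt, ← hmdl,
      ← sum_sub_distrib]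
    refine (norm_sum_le _ _).trans (le_trans (le_of_eq (sum_congr rfl fun k _ => ?_)) hdiff)
    rw [← sub_mul, norm_mul, norm_ex, mul_one]
  have hRpos : Rv ≠ 0 := by
    intro h0
    rw [h0, mul_zero, zero_sub, abs_neg] at hR
    have h1 := (le_abs_self _).trans hR
    have h2 : (δ * N / 2) ^ 2 ≤ Rm := by
      refine le_trans ?_ hmain
      push_cast
      gcongr
      linarith
    have h3 : 2 * (N:ℝ) * (δ * N / 2) ^ 2 ≤ 2 * N * Rm := by gcongr
    push_cast at h1
    have h4 : 0 < δ ^ 2 * (N:ℝ) ^ 3 := by positivity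
    nlinarith
  obtain ⟨n₁, h₁, hn⟩ := exists_ne_zero_of_sum_ne_zero hRpos
  obtain ⟨n₂, h₂, hn⟩ := exists_ne_zero_of_sum_ne_zero hn
  obtain ⟨n₃, h₃, hn⟩ := exists_ne_zero_of_sum_ne_zero hn
  have hprime : ∀ n, vt n ≠ 0 → n.Prime := fun n h => by
    by_contra hnp
    exact h (by rw [vt, if_neg hnp])
  have hlow : ∀ n ∈ Ioc A (N / 2), (1 / 3 - δ) * N < n := fun n hn => by
    have : (A:ℝ) < n := by exact_mod_cast (mem_Ioc.1 hn).1
    linarith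
  have hsum : n₁ + n₂ + n₃ = N := by
    by_contra h
    exact hn (if_neg h)
  rw [if_pos hsum] at hn
  exact ⟨n₁, n₂, n₃, hprime _ (left_ne_zero_of_mul (left_ne_zero_of_mul hn)),
    hprime _ (right_ne_zero_of_mul (left_ne_zero_of_mul hn)), hprime _ (right_ne_zero_of_mul hn),
    hsum, hlow _ h₁, hlow _ h₂, hlow _ h₃⟩

end PrimeSemigroup

namespace PrimeSemigroup

lemma nthPrime_succ_le {n q : ℕ} (hq : q.Prime) (h : nthPrime n < q) : nthPrime (n + 1) ≤ q := by
  rw [nthPrime, ← Nat.nth_count hq,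
    (Nat.nth_strictMono Nat.infinite_setOfPred_prime).lt_iff_lt] at h
  rw [nthPrime, ← Nat.nth_count hq,
    (Nat.nth_strictMono Nat.infinite_setOfPred_prime).le_iff_le]
  omega

lemma nthPrime_prime (n : ℕ) : (nthPrime n).Prime :=
  Nat.nth_mem_of_infinite Nat.infinite_setOfPred_prime _

lemma lt_nthPrime_add_two (n : ℕ) : n < nthPrime n + 2 := by
  have : n - 1 ≤ nthPrime n := (Nat.nth_strictMono Nat.infinite_setOfPred_prime).le_apply
  have := (nthPrime_prime n).two_le
  omega

lemma frob_notMem {n : ℕ} (h : 0 < frob n) : frob n ∉ S n := by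
  have hne : {m : ℕ | m ∉ S n}.Nonempty := by
    by_contra hcon
    rw [Set.not_nonempty_iff_eq_empty] at hcon
    rw [frob, hcon] at h
    simp at h
  have hb : BddAbove {m : ℕ | m ∉ S n} := by
    by_contra hcon
    rw [frob, Nat.sSup_of_not_bddAbove hcon] at h
    omega
  exact Nat.sSup_mem hne hb

end PrimeSemigroup

theorem frob_succ_bound (ε : ℝ) (hε : 0 < ε) :
    ∃ n₀ : ℕ, ∀ n ≥ n₀,
      (Odd (frob (n + 1)) → (frob (n + 1) : ℝ) < (3 + ε) * (nthPrime n : ℝ)) ∧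
      (Even (frob (n + 1)) →
        (frob (n + 1) : ℝ) < (3 + ε) * (nthPrime n : ℝ) + (nthPrime (n + 1) : ℝ)) := by
  set δ : ℝ := min (1 / 12) (1 / 3 - 1 / (3 + ε)) with hδ
  have hδ0 : 0 < δ := by
    refine lt_min (by norm_num) (sub_pos.2 ?_)
    exact one_div_lt_one_div_of_lt (by norm_num) (by linarith)
  have hδ1 : 1 / (3 + ε) ≤ 1 / 3 - δ := by
    have : δ ≤ 1 / 3 - 1 / (3 + ε) := min_le_right _ _
    linarith
  obtain ⟨N₀, hN₀⟩ := eventually_atTop.1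
    (PrimeSemigroup.eventually_exists_three_primes hδ0 (min_le_left _ _))
  have key : ∀ n ≥ N₀ + 2, ∀ m : ℕ, Odd m → (3 + ε) * (nthPrime n : ℝ) ≤ m → m ∈ S (n + 1) := by
    intro n hn m hm hmn
    have hp := PrimeSemigroup.lt_nthPrime_add_two n
    have hpm : nthPrime n ≤ m := by
      have : (nthPrime n : ℝ) ≤ m := by
        have : (0:ℝ) ≤ nthPrime n := Nat.cast_nonneg _
        nlinarith
      exact_mod_cast this
    obtain ⟨q₁, q₂, q₃, h₁, h₂, h₃, hsum, hl₁, hl₂, hl₃⟩ := hN₀ m (by omega) hm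
    have hmem : ∀ q : ℕ, q.Prime → (1 / 3 - δ) * m < q → q ∈ S (n + 1) := fun q hq hlq => by
      refine AddSubmonoid.subset_closure ⟨hq, PrimeSemigroup.nthPrime_succ_le hq ?_⟩
      have h1 : (nthPrime n : ℝ) ≤ 1 / (3 + ε) * m := by
        rw [one_div_mul_eq_div, le_div_iff₀ (by linarith)]
        linarith
      have h2 : 1 / (3 + ε) * m ≤ (1 / 3 - δ) * (m : ℝ) := by gcongr
      exact_mod_cast h1.trans_lt (h2.trans_lt hlq)
    rw [← hsum]
    exact add_mem (add_mem (hmem _ h₁ hl₁) (hmem _ h₂ hl₂)) (hmem _ h₃ hl₃)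
  refine ⟨N₀ + 2, fun n hn => ⟨fun hodd => ?_, fun heven => ?_⟩⟩
  · by_contra! hcon
    exact PrimeSemigroup.frob_notMem hodd.pos (key n hn _ hodd hcon)
  · by_contra! hcon
    have hp := PrimeSemigroup.nthPrime_prime (n + 1)
    have h1 : (0:ℝ) ≤ (3 + ε) * nthPrime n := by positivity
    have hle : nthPrime (n + 1) ≤ frob (n + 1) := by
      have : (nthPrime (n + 1) : ℝ) ≤ frob (n + 1) := by linarith
      exact_mod_cast this
    have h2 : nthPrime (n + 1) ≠ 2 := by
      have hlt : nthPrime 1 < nthPrime (n + 1) :=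
        Nat.nth_strictMono Nat.infinite_setOfPred_prime (by omega)
      have := (PrimeSemigroup.nthPrime_prime 1).two_le
      omega
    have hodd : Odd (frob (n + 1) - nthPrime (n + 1)) :=
      Nat.Even.sub_odd hle heven (hp.odd_of_ne_two h2)
    have hmem := key n hn _ hodd (by
      rw [Nat.cast_sub hle]; linarith)
    refine PrimeSemigroup.frob_notMem (hp.pos.trans_le hle) ?_
    rw [← Nat.sub_add_cancel hle]
    exact add_mem hmem (AddSubmonoid.subset_closure ⟨hp, le_rfl⟩)
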